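/- Let d ≥ 2 and p > p_c. For every α ∈ (0,1) there exist constants C_i, C_s > 0 such that, Q-almost surely on the event {|C| = +∞}, for all sufficiently large n: exp(−C_i n^{d/(d+2)}) ≤ E_0^ω(α^{N_n}) ≤ exp(−C_s n^{d/(d+2)}). -/

import Mathlib

open MeasureTheory
open scoped ENNReal

namespace Perco

/-- Vertices of the lattice `Z^d`. -/
abbrev Zd (d : ℕ) := Fin d → ℤ

/-- A percolation configuration: each (unordered) edge of the lattice is open or closed.
(Only the values on nearest-neighbour pairs matter.) -/
abbrev Config (d : ℕ) := Sym2 (Zd d) → Bool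

/-- Lattice adjacency: `(x,y) ∈ E^d`. -/
def latAdj {d : ℕ} (x y : Zd d) : Prop := (∑ i, |x i - y i|) = 1

/-- Open adjacency in the configuration `ω`. -/
def openAdj {d : ℕ} (ω : Config d) (x y : Zd d) : Prop :=
  latAdj x y ∧ ω s(x, y) = true

/-- `C`: the open cluster of the origin. -/
def cluster {d : ℕ} (ω : Config d) : Set (Zd d) :=
  {y | Relation.ReflTransGen (openAdj ω) 0 y}

/-- `Q` is the product measure making the edge states i.i.d. Bernoulli(p). -/
def IsBernoulli {d : ℕ} (p : ℝ) (Q : Measure (Config d)) : Prop :=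
  IsProbabilityMeasure Q ∧
    ∀ (s : Finset (Sym2 (Zd d))) (f : Sym2 (Zd d) → Bool),
      Q {ω : Config d | ∀ e ∈ s, ω e = f e} =
        ∏ e ∈ s, (if f e then ENNReal.ofReal p else ENNReal.ofReal (1 - p))

/-- The critical probability `p_c`. -/
noncomputable def pc (d : ℕ) : ℝ :=
  sSup {p : ℝ | 0 ≤ p ∧ p ≤ 1 ∧
    ∀ Q : Measure (Config d), IsBernoulli p Q → Q {ω | (cluster ω).Infinite} = 0}

/-- The box `B_n = [-n,n]^d`. -/
def box (d n : ℕ) : Set (Zd d) := {x | ∀ i, |x i| ≤ (n : ℤ)}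

/-- `C_n`: the connected component of `0` in `C ∩ B_n`. -/
def clusterN {d : ℕ} (ω : Config d) (n : ℕ) : Set (Zd d) :=
  {y | Relation.ReflTransGen
    (fun a b => openAdj ω a b ∧ a ∈ box d n ∧ b ∈ box d n) 0 y}

/-- `A` is connected in the open subgraph. -/
def ConnOpen {d : ℕ} (ω : Config d) (A : Set (Zd d)) : Prop :=
  ∀ x ∈ A, ∀ y ∈ A,
    Relation.ReflTransGen (fun a b => openAdj ω a b ∧ a ∈ A ∧ b ∈ A) x y

/-- `A` is connected in the lattice. -/
def ConnLat {d : ℕ} (A : Set (Zd d)) : Prop :=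
  ∀ x ∈ A, ∀ y ∈ A,
    Relation.ReflTransGen (fun a b => latAdj a b ∧ a ∈ A ∧ b ∈ A) x y

/-- The boundary `∂_{C^g} A` = open lattice edges from `A` to its complement. -/
def bdry {d : ℕ} (ω : Config d) (A : Set (Zd d)) : Set (Zd d × Zd d) :=
  {e | openAdj ω e.1 e.2 ∧ e.1 ∈ A ∧ e.2 ∉ A}

/-- The profile `f_c` (at scale `n`, exponent `γ`). -/
noncomputable def fcut (d : ℕ) (γ c : ℝ) (n : ℕ) (x : ℝ) : ℝ :=
  if x < c * (n : ℝ) ^ γ then 1 else x ^ (1 - 1 / (d : ℝ))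

/-- `ν(x)`: number of open neighbours of `x`. -/
noncomputable def nu {d : ℕ} (ω : Config d) (x : Zd d) : ℕ :=
  Set.ncard {y | openAdj ω x y}

-- Transition kernel of the simple random walk on the open subgraph.
open Classical in
noncomputable def step {d : ℕ} (ω : Config d) (x y : Zd d) : ℝ :=
  if openAdj ω x y then ((nu ω x : ℝ))⁻¹ else 0

/-- Weight of a path of length `n`. -/
noncomputable def pathW {d n : ℕ} (ω : Config d) (γ : Fin (n + 1) → Zd d) : ℝ :=
  ∏ i : Fin n, step ω (γ i.castSucc) (γ i.succ)

/-- `N_n`: number of distinct sites visited by the path. -/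
noncomputable def visits {d n : ℕ} (γ : Fin (n + 1) → Zd d) : ℕ :=
  (Set.range γ).ncard

/-- `P_0^ω(E)`, the probability of a path event for the walk started at 0. -/
noncomputable def PWalk {d : ℕ} (ω : Config d) (n : ℕ)
    (E : (Fin (n + 1) → Zd d) → Prop) : ℝ :=
  ∑' γ : Fin (n + 1) → Zd d,
    Set.indicator {γ | γ 0 = 0 ∧ E γ} (fun γ => pathW ω γ) γ

/-- `E_0^ω(α^{N_n})`. -/
noncomputable def LaplaceN {d : ℕ} (ω : Config d) (α : ℝ) (n : ℕ) : ℝ :=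
  ∑' γ : Fin (n + 1) → Zd d,
    Set.indicator {γ | γ 0 = 0} (fun γ => pathW ω γ * α ^ visits γ) γ

/-- `E_0^ω(α^{N_n} 1_{X_n = 0})`. -/
noncomputable def LaplaceNReturn {d : ℕ} (ω : Config d) (α : ℝ) (n : ℕ) : ℝ :=
  ∑' γ : Fin (n + 1) → Zd d,
    Set.indicator {γ | γ 0 = 0 ∧ γ (Fin.last n) = 0}
      (fun γ => pathW ω γ * α ^ visits γ) γ

/-- Vertices of the wreath product `C^g ≀ Z/2Z` (lamplighter states). -/
abbrev Lamp (d : ℕ) := Zd d × (Zd d →₀ ZMod 2)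

/-- Flip a lamp configuration at one point. -/
noncomputable def flipAt {σ : Type*} (f : σ →₀ ZMod 2) (x : σ) : σ →₀ ZMod 2 :=
  f + Finsupp.single x 1

/-- Transition kernel of the lamplighter walk `Z` with parameter `α`. -/
noncomputable def ptilde {d : ℕ} (ω : Config d) (α : ℝ) (u v : Lamp d) : ℝ :=
  Set.indicator
    {q : Lamp d × Lamp d | ∀ x, x ≠ q.1.1 → x ≠ q.2.1 → q.1.2 x = q.2.2 x}
    (fun q => (if q.2.2 q.1.1 = 0 then α else 1 - α) *
      (if q.2.2 q.2.1 = 0 then α else 1 - α) * step ω q.1.1 q.2.1) (u, v)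

/-- `P̃_o^ω(Z_n = o)`: return probability of the lamplighter walk. -/
noncomputable def ZReturn {d : ℕ} (ω : Config d) (α : ℝ) (n : ℕ) : ℝ :=
  ∑' γ : Fin (n + 1) → Lamp d,
    Set.indicator {γ | γ 0 = (0, 0) ∧ γ (Fin.last n) = (0, 0)}
      (fun γ => ∏ i : Fin n, ptilde ω α (γ i.castSucc) (γ i.succ)) γ

/-- Vertex set of the wreath product over a vertex set `V` of the base. -/
def wVert {d : ℕ} (V : Set (Zd d)) : Set (Lamp d) :=
  {u | u.1 ∈ V ∧ ↑u.2.support ⊆ V}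

/-- Adjacency in the wreath product `C^g ≀ Z/2Z`. -/
def wAdj {d : ℕ} (ω : Config d) (u v : Lamp d) : Prop :=
  (u.1 = v.1 ∧ (∀ x, x ≠ u.1 → u.2 x = v.2 x) ∧ u.2 u.1 ≠ v.2 u.1) ∨
    (u.2 = v.2 ∧ openAdj ω u.1 v.1)

/-- Boundary of `U` in the wreath product `C^g ≀ Z/2Z`. -/
def wBdry {d : ℕ} (ω : Config d) (U : Set (Lamp d)) : Set (Lamp d × Lamp d) :=
  {e | e.1 ∈ U ∧ e.2 ∈ wVert (cluster ω) \ U ∧ wAdj ω e.1 e.2}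

/-- Følner function `Fol_{C_n^g}^{C^g}` (with value `⊤` when no set qualifies). -/
noncomputable def FolC {d : ℕ} (ω : Config d) (n : ℕ) (k : ℝ) : ℝ≥0∞ :=
  sInf {m : ℝ≥0∞ | ∃ A : Set (Zd d), A ⊆ clusterN ω n ∧ A.Nonempty ∧
    ((bdry ω A).ncard : ℝ) / (A.ncard : ℝ) ≤ 1 / k ∧ m = (A.ncard : ℝ≥0∞)}

/-- Følner function `Fol_{C_n^g ≀ Z/2Z}^{C^g ≀ Z/2Z}`. -/
noncomputable def FolW {d : ℕ} (ω : Config d) (n : ℕ) (k : ℝ) : ℝ≥0∞ :=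
  sInf {m : ℝ≥0∞ | ∃ U : Set (Lamp d), U ⊆ wVert (clusterN ω n) ∧ U.Nonempty ∧
    ((wBdry ω U).ncard : ℝ) / (U.ncard : ℝ) ≤ 1 / k ∧ m = (U.ncard : ℝ≥0∞)}

/-- Degree of a configuration `f` in the graph `K_U`. -/
noncomputable def Kdeg {d : ℕ} (U : Set (Lamp d)) (f : Zd d →₀ ZMod 2) : ℕ :=
  Set.ncard {g : Zd d →₀ ZMod 2 | ∃ x : Zd d, (x, f) ∈ U ∧ (x, g) ∈ U ∧ g = flipAt f x}

/-- A point `u = (x,f)` of `U` is bad if `(x, f̄_x) ∉ U`. -/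
def badPt {d : ℕ} (U : Set (Lamp d)) (u : Lamp d) : Prop :=
  (u.1, flipAt u.2 u.1) ∉ U

/-- `D(0,x) ≤ r`: the chemical distance from the origin to `x` is at most `r`. -/
def chemLE {d : ℕ} (ω : Config d) (x : Zd d) (r : ℕ) : Prop :=
  ∃ m ≤ r, ∃ γ : ℕ → Zd d, γ 0 = 0 ∧ γ m = x ∧ ∀ i < m, openAdj ω (γ i) (γ (i + 1))

/-- `B_r(C)`: chemical ball of radius `r` around the origin. -/
def chemBall {d : ℕ} (ω : Config d) (r : ℕ) : Set (Zd d) := {x | chemLE ω x r}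

/-- Lattice connected component of `x` inside a vertex set `V`. -/
def latCompIn {d : ℕ} (V : Set (Zd d)) (x : Zd d) : Set (Zd d) :=
  {y | Relation.ReflTransGen (fun a b => latAdj a b ∧ a ∈ V ∧ b ∈ V) x y}

/-- Open connected component of `x` inside a vertex set `V`. -/
def openCompIn {d : ℕ} (ω : Config d) (V : Set (Zd d)) (x : Zd d) : Set (Zd d) :=
  {y | Relation.ReflTransGen (fun a b => openAdj ω a b ∧ a ∈ V ∧ b ∈ V) x y}

/-- `L_n`: a connected component of the open subgraph inside `B_n` of maximal cardinality. -/
def IsLargestComp {d : ℕ} (ω : Config d) (n : ℕ) (L : Set (Zd d)) : Prop :=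
  (∃ x ∈ box d n, L = openCompIn ω (box d n) x) ∧
    ∀ y ∈ box d n, (openCompIn ω (box d n) y).ncard ≤ L.ncard

/-- `\bar L`: the connected component of `L` in the full open subgraph. -/
def closureOf {d : ℕ} (ω : Config d) (L : Set (Zd d)) : Set (Zd d) :=
  {y | ∃ x ∈ L, Relation.ReflTransGen (openAdj ω) x y}

/-- The boundary `∂_{\bar L_n^g} A`. -/
def bdryBar {d : ℕ} (ω : Config d) (n : ℕ) (L A : Set (Zd d)) : Set (Zd d × Zd d) :=
  {e | openAdj ω e.1 e.2 ∧ e.1 ∈ A ∩ closureOf ω L ∧ e.2 ∈ box d (n + 1) \ A}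

/-- `n(A)`: number of connected components of `B_n − L` containing a component of `A`. -/
noncomputable def nComp {d : ℕ} (n : ℕ) (L A : Set (Zd d)) : ℕ :=
  Set.ncard {P : Set (Zd d) |
    (∃ x ∈ box d n \ L, P = latCompIn (box d n \ L) x) ∧
    ∃ x ∈ A, latCompIn A x ⊆ P}

/-- The killed kernel `P^{B_r(C)}` acting on functions. -/
noncomputable def Pball {d : ℕ} (ω : Config d) (r : ℕ) (f : Zd d → ℝ) : Zd d → ℝ :=
  Set.indicator (chemBall ω r) (fun x =>
    ∑' y : Zd d, Set.indicator (chemBall ω r) (fun y => step ω x y * f y) y)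

/-- The Dirichlet form `ξ(f,f) = ((Id − P^{B_r(C)}) 1_{B_r(C)} f | f)_ν`. -/
noncomputable def dirichletForm {d : ℕ} (ω : Config d) (r : ℕ) (f : Zd d → ℝ) : ℝ :=
  ∑' x : Zd d, (nu ω x : ℝ) * f x *
    (Set.indicator (chemBall ω r) f x - Pball ω r (Set.indicator (chemBall ω r) f) x)

/-- `‖f‖²_{l²(ν)}`. -/
noncomputable def normSq {d : ℕ} (ω : Config d) (f : Zd d → ℝ) : ℝ :=
  ∑' x : Zd d, (nu ω x : ℝ) * f x ^ 2

/-- `λ_1(B_r(C))`: smallest Dirichlet eigenvalue of the killed walk. -/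
noncomputable def lambda1 {d : ℕ} (ω : Config d) (r : ℕ) : ℝ :=
  sInf {t : ℝ | ∃ f : Zd d → ℝ, f ≠ 0 ∧ Function.support f ⊆ chemBall ω r ∧
    t = dirichletForm ω r f / normSq ω f}

open Relation

/-! ### Product Bernoulli measures -/

/-- The Bernoulli law on `Bool`. -/
noncomputable def berM (q : unitInterval) : Measure Bool :=
  ENNReal.ofReal q • Measure.dirac true + ENNReal.ofReal (1 - q) • Measure.dirac false

lemma berM_singleton (q : unitInterval) (b : Bool) :
    berM q {b} = if b then ENNReal.ofReal q else ENNReal.ofReal (1 - q) := by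
  cases b <;> simp [berM]

instance (q : unitInterval) : IsProbabilityMeasure (berM q) := by
  constructor
  simp only [berM, Measure.coe_add, Measure.coe_smul, Pi.add_apply, Pi.smul_apply,
    measure_univ, smul_eq_mul, mul_one]
  rw [← ENNReal.ofReal_add q.2.1 (by linarith [q.2.2])]
  simp

/-- Independent Bernoulli variables indexed by `ι`. -/
noncomputable def bern {ι : Type*} (q : ι → unitInterval) : Measure (ι → Bool) :=
  Measure.infinitePi fun i => berM (q i)

instance {ι : Type*} (q : ι → unitInterval) : IsProbabilityMeasure (bern q) := by
  unfold bern; infer_instance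

/-- Weight of a single coordinate. -/
noncomputable def bw (q : unitInterval) (b : Bool) : ℝ := if b then (q : ℝ) else 1 - q

lemma bw_nonneg (q : unitInterval) (b : Bool) : 0 ≤ bw q b := by
  unfold bw; split_ifs
  · exact q.2.1
  · linarith [q.2.2]

lemma berM_singleton_toReal (q : unitInterval) (b : Bool) : (berM q {b}) = ENNReal.ofReal (bw q b) := by
  rw [berM_singleton, bw]; split_ifs <;> rfl

lemma bern_cyl {ι : Type*} (q : ι → unitInterval) (s : Finset ι) (f : ι → Bool) :
    bern q {ω | ∀ i ∈ s, ω i = f i} = ∏ i ∈ s, ENNReal.ofReal (bw (q i) (f i)) := by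
  have : {ω : ι → Bool | ∀ i ∈ s, ω i = f i} = Set.pi (s : Set ι) (fun i => {f i}) := by
    ext ω; simp [Set.mem_pi]
  rw [this, bern, Measure.infinitePi_pi _ (fun i _ => measurableSet_singleton _)]
  simp [berM_singleton_toReal]

/-- A probability measure with Bernoulli cylinder probabilities is the product measure. -/
lemma eq_bern {ι : Type*} (q : ι → unitInterval) (μ : Measure (ι → Bool)) [IsProbabilityMeasure μ]
    (h : ∀ (s : Finset ι) (f : ι → Bool),
      μ {ω | ∀ i ∈ s, ω i = f i} = ∏ i ∈ s, ENNReal.ofReal (bw (q i) (f i))) : μ = bern q := by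
  refine (Measure.isProjectiveLimit_infinitePi (fun i => berM (q i))).unique ?_ |>.symm
  intro s
  refine Measure.ext_of_singleton fun g => ?_
  classical
  rw [Measure.map_apply (by fun_prop) (measurableSet_singleton _), Measure.pi_singleton]
  have e : s.restrict ⁻¹' ({g} : Set (s → Bool)) =
      {ω : ι → Bool | ∀ i ∈ s, ω i = (fun i => if hi : i ∈ s then g ⟨i, hi⟩ else false) i} := by
    ext ω
    simp only [Set.mem_preimage, Set.mem_singleton_iff, Set.mem_ofPred_eq, funext_iff]
    constructor
    · intro h i hi; simp [hi, ← h ⟨i, hi⟩]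
    · rintro h ⟨i, hi⟩; simpa [hi] using h i hi
  rw [e, h, ← Finset.prod_coe_sort]
  refine Finset.prod_congr rfl fun i _ => ?_
  rw [berM_singleton_toReal]; simp

/-- The event `A` depends only on the coordinates in `S`. -/
def DetBy {ι : Type*} (S : Set ι) (A : Set (ι → Bool)) : Prop :=
  ∀ ω ω' : ι → Bool, (∀ i ∈ S, ω i = ω' i) → (ω ∈ A ↔ ω' ∈ A)

section det
variable {ι : Type*} {S T : Set ι} {A B : Set (ι → Bool)}

lemma DetBy.mono (h : DetBy S A) (hST : S ⊆ T) : DetBy T A :=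
  fun ω ω' hw => h ω ω' fun i hi => hw i (hST hi)

lemma DetBy.compl (h : DetBy S A) : DetBy S Aᶜ := fun ω ω' hw => not_congr (h ω ω' hw)

lemma DetBy.inter (h : DetBy S A) (h' : DetBy S B) : DetBy S (A ∩ B) :=
  fun ω ω' hw => and_congr (h ω ω' hw) (h' ω ω' hw)

lemma DetBy.iInter {κ : Sort*} {A : κ → Set (ι → Bool)} (h : ∀ k, DetBy S (A k)) :
    DetBy S (⋂ k, A k) := fun ω ω' hw => by
  simp only [Set.mem_iInter]; exact forall_congr' fun k => h k ω ω' hw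

lemma DetBy.eq_preimage (s : Finset ι) (h : DetBy (s : Set ι) A) [DecidableEq ι] :
    A = s.restrict ⁻¹' {g : s → Bool | (fun i => if hi : i ∈ s then g ⟨i, hi⟩ else false) ∈ A} := by
  ext ω
  refine h ω _ fun i hi => ?_
  have : i ∈ s := hi
  simp [this]

lemma DetBy.measurableSet (h : DetBy S A) (hS : S.Finite) : MeasurableSet A := by
  classical
  lift S to Finset ι using hS
  rw [h.eq_preimage]
  exact (Finset.measurable_restrict S) (Set.toFinite _).measurableSet

lemma bern_inter (q : ι → unitInterval) (hA : DetBy S A) (hB : DetBy T B) (hS : S.Finite)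
    (hT : T.Finite) (hST : Disjoint S T) :
    (bern q).real (A ∩ B) = (bern q).real A * (bern q).real B := by
  classical
  lift S to Finset ι using hS
  lift T to Finset ι using hT
  have hind : ProbabilityTheory.iIndepFun (fun i (ω : ι → Bool) => ω i) (bern q) :=
    ProbabilityTheory.iIndepFun_infinitePi (X := fun _ b => b) fun i => measurable_id
  have h2 := hind.indepFun_finset S T (by exact_mod_cast hST) (fun i => measurable_pi_apply i)
  rw [hA.eq_preimage, hB.eq_preimage]
  have := h2.measure_inter_preimage_eq_mul _ _
    (Set.toFinite {g : S → Bool | (fun i => if hi : i ∈ S then g ⟨i, hi⟩ else false) ∈ A}).measurableSet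
    (Set.toFinite {g : T → Bool | (fun i => if hi : i ∈ T then g ⟨i, hi⟩ else false) ∈ B}).measurableSet
  rw [Measure.real, Measure.real, Measure.real, ← ENNReal.toReal_mul]
  exact congrArg ENNReal.toReal this

lemma bern_biInter {κ : Type*} (q : ι → unitInterval) (s : Finset κ) (S : κ → Set ι)
    (A : κ → Set (ι → Bool)) (hA : ∀ k ∈ s, DetBy (S k) (A k)) (hS : ∀ k ∈ s, (S k).Finite)
    (hd : ∀ k ∈ s, ∀ l ∈ s, k ≠ l → Disjoint (S k) (S l)) :
    (bern q).real (⋂ k ∈ s, A k) = ∏ k ∈ s, (bern q).real (A k) := by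
  classical
  induction s using Finset.induction_on with
  | empty => simp
  | insert a s ha ih =>
    rw [Finset.prod_insert ha, Finset.set_biInter_insert, ← ih (fun k hk => hA k (by simp [hk]))
      (fun k hk => hS k (by simp [hk])) (fun k hk l hl => hd k (by simp [hk]) l (by simp [hl]))]
    refine bern_inter (T := ⋃ k ∈ s, S k) q (hA a (by simp)) ?_ (hS a (by simp)) ?_ ?_
    · refine DetBy.iInter fun k => DetBy.iInter fun hk => (hA k (by simp [hk])).mono ?_
      exact Set.subset_biUnion_of_mem (u := S) hk
    · exact s.finite_toSet.biUnion fun k hk => hS k (by simp; right; exact hk)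
    · simp only [Set.disjoint_iUnion_right]
      exact fun k hk => hd a (by simp) k (by simp [hk]) (by rintro rfl; exact ha hk)

lemma bern_real_eq_sum (q : ι → unitInterval) (s : Finset ι) [DecidableEq ι]
    (h : DetBy (s : Set ι) A) [DecidablePred (· ∈ A)] :
    (bern q).real A = ∑ g : s → Bool, (∏ i : s, bw (q i) (g i)) *
      (if (fun i => if hi : i ∈ s then g ⟨i, hi⟩ else false) ∈ A then 1 else 0) := by
  conv_lhs => rw [h.eq_preimage, Measure.real, ← Measure.map_apply (Finset.measurable_restrict s)
    (Set.toFinite _).measurableSet, bern, Measure.infinitePi_map_restrict]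
  rw [← Measure.real, ← Set.Finite.coe_toFinset (Set.toFinite {g : s → Bool |
    (fun i => if hi : i ∈ s then g ⟨i, hi⟩ else false) ∈ A}), ← sum_measureReal_singleton]
  simp only [mul_ite, mul_one, mul_zero]
  rw [← Finset.sum_filter]
  refine Finset.sum_congr (by ext; simp) fun g _ => ?_
  rw [Measure.real, Measure.pi_singleton, ENNReal.toReal_prod]
  refine Finset.prod_congr rfl fun i _ => ?_
  rw [berM_singleton_toReal, ENNReal.toReal_ofReal (bw_nonneg _ _)]

/-- Harris' inequality for increasing events depending on finitely many coordinates. -/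
lemma harris (q : ι → unitInterval) (hA : DetBy S A) (hB : DetBy S B) (hS : S.Finite)
    (mA : IsUpperSet A) (mB : IsUpperSet B) :
    (bern q).real A * (bern q).real B ≤ (bern q).real (A ∩ B) := by
  classical
  lift S to Finset ι using hS
  rw [bern_real_eq_sum q S hA, bern_real_eq_sum q S hB, bern_real_eq_sum q S (hA.inter hB)]
  have key := fkg (μ := fun g : S → Bool => ∏ i : S, bw (q i) (g i))
    (f := fun g =>
      if (fun i => if hi : i ∈ S then g ⟨i, hi⟩ else false) ∈ A then (1 : ℝ) else 0)
    (g := fun g =>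
      if (fun i => if hi : i ∈ S then g ⟨i, hi⟩ else false) ∈ B then (1 : ℝ) else 0)
    (fun g => Finset.prod_nonneg fun i _ => bw_nonneg _ _)
    (fun g => by dsimp only [Pi.zero_apply]; positivity)
    (fun g => by dsimp only [Pi.zero_apply]; positivity) ?_ ?_ ?_
  · have h1 : ∑ g : S → Bool, ∏ i : S, bw (q i) (g i) = 1 := by
      have := bern_real_eq_sum (A := Set.univ) q S (fun _ _ _ => Iff.rfl)
      simpa using this.symm
    rw [h1, one_mul] at key
    refine key.trans (le_of_eq (Finset.sum_congr rfl fun g _ => ?_))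
    simp only [Set.mem_inter_iff]
    split_ifs <;> simp_all
  · intro g g' hgg
    dsimp only
    split_ifs with h1 h2
    · exact le_rfl
    · refine absurd (mA ?_ h1) h2
      intro i; dsimp only; split_ifs
      · exact hgg _
      · exact le_rfl
    · exact zero_le_one
    · exact le_rfl
  · intro g g' hgg
    dsimp only
    split_ifs with h1 h2
    · exact le_rfl
    · refine absurd (mB ?_ h1) h2
      intro i; dsimp only; split_ifs
      · exact hgg _
      · exact le_rfl
    · exact zero_le_one
    · exact le_rfl
  · intro a b
    rw [← Finset.prod_mul_distrib, ← Finset.prod_mul_distrib]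
    refine le_of_eq (Finset.prod_congr rfl fun i _ => ?_)
    simp only [Pi.inf_apply, Pi.sup_apply]
    cases a i <;> cases b i <;> simp [mul_comm]

lemma bern_compl (q : ι → unitInterval) (hA : DetBy S A) (hS : S.Finite) :
    (bern q).real Aᶜ = 1 - (bern q).real A := by
  rw [measureReal_compl (hA.measurableSet hS)]; simp

/-- Increasing and decreasing events are negatively correlated. -/
lemma harris_upper_lower (q : ι → unitInterval) (hA : DetBy S A) (hB : DetBy S B) (hS : S.Finite)
    (mA : IsUpperSet A) (mB : IsLowerSet B) :
    (bern q).real (A ∩ B) ≤ (bern q).real A * (bern q).real B := by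
  have h := harris q hA hB.compl hS mA mB.compl
  rw [bern_compl q hB hS] at h
  have : (bern q).real (A ∩ B) = (bern q).real A - (bern q).real (A ∩ Bᶜ) := by
    have := measureReal_inter_add_sdiff (μ := bern q) (s := A) (hB.measurableSet hS)
    rw [Set.sdiff_eq] at this; linarith
  linarith

lemma harris_lower (q : ι → unitInterval) (hA : DetBy S A) (hB : DetBy S B) (hS : S.Finite)
    (mA : IsLowerSet A) (mB : IsLowerSet B) :
    (bern q).real A * (bern q).real B ≤ (bern q).real (A ∩ B) := by
  have h := harris_upper_lower q hA.compl hB hS mA.compl mB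
  rw [bern_compl q hA hS] at h
  have : (bern q).real (Aᶜ ∩ B) = (bern q).real B - (bern q).real (A ∩ B) := by
    have := measureReal_inter_add_sdiff (μ := bern q) (s := B) (hA.measurableSet hS)
    rw [Set.sdiff_eq] at this; rw [Set.inter_comm, Set.inter_comm A B]; linarith
  linarith

lemma harris_lower_biInter {κ : Type*} (q : ι → unitInterval) (hS : S.Finite) (s : Finset κ)
    (A : κ → Set (ι → Bool)) (hA : ∀ k ∈ s, DetBy S (A k)) (mA : ∀ k ∈ s, IsLowerSet (A k)) :
    ∏ k ∈ s, (bern q).real (A k) ≤ (bern q).real (⋂ k ∈ s, A k) := by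
  classical
  induction s using Finset.induction_on with
  | empty => simp
  | insert a s ha ih =>
    rw [Finset.prod_insert ha, Finset.set_biInter_insert]
    refine le_trans (mul_le_mul_of_nonneg_left (ih (fun k hk => hA k (by simp [hk]))
      (fun k hk => mA k (by simp [hk]))) measureReal_nonneg) ?_
    exact harris_lower q (hA a (by simp))
      (DetBy.iInter fun k => DetBy.iInter fun hk => hA k (by simp [hk])) hS (mA a (by simp))
      (isLowerSet_iInter fun k => isLowerSet_iInter fun hk => mA k (by simp [hk]))

lemma bern_le_sum {κ : Type*} (q : ι → unitInterval) (t : Finset κ) (E F : κ → Set (ι → Bool))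
    (S T : κ → Set ι) (c : κ → ℝ) (hE : ∀ k ∈ t, DetBy (S k) (E k)) (hS : ∀ k ∈ t, (S k).Finite)
    (hF : ∀ k ∈ t, DetBy (T k) (F k)) (hT : ∀ k ∈ t, (T k).Finite)
    (hd : ∀ k ∈ t, Disjoint (S k) (T k)) (hc : ∀ k ∈ t, (bern q).real (F k) ≤ c k)
    (hA : A ⊆ ⋃ k ∈ t, E k ∩ F k) :
    (bern q).real A ≤ ∑ k ∈ t, (bern q).real (E k) * c k := by
  refine (measureReal_mono hA (measure_ne_top _ _)).trans ((measureReal_biUnion_finset_le _ _).trans ?_)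
  refine Finset.sum_le_sum fun k hk => ?_
  rw [bern_inter q (hE k hk) (hF k hk) (hS k hk) (hT k hk) (hd k hk)]
  exact mul_le_mul_of_nonneg_left (hc k hk) measureReal_nonneg

lemma bern_sum_le {κ : Type*} (q : ι → unitInterval) (t : Finset κ) (E : κ → Set (ι → Bool))
    (S : κ → Set ι) (hE : ∀ k ∈ t, DetBy (S k) (E k)) (hS : ∀ k ∈ t, (S k).Finite)
    (hd : ∀ k ∈ t, ∀ l ∈ t, k ≠ l → Disjoint (E k) (E l)) (hA : ∀ k ∈ t, E k ⊆ A) :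
    ∑ k ∈ t, (bern q).real (E k) ≤ (bern q).real A := by
  rw [← measureReal_biUnion_finset (fun k hk l hl h => hd k hk l hl h)
    (fun k hk => (hE k hk).measurableSet (hS k hk))]
  exact measureReal_mono (Set.iUnion₂_subset hA) (measure_ne_top _ _)

end det

lemma bern_map_comp {ι κ : Type*} (q : ι → unitInterval) (e : κ ≃ ι) :
    (bern q).map (fun ω => ω ∘ e) = bern (q ∘ e) := by
  have hm : Measurable (fun ω : ι → Bool => ω ∘ e) := by
    refine measurable_pi_lambda _ fun i => measurable_pi_apply _
  have : IsProbabilityMeasure ((bern q).map (fun ω => ω ∘ e)) :=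
    Measure.isProbabilityMeasure_map hm.aemeasurable
  refine eq_bern _ _ fun s f => ?_
  have hs : DetBy (s : Set κ) {ω : κ → Bool | ∀ i ∈ s, ω i = f i} := fun ω ω' h =>
    forall₂_congr fun i hi => by rw [h i hi]
  rw [Measure.map_apply hm (hs.measurableSet s.finite_toSet)]
  have := bern_cyl q (s.map e.toEmbedding) (f ∘ e.symm)
  simp only [Finset.mem_map_equiv, Finset.prod_map, Equiv.coe_toEmbedding, Function.comp,
    Equiv.symm_apply_apply] at this
  simp only [Function.comp]
  rw [← this]
  congr 1
  ext ω
  simp only [Set.mem_preimage, Set.mem_ofPred_eq, Function.comp]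
  constructor
  · intro h i hi; simpa using h _ hi
  · intro h i hi; simpa using h (e i) (by simpa using hi)

/-- Taking the maximum over independent labels yields independent Bernoulli variables. -/
lemma bern_map_merge {ι κ : Type*} [Fintype κ] (q : ι × κ → unitInterval) (p : ι → unitInterval)
    (h : ∀ i, ∏ c, (1 - (q (i, c) : ℝ)) = 1 - p i) :
    (bern q).map (fun b i => decide (∃ c, b (i, c) = true)) = bern p := by
  classical
  have hdet : ∀ i (v : Bool), DetBy {x : ι × κ | x.1 = i}
      {b : ι × κ → Bool | decide (∃ c, b (i, c) = true) = v} := by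
    intro i v b b' hb
    have : (∃ c, b (i, c) = true) ↔ ∃ c, b' (i, c) = true :=
      exists_congr fun c => by rw [hb (i, c) rfl]
    simp [this]
  have hfin : ∀ i, {x : ι × κ | x.1 = i}.Finite := fun i => by
    refine (Set.finite_range (fun c : κ => (i, c))).subset ?_
    rintro ⟨a, b⟩ rfl; exact ⟨b, rfl⟩
  have hm : Measurable (fun (b : ι × κ → Bool) (i : ι) => decide (∃ c, b (i, c) = true)) := by
    refine measurable_pi_lambda _ fun i => measurable_to_bool ?_
    exact (hdet i true).measurableSet (hfin i)
  have : IsProbabilityMeasure ((bern q).map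
      (fun (b : ι × κ → Bool) (i : ι) => decide (∃ c, b (i, c) = true))) :=
    Measure.isProbabilityMeasure_map hm.aemeasurable
  refine eq_bern _ _ fun s f => ?_
  have hs : DetBy (s : Set ι) {ω : ι → Bool | ∀ i ∈ s, ω i = f i} := fun ω ω' h =>
    forall₂_congr fun i hi => by rw [h i hi]
  rw [Measure.map_apply hm (hs.measurableSet s.finite_toSet)]
  have h0 : ∀ i, (bern q).real {b : ι × κ → Bool | decide (∃ c, b (i, c) = true) = false} =
      1 - p i := by
    intro i
    have := bern_cyl q (Finset.univ.image fun c : κ => (i, c)) (fun _ => false)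
    rw [← h i]
    rw [Measure.real]
    have e : {b : ι × κ → Bool | decide (∃ c, b (i, c) = true) = false} =
      {ω : ι × κ → Bool | ∀ x ∈ Finset.univ.image fun c : κ => (i, c), ω x = false} := by
      ext b; simp
    rw [e, this, ENNReal.toReal_prod]
    rw [Finset.prod_image (by intro a _ b _ h; simpa using h)]
    refine Finset.prod_congr rfl fun c _ => ?_
    rw [ENNReal.toReal_ofReal (bw_nonneg _ _)]; simp [bw]
  have h1 : ∀ i (v : Bool), (bern q).real {b : ι × κ → Bool | decide (∃ c, b (i, c) = true) = v} =
      bw (p i) v := by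
    intro i v
    cases v
    · rw [h0]; simp [bw]
    · have := bern_compl q (hdet i false) (hfin i)
      rw [h0] at this
      simp only [bw, if_true]
      have e : {b : ι × κ → Bool | decide (∃ c, b (i, c) = true) = true} =
        {b : ι × κ → Bool | decide (∃ c, b (i, c) = true) = false}ᶜ := by
        ext b; simp
      rw [e, this]; ring
  have h2 := bern_biInter q s (fun i => {x : ι × κ | x.1 = i})
    (fun i => {b : ι × κ → Bool | decide (∃ c, b (i, c) = true) = f i})
    (fun i _ => hdet i _) (fun i _ => hfin i) (fun i _ j _ hij => by
      rw [Set.disjoint_left]; rintro x rfl; exact hij)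
  have e : (fun (b : ι × κ → Bool) (i : ι) => decide (∃ c, b (i, c) = true)) ⁻¹'
      {ω : ι → Bool | ∀ i ∈ s, ω i = f i} =
      ⋂ i ∈ s, {b : ι × κ → Bool | decide (∃ c, b (i, c) = true) = f i} := by
    ext b; simp
  rw [e, ← ENNReal.ofReal_toReal (measure_ne_top (bern q) _)]
  change ENNReal.ofReal ((bern q).real _) = _
  rw [h2, ENNReal.ofReal_prod_of_nonneg (fun _ _ => measureReal_nonneg)]
  simp_rw [h1]

lemma IsBernoulli.eq_bern {d : ℕ} {p : unitInterval} {Q : Measure (Config d)}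
    (h : IsBernoulli (p : ℝ) Q) : Q = bern fun _ => p := by
  have := h.1
  refine Perco.eq_bern _ _ fun s f => ?_
  have h2 := h.2 s f
  rw [h2]
  refine Finset.prod_congr rfl fun i _ => ?_
  rw [bw]; split_ifs <;> rfl

/-! ### Paths and lattice geometry -/

section rtg
variable {V : Type*} {r r' : V → V → Prop} {x y : V}

/-- The restriction of a relation to a set. -/
def restr (r : V → V → Prop) (S : Set V) : V → V → Prop := fun a b => r a b ∧ a ∈ S ∧ b ∈ S

lemma restr_mono {S T : Set V} (h : ∀ a ∈ S, ∀ b ∈ S, r a b → r' a b) (hST : S ⊆ T) (x y : V)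
    (hxy : restr r S x y) : restr r' T x y :=
  ⟨h x hxy.2.1 y hxy.2.2 hxy.1, hST hxy.2.1, hST hxy.2.2⟩

lemma rtg_mono (hr : ∀ a b, r a b → r' a b) (h : ReflTransGen r x y) : ReflTransGen r' x y := by
  induction h with
  | refl => exact .refl
  | tail _ hbc ih => exact ih.tail (hr _ _ hbc)

lemma rtg_lift {W : Type*} {t : W → W → Prop} (f : V → W) (hr : ∀ a b, r a b → t (f a) (f b))
    (h : ReflTransGen r x y) : ReflTransGen t (f x) (f y) := by
  induction h with
  | refl => exact .refl
  | tail _ hbc ih => exact ih.tail (hr _ _ hbc)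

lemma rtg_exit (h : ReflTransGen r x y) {S : Set V} (hx : x ∈ S) (hy : y ∉ S) :
    ∃ a b, ReflTransGen (restr r S) x a ∧ a ∈ S ∧ r a b ∧ b ∉ S ∧ ReflTransGen r b y := by
  induction h using ReflTransGen.head_induction_on with
  | refl => exact absurd hx hy
  | @head a c hac hcy ih =>
    by_cases hc : c ∈ S
    · obtain ⟨a', b', h1, h2, h3, h4, h5⟩ := ih hc
      exact ⟨a', b', ReflTransGen.head ⟨hac, hx, hc⟩ h1, h2, h3, h4, h5⟩
    · exact ⟨a, c, .refl, hx, hac, hc, hcy⟩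

lemma rtg_symm (hr : ∀ a b, r a b → r b a) (h : ReflTransGen r x y) : ReflTransGen r y x := by
  induction h with
  | refl => exact .refl
  | tail _ hbc ih => exact ReflTransGen.head (hr _ _ hbc) ih

lemma rtg_last_exit (hr : ∀ a b, r a b → r b a) (h : ReflTransGen r x y) {S : Set V}
    (hx : x ∈ S) (hy : y ∉ S) :
    ∃ a b, a ∈ S ∧ r a b ∧ b ∉ S ∧ ReflTransGen r x a ∧ ReflTransGen (restr r Sᶜ) b y := by
  obtain ⟨b, a, h1, h2, h3, h4, h5⟩ := rtg_exit (rtg_symm hr h) (S := Sᶜ) hy (by simpa using hx)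
  exact ⟨a, b, by simpa using h4, hr _ _ h3, h2, rtg_symm hr h5,
    rtg_symm (fun a b hab => ⟨hr _ _ hab.1, hab.2.2, hab.2.1⟩) h1⟩

lemma rtg_ivt (h : ReflTransGen r x y) (f : V → ℤ) (hf : ∀ a b, r a b → f b ≤ f a + 1) {t : ℤ}
    (hx : f x ≤ t) (hy : t ≤ f y) : ∃ z, ReflTransGen r x z ∧ f z = t := by
  induction h with
  | refl => exact ⟨x, .refl, le_antisymm hx hy⟩
  | @tail b c hxb hbc ih =>
    by_cases hb : t ≤ f b
    · exact ih hb
    · exact ⟨c, hxb.tail hbc, by have := hf b c hbc; omega⟩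

lemma rtg_mem {S : Set V} (h : ReflTransGen (restr r S) x y) (hx : x ∈ S) : y ∈ S := by
  induction h with
  | refl => exact hx
  | tail _ hbc _ => exact hbc.2.2

lemma rtg_of_closed {S : Set V} (h : ReflTransGen r x y) (hS : ∀ a b, a ∈ S → r a b → b ∈ S)
    (hx : x ∈ S) : y ∈ S := by
  induction h with
  | refl => exact hx
  | tail _ hbc ih => exact hS _ _ ih hbc

/-- A walk can be restricted to the set of its own vertices reachable so far. -/
lemma rtg_restr_closed {S : Set V} (h : ReflTransGen r x y) (hS : ∀ a b, a ∈ S → r a b → b ∈ S)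
    (hx : x ∈ S) : ReflTransGen (restr r S) x y := by
  induction h with
  | refl => exact .refl
  | tail hab hbc ih =>
    exact ih.tail ⟨hbc, rtg_mem ih hx, hS _ _ (rtg_mem ih hx) hbc⟩

end rtg

section lattice
variable {d : ℕ}

lemma latAdj_comm {x y : Zd d} : latAdj x y ↔ latAdj y x := by
  simp only [latAdj, abs_sub_comm]

lemma latAdj.symm {x y : Zd d} (h : latAdj x y) : latAdj y x := latAdj_comm.1 h

lemma latAdj_iff {x y : Zd d} : latAdj x y ↔
    ∃ i, ∃ s : ℤ, (s = 1 ∨ s = -1) ∧ y = Function.update x i (x i + s) := by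
  constructor
  · intro h
    obtain ⟨i, hi⟩ : ∃ i, x i ≠ y i := by
      by_contra hc; push Not at hc
      have : x = y := funext hc
      subst this; simp [latAdj] at h
    have h1 : |x i - y i| + ∑ j ∈ Finset.univ.erase i, |x j - y j| = 1 := by
      rw [Finset.add_sum_erase _ (fun j => |x j - y j|) (Finset.mem_univ i)]; exact h
    have h2 : 1 ≤ |x i - y i| := Int.one_le_abs (sub_ne_zero.2 hi)
    have h3 : 0 ≤ ∑ j ∈ Finset.univ.erase i, |x j - y j| := Finset.sum_nonneg fun _ _ => abs_nonneg _
    have h4 : ∑ j ∈ Finset.univ.erase i, |x j - y j| = 0 := by omega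
    rw [Finset.sum_eq_zero_iff_of_nonneg fun _ _ => abs_nonneg _] at h4
    refine ⟨i, y i - x i, ?_, ?_⟩
    · have : |x i - y i| = 1 := by omega
      rcases abs_eq (zero_le_one) |>.1 this with h | h <;> omega
    · ext j
      by_cases hj : j = i
      · subst hj; simp
      · rw [Function.update_of_ne hj]
        have := h4 j (by simp [hj])
        rw [abs_eq_zero] at this; omega
  · rintro ⟨i, s, hs, rfl⟩
    rw [latAdj, Finset.sum_eq_single i]
    · rcases hs with rfl | rfl <;> simp
    · intro j _ hj; simp [Function.update_of_ne hj]
    · simp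

lemma latAdj.abs_le {x y : Zd d} (h : latAdj x y) (i : Fin d) : |x i - y i| ≤ 1 := by
  rw [latAdj] at h
  rw [← h]
  exact Finset.single_le_sum (f := fun i => |x i - y i|) (fun _ _ => abs_nonneg _) (Finset.mem_univ i)

lemma latAdj.ne {x y : Zd d} (h : latAdj x y) : x ≠ y := by
  rintro rfl; simp [latAdj] at h

lemma latAdj_update (x : Zd d) (i : Fin d) (s : ℤ) (hs : s = 1 ∨ s = -1) :
    latAdj x (Function.update x i (x i + s)) := latAdj_iff.2 ⟨i, s, hs, rfl⟩

lemma openAdj.symm {ω : Config d} {x y : Zd d} (h : openAdj ω x y) : openAdj ω y x :=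
  ⟨h.1.symm, by rw [Sym2.eq_swap]; exact h.2⟩

/-- The sup-norm distance. -/
def dst (x y : Zd d) : ℕ := Finset.univ.sup fun i => (x i - y i).natAbs

lemma dst_le {x y : Zd d} {n : ℕ} : dst x y ≤ n ↔ ∀ i, |x i - y i| ≤ n := by
  simp only [dst, Finset.sup_le_iff, Finset.mem_univ, true_imp_iff]
  exact forall_congr' fun i => by rw [Int.abs_eq_natAbs]; omega

lemma dst_comm (x y : Zd d) : dst x y = dst y x := by
  simp only [dst]; congr 1; ext i; omega

lemma dst_triangle (x y z : Zd d) : dst x z ≤ dst x y + dst y z := by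
  rw [dst_le]; intro i
  have h1 := dst_le.1 (le_refl (dst x y)) i
  have h2 := dst_le.1 (le_refl (dst y z)) i
  have := abs_sub_le (x i) (y i) (z i)
  push_cast; linarith

lemma abs_le_dst (x y : Zd d) (i : Fin d) : |x i - y i| ≤ dst x y := dst_le.1 le_rfl i

lemma exists_eq_dst [NeZero d] (x y : Zd d) : ∃ i, |x i - y i| = dst x y := by
  obtain ⟨i, -, hi⟩ := Finset.exists_mem_eq_sup (Finset.univ : Finset (Fin d)) Finset.univ_nonempty
    (fun i => (x i - y i).natAbs)
  exact ⟨i, by rw [dst, hi]; simp⟩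

@[simp] lemma dst_self (x : Zd d) : dst x x = 0 := by
  rw [← Nat.le_zero, dst_le]; simp

lemma latAdj.dst_le {x y : Zd d} (h : latAdj x y) : dst x y ≤ 1 := Perco.dst_le.2 h.abs_le

/-- Closed sup-norm ball. -/
def ball (x : Zd d) (n : ℕ) : Set (Zd d) := {y | dst y x ≤ n}

lemma mem_ball {x y : Zd d} {n : ℕ} : y ∈ ball x n ↔ ∀ i, |y i - x i| ≤ n := dst_le

lemma mem_ball' {x y : Zd d} {n : ℕ} : y ∈ ball x n ↔ dst y x ≤ n := Iff.rfl

lemma ball_finite (x : Zd d) (n : ℕ) : (ball x n).Finite := by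
  refine (Set.finite_Icc (fun i => x i - n) (fun i => x i + n)).subset fun y hy => ?_
  rw [mem_ball] at hy
  constructor <;> intro i <;> have := abs_le.1 (hy i) <;> simp only <;> omega

lemma ball_subset {x y : Zd d} {m n : ℕ} (h : m + dst x y ≤ n) : ball x m ⊆ ball y n :=
  fun z hz => by
    have := dst_triangle z x y
    have hz : dst z x ≤ m := hz
    show dst z y ≤ n; omega

lemma box_eq_ball (n : ℕ) : box d n = ball 0 n := by
  ext x; simp [box, mem_ball]

lemma self_mem_ball (x : Zd d) (n : ℕ) : x ∈ ball x n := by simp [mem_ball]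

/-- Edges with both endpoints in `R`. -/
def edgesIn (R : Set (Zd d)) : Set (Sym2 (Zd d)) := {e | ∀ v ∈ e, v ∈ R}

lemma mem_edgesIn {R : Set (Zd d)} {a b : Zd d} : s(a, b) ∈ edgesIn R ↔ a ∈ R ∧ b ∈ R := by
  simp [edgesIn]

lemma edgesIn_finite {R : Set (Zd d)} (h : R.Finite) : (edgesIn R).Finite := by
  refine ((h.prod h).image fun x => s(x.1, x.2)).subset fun e => ?_
  induction e with | _ a b
  intro he
  rw [mem_edgesIn] at he
  exact ⟨(a, b), he, rfl⟩

lemma edgesIn_mono {R R' : Set (Zd d)} (h : R ⊆ R') : edgesIn R ⊆ edgesIn R' :=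
  fun _ he v hv => h (he v hv)

lemma edgesIn_disjoint {R R' : Set (Zd d)} (h : Disjoint R R') :
    Disjoint (edgesIn R) (edgesIn R') := by
  rw [Set.disjoint_left]
  intro e
  induction e with | _ a b
  intro h1 h2
  exact Set.disjoint_left.1 h (mem_edgesIn.1 h1).1 (mem_edgesIn.1 h2).1

/-- Open connection inside `R`. -/
def Conn (ω : Config d) (R : Set (Zd d)) (x y : Zd d) : Prop :=
  Relation.ReflTransGen (restr (openAdj ω) R) x y

section conn
variable {ω ω' : Config d} {R R' : Set (Zd d)} {x y z : Zd d}

lemma Conn.refl (x : Zd d) : Conn ω R x x := Relation.ReflTransGen.refl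

lemma Conn.trans (h : Conn ω R x y) (h' : Conn ω R y z) : Conn ω R x z :=
  Relation.ReflTransGen.trans h h'

lemma restr_openAdj_symm (a b : Zd d) (h : restr (openAdj ω) R a b) : restr (openAdj ω) R b a :=
  ⟨h.1.symm, h.2.2, h.2.1⟩

lemma Conn.symm (h : Conn ω R x y) : Conn ω R y x := rtg_symm restr_openAdj_symm h

lemma Conn.mono (h : Conn ω R x y) (hR : R ⊆ R')
    (hω : ∀ a ∈ R, ∀ b ∈ R, ω s(a, b) = true → ω' s(a, b) = true) : Conn ω' R' x y :=
  rtg_mono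
    (restr_mono (fun a ha b hb hab => ⟨hab.1, hω a ha b hb hab.2⟩) hR) h

lemma Conn.mono_set (h : Conn ω R x y) (hR : R ⊆ R') : Conn ω R' x y :=
  h.mono hR fun _ _ _ _ => id

lemma Conn.mem (h : Conn ω R x y) (hx : x ∈ R) : y ∈ R := rtg_mem h hx

lemma Conn.single (h : openAdj ω x y) (hx : x ∈ R) (hy : y ∈ R) : Conn ω R x y :=
  Relation.ReflTransGen.single ⟨h, hx, hy⟩

lemma Conn.exit (h : Conn ω R x y) {S : Set (Zd d)} (hx : x ∈ S) (hy : y ∉ S) :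
    ∃ a b, Conn ω (R ∩ S) x a ∧ a ∈ R ∩ S ∧ openAdj ω a b ∧ b ∈ R ∧ b ∉ S ∧ Conn ω R b y := by
  obtain ⟨a, b, h1, h2, h3, h4, h5⟩ := rtg_exit h hx hy
  refine ⟨a, b, rtg_mono ?_ h1, ⟨h3.2.1, h2⟩, h3.1, h3.2.2, h4, h5⟩
  rintro a b ⟨⟨h, h'⟩, h''⟩
  exact ⟨h, ⟨h'.1, h''.1⟩, ⟨h'.2, h''.2⟩⟩

lemma Conn.last_exit (h : Conn ω R x y) {S : Set (Zd d)} (hx : x ∈ S) (hy : y ∉ S) :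
    ∃ a b, a ∈ R ∩ S ∧ openAdj ω a b ∧ b ∈ R \ S ∧ Conn ω R x a ∧ Conn ω (R \ S) b y := by
  obtain ⟨a, b, h1, h2, h3, h4, h5⟩ := rtg_last_exit restr_openAdj_symm h hx hy
  refine ⟨a, b, ⟨h2.2.1, h1⟩, h2.1, ⟨h2.2.2, h3⟩, h4, rtg_mono ?_ h5⟩
  rintro a b ⟨⟨h, h'⟩, h''⟩
  exact ⟨h, ⟨h'.1, h''.1⟩, ⟨h'.2, h''.2⟩⟩

lemma Conn.rtg (h : Conn ω R x y) : Relation.ReflTransGen (openAdj ω) x y :=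
  rtg_mono (fun _ _ h => h.1) h

lemma conn_univ : Conn ω Set.univ x y ↔ Relation.ReflTransGen (openAdj ω) x y :=
  ⟨Conn.rtg, fun h => rtg_mono (fun _ _ h => ⟨h, trivial, trivial⟩) h⟩

lemma conn_congr (h : ∀ e ∈ edgesIn R, ω e = ω' e) : Conn ω R x y ↔ Conn ω' R x y := by
  constructor <;> intro hc <;> refine hc.mono subset_rfl fun a ha b hb hab => ?_
  · rw [← h _ (mem_edgesIn.2 ⟨ha, hb⟩)]; exact hab
  · rw [h _ (mem_edgesIn.2 ⟨ha, hb⟩)]; exact hab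

lemma detBy_conn (R : Set (Zd d)) (x y : Zd d) : DetBy (edgesIn R) {ω | Conn ω R x y} :=
  fun _ _ h => conn_congr h

lemma isUpperSet_conn (R : Set (Zd d)) (x y : Zd d) : IsUpperSet {ω : Config d | Conn ω R x y} := by
  intro ω ω' hω hc
  refine Conn.mono hc subset_rfl fun a _ b _ hab => ?_
  have := hω s(a, b)
  rw [hab] at this
  exact top_le_iff.1 this

end conn

/-- A set is connected to another inside `R`. -/
def SConn (ω : Config d) (R S T : Set (Zd d)) : Prop := ∃ x ∈ S, ∃ y ∈ T, Conn ω R x y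

lemma detBy_sconn (R S T : Set (Zd d)) : DetBy (edgesIn R) {ω | SConn ω R S T} :=
  fun _ _ h => exists_congr fun _ => and_congr_right fun _ => exists_congr fun _ =>
    and_congr_right fun _ => conn_congr h

lemma isUpperSet_sconn (R S T : Set (Zd d)) : IsUpperSet {ω : Config d | SConn ω R S T} := by
  rintro ω ω' hω ⟨x, hx, y, hy, h⟩
  exact ⟨x, hx, y, hy, isUpperSet_conn R x y hω h⟩

/-- Transport of connections along lattice automorphisms. -/
lemma conn_map (g : Zd d ≃ Zd d) (hg : ∀ a b, latAdj (g a) (g b) ↔ latAdj a b) (ω : Config d)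
    (R : Set (Zd d)) (x y : Zd d) :
    Conn (ω ∘ Sym2.map g) R x y ↔ Conn ω (g '' R) (g x) (g y) := by
  constructor
  · intro h
    refine rtg_lift g ?_ h
    rintro a b ⟨⟨h1, h2⟩, ha, hb⟩
    exact ⟨⟨(hg a b).2 h1, h2⟩, ⟨a, ha, rfl⟩, ⟨b, hb, rfl⟩⟩
  · intro h
    have : Conn (ω ∘ Sym2.map g) R (g.symm (g x)) (g.symm (g y)) := by
      refine rtg_lift g.symm ?_ h
      rintro _ _ ⟨⟨h1, h2⟩, ⟨a, ha, rfl⟩, ⟨b, hb, rfl⟩⟩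
      simp only [Equiv.symm_apply_apply]
      exact ⟨⟨(hg a b).1 h1, h2⟩, ha, hb⟩
    simpa using this

/-- The permutation of edges induced by a permutation of vertices. -/
def symEquiv (g : Zd d ≃ Zd d) : Sym2 (Zd d) ≃ Sym2 (Zd d) where
  toFun := Sym2.map g
  invFun := Sym2.map g.symm
  left_inv e := by induction e with | _ a b => simp
  right_inv e := by induction e with | _ a b => simp

lemma bern_real_map (p : unitInterval) (g : Zd d ≃ Zd d) {A : Set (Config d)}
    {S : Set (Sym2 (Zd d))} (hA : DetBy S A) (hS : S.Finite) :
    (bern fun _ => p).real {ω : Config d | ω ∘ Sym2.map g ∈ A} = (bern fun _ => p).real A := by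
  have h := bern_map_comp (fun _ : Sym2 (Zd d) => p) (symEquiv g)
  have hm : Measurable (fun ω : Config d => ω ∘ (symEquiv g)) := by
    refine measurable_pi_lambda _ fun i => measurable_pi_apply _
  have h2 : bern (fun _ : Sym2 (Zd d) => p) A = bern (fun _ => p)
      ((fun ω : Config d => ω ∘ (symEquiv g)) ⁻¹' A) := by
    rw [← Measure.map_apply hm (hA.measurableSet hS), h]; rfl
  rw [Measure.real, Measure.real, h2]; rfl

end lattice

/-! ### Static estimates above the critical point -/

section
variable {d : ℕ}

/-- Probability under the homogeneous product measure. -/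
noncomputable def Pr (p : unitInterval) (A : Set (Config d)) : ℝ := (bern fun _ => p).real A

lemma Pr_nonneg (p : unitInterval) (A : Set (Config d)) : 0 ≤ Pr p A := measureReal_nonneg

lemma Pr_mono (p : unitInterval) {A B : Set (Config d)} (h : A ⊆ B) : Pr p A ≤ Pr p B :=
  measureReal_mono h (measure_ne_top _ _)

lemma Pr_le_one (p : unitInterval) (A : Set (Config d)) : Pr p A ≤ 1 := measureReal_le_one

lemma Pr_union_le (p : unitInterval) (A B : Set (Config d)) : Pr p (A ∪ B) ≤ Pr p A + Pr p B :=
  measureReal_union_le _ _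

lemma Pr_biUnion_le {κ : Type*} (p : unitInterval) (s : Finset κ) (A : κ → Set (Config d)) :
    Pr p (⋃ k ∈ s, A k) ≤ ∑ k ∈ s, Pr p (A k) := measureReal_biUnion_finset_le _ _

lemma Icc_latConn (lo hi x y : Zd d) (hx : x ∈ Set.Icc lo hi) (hy : y ∈ Set.Icc lo hi) :
    Relation.ReflTransGen (restr latAdj (Set.Icc lo hi)) x y := by
  obtain ⟨n, hn⟩ : ∃ n : ℕ, ∑ i, (x i - y i).natAbs = n := ⟨_, rfl⟩
  induction n using Nat.strong_induction_on generalizing x with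
  | _ n ih =>
    by_cases hxy : x = y
    · subst hxy; exact .refl
    obtain ⟨i, hi'⟩ : ∃ i, x i ≠ y i := by
      by_contra hc; push Not at hc; exact hxy (funext hc)
    obtain ⟨s, hs, hs2⟩ : ∃ s : ℤ, (s = 1 ∨ s = -1) ∧
        (x i + s - y i).natAbs < (x i - y i).natAbs ∧ (lo i ≤ x i + s ∧ x i + s ≤ hi i) := by
      have h1 : lo i ≤ x i := hx.1 i
      have h2 : x i ≤ hi i := hx.2 i
      have h3 : lo i ≤ y i := hy.1 i
      have h4 : y i ≤ hi i := hy.2 i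
      rcases lt_or_gt_of_ne hi' with h | h
      · exact ⟨1, Or.inl rfl, by omega, by omega, by omega⟩
      · exact ⟨-1, Or.inr rfl, by omega, by omega, by omega⟩
    have hx' : Function.update x i (x i + s) ∈ Set.Icc lo hi := by
      constructor <;> intro l <;> by_cases hl : l = i
      · subst hl; simpa using hs2.2.1
      · simpa [Function.update_of_ne hl] using hx.1 l
      · subst hl; simpa using hs2.2.2
      · simpa [Function.update_of_ne hl] using hx.2 l
    refine Relation.ReflTransGen.head ⟨latAdj_update x i s hs, hx, hx'⟩ (ih _ ?_ _ hx' rfl)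
    rw [← hn]
    refine Finset.sum_lt_sum (fun l _ => ?_) ⟨i, Finset.mem_univ _, ?_⟩
    · by_cases hl : l = i
      · subst hl; simpa using hs2.1.le
      · simp [Function.update_of_ne hl]
    · simpa using hs2.1

lemma ball_eq_Icc (x : Zd d) (n : ℕ) :
    ball x n = Set.Icc (fun i => x i - n) (fun i => x i + n) := by
  ext y
  simp only [mem_ball, Set.mem_Icc, Pi.le_def, abs_le, ← forall_and]
  exact forall_congr' fun i => by omega

lemma ball_conn {ω : Config d} {x : Zd d} {n : ℕ} (h : ∀ e ∈ edgesIn (ball x n), ω e = true)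
    {a b : Zd d} (ha : a ∈ ball x n) (hb : b ∈ ball x n) : Conn ω (ball x n) a b := by
  rw [ball_eq_Icc] at ha hb h ⊢
  refine rtg_mono ?_ (Icc_latConn _ _ a b ha hb)
  rintro a b ⟨h1, h2, h3⟩
  exact ⟨⟨h1, h _ (mem_edgesIn.2 ⟨h2, h3⟩)⟩, h2, h3⟩

lemma Conn.exit_ball {ω : Config d} {R : Set (Zd d)} {x y c : Zd d} {m : ℕ}
    (h : Conn ω R x y) (hx : dst x c ≤ m) (hy : m ≤ dst y c) :
    ∃ z, dst z c = m ∧ Conn ω (R ∩ ball c m) x z ∧ Conn ω R x z := by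
  by_cases hy' : dst y c ≤ m
  · by_cases hall : ∃ z, dst z c = m ∧ Conn ω (R ∩ ball c m) x z
    · obtain ⟨z, h1, h2⟩ := hall
      exact ⟨z, h1, h2, h2.mono_set Set.inter_subset_left⟩
    -- the path must leave the open ball
    rcases Nat.eq_or_lt_of_le hx with hxm | hxm
    · exact ⟨x, hxm, .refl x, .refl x⟩
    obtain ⟨a, b, h1, h2, h3, h4, h5, -⟩ := h.exit (S := {z | dst z c < m}) hxm
      (by simp; exact hy)
    have hb : dst b c = m := by
      have := dst_triangle b a c
      have h6 := h3.1.symm.dst_le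
      have h7 : dst a c < m := h2.2
      have h8 : ¬ dst b c < m := h5
      omega
    refine absurd ⟨b, hb, ?_⟩ hall
    have h6 : Conn ω (R ∩ ball c m) x a := h1.mono_set
      (Set.inter_subset_inter_right _ fun z (hz : dst z c < m) => (hz.le : dst z c ≤ m))
    exact h6.trans (Conn.single h3 ⟨h2.1, (show dst a c ≤ m from le_of_lt h2.2)⟩ ⟨h4, hb.le⟩)
  · obtain ⟨a, b, h1, h2, h3, h4, h5, -⟩ := h.exit (S := ball c m) hx hy'
    have h7 : dst a c ≤ m := h2.2
    have h8 : ¬ dst b c ≤ m := h5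
    have := dst_triangle b a c
    have h6 := h3.1.symm.dst_le
    exact ⟨a, by omega, h1, h1.mono_set Set.inter_subset_left⟩

/-- Translation of the lattice. -/
def tr (x : Zd d) : Zd d ≃ Zd d := Equiv.addRight x

lemma tr_apply (x y : Zd d) : tr x y = y + x := rfl

lemma latAdj_tr (x a b : Zd d) : latAdj (tr x a) (tr x b) ↔ latAdj a b := by
  simp [latAdj, tr_apply]

lemma dst_add (x y z : Zd d) : dst (x + z) (y + z) = dst x y := by
  simp [dst]

lemma tr_image_ball (x y : Zd d) (n : ℕ) : tr x '' ball y n = ball (y + x) n := by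
  ext z
  simp only [Set.mem_image, mem_ball', tr_apply]
  constructor
  · rintro ⟨w, hw, rfl⟩; rwa [dst_add]
  · intro h
    exact ⟨z - x, by rw [← dst_add _ _ x]; simpa using h, by simp⟩

/-- The site `x` is connected to distance `m`. -/
def arm (x : Zd d) (m : ℕ) : Set (Config d) := {ω | ∃ y, dst y x = m ∧ Conn ω (ball x m) x y}

lemma detBy_arm (x : Zd d) (m : ℕ) : DetBy (edgesIn (ball x m)) (arm x m) :=
  fun _ _ h => exists_congr fun _ => and_congr_right fun _ => conn_congr h

lemma Pr_arm (p : unitInterval) (x : Zd d) (m : ℕ) : Pr p (arm x m) = Pr p (arm (0 : Zd d) m) := by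
  rw [Pr, Pr, ← bern_real_map p (tr x) (detBy_arm 0 m) (edgesIn_finite (ball_finite _ _))]
  congr 1
  ext ω
  simp only [arm, Set.mem_ofPred_eq, conn_map _ (latAdj_tr x), tr_image_ball, zero_add, tr_apply]
  constructor
  · rintro ⟨y, h1, h2⟩
    exact ⟨y - x, by rw [← dst_add _ _ x]; simpa using h1, by simpa using h2⟩
  · rintro ⟨y, h1, h2⟩
    exact ⟨y + x, by rw [← h1, ← dst_add y 0 x]; simp, h2⟩

lemma arm_anti {x : Zd d} {m n : ℕ} (h : m ≤ n) : (arm x n : Set (Config d)) ⊆ arm x m := by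
  rintro ω ⟨y, h1, h2⟩
  obtain ⟨z, h3, h4, -⟩ := h2.exit_ball (c := x) (m := m) (by simp) (by omega)
  exact ⟨z, h3, h4.mono_set Set.inter_subset_right⟩

lemma mem_arm_of_infinite {ω : Config d} (h : (cluster ω).Infinite) (m : ℕ) : ω ∈ arm 0 m := by
  obtain ⟨y, hy, hym⟩ := h.exists_notMem_finite (ball_finite 0 m)
  obtain ⟨z, h3, h4, -⟩ := (conn_univ.2 hy).exit_ball (c := 0) (m := m) (by simp)
    (by have : ¬ dst y 0 ≤ m := hym
        omega)
  exact ⟨z, h3, h4.mono_set Set.inter_subset_right⟩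

/-- Positive one-arm probability at all scales. -/
def Perc (d : ℕ) (p : unitInterval) : Prop :=
  ∃ θ > 0, ∀ m, θ ≤ Pr p (arm (0 : Zd d) m)

lemma perc_of_pc_lt {p : ℝ} (hp : pc d < p) (hp1 : p ≤ 1) :
    ∃ p0 : unitInterval, (0 : ℝ) < p0 ∧ (p0 : ℝ) < p ∧ Perc d p0 := by
  have hbdd : BddAbove {p : ℝ | 0 ≤ p ∧ p ≤ 1 ∧
    ∀ Q : Measure (Config d), IsBernoulli p Q → Q {ω | (cluster ω).Infinite} = 0} :=
    ⟨1, fun x hx => hx.2.1⟩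
  have h0 : 0 ≤ pc d := Real.sSup_nonneg fun x hx => hx.1
  obtain ⟨r, hr1, hr2⟩ := exists_between hp
  have hrmem : r ∈ unitInterval := ⟨by linarith, by linarith⟩
  refine ⟨⟨r, hrmem⟩, by simp; linarith, hr2, ?_⟩
  have hn : ¬ ∀ Q : Measure (Config d), IsBernoulli r Q → Q {ω | (cluster ω).Infinite} = 0 := by
    intro h
    have := le_csSup hbdd ⟨hrmem.1, hrmem.2, h⟩
    exact absurd hr1 (not_lt.2 this)
  push Not at hn
  obtain ⟨Q, hQ, hQ2⟩ := hn
  rw [IsBernoulli.eq_bern (p := ⟨r, hrmem⟩) hQ] at hQ2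
  refine ⟨_, ENNReal.toReal_pos hQ2 (measure_ne_top _ _), fun m => ?_⟩
  exact measureReal_mono (fun ω hω => mem_arm_of_infinite hω m) (measure_ne_top _ _)

lemma ball_disjoint {x y : Zd d} {m : ℕ} (h : 2 * m < dst x y) : Disjoint (ball x m) (ball y m) := by
  rw [Set.disjoint_left]
  intro z hz hz'
  have h1 : dst z x ≤ m := hz
  have h2 : dst z y ≤ m := hz'
  have := dst_triangle x z y
  rw [dst_comm] at h1
  omega

/-- Points spaced by `s` along the first axis. -/
def axisPt [NeZero d] (s i : ℕ) : Zd d := Function.update 0 0 ((i * s : ℕ) : ℤ)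

lemma dst_axisPt [NeZero d] (s i j : ℕ) :
    dst (axisPt s i : Zd d) (axisPt s j) = ((i * s : ℕ) - (j * s : ℕ) : ℤ).natAbs := by
  apply le_antisymm
  · rw [dst_le]
    intro l
    by_cases hl : l = 0
    · subst hl; simp [axisPt]
    · simp [axisPt, Function.update_of_ne hl]
  · have := abs_le_dst (axisPt s i : Zd d) (axisPt s j) 0
    simp only [axisPt, Function.update_self, Int.abs_eq_natAbs] at this ⊢
    omega

lemma dst_axisPt_zero [NeZero d] (s i : ℕ) : dst (axisPt s i : Zd d) 0 = i * s := by
  have := dst_axisPt (d := d) s i 0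
  have h0 : (axisPt s 0 : Zd d) = 0 := by simp [axisPt]
  rw [h0] at this; rw [this, zero_mul, Nat.cast_zero, sub_zero, Int.natAbs_natCast]

lemma spaced_lt {s i j : ℕ} (hij : i ≠ j) : s ≤ ((i * s : ℕ) - (j * s : ℕ) : ℤ).natAbs := by
  rcases lt_or_gt_of_ne hij with h | h
  · have : (i + 1) * s ≤ j * s := Nat.mul_le_mul_right _ h
    rw [add_mul] at this; omega
  · have : (j + 1) * s ≤ i * s := Nat.mul_le_mul_right _ h
    rw [add_mul] at this; omega

/-- Large balls are connected to large distances with high probability. -/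
lemma ball_to_sphere [NeZero d] {p : unitInterval} (h : Perc d p) {ε : ℝ} (hε : 0 < ε) :
    ∃ k : ℕ, ∀ L ≥ k, Pr p {ω | ¬ SConn ω (ball (0 : Zd d) L) (ball 0 k) {y | dst y 0 = L}} ≤ ε := by
  obtain ⟨θ, hθ, hθm⟩ := h
  have hθ1 : θ ≤ 1 := (hθm 0).trans (Pr_le_one _ _)
  obtain ⟨j, hj⟩ := exists_pow_lt_of_lt_one (half_pos hε) (show 1 - θ < 1 by linarith)
  -- the one-arm probabilities converge
  have hanti : Antitone fun m => Pr p (arm (0 : Zd d) m) := fun m n hmn => Pr_mono p (arm_anti hmn)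
  have hbdd : BddBelow (Set.range fun m => Pr p (arm (0 : Zd d) m)) :=
    ⟨0, by rintro _ ⟨m, rfl⟩; exact Pr_nonneg _ _⟩
  have htend := tendsto_atTop_ciInf hanti hbdd
  set t := ⨅ m, Pr p (arm (0 : Zd d) m) with ht
  obtain ⟨m, hm⟩ := ((tendsto_order.1 htend).2 (t + ε / (2 * (j + 1))) (by
    have : 0 < ε / (2 * (j + 1)) := by positivity
    linarith)).exists
  refine ⟨j * (2 * m + 1) + m, fun L hL => ?_⟩
  set k := j * (2 * m + 1) + m with hk
  set s : ℕ → Zd d := axisPt (2 * m + 1) with hs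
  have hsk : ∀ i ∈ Finset.range j, dst (s i) 0 ≤ k := by
    intro i hi
    rw [hs, dst_axisPt_zero]
    have : i * (2 * m + 1) ≤ j * (2 * m + 1) := Nat.mul_le_mul_right _ (Finset.mem_range.1 hi).le
    omega
  have hsub : {ω | ¬ SConn ω (ball (0 : Zd d) L) (ball 0 k) {y | dst y 0 = L}} ⊆
      (⋂ i ∈ Finset.range j, (arm (s i) m)ᶜ) ∪
      ⋃ i ∈ Finset.range j, arm (s i) m \ arm (s i) (L + k) := by
    intro ω hω
    by_contra hc
    simp only [Set.mem_union, Set.mem_iInter, Set.mem_iUnion, not_or, not_forall, not_exists,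
      Set.mem_compl_iff, not_not, Set.mem_sdiff, not_and] at hc
    obtain ⟨⟨i, hi, hi2⟩, hc2⟩ := hc
    obtain ⟨y, hy, hy2⟩ := hc2 i hi hi2
    refine hω ⟨s i, hsk i hi, ?_⟩
    have h1 := dst_triangle y 0 (s i)
    rw [dst_comm 0] at h1
    obtain ⟨z, hz, hz2, -⟩ := hy2.exit_ball (c := 0) (m := L) ((hsk i hi).trans hL)
      (by have := hsk i hi; omega)
    exact ⟨z, hz, hz2.mono_set Set.inter_subset_right⟩
  refine (Pr_mono p hsub).trans ((Pr_union_le _ _ _).trans ?_)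
  have h1 : Pr p (⋂ i ∈ Finset.range j, (arm (s i) m)ᶜ) ≤ ε / 2 := by
    rw [Pr, bern_biInter (S := fun i => edgesIn (ball (s i) m))]
    · calc ∏ i ∈ Finset.range j, (bern fun _ => p).real (arm (s i) m)ᶜ
          ≤ ∏ i ∈ Finset.range j, (1 - θ) := by
            refine Finset.prod_le_prod (fun _ _ => measureReal_nonneg) fun i _ => ?_
            rw [bern_compl _ (detBy_arm _ _) (edgesIn_finite (ball_finite _ _))]
            have := hθm m
            rw [← Pr_arm p (s i)] at this
            rw [Pr] at this; linarith
        _ ≤ ε / 2 := by simpa using hj.le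
    · exact fun i _ => (detBy_arm _ _).compl
    · exact fun i _ => edgesIn_finite (ball_finite _ _)
    · intro i _ l _ hil
      refine edgesIn_disjoint (ball_disjoint ?_)
      rw [hs, dst_axisPt]
      exact lt_of_lt_of_le (by omega) (spaced_lt hil)
  have h2 : ∀ i ∈ Finset.range j, Pr p (arm (s i) m \ arm (s i) (L + k)) ≤ ε / (2 * (j + 1)) := by
    intro i _
    have hsub2 : arm (s i) (L + k) ⊆ arm (s i) m := arm_anti (by omega)
    rw [Pr, measureReal_sdiff hsub2 ((detBy_arm _ _).measurableSet (edgesIn_finite (ball_finite _ _)))]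
    have e1 := Pr_arm p (s i) m
    have e2 := Pr_arm p (s i) (L + k)
    have e3 : t ≤ Pr p (arm (0 : Zd d) (L + k)) := ciInf_le hbdd _
    rw [Pr] at e1 e2
    rw [e1, e2]; linarith
  have h3 : Pr p (⋃ i ∈ Finset.range j, arm (s i) m \ arm (s i) (L + k)) ≤ ε / 2 := by
    refine (Pr_biUnion_le _ _ _).trans ((Finset.sum_le_sum h2).trans ?_)
    rw [Finset.sum_const, Finset.card_range, nsmul_eq_mul]
    have hj0 : (0 : ℝ) < j + 1 := by positivity
    rw [mul_div_assoc', div_le_div_iff₀ (by positivity) (by norm_num)]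
    nlinarith
  linarith

end

section
variable {d : ℕ}

lemma Pr_sconn_map (p : unitInterval) (g : Zd d ≃ Zd d)
    (hg : ∀ a b, latAdj (g a) (g b) ↔ latAdj a b) {R : Set (Zd d)} (hR : R.Finite)
    (S T : Set (Zd d)) :
    Pr p {ω | SConn ω (g '' R) (g '' S) (g '' T)} = Pr p {ω | SConn ω R S T} := by
  rw [Pr, Pr, ← bern_real_map p g (detBy_sconn R S T) (edgesIn_finite hR)]
  congr 1
  ext ω
  simp only [SConn, Set.mem_ofPred_eq, conn_map g hg, Set.exists_mem_image]

lemma Pr_not_sconn_map (p : unitInterval) (g : Zd d ≃ Zd d)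
    (hg : ∀ a b, latAdj (g a) (g b) ↔ latAdj a b) {R : Set (Zd d)} (hR : R.Finite)
    (S T : Set (Zd d)) :
    Pr p {ω | ¬ SConn ω (g '' R) (g '' S) (g '' T)} = Pr p {ω | ¬ SConn ω R S T} := by
  have h := Pr_sconn_map p g hg hR S T
  have h1 := bern_compl (fun _ => p) (detBy_sconn R S T) (edgesIn_finite hR)
  have h2 := bern_compl (fun _ => p) (detBy_sconn (g '' R) (g '' S) (g '' T))
    (edgesIn_finite (hR.image g))
  simp only [Pr, Set.compl_ofPred] at h h1 h2 ⊢
  rw [h1, h2, h]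

/-- The orthant piece of the sphere of radius `L` selected by a direction and signs. -/
def facet (i : Fin d) (σ : Fin d → ℤˣ) (L : ℕ) : Set (Zd d) :=
  {y | y ∈ ball 0 L ∧ (σ i : ℤ) * y i = L ∧ ∀ l, 0 ≤ (σ l : ℤ) * y l}

/-- The signed coordinate permutation carrying the first positive facet to a given one. -/
def facetMap [NeZero d] (i : Fin d) (σ : Fin d → ℤˣ) : Zd d ≃ Zd d where
  toFun y := fun l => (σ l : ℤ) * y (Equiv.swap 0 i l)
  invFun y := fun l => (σ (Equiv.swap 0 i l) : ℤ) * y (Equiv.swap 0 i l)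
  left_inv y := by
    funext l
    simp only [Equiv.swap_apply_self, ← mul_assoc]
    rw [← Units.val_mul, Int.units_mul_self]; simp
  right_inv y := by
    funext l
    simp only [Equiv.swap_apply_self, ← mul_assoc]
    rw [← Units.val_mul, Int.units_mul_self]; simp

lemma abs_units_mul (s : ℤˣ) (a : ℤ) : |(s : ℤ) * a| = |a| := by
  rcases Int.units_eq_one_or s with h | h <;> simp [h]

lemma latAdj_facetMap [NeZero d] (i : Fin d) (σ : Fin d → ℤˣ) (a b : Zd d) :
    latAdj (facetMap i σ a) (facetMap i σ b) ↔ latAdj a b := by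
  simp only [latAdj, facetMap, Equiv.coe_fn_mk, ← mul_sub, abs_units_mul]
  rw [Equiv.sum_comp (Equiv.swap 0 i) (fun l => |a l - b l|)]

lemma facetMap_image_ball [NeZero d] (i : Fin d) (σ : Fin d → ℤˣ) (n : ℕ) :
    facetMap i σ '' ball 0 n = ball 0 n := by
  rw [Equiv.image_eq_preimage_symm]
  ext y
  simp only [Set.mem_preimage, mem_ball, facetMap, Equiv.coe_fn_symm_mk, Pi.zero_apply, sub_zero,
    abs_units_mul]
  exact (Equiv.swap 0 i).forall_congr_right (q := fun l => |y l| ≤ (n : ℤ))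

lemma facetMap_image_facet [NeZero d] (i : Fin d) (σ : Fin d → ℤˣ) (L : ℕ) :
    facetMap i σ '' facet 0 1 L = facet i σ L := by
  ext y
  constructor
  · rintro ⟨x, ⟨h1, h2, h3⟩, rfl⟩
    refine ⟨by rw [← facetMap_image_ball i σ]; exact ⟨x, h1, rfl⟩, ?_, fun l => ?_⟩
    · simp only [facetMap, Equiv.coe_fn_mk, Equiv.swap_apply_right, ← mul_assoc]
      rw [← Units.val_mul, Int.units_mul_self]; simpa using h2
    · simp only [facetMap, Equiv.coe_fn_mk, ← mul_assoc]
      rw [← Units.val_mul, Int.units_mul_self]; simpa using h3 _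
  · rintro ⟨h1, h2, h3⟩
    refine ⟨(facetMap i σ).symm y, ⟨?_, ?_, ?_⟩, by simp⟩
    · rw [← facetMap_image_ball i σ, Equiv.image_eq_preimage_symm] at h1; exact h1
    · simpa [facetMap] using h2
    · intro l; simpa [facetMap] using h3 _

lemma exists_facet [NeZero d] {y : Zd d} {L : ℕ} (h : dst y 0 = L) :
    ∃ i σ, y ∈ facet i σ L := by
  obtain ⟨i, hi⟩ := exists_eq_dst y 0
  refine ⟨i, fun l => if 0 ≤ y l then 1 else -1, h.le, ?_, fun l => ?_⟩
  · rw [h, Pi.zero_apply, sub_zero] at hi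
    dsimp only
    split_ifs with h0
    · rw [abs_of_nonneg h0] at hi; simpa using hi
    · rw [abs_of_neg (by omega)] at hi; simpa using hi
  · dsimp only
    split_ifs with h0 <;> simp <;> omega

/-- Large balls are connected to every facet of large spheres with high probability. -/
lemma ball_to_facet [NeZero d] {p : unitInterval} (h : Perc d p) {ε : ℝ} (hε : 0 < ε) :
    ∃ k : ℕ, ∀ L ≥ k, ∀ i σ,
      Pr p {ω | ¬ SConn ω (ball (0 : Zd d) L) (ball 0 k) (facet i σ L)} ≤ ε := by
  set M := Fintype.card (Fin d × (Fin d → ℤˣ))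
  have hM : M ≠ 0 := Fintype.card_ne_zero
  obtain ⟨k, hk⟩ := ball_to_sphere h (pow_pos hε M)
  refine ⟨k, fun L hL => ?_⟩
  set u := Pr p {ω | ¬ SConn ω (ball (0 : Zd d) L) (ball 0 k) (facet 0 1 L)} with hu
  have hall : ∀ i σ, Pr p {ω | ¬ SConn ω (ball (0 : Zd d) L) (ball 0 k) (facet i σ L)} = u := by
    intro i σ
    rw [hu, ← Pr_not_sconn_map p (facetMap i σ) (latAdj_facetMap i σ) (ball_finite _ _) _ (facet 0 1 L),
      facetMap_image_ball, facetMap_image_ball, facetMap_image_facet]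
  intro i σ
  rw [hall]
  have h1 := harris_lower_biInter (fun _ => p) (edgesIn_finite (ball_finite (0 : Zd d) L))
    (Finset.univ : Finset (Fin d × (Fin d → ℤˣ)))
    (fun a => {ω | ¬ SConn ω (ball (0 : Zd d) L) (ball 0 k) (facet a.1 a.2 L)})
    (fun a _ => (detBy_sconn _ _ _).compl) (fun a _ => (isUpperSet_sconn _ _ _).compl)
  have h2 : ∏ a : Fin d × (Fin d → ℤˣ), (bern fun _ => p).real
      {ω | ¬ SConn ω (ball (0 : Zd d) L) (ball 0 k) (facet a.1 a.2 L)} = u ^ M := by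
    rw [Finset.prod_congr rfl fun a _ => hall a.1 a.2, Finset.prod_const, Finset.card_univ]
  rw [h2] at h1
  refine le_of_pow_le_pow_left₀ hM hε.le (h1.trans (le_trans (Pr_mono p ?_) (hk L hL)))
  intro ω hω
  simp only [Set.mem_iInter, Set.mem_ofPred_eq] at hω ⊢
  rintro ⟨x, hx, y, hy, hxy⟩
  obtain ⟨i, σ, hiσ⟩ := exists_facet hy
  exact hω (i, σ) (Finset.mem_univ _) ⟨x, hx, y, hiσ, hxy⟩

/-- All edges inside a ball are open. -/
def fullBall (x : Zd d) (k : ℕ) : Set (Config d) := {ω | ∀ e ∈ edgesIn (ball x k), ω e = true}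

lemma detBy_fullBall (x : Zd d) (k : ℕ) : DetBy (edgesIn (ball x k)) (fullBall x k) :=
  fun _ _ h => forall₂_congr fun e he => by rw [h e he]

lemma isUpperSet_fullBall (x : Zd d) (k : ℕ) : IsUpperSet (fullBall x k) := by
  intro ω ω' hω hc e he
  have := hω e
  rw [hc e he] at this
  exact top_le_iff.1 this

lemma Pr_fullBall_pos {p : unitInterval} (hp : (0 : ℝ) < p) (k : ℕ) :
    ∃ c > 0, c ≤ 1 ∧ ∀ x : Zd d, Pr p (fullBall x k) = c := by
  refine ⟨Pr p (fullBall (0 : Zd d) k), ?_, Pr_le_one _ _, fun x => ?_⟩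
  · set s := (edgesIn_finite (ball_finite (0 : Zd d) k)).toFinset
    have : fullBall (0 : Zd d) k = {ω | ∀ e ∈ s, ω e = (fun _ => true : Config d) e} := by
      ext ω; simp [fullBall, s]
    rw [this, Pr, Measure.real, bern_cyl]
    refine ENNReal.toReal_pos ?_ ?_
    · rw [Finset.prod_ne_zero_iff]; intro i _; simpa [bw] using hp
    · exact ENNReal.prod_ne_top fun i _ => ENNReal.ofReal_ne_top
  · rw [Pr, Pr, ← bern_real_map p (tr x) (detBy_fullBall 0 k) (edgesIn_finite (ball_finite _ _))]
    congr 1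
    ext ω
    simp only [fullBall, Set.mem_ofPred_eq]
    have : edgesIn (ball x k) = Sym2.map (tr x) '' edgesIn (ball 0 k) := by
      rw [← zero_add x, ← tr_image_ball x 0 k, zero_add]
      ext e
      induction e with | _ a b
      simp only [mem_edgesIn, Set.mem_image]
      constructor
      · rintro ⟨⟨a, ha, rfl⟩, b, hb, rfl⟩
        exact ⟨s(a, b), mem_edgesIn.2 ⟨ha, hb⟩, by simp⟩
      · rintro ⟨e, he, h⟩
        induction e with | _ a' b'
        rw [mem_edgesIn] at he
        simp only [Sym2.map_mk, Sym2.eq_iff] at h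
        rcases h with ⟨rfl, rfl⟩ | ⟨rfl, rfl⟩
        · exact ⟨⟨_, he.1, rfl⟩, _, he.2, rfl⟩
        · exact ⟨⟨_, he.2, rfl⟩, _, he.1, rfl⟩
    rw [this]
    simp

/-- The enlarged facet around `x`. -/
def Tgt (x : Zd d) (i : Fin d) (σ : Fin d → ℤˣ) (L n : ℕ) : Set (Zd d) :=
  {y | (L : ℤ) - n ≤ σ i * (y i - x i) ∧ ∀ l, -(n : ℤ) ≤ σ l * (y l - x l) ∧
    (σ l : ℤ) * (y l - x l) ≤ L + n}

lemma units_mul_le_abs (s : ℤˣ) (a : ℤ) : (s : ℤ) * a ≤ |a| := by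
  rw [← abs_units_mul s a]; exact le_abs_self _

lemma neg_abs_le_units_mul (s : ℤˣ) (a : ℤ) : -|a| ≤ (s : ℤ) * a := by
  rw [← abs_units_mul s a]; exact neg_abs_le _

lemma facet_sub_Tgt {x s : Zd d} {n L : ℕ} (hs : dst s x ≤ n) (i : Fin d) (σ : Fin d → ℤˣ) :
    tr s '' facet i σ L ⊆ Tgt x i σ L n := by
  rintro _ ⟨y, ⟨h1, h2, h3⟩, rfl⟩
  have e : ∀ l, (σ l : ℤ) * (tr s y l - x l) = σ l * y l + σ l * (s l - x l) := by
    intro l; simp only [tr_apply, Pi.add_apply]; ring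
  have h4 : ∀ l, |s l - x l| ≤ n := fun l => (abs_le_dst s x l).trans (by exact_mod_cast hs)
  have h5 := fun l => units_mul_le_abs (σ l) (s l - x l)
  have h6 := fun l => neg_abs_le_units_mul (σ l) (s l - x l)
  refine ⟨?_, fun l => ⟨?_, ?_⟩⟩
  · rw [e, h2]; linarith [h6 i, h4 i]
  · rw [e]; linarith [h6 l, h4 l, h3 l]
  · rw [e]
    have h7 := mem_ball.1 h1 l
    rw [Pi.zero_apply, sub_zero] at h7
    linarith [h5 l, h4 l, units_mul_le_abs (σ l) (y l)]

/-- Any lattice-connected set of large diameter is connected to every enlarged facet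
with high probability. -/
lemma seed_estimate [NeZero d] {p : unitInterval} (hp : (0 : ℝ) < p) (h : Perc d p) {η : ℝ}
    (hη : 0 < η) :
    ∃ n L0 : ℕ, ∀ L ≥ L0, ∀ (K : Set (Zd d)) (x : Zd d), ConnLat K → x ∈ K →
      (∃ y ∈ K, n ≤ dst y x) → ∀ i σ,
        Pr p {ω | ¬ SConn ω (ball x (L + n)) K (Tgt x i σ L n)} ≤ η := by
  obtain ⟨k, hk⟩ := ball_to_facet h (ε := η / (2 * (2 / η + 1))) (by positivity)
  obtain ⟨c, hc, hc1, hck⟩ := Pr_fullBall_pos (d := d) hp k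
  set T := 2 / η with hT
  have hT0 : 0 < T := by positivity
  set j := ⌈T / c⌉₊ with hj
  have hj1 : T ≤ c * j := by
    rw [mul_comm, ← div_le_iff₀ hc]; exact Nat.le_ceil _
  have hj2 : c * j ≤ T + 1 := by
    have := (Nat.ceil_lt_add_one (show 0 ≤ T / c by positivity)).le
    calc c * j ≤ c * (T / c + 1) := by gcongr
      _ = T + c := by field_simp
      _ ≤ T + 1 := by linarith
  refine ⟨j * (2 * k + 1) + k, k, fun L hL K x hK hx hfar i σ => ?_⟩
  obtain ⟨y, hy, hyx⟩ := hfar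
  set n := j * (2 * k + 1) + k with hn
  have hpts : ∀ m : ℕ, m < j → ∃ s ∈ K, dst s x = m * (2 * k + 1) := by
    intro m hm
    obtain ⟨z, hz1, hz2⟩ := rtg_ivt (hK x hx y hy) (fun z => (dst z x : ℤ))
      (t := (m * (2 * k + 1) : ℕ)) (fun a b hab => by
        have h1 := dst_triangle b a x
        have h2 := hab.1.symm.dst_le
        omega) (by simp only [dst_self]; positivity) (by
        have : m * (2 * k + 1) ≤ j * (2 * k + 1) := Nat.mul_le_mul_right _ hm.le
        omega)
    exact ⟨z, rtg_mem hz1 hx, by exact_mod_cast hz2⟩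
  choose! s hsK hsd using hpts
  have hsn : ∀ m < j, dst (s m) x + k ≤ n := fun m hm => by
    have : m * (2 * k + 1) ≤ j * (2 * k + 1) := Nat.mul_le_mul_right _ hm.le
    rw [hsd m hm]; omega
  let D : ℕ → Set (Config d) := fun m =>
    {ω | ¬ SConn ω (tr (s m) '' ball 0 L) (tr (s m) '' ball 0 k) (tr (s m) '' facet i σ L)}
  have hsub : {ω | ¬ SConn ω (ball x (L + n)) K (Tgt x i σ L n)} ⊆
      (⋂ m ∈ Finset.range j, (fullBall (s m) k)ᶜ) ∪
        ⋃ m ∈ Finset.range j, fullBall (s m) k ∩ D m := by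
    intro ω hω
    by_contra hc
    simp only [Set.mem_union, Set.mem_iInter, Set.mem_iUnion, not_or, not_forall, not_exists,
      Set.mem_compl_iff, not_not, Set.mem_inter_iff, not_and, Finset.mem_range] at hc
    obtain ⟨⟨m, hm, hm2⟩, hc2⟩ := hc
    have h3 := hc2 m hm hm2
    simp only [D, Set.mem_ofPred_eq, not_not, tr_image_ball, zero_add] at h3
    obtain ⟨a, ha, b, hb, hab⟩ := h3
    have hball : ball (s m) L ⊆ ball x (L + n) := ball_subset (by have := hsn m hm; omega)
    refine hω ⟨s m, hsK m hm, b, facet_sub_Tgt (by have := hsn m hm; omega) i σ hb, ?_⟩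
    refine ((ball_conn hm2 (self_mem_ball _ _) ha).mono_set ?_).trans (hab.mono_set hball)
    exact (ball_subset (by rw [dst_self]; omega)).trans hball
  refine (Pr_mono p hsub).trans ((Pr_union_le _ _ _).trans ?_)
  have h1 : Pr p (⋂ m ∈ Finset.range j, (fullBall (s m) k)ᶜ) ≤ η / 2 := by
    rw [Pr, bern_biInter (S := fun m => edgesIn (ball (s m) k))]
    · have he : ∀ m ∈ Finset.range j, (bern fun _ => p).real (fullBall (s m) k)ᶜ = 1 - c := by
        intro m _
        rw [bern_compl _ (detBy_fullBall _ _) (edgesIn_finite (ball_finite _ _))]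
        have := hck (s m)
        rw [Pr] at this; rw [this]
      rw [Finset.prod_congr rfl he, Finset.prod_const, Finset.card_range]
      calc (1 - c) ^ j ≤ (Real.exp (-c)) ^ j := by
            refine pow_le_pow_left₀ (by linarith) ?_ _
            have := Real.add_one_le_exp (-c); linarith
        _ = Real.exp (-(c * j)) := by rw [← Real.exp_nat_mul]; ring_nf
        _ ≤ Real.exp (-T) := Real.exp_le_exp.2 (by linarith)
        _ ≤ η / 2 := by
            rw [Real.exp_neg]
            have h8 : T ≤ Real.exp T := by have := Real.add_one_le_exp T; linarith
            calc (Real.exp T)⁻¹ ≤ T⁻¹ := inv_anti₀ hT0 h8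
              _ = η / 2 := by rw [hT]; field_simp
    · exact fun m _ => (detBy_fullBall _ _).compl
    · exact fun m _ => edgesIn_finite (ball_finite _ _)
    · intro m hm l hl hml
      refine edgesIn_disjoint (ball_disjoint ?_)
      have e1 := hsd m (Finset.mem_range.1 hm)
      have e2 := hsd l (Finset.mem_range.1 hl)
      have e3 := dst_triangle (s m) (s l) x
      have e4 := dst_triangle (s l) (s m) x
      rw [dst_comm (s l) (s m)] at e4
      have := spaced_lt (s := 2 * k + 1) hml
      omega
  have h2 : ∀ m ∈ Finset.range j, Pr p (fullBall (s m) k ∩ D m) ≤ c * (η / (2 * (T + 1))) := by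
    intro m hm
    have hfin : (edgesIn (ball (s m) (L + k))).Finite := edgesIn_finite (ball_finite _ _)
    have hd1 : DetBy (edgesIn (ball (s m) (L + k))) (fullBall (s m) k) :=
      (detBy_fullBall _ _).mono (edgesIn_mono (ball_subset (by rw [dst_self]; omega)))
    have hd2 : DetBy (edgesIn (ball (s m) (L + k))) (D m) := by
      refine (detBy_sconn _ _ _).compl.mono (edgesIn_mono ?_)
      rw [tr_image_ball, zero_add]
      exact ball_subset (by rw [dst_self]; omega)
    refine (harris_upper_lower _ hd1 hd2 hfin (isUpperSet_fullBall _ _)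
      (isUpperSet_sconn _ _ _).compl).trans ?_
    have e1 := hck (s m)
    have e2 := Pr_not_sconn_map p (tr (s m)) (latAdj_tr _) (ball_finite (0 : Zd d) L) (ball 0 k)
      (facet i σ L)
    rw [Pr] at e1
    rw [e1]
    refine mul_le_mul_of_nonneg_left ?_ hc.le
    exact e2.le.trans (hk L hL i σ)
  have h3 : Pr p (⋃ m ∈ Finset.range j, fullBall (s m) k ∩ D m) ≤ η / 2 := by
    refine (Pr_biUnion_le _ _ _).trans ((Finset.sum_le_sum h2).trans ?_)
    rw [Finset.sum_const, Finset.card_range, nsmul_eq_mul]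
    calc (j : ℝ) * (c * (η / (2 * (T + 1)))) = c * j * (η / (2 * (T + 1))) := by ring
      _ ≤ (T + 1) * (η / (2 * (T + 1))) := by gcongr
      _ = η / 2 := by field_simp
  linarith

end

/-! ### Connectedness of boundaries -/

section boundary
variable {d : ℕ}

/-- Connectedness of a set under a relation restricted to it. -/
def RConn {V : Type*} (r : V → V → Prop) (F : Set V) : Prop :=
  ∀ x ∈ F, ∀ y ∈ F, Relation.ReflTransGen (restr r F) x y

/-- Adjacency in the sup distance. -/
def starAdj (x y : Zd d) : Prop := dst x y ≤ 1

/-- The lattice shift twisted by a mod-two cochain. -/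
def twist (g : Zd d → Zd d → ZMod 2) (i : Fin d) : Equiv.Perm (Zd d × ZMod 2) where
  toFun z := (z.1 + Pi.single i 1, z.2 + g z.1 (z.1 + Pi.single i 1))
  invFun z := (z.1 - Pi.single i 1, z.2 - g (z.1 - Pi.single i 1) z.1)
  left_inv z := by simp
  right_inv z := by simp

/-- Closed mod-two cochains on the lattice are exact. -/
lemma exists_potential (g : Zd d → Zd d → ZMod 2)
    (hg : ∀ x i j, g x (x + Pi.single i 1) + g (x + Pi.single i 1) (x + Pi.single i 1 + Pi.single j 1)
      = g x (x + Pi.single j 1) + g (x + Pi.single j 1) (x + Pi.single j 1 + Pi.single i 1)) :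
    ∃ φ : Zd d → ZMod 2, ∀ x i, φ (x + Pi.single i 1) = φ x + g x (x + Pi.single i 1) := by
  have hcomm : Pairwise fun i j : Fin d => ∀ x y : Multiplicative ℤ,
      Commute (zpowersHom (Equiv.Perm (Zd d × ZMod 2)) (twist g i) x)
        (zpowersHom (Equiv.Perm (Zd d × ZMod 2)) (twist g j) y) := by
    intro i j _ x y
    simp only [zpowersHom_apply]
    refine Commute.zpow_zpow (Equiv.ext fun z => ?_) _ _
    simp only [Equiv.Perm.mul_apply, twist, Equiv.coe_fn_mk]
    refine Prod.ext (by simp only; abel) ?_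
    have := hg z.1 i j
    simp only
    rw [add_assoc z.2, add_assoc z.2, this]
  let Φ : (Fin d → Multiplicative ℤ) →* Equiv.Perm (Zd d × ZMod 2) :=
    MonoidHom.noncommPiCoprod (fun i => zpowersHom _ (twist g i)) hcomm
  have hΦs : ∀ (i : Fin d) (n : Multiplicative ℤ),
      Φ (Pi.mulSingle i n) = twist g i ^ Multiplicative.toAdd n := by
    intro i n
    simp only [Φ, MonoidHom.noncommPiCoprod_mulSingle, zpowersHom_apply]
  have hpow : ∀ (i : Fin d) (n : ℤ) (z : Zd d × ZMod 2), ((twist g i ^ n) z).1 = z.1 + Pi.single i n := by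
    intro i n
    induction n using Int.induction_on with
    | zero => intro z; simp
    | succ n ih =>
      intro z
      rw [zpow_add_one, Equiv.Perm.mul_apply, ih]
      simp only [twist, Equiv.coe_fn_mk]
      rw [add_assoc, ← Pi.single_add, add_comm (1 : ℤ)]
    | pred n ih =>
      intro z
      rw [zpow_sub_one, Equiv.Perm.mul_apply, ih]
      have : ((twist g i)⁻¹ z).1 = z.1 - Pi.single i 1 := rfl
      rw [this, sub_add_eq_add_sub, add_sub_assoc, ← Pi.single_sub]
  have h1 : ∀ (x : Fin d → Multiplicative ℤ) (z : Zd d × ZMod 2),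
      (Φ x z).1 = z.1 + fun i => Multiplicative.toAdd (x i) := by
    intro x
    have := Finset.prod_induction (fun i => (Pi.mulSingle i (x i) : Fin d → Multiplicative ℤ))
      (fun x => ∀ z : Zd d × ZMod 2, (Φ x z).1 = z.1 + fun i => Multiplicative.toAdd (x i))
      (s := Finset.univ) (fun a b ha hb z => by
        rw [map_mul, Equiv.Perm.mul_apply, ha, hb, add_assoc]
        congr 1; funext i; simp [add_comm]) (fun z => by simp; rfl) (fun i _ z => by
        rw [hΦs, hpow]; congr 1)
    rwa [Finset.univ_prod_mulSingle] at this
  refine ⟨fun x => (Φ (fun i => Multiplicative.ofAdd (x i)) (0, 0)).2, fun x i => ?_⟩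
  have h2 : (fun l => Multiplicative.ofAdd ((x + Pi.single i 1 : Zd d) l)) =
      Pi.mulSingle i (Multiplicative.ofAdd 1) * fun l => Multiplicative.ofAdd (x l) := by
    funext l
    by_cases h : l = i
    · subst h; simp [mul_comm, ofAdd_add]
    · simp [h]
  have h3 := h1 (fun i => Multiplicative.ofAdd (x i)) (0, 0)
  simp only [toAdd_ofAdd, zero_add] at h3
  simp only [h2, map_mul, Equiv.Perm.mul_apply, hΦs, toAdd_ofAdd, zpow_one]
  simp only [twist, Equiv.coe_fn_mk]
  rw [h3]

/-- The vertex boundary of a connected set with connected complement is `*`-connected. -/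
lemma boundary_starConn (V : Set (Zd d)) (hV : ConnLat V) (hW : ConnLat Vᶜ) :
    RConn starAdj {x : Zd d | x ∉ V ∧ ∃ v ∈ V, latAdj x v} := by
  classical
  set F := {x : Zd d | x ∉ V ∧ ∃ v ∈ V, latAdj x v} with hF
  intro x hx y hy
  by_contra hxy
  set F1 : Set (Zd d) := {z | z ∈ F ∧ Relation.ReflTransGen (restr starAdj F) x z} with hF1
  have hsep : ∀ a ∈ F1, ∀ b ∈ F, starAdj a b → b ∈ F1 := fun a ha b hb hab =>
    ⟨hb, ha.2.tail ⟨hab, ha.1, hb⟩⟩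
  let g : Zd d → Zd d → ZMod 2 := fun a b => if (a ∈ V ∧ b ∈ F1) ∨ (b ∈ V ∧ a ∈ F1) then 1 else 0
  have hgs : ∀ a b, g a b = g b a := fun a b => by simp only [g, or_comm]
  have hadj : ∀ (x : Zd d) (i : Fin d), latAdj x (x + Pi.single i 1) := fun x i =>
    latAdj_iff.2 ⟨i, 1, Or.inl rfl, by
      funext l
      by_cases h : l = i
      · subst h; simp
      · simp [h]⟩
  have h1V : ∀ a ∈ F1, a ∉ V := fun a ha => ha.1.1
  obtain ⟨φ, hφ⟩ := exists_potential g (by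
    intro x i j
    have e : x + Pi.single j 1 + Pi.single i 1 = x + Pi.single i 1 + Pi.single j 1 := by abel
    rw [e]
    by_cases hij : i = j
    · subst hij; rfl
    have a1 := hadj x i
    have a2 := hadj x j
    have a3 := hadj (x + Pi.single i 1) j
    have a4 := hadj (x + Pi.single j 1) i
    rw [e] at a4
    have c1 : starAdj (x + Pi.single i 1) (x + Pi.single j 1) := by
      rw [starAdj, dst_le]; intro l
      simp only [Pi.add_apply, Pi.single_apply]
      split_ifs <;> simp
    have c2 : starAdj x (x + Pi.single i 1 + Pi.single j 1) := by
      rw [starAdj, dst_le]; intro l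
      simp only [Pi.add_apply, Pi.single_apply]
      split_ifs with h1 h2
      · exact absurd (h1.symm.trans h2) hij
      all_goals simp
    generalize x + Pi.single i 1 + Pi.single j 1 = w at *
    generalize x + Pi.single i 1 = u at *
    generalize x + Pi.single j 1 = v at *
    have b1 := a1.dst_le
    have b2 := a2.dst_le
    have b3 := a3.dst_le
    have b4 := a4.dst_le
    let P : Set (Zd d) := {a | a = x ∨ a = u ∨ a = v ∨ a = w}
    have sy : ∀ {a b : Zd d}, starAdj a b → starAdj b a := fun {a b} h => by
      rw [starAdj, dst_comm]; exact h
    have rf : ∀ a : Zd d, starAdj a a := fun a => by rw [starAdj, dst_self]; omega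
    have hP : ∀ a ∈ P, ∀ b ∈ P, starAdj a b := by
      rintro a (rfl | rfl | rfl | rfl) b (rfl | rfl | rfl | rfl)
      all_goals first | exact rf _ | assumption | (apply sy; assumption)
    have key : ∃ ψ : Zd d → ZMod 2, ∀ a ∈ P, ∀ b ∈ P, latAdj a b → g a b = ψ a + ψ b := by
      by_cases h : ∃ a ∈ P, a ∈ F1
      · obtain ⟨c, hc, hc1⟩ := h
        have q : ∀ a ∈ P, ∀ b ∈ V, latAdj a b → a ∉ V → a ∈ F1 := fun a ha b hb hab haV =>
          hsep c hc1 a ⟨haV, b, hb, hab⟩ (hP c hc a ha)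
        refine ⟨fun a => if a ∈ V then 1 else 0, fun a ha b hb hab => ?_⟩
        have q1 := q a ha b
        have q2 := fun h => q b hb a h hab.symm
        have q3 := h1V a
        have q4 := h1V b
        simp only [g]
        by_cases pa : a ∈ V <;> by_cases pb : b ∈ V
        · simp [pa, pb, show a ∉ F1 from fun h => q3 h pa, show b ∉ F1 from fun h => q4 h pb]; rfl
        · simp [pa, pb, q2 pa pb]
        · simp [pa, pb, q1 pb hab pa]
        · simp [pa, pb]
      · push Not at h
        refine ⟨fun _ => 0, fun a ha b hb _ => ?_⟩
        simp [g, h a ha, h b hb]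
    obtain ⟨ψ, hψ⟩ := key
    rw [hψ x (by simp [P]) u (by simp [P]) a1, hψ u (by simp [P]) w (by simp [P]) a3,
      hψ x (by simp [P]) v (by simp [P]) a2, hψ v (by simp [P]) w (by simp [P]) a4]
    have t := fun a => CharTwo.add_self_eq_zero (ψ a)
    linear_combination t u - t v)
  have hstep : ∀ a b, latAdj a b → φ b = φ a + g a b := by
    intro a b hab
    obtain ⟨i, s, hs, rfl⟩ := latAdj_iff.1 hab
    rcases hs with rfl | rfl
    · have e : Function.update a i (a i + 1) = a + Pi.single i 1 := by
        funext l
        by_cases h : l = i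
        · subst h; simp
        · simp [h]
      rw [e]; exact hφ a i
    · set b := Function.update a i (a i + -1) with hb
      have e : a = b + Pi.single i 1 := by
        funext l
        by_cases h : l = i
        · subst h; simp [hb]
        · simp [h, hb]
      have := hφ b i
      rw [← e, hgs] at this
      rw [this, add_assoc, CharTwo.add_self_eq_zero, add_zero]
  have hconst : ∀ (S : Set (Zd d)), (∀ a ∈ S, ∀ b ∈ S, g a b = 0) → ConnLat S →
      ∀ a ∈ S, ∀ b ∈ S, φ a = φ b := by
    intro S hS hc a ha b hb
    have := hc a ha b hb
    clear hb
    induction this with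
    | refl => rfl
    | @tail u v _ h ih => rw [ih, hstep u v h.1, hS u h.2.1 v h.2.2, add_zero]
  have hVc := hconst V (fun a ha b hb => if_neg (by
    rintro (⟨_, h⟩ | ⟨_, h⟩)
    · exact h1V _ h hb
    · exact h1V _ h ha)) hV
  have hWc := hconst Vᶜ (fun a ha b hb => if_neg (by
    rintro (⟨h, _⟩ | ⟨h, _⟩)
    · exact ha h
    · exact hb h)) hW
  obtain ⟨hx1, v, hv, hxv⟩ := hx
  obtain ⟨hy1, u, hu, hyu⟩ := hy
  have e1 := hstep x v hxv
  have e2 := hstep y u hyu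
  have hx1F : x ∈ F1 := ⟨⟨hx1, v, hv, hxv⟩, .refl⟩
  have g1 : g x v = 1 := if_pos (Or.inr ⟨hv, hx1F⟩)
  have g2 : g y u = 0 := if_neg (by
    rintro (⟨h, _⟩ | ⟨_, h⟩)
    · exact hy1 h
    · exact hxy h.2)
  rw [g1, hVc v hv u hu, hWc x hx1 y hy1, e2, g2] at e1
  simp at e1

/-- Relative version of `boundary_starConn` inside a discrete rectangle. -/
lemma boundary_starConn_Icc (lo hi : Zd d) (hle : lo ≤ hi) (V : Set (Zd d)) (hVs : V ⊆ Set.Icc lo hi)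
    (hV : ConnLat V) (hW : ConnLat (Set.Icc lo hi \ V)) :
    RConn starAdj {x : Zd d | x ∈ Set.Icc lo hi \ V ∧ ∃ v ∈ V, latAdj x v} := by
  let c : Zd d → Zd d := fun x i => max (lo i) (min (hi i) (x i))
  have hc : ∀ x, c x ∈ Set.Icc lo hi := fun x =>
    ⟨fun i => le_max_left _ _, fun i => max_le (hle i) (min_le_left _ _)⟩
  have hfix : ∀ x ∈ Set.Icc lo hi, c x = x := fun x hx => by
    funext i
    have h1 : lo i ≤ x i := hx.1 i
    have h2 : x i ≤ hi i := hx.2 i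
    simp only [c]; omega
  have hpull : ∀ S ⊆ Set.Icc lo hi, ConnLat S → ConnLat (c ⁻¹' S) := by
    intro S hS hconn
    have key : ∀ x ∈ c ⁻¹' S, Relation.ReflTransGen (restr latAdj (c ⁻¹' S)) x (c x) := by
      intro x hx
      refine rtg_mono ?_ (Icc_latConn (x ⊓ c x) (x ⊔ c x) x (c x) ⟨inf_le_left, le_sup_left⟩
        ⟨inf_le_right, le_sup_right⟩)
      have hz : ∀ z ∈ Set.Icc (x ⊓ c x) (x ⊔ c x), z ∈ c ⁻¹' S := by
        intro z hz
        have : c z = c x := by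
          funext i
          have h1 : min (x i) (c x i) ≤ z i := hz.1 i
          have h2 : z i ≤ max (x i) (c x i) := hz.2 i
          have h3 : lo i ≤ hi i := hle i
          simp only [c] at h1 h2 ⊢; omega
        rw [Set.mem_preimage, this]; exact hx
      rintro a b ⟨h1, h2, h3⟩
      exact ⟨h1, hz a h2, hz b h3⟩
    have hsub : S ⊆ c ⁻¹' S := fun x hx => by rw [Set.mem_preimage, hfix x (hS hx)]; exact hx
    have sy : ∀ a b, restr latAdj (c ⁻¹' S) a b → restr latAdj (c ⁻¹' S) b a := fun a b h =>
      ⟨h.1.symm, h.2.2, h.2.1⟩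
    intro x hx y hy
    refine (key x hx).trans (Relation.ReflTransGen.trans ?_ (rtg_symm sy (key y hy)))
    exact rtg_mono (fun a b h => ⟨h.1, hsub h.2.1, hsub h.2.2⟩) (hconn (c x) hx (c y) hy)
  have hcompl : (c ⁻¹' V)ᶜ = c ⁻¹' (Set.Icc lo hi \ V) := by
    ext x; simp only [Set.mem_compl_iff, Set.mem_preimage, Set.mem_sdiff, hc, true_and]
  have hmain := boundary_starConn (c ⁻¹' V) (hpull V hVs hV)
    (by rw [hcompl]; exact hpull _ Set.sdiff_subset hW)
  rintro x ⟨⟨hxR, hx⟩, v, hv, hxv⟩ y ⟨⟨hyR, hy⟩, u, hu, hyu⟩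
  have hpre : ∀ z ∈ Set.Icc lo hi, ∀ S, z ∈ c ⁻¹' S ↔ z ∈ S := fun z hz S => by
    rw [Set.mem_preimage, hfix z hz]
  have h := hmain x ⟨fun h => hx ((hpre x hxR V).1 h), v, (hpre v (hVs hv) V).2 hv, hxv⟩
    y ⟨fun h => hy ((hpre y hyR V).1 h), u, (hpre u (hVs hu) V).2 hu, hyu⟩
  have hcl : ∀ a b : Zd d, ∀ i, |c a i - c b i| ≤ |a i - b i| := fun a b i => by
    have : lo i ≤ hi i := hle i
    simp only [c]
    rw [Int.abs_eq_natAbs, Int.abs_eq_natAbs]; omega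
  have himg : ∀ a, (a ∉ c ⁻¹' V ∧ ∃ v ∈ c ⁻¹' V, latAdj a v) →
      (c a ∈ Set.Icc lo hi \ V ∧ ∃ v ∈ V, latAdj (c a) v) := by
    rintro a ⟨h1, v, hv, hav⟩
    refine ⟨⟨hc a, h1⟩, c v, hv, ?_⟩
    have hne : c a ≠ c v := fun h => h1 (by rw [Set.mem_preimage, h]; exact hv)
    rw [latAdj] at hav ⊢
    have hle' : ∑ i, |c a i - c v i| ≤ 1 := by
      rw [← hav]; exact Finset.sum_le_sum fun i _ => hcl a v i
    have hpos : 0 < ∑ i, |c a i - c v i| := by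
      obtain ⟨i, hi⟩ := Function.ne_iff.1 hne
      exact Finset.sum_pos' (fun _ _ => abs_nonneg _) ⟨i, Finset.mem_univ _, abs_pos.2 (sub_ne_zero.2 hi)⟩
    omega
  have := rtg_lift (t := restr starAdj {x : Zd d | x ∈ Set.Icc lo hi \ V ∧ ∃ v ∈ V, latAdj x v}) c
    (fun a b hab => ⟨by
      have h1 := dst_le.1 hab.1
      exact dst_le.2 fun i => (hcl a b i).trans (h1 i), himg a hab.2.1, himg b hab.2.2⟩) h
  rwa [hfix x hxR, hfix y hyR] at this

end boundary

/-! ### Counting connected sets -/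

section animals
variable {V : Type*}

/-- Exponentially weighted sums over connected sets containing a given point are bounded. -/
lemma animal_weight (r : V → V → Prop) (nb : V → Finset V) (Δ : ℕ) (hnb : ∀ v, (nb v).card ≤ Δ)
    (hr : ∀ a b, r a b → b ∈ nb a) (x : V) (𝒢 : Finset (Finset V))
    (h𝒢 : ∀ F ∈ 𝒢, x ∈ F ∧ RConn r (F : Set V)) :
    ∑ F ∈ 𝒢, ((2 : ℝ) ^ (Δ + 1))⁻¹ ^ F.card ≤ 1 := by
  classical
  have half : (1 / 2 : ℝ) ∈ unitInterval := ⟨by norm_num, by norm_num⟩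
  let q : V → unitInterval := fun _ => ⟨1 / 2, half⟩
  let S : Finset V → Finset V := fun F => F ∪ F.biUnion nb
  let E : Finset V → Set (V → Bool) := fun F => {ω | ∀ v ∈ S F, ω v = decide (v ∈ F)}
  have hcard : ∀ F, (S F).card ≤ (Δ + 1) * F.card := fun F => by
    refine (Finset.card_union_le _ _).trans ?_
    have := Finset.card_biUnion_le_card_mul F nb Δ fun v _ => hnb v
    linarith
  have hE : ∀ F, ((2 : ℝ) ^ (Δ + 1))⁻¹ ^ F.card ≤ (bern q).real (E F) := by
    intro F
    rw [Measure.real, bern_cyl, ENNReal.toReal_prod]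
    have : ∀ i ∈ S F, (ENNReal.ofReal (bw (q i) (decide (i ∈ F)))).toReal = 1 / 2 := by
      intro i _
      rw [ENNReal.toReal_ofReal (bw_nonneg _ _), bw]
      split_ifs <;> norm_num [q]
    rw [Finset.prod_congr rfl this, Finset.prod_const, ← inv_pow, ← pow_mul, one_div]
    exact pow_le_pow_of_le_one (by norm_num) (by norm_num) (hcard F)
  refine (Finset.sum_le_sum fun F _ => hE F).trans ?_
  refine (bern_sum_le q 𝒢 E (fun F => (S F : Set V)) (A := Set.univ) ?_ (fun F _ => (S F).finite_toSet)
    ?_ (fun _ _ => Set.subset_univ _)).trans measureReal_le_one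
  · intro F _ ω ω' h
    exact forall₂_congr fun v hv => by rw [h v hv]
  · intro F hF F' hF' hne
    rw [Set.disjoint_left]
    intro ω h1 h2
    have sub : ∀ A ∈ 𝒢, ∀ B ∈ 𝒢, ω ∈ E A → ω ∈ E B → A ⊆ B := by
      intro A hA B hB hωA hωB y hy
      by_contra hyB
      obtain ⟨a, b, -, ha, hab, hb, -⟩ := rtg_exit ((h𝒢 A hA).2 x (h𝒢 A hA).1 y hy) (S := (B : Set V))
        (h𝒢 B hB).1 hyB
      have hbB := hωB b (Finset.mem_union_right _ (Finset.mem_biUnion.2 ⟨a, ha, hr a b hab.1⟩))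
      have hbA := hωA b (Finset.mem_union_left _ hab.2.2)
      rw [hbB] at hbA
      have e1 : b ∈ A := hab.2.2
      have e2 : b ∉ B := hb
      simp [e1, e2] at hbA
    exact hne ((sub F hF F' hF' h1 h2).antisymm (sub F' hF' F hF h2 h1))

lemma animal_sum (r : V → V → Prop) (nb : V → Finset V) (Δ : ℕ) (hnb : ∀ v, (nb v).card ≤ Δ)
    (hr : ∀ a b, r a b → b ∈ nb a) (x : V) (𝒢 : Finset (Finset V)) (m : ℕ)
    (h𝒢 : ∀ F ∈ 𝒢, x ∈ F ∧ RConn r (F : Set V) ∧ m ≤ F.card) {η : ℝ} (hη : 0 ≤ η)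
    (hη1 : η * 2 ^ (Δ + 1) ≤ 1) :
    ∑ F ∈ 𝒢, η ^ F.card ≤ (η * 2 ^ (Δ + 1)) ^ m := by
  have hpos : (0 : ℝ) < 2 ^ (Δ + 1) := by positivity
  calc ∑ F ∈ 𝒢, η ^ F.card ≤ ∑ F ∈ 𝒢, (η * 2 ^ (Δ + 1)) ^ m * ((2 : ℝ) ^ (Δ + 1))⁻¹ ^ F.card := by
        refine Finset.sum_le_sum fun F hF => ?_
        have h1 : (η * 2 ^ (Δ + 1)) ^ F.card ≤ (η * 2 ^ (Δ + 1)) ^ m :=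
          pow_le_pow_of_le_one (by positivity) hη1 (h𝒢 F hF).2.2
        calc η ^ F.card = (η * 2 ^ (Δ + 1)) ^ F.card * ((2 : ℝ) ^ (Δ + 1))⁻¹ ^ F.card := by
              rw [← mul_pow]; congr 1; field_simp
          _ ≤ _ := by gcongr
    _ ≤ (η * 2 ^ (Δ + 1)) ^ m * 1 := by
        rw [← Finset.mul_sum]
        gcongr
        exact animal_weight r nb Δ hnb hr x 𝒢 fun F hF => ⟨(h𝒢 F hF).1, (h𝒢 F hF).2.1⟩
    _ = _ := mul_one _

/-- The sup-norm unit ball as a finset. -/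
noncomputable def starNb {d : ℕ} (x : Zd d) : Finset (Zd d) := Finset.Icc (x - 1) (x + 1)

lemma starNb_card {d : ℕ} (x : Zd d) : (starNb x).card ≤ 3 ^ d := by
  rw [starNb, Pi.card_Icc]
  refine (Finset.prod_le_pow_card _ _ 3 fun i _ => ?_).trans (by simp)
  simp only [Int.card_Icc, Pi.add_apply, Pi.sub_apply, Pi.one_apply]; omega

lemma mem_starNb {d : ℕ} {x y : Zd d} (h : starAdj x y) : y ∈ starNb x := by
  rw [starNb, Finset.mem_Icc]
  have := dst_le.1 h
  constructor <;> intro i <;> have := abs_le.1 (this i) <;>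
    simp only [Pi.add_apply, Pi.sub_apply, Pi.one_apply] <;> push_cast at this <;> omega

end animals

lemma bern_map_comp_injective {ι κ : Type*} (q : ι → unitInterval) (e : κ → ι)
    (he : Function.Injective e) : (bern q).map (fun ω => ω ∘ e) = bern (q ∘ e) := by
  have hm : Measurable (fun ω : ι → Bool => ω ∘ e) := by
    refine measurable_pi_lambda _ fun i => measurable_pi_apply _
  have : IsProbabilityMeasure ((bern q).map (fun ω => ω ∘ e)) :=
    Measure.isProbabilityMeasure_map hm.aemeasurable
  classical
  refine eq_bern _ _ fun s f => ?_
  have hset : MeasurableSet {ω : κ → Bool | ∀ i ∈ s, ω i = f i} :=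
    DetBy.measurableSet (S := (s : Set κ)) (fun ω ω' h => by
      simp only [Set.mem_ofPred_eq]
      exact forall₂_congr fun i hi => by rw [h i hi]) s.finite_toSet
  rw [Measure.map_apply hm hset]
  have h2 : (fun ω : ι → Bool => ω ∘ e) ⁻¹' {ω : κ → Bool | ∀ i ∈ s, ω i = f i} =
      {ω : ι → Bool | ∀ i ∈ s.image e, ω i = Function.extend e f (fun _ => false) i} := by
    ext ω
    simp [he.extend_apply]
  rw [h2, bern_cyl, Finset.prod_image fun a _ b _ h => he h]
  simp [he.extend_apply]

section labels

variable {d : ℕ} {κ : Type*}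

/-- Labels: for each edge, a base label `none`, a filler label `some none`, and colours. -/
abbrev Lab (d : ℕ) (κ : Type*) := Sym2 (Zd d) × Option (Option κ)

/-- The base configuration. -/
def base0 (b : Lab d κ → Bool) : Config d := fun e => b (e, none)

open Classical in
/-- The environment available once `K` has been explored, with colours `Y` left. -/
noncomputable def env (b : Lab d κ → Bool) (K : Set (Zd d)) (Y : Finset κ) : Config d := fun e =>
  decide (((∀ v ∈ e, v ∉ K) ∧ b (e, none) = true) ∨ ∃ c ∈ Y, b (e, some (some c)) = true)

lemma env_eq_true {b : Lab d κ → Bool} {K : Set (Zd d)} {Y : Finset κ} {e : Sym2 (Zd d)} :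
    env b K Y e = true ↔ ((∀ v ∈ e, v ∉ K) ∧ b (e, none) = true) ∨
      ∃ c ∈ Y, b (e, some (some c)) = true := by simp [env]

lemma env_mono {b : Lab d κ → Bool} {K K' : Set (Zd d)} {Y Y' : Finset κ} (hK : K ⊆ K')
    (hY : Y' ⊆ Y) (e : Sym2 (Zd d)) (h : env b K' Y' e = true) : env b K Y e = true := by
  rw [env_eq_true] at h ⊢
  rcases h with ⟨h1, h2⟩ | ⟨c, hc, h⟩
  · exact .inl ⟨fun v hv hvK => h1 v hv (hK hvK), h2⟩
  · exact .inr ⟨c, hY hc, h⟩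

/-- Failure to connect `K` to `T` inside `R` in the remaining environment. -/
def failSet (R T K : Set (Zd d)) (Y : Finset κ) : Set (Lab d κ → Bool) :=
  {b | ¬ SConn (env b K Y) R K T}

/-- The labels relevant for `failSet`. -/
def failLab (R K : Set (Zd d)) (Y : Finset κ) : Set (Lab d κ) :=
  {l | l.1 ∈ edgesIn R ∧ ((l.2 = none ∧ ∀ v ∈ l.1, v ∉ K) ∨ ∃ c ∈ Y, l.2 = some (some c))}

lemma detBy_failSet (R T K : Set (Zd d)) (Y : Finset κ) :
    DetBy (failLab R K Y) (failSet R T K Y) := by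
  intro b b' h
  refine not_congr (detBy_sconn R K T (env b K Y) (env b' K Y) fun e he => ?_)
  rw [Bool.eq_iff_iff, env_eq_true, env_eq_true]
  refine or_congr (and_congr_right fun hv => ?_) (exists_congr fun c => and_congr_right fun hc => ?_)
  · rw [h (e, none) ⟨he, .inl ⟨rfl, hv⟩⟩]
  · rw [h (e, some (some c)) ⟨he, .inr ⟨c, hc, rfl⟩⟩]

lemma failLab_finite {R : Set (Zd d)} (hR : R.Finite) (K : Set (Zd d)) (Y : Finset κ) :
    (failLab R K Y).Finite := by
  classical
  have hfin := (edgesIn_finite hR).prod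
    (((Y.image fun c => (some (some c) : Option (Option κ))) ∪ {none}).finite_toSet)
  refine hfin.subset fun l hl => ⟨hl.1, ?_⟩
  rcases hl.2 with h | ⟨c, hc, h⟩
  · simp [h.1]
  · simp [h, hc]

/-- One exploration step from `K` in the box `B` using colour `c`. -/
def grow (b : Lab d κ → Bool) (K : Set (Zd d)) (c : κ) (B : Set (Zd d)) : Set (Zd d) :=
  K ∪ {y | ∃ a ∈ K ∩ B, ∃ a' ∈ B \ K, latAdj a a' ∧ b (s(a, a'), some (some c)) = true ∧
    Conn (base0 b) (B \ K) a' y}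

lemma subset_grow (b : Lab d κ → Bool) (K : Set (Zd d)) (c : κ) (B : Set (Zd d)) :
    K ⊆ grow b K c B := Set.subset_union_left

lemma grow_subset (b : Lab d κ → Bool) (K : Set (Zd d)) (c : κ) (B : Set (Zd d)) :
    grow b K c B ⊆ K ∪ (B \ K) := by
  rintro y (hy | ⟨a, -, a', ha', -, -, h⟩)
  · exact .inl hy
  · exact .inr (h.mem ha')

lemma connLat_grow {K : Set (Zd d)} (hK : ConnLat K) (b : Lab d κ → Bool) (c : κ)
    (B : Set (Zd d)) : ConnLat (grow b K c B) := by
  have key : ∀ y ∈ grow b K c B, ∃ x ∈ K, ReflTransGen (restr latAdj (grow b K c B)) x y := by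
    rintro y (hy | ⟨a, ha, a', ha', hl, hb, h⟩)
    · exact ⟨y, hy, .refl⟩
    · have h1 : ∀ z, Conn (base0 b) (B \ K) a' z → z ∈ grow b K c B := fun z hz =>
        .inr ⟨a, ha, a', ha', hl, hb, hz⟩
      refine ⟨a, ha.1, ReflTransGen.head ⟨hl, .inl ha.1, h1 _ (Conn.refl _)⟩ ?_⟩
      have : ReflTransGen (restr latAdj (grow b K c B)) a' y ∧ Conn (base0 b) (B \ K) a' y := by
        induction h with
        | refl => exact ⟨.refl, Conn.refl _⟩
        | tail h1' h2 ih =>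
          obtain ⟨i1, i2⟩ := ih
          exact ⟨i1.tail ⟨h2.1.1, h1 _ i2, h1 _ (i2.tail h2)⟩, i2.tail h2⟩
      exact this.1
  intro x hx y hy
  obtain ⟨u, hu, h1⟩ := key x hx
  obtain ⟨v, hv, h2⟩ := key y hy
  have h3 := hK u hu v hv
  refine (rtg_symm (fun a b h => ⟨h.1.symm, h.2.2, h.2.1⟩) h1).trans (ReflTransGen.trans ?_ h2)
  exact rtg_mono (restr_mono (fun _ _ _ _ h => h) (subset_grow b K c B)) h3

/-- The labels determining that `grow` equals `K'`. -/
def growLab (K' : Set (Zd d)) (c : κ) (B : Set (Zd d)) : Set (Lab d κ) :=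
  {l | l.1 ∈ edgesIn B ∧ (l.2 = some (some c) ∨ (l.2 = none ∧ ∃ v ∈ l.1, v ∈ K'))}

lemma grow_congr_aux {K K' : Set (Zd d)} {c : κ} {B : Set (Zd d)} {b b' : Lab d κ → Bool}
    (h : ∀ l ∈ growLab K' c B, b l = b' l) (hb : grow b K c B = K') : grow b' K c B = K' := by
  subst hb
  apply Set.Subset.antisymm
  · rintro y (hy | ⟨a, ha, a', ha', hl, hc, hy⟩)
    · exact .inl hy
    · have h0 : a' ∈ grow b K c B := by
        refine .inr ⟨a, ha, a', ha', hl, ?_, .refl _⟩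
        rw [h _ ⟨mem_edgesIn.2 ⟨ha.2, ha'.1⟩, .inl rfl⟩]; exact hc
      refine rtg_of_closed hy (S := grow b K c B) ?_ h0
      rintro u v hu ⟨huv, hu1, hv1⟩
      rcases hu with hu | ⟨a, ha, a', ha', hl, hc, hy⟩
      · exact absurd hu hu1.2
      · have hu' : u ∈ grow b K c B := .inr ⟨a, ha, a', ha', hl, hc, hy⟩
        refine .inr ⟨a, ha, a', ha', hl, hc, hy.tail ⟨⟨huv.1, ?_⟩, hu1, hv1⟩⟩
        have := h (s(u, v), none) ⟨mem_edgesIn.2 ⟨hu1.1, hv1.1⟩, .inr ⟨rfl, u, by simp, hu'⟩⟩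
        exact this.trans huv.2
  · rintro y (hy | ⟨a, ha, a', ha', hl, hc, hy⟩)
    · exact .inl hy
    · refine .inr ⟨a, ha, a', ha', hl, ?_, ?_⟩
      · rw [← h _ ⟨mem_edgesIn.2 ⟨ha.2, ha'.1⟩, .inl rfl⟩]; exact hc
      · have hcl : ∀ z, Conn (base0 b) (B \ K) a' z → z ∈ grow b K c B := fun z hz =>
          .inr ⟨a, ha, a', ha', hl, hc, hz⟩
        have : Conn (base0 b) (B \ K) a' y ∧ Conn (base0 b') (B \ K) a' y := by
          induction hy with
          | refl => exact ⟨.refl _, .refl _⟩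
          | @tail u v h1' h2 ih =>
            refine ⟨h1'.tail h2, ih.2.tail ⟨⟨h2.1.1, ?_⟩, h2.2⟩⟩
            have := h (s(u, v), none)
              ⟨mem_edgesIn.2 ⟨h2.2.1.1, h2.2.2.1⟩, .inr ⟨rfl, u, by simp, hcl u h1'⟩⟩
            exact this.symm.trans h2.1.2
        exact this.2

lemma detBy_grow (K K' : Set (Zd d)) (c : κ) (B : Set (Zd d)) :
    DetBy (growLab K' c B) {b : Lab d κ → Bool | grow b K c B = K'} := fun _ _ h =>
  ⟨grow_congr_aux h, grow_congr_aux fun l hl => (h l hl).symm⟩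

lemma growLab_finite {B : Set (Zd d)} (hB : B.Finite) (K' : Set (Zd d)) (c : κ) :
    (growLab K' c B).Finite := by
  have hfin := (edgesIn_finite hB).prod
    (Set.toFinite {(none : Option (Option κ)), some (some c)})
  refine hfin.subset fun l hl => ⟨hl.1, ?_⟩
  rcases hl.2 with h | h
  · simp [h]
  · simp [h.1]

/-- Connections in the environment left after one step are connections before it. -/
lemma sconn_of_grow [DecidableEq κ] {b : Lab d κ → Bool} {K R T B : Set (Zd d)} {Y : Finset κ}
    {c : κ} (hc : c ∈ Y) (hB : B ⊆ R)
    (h : SConn (env b (grow b K c B) (Y.erase c)) R (grow b K c B) T) :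
    SConn (env b K Y) R K T := by
  obtain ⟨x, hx, y, hy, hxy⟩ := h
  have h2 : Conn (env b K Y) R x y :=
    hxy.mono subset_rfl fun u _ v _ => env_mono (subset_grow b K c B) (Finset.erase_subset _ _) _
  rcases hx with hx | ⟨a, ha, a', ha', hl, hb, h⟩
  · exact ⟨x, hx, y, hy, h2⟩
  · refine ⟨a, ha.1, y, hy, ?_⟩
    have h3 : Conn (env b K Y) R a a' :=
      Conn.single ⟨hl, env_eq_true.2 (.inr ⟨c, hc, hb⟩)⟩ (hB ha.2) (hB ha'.1)
    refine (h3.trans (h.mono (Set.sdiff_subset.trans hB) fun u hu v hv huv => ?_)).trans h2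
    refine env_eq_true.2 (.inl ⟨?_, huv⟩)
    simp only [Sym2.mem_iff, forall_eq_or_imp, forall_eq]
    exact ⟨hu.2, hv.2⟩

/-- The failure probability. -/
noncomputable def val (q : Lab d κ → unitInterval) (R T K : Set (Zd d)) (Y : Finset κ) : ℝ :=
  (bern q).real (failSet R T K Y)

lemma val_le_one (q : Lab d κ → unitInterval) (R T K : Set (Zd d)) (Y : Finset κ) :
    val q R T K Y ≤ 1 := measureReal_le_one

lemma val_anti (q : Lab d κ → unitInterval) (R T K : Set (Zd d)) {Y Y' : Finset κ} (h : Y ⊆ Y') :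
    val q R T K Y' ≤ val q R T K Y := by
  refine measureReal_mono fun b hb hs => hb ?_
  obtain ⟨x, hx, y, hy, hxy⟩ := hs
  exact ⟨x, hx, y, hy, hxy.mono subset_rfl fun u _ v _ => env_mono subset_rfl h _⟩

lemma val_eq_zero (q : Lab d κ → unitInterval) {R T K : Set (Zd d)} (Y : Finset κ)
    (h : (K ∩ T).Nonempty) : val q R T K Y = 0 := by
  obtain ⟨x, hx, hx'⟩ := h
  have : failSet R T K Y = ∅ := by
    ext b; simp only [failSet, Set.mem_ofPred_eq, Set.mem_empty_iff_false, iff_false, not_not]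
    exact ⟨x, hx, x, hx', .refl _⟩
  simp [val, this]

/-- One exploration step. -/
lemma val_step [DecidableEq κ] (q : Lab d κ → unitInterval) {R T K B : Set (Zd d)} {Y : Finset κ}
    {c : κ} (hc : c ∈ Y) (hB : B ⊆ R) (hR : R.Finite) (hK : ConnLat K) (G : Set (Zd d) → Prop)
    {vg vb : ℝ} (hgb : vg ≤ vb)
    (hvb : ∀ K', K ⊆ K' → K' ⊆ K ∪ B → ConnLat K' → val q R T K' (Y.erase c) ≤ vb)
    (hvg : ∀ K', K ⊆ K' → K' ⊆ K ∪ B → ConnLat K' → G K' → val q R T K' (Y.erase c) ≤ vg) :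
    val q R T K Y ≤ vg + (vb - vg) * (bern q).real {b | ¬ G (grow b K c B)} := by
  classical
  have hBf : B.Finite := hR.subset hB
  have hBK : (B \ K).Finite := hBf.subset Set.sdiff_subset
  set t : Finset (Finset (Zd d)) := hBK.toFinset.powerset
  set E : Finset (Zd d) → Set (Lab d κ → Bool) := fun F => {b | grow b K c B = K ∪ F} with hE
  have hdisj : ∀ k ∈ t, ∀ l ∈ t, k ≠ l → Disjoint (E k) (E l) := by
    intro k hk l hl hkl
    rw [Set.disjoint_left]
    intro b hb hb'
    apply hkl
    have hk' := Finset.mem_powerset.1 hk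
    have hl' := Finset.mem_powerset.1 hl
    have hh : K ∪ (k : Set (Zd d)) = K ∪ l := hb.symm.trans hb'
    ext v
    constructor <;> intro hv
    · have h1 : v ∈ K ∪ (l : Set (Zd d)) := hh ▸ Or.inr hv
      have h2 := hk' hv
      simp only [Set.Finite.mem_toFinset] at h2
      exact h1.resolve_left h2.2
    · have h1 : v ∈ K ∪ (k : Set (Zd d)) := hh ▸ Or.inr hv
      have h2 := hl' hv
      simp only [Set.Finite.mem_toFinset] at h2
      exact h1.resolve_left h2.2
  have h1 : val q R T K Y ≤ ∑ F ∈ t, (bern q).real (E F) * val q R T (K ∪ F) (Y.erase c) := by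
    refine bern_le_sum q t E (fun F => failSet R T (K ∪ F) (Y.erase c))
      (fun F => growLab (K ∪ F) c B) (fun F => failLab R (K ∪ F) (Y.erase c)) _
      (fun F _ => detBy_grow K _ c B) (fun F _ => growLab_finite hBf _ c)
      (fun F _ => detBy_failSet _ _ _ _) (fun F _ => failLab_finite hR _ _) ?_ (fun F _ => le_rfl) ?_
    · intro F _
      rw [Set.disjoint_left]
      rintro ⟨e, o⟩ ⟨-, h⟩ ⟨-, h'⟩
      simp only at h h'
      rcases h with h | ⟨h, v, hv, hv'⟩ <;> rcases h' with ⟨h1, h2⟩ | ⟨c', hc', h1⟩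
      · rw [h] at h1; simp at h1
      · rw [h] at h1; simp only [Option.some.injEq] at h1; subst h1
        simp at hc'
      · exact h2 v hv hv'
      · rw [h] at h1; simp at h1
    · intro b hb
      have hsub := grow_subset b K c B
      set F := (hBK.subset (t := grow b K c B \ K) (fun v hv => (hsub hv.1).resolve_left hv.2)).toFinset
        with hF
      have hgF : grow b K c B = K ∪ F := by
        rw [hF, Set.Finite.coe_toFinset, Set.union_sdiff_cancel (subset_grow b K c B)]
      simp only [Set.mem_iUnion]
      refine ⟨F, ?_, hgF, ?_⟩
      · rw [Finset.mem_powerset]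
        intro v hv
        simp only [hF, Set.Finite.mem_toFinset] at hv ⊢
        exact (hsub hv.1).resolve_left hv.2
      · rw [← hgF]
        exact fun hs => hb (sconn_of_grow hc hB hs)
  have hterm : ∀ F ∈ t, (bern q).real (E F) * val q R T (K ∪ F) (Y.erase c) ≤
      vg * (bern q).real (E F) + (vb - vg) * (if G (K ∪ F) then 0 else (bern q).real (E F)) := by
    intro F hF
    by_cases hne : (E F).Nonempty
    · obtain ⟨b, hb⟩ := hne
      have hb' : grow b K c B = K ∪ F := hb
      have p1 : K ⊆ K ∪ (F : Set (Zd d)) := Set.subset_union_left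
      have p2 : K ∪ (F : Set (Zd d)) ⊆ K ∪ B := by
        rw [← hb']; exact (grow_subset b K c B).trans (Set.union_subset_union_right _ Set.sdiff_subset)
      have p3 : ConnLat (K ∪ (F : Set (Zd d))) := hb' ▸ connLat_grow hK b c B
      have hn : 0 ≤ (bern q).real (E F) := measureReal_nonneg
      split_ifs with hG
      · nlinarith [hvg _ p1 p2 p3 hG]
      · nlinarith [hvb _ p1 p2 p3]
    · rw [Set.not_nonempty_iff_eq_empty] at hne
      simp [hne]
  have hS : ∀ k ∈ t, DetBy (growLab (K ∪ k) c B) (E k) := fun k _ => detBy_grow K _ c B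
  have hmeas : ∀ k ∈ t, MeasurableSet (E k) := fun k hk => (hS k hk).measurableSet (growLab_finite hBf _ c)
  have hcover : ∀ b : Lab d κ → Bool, ∃ F ∈ t, b ∈ E F := by
    intro b
    have hsub := grow_subset b K c B
    set F := (hBK.subset (t := grow b K c B \ K) (fun v hv => (hsub hv.1).resolve_left hv.2)).toFinset
      with hF
    refine ⟨F, ?_, ?_⟩
    · rw [Finset.mem_powerset]
      intro v hv
      simp only [hF, Set.Finite.mem_toFinset] at hv ⊢
      exact (hsub hv.1).resolve_left hv.2
    · show grow b K c B = K ∪ F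
      rw [hF, Set.Finite.coe_toFinset, Set.union_sdiff_cancel (subset_grow b K c B)]
  have h2 : ∑ F ∈ t, (bern q).real (E F) = 1 := by
    rw [← measureReal_biUnion_finset (fun k hk l hl h => hdisj k hk l hl h) hmeas]
    have : (⋃ F ∈ t, E F) = Set.univ := by
      ext b; simpa using hcover b
    rw [this]; simp
  set g : Finset (Zd d) → ℝ := fun F => if G (K ∪ F) then 0 else (bern q).real (E F) with hg
  have h3 : ∑ F ∈ t, g F ≤
      (bern q).real {b | ¬ G (grow b K c B)} := by
    have : ∑ F ∈ t, g F =
        ∑ F ∈ t.filter (fun F : Finset (Zd d) => ¬ G (K ∪ F)), (bern q).real (E F) := by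
      rw [Finset.sum_filter]; exact Finset.sum_congr rfl fun F _ => by simp only [g]; split_ifs <;> simp_all
    rw [this]
    refine bern_sum_le q _ E (fun F => growLab (K ∪ (F : Set (Zd d))) c B) (fun k hk => hS k (Finset.mem_filter.1 hk).1)
      (fun k hk => growLab_finite hBf _ c) (fun k hk l hl h => hdisj k (Finset.mem_filter.1 hk).1 l
        (Finset.mem_filter.1 hl).1 h) ?_
    intro k hk b hb
    have hb' : grow b K c B = K ∪ k := hb
    simp only [Set.mem_ofPred_eq, hb']
    exact (Finset.mem_filter.1 hk).2
  refine h1.trans ((Finset.sum_le_sum hterm).trans ?_)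
  rw [Finset.sum_add_distrib, ← Finset.mul_sum, ← Finset.mul_sum, h2, mul_one]
  gcongr

lemma bern_real_base0 (q : Lab d κ → unitInterval) (p0 : unitInterval) (h0 : ∀ e, q (e, none) = p0)
    {A : Set (Config d)} {S : Set (Sym2 (Zd d))} (hA : DetBy S A) (hS : S.Finite) :
    (bern q).real {b | base0 b ∈ A} = Pr p0 A := by
  have h := bern_map_comp_injective q (fun e : Sym2 (Zd d) => (e, (none : Option (Option κ))))
    (fun a b h => (Prod.ext_iff.1 h).1)
  have hq : q ∘ (fun e : Sym2 (Zd d) => (e, (none : Option (Option κ)))) = fun _ => p0 :=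
    funext h0
  rw [hq] at h
  have hm : Measurable (fun (ω : Lab d κ → Bool) => ω ∘ fun e : Sym2 (Zd d) =>
      (e, (none : Option (Option κ)))) :=
    measurable_pi_lambda _ fun i => measurable_pi_apply _
  rw [Pr, ← h, Measure.real, Measure.real, Measure.map_apply hm (hA.measurableSet hS)]
  rfl

lemma bern_all_false {ι : Type*} (q : ι → unitInterval) (E : Finset ι) (u : unitInterval)
    (h : ∀ i ∈ E, q i = u) :
    (bern q).real {b | ∀ i ∈ E, b i = false} = (1 - (u : ℝ)) ^ E.card := by
  have := bern_cyl q E (fun _ => false)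
  rw [Measure.real, this, ENNReal.toReal_prod, ← Finset.prod_const]
  refine Finset.prod_congr rfl fun i hi => ?_
  rw [h i hi, ENNReal.toReal_ofReal (bw_nonneg _ _)]
  simp [bw]

/-- The pivotal edges of an exploration step: edges from `K` to a point connected to `T` off `K`. -/
def pivots (ω : Config d) (K B T : Set (Zd d)) : Set (Sym2 (Zd d)) :=
  {e | ∃ a ∈ K ∩ B, ∃ a' ∈ B \ K, e = s(a, a') ∧ latAdj a a' ∧ SConn ω (B \ K) {a'} T}

lemma pivots_congr {ω ω' : Config d} {K B T : Set (Zd d)} (h : ∀ e ∈ edgesIn (B \ K), ω e = ω' e) :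
    pivots ω K B T = pivots ω' K B T := by
  ext e
  refine exists_congr fun a => and_congr_right fun _ => exists_congr fun a' =>
    and_congr_right fun _ => and_congr_right fun _ => and_congr_right fun _ => ?_
  exact detBy_sconn (B \ K) {a'} T ω ω' h

/-- One exploration step reaches the target with high probability. -/
lemma micro (q : Lab d κ → unitInterval) (p0 ε : unitInterval) (h0 : ∀ e, q (e, none) = p0)
    (hp0 : (p0 : ℝ) < 1) (c : κ) {B : Set (Zd d)} (hB : B.Finite)
    (hε : ∀ e ∈ edgesIn B, q (e, some (some c)) = ε) (K T : Set (Zd d)) {η : ℝ} (J : ℕ)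
    (hη : Pr p0 {ω | ¬ SConn ω B K T} ≤ η) :
    (bern q).real {b | ¬ (grow b K c B ∩ T).Nonempty} ≤
      (1 - (ε : ℝ)) ^ J + ((1 - (p0 : ℝ)) ^ J)⁻¹ * η := by
  classical
  have hε0 : 0 ≤ 1 - (ε : ℝ) := by linarith [ε.2.2]
  have hε1 : 1 - (ε : ℝ) ≤ 1 := by linarith [ε.2.1]
  have hp0' : 0 < 1 - (p0 : ℝ) := by linarith
  have hp1 : 1 - (p0 : ℝ) ≤ 1 := by linarith [p0.2.1]
  have hη0 : 0 ≤ η := le_trans (Pr_nonneg _ _) hη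
  by_cases hKT : (K ∩ T).Nonempty
  · have : {b : Lab d κ → Bool | ¬ (grow b K c B ∩ T).Nonempty} = ∅ := by
      ext b
      simp only [Set.mem_ofPred_eq, Set.mem_empty_iff_false, iff_false, not_not]
      exact hKT.mono (Set.inter_subset_inter_left _ (subset_grow b K c B))
    rw [this]; simp; positivity
  have hEf := edgesIn_finite hB
  set t : Finset (Finset (Sym2 (Zd d))) := hEf.toFinset.powerset.filter
    (fun E => ∀ e ∈ E, ∃ v ∈ e, v ∈ K) with ht
  set X : Finset (Sym2 (Zd d)) → Set (Lab d κ → Bool) := fun E => {b | pivots (base0 b) K B T = E}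
    with hX
  set S0 : Set (Lab d κ) := (fun e => (e, none)) '' edgesIn (B \ K) with hS0
  have hS0f : S0.Finite := (edgesIn_finite (hB.subset Set.sdiff_subset)).image _
  have hXdet : ∀ E, DetBy S0 (X E) := by
    intro E b b' h
    have : pivots (base0 b) K B T = pivots (base0 b') K B T :=
      pivots_congr fun e he => h (e, none) ⟨e, he, rfl⟩
    simp [X, this]
  have hdet : ∀ (o : Option (Option κ)) (E : Finset (Sym2 (Zd d))),
      DetBy ((fun e => (e, o)) '' (E : Set (Sym2 (Zd d))))
        {b : Lab d κ → Bool | ∀ e ∈ E, b (e, o) = false} := by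
    intro o E b b' h
    exact forall₂_congr fun e he => by rw [h (e, o) ⟨e, he, rfl⟩]
  have hprob : ∀ (o : Option (Option κ)) (E : Finset (Sym2 (Zd d))) (u : unitInterval),
      (∀ e ∈ E, q (e, o) = u) →
      (bern q).real {b : Lab d κ → Bool | ∀ e ∈ E, b (e, o) = false} = (1 - (u : ℝ)) ^ E.card := by
    intro o E u hu
    have hinj : Function.Injective (fun e : Sym2 (Zd d) => (e, o)) :=
      fun a b h => (Prod.ext_iff.1 h).1
    have := bern_all_false q (E.image fun e => (e, o)) u (by simpa using hu)
    rw [Finset.card_image_of_injective _ hinj] at this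
    rw [← this]; congr 1; ext b; simp
  have hcover : ∀ b : Lab d κ → Bool, ∃ E ∈ t, b ∈ X E := by
    intro b
    have hsub : pivots (base0 b) K B T ⊆ edgesIn B := by
      rintro e ⟨a, ha, a', ha', rfl, -⟩
      exact mem_edgesIn.2 ⟨ha.2, ha'.1⟩
    refine ⟨(hEf.subset hsub).toFinset, ?_, by simp [X]⟩
    rw [ht, Finset.mem_filter, Finset.mem_powerset]
    refine ⟨fun e he => ?_, fun e he => ?_⟩
    · simp only [Set.Finite.mem_toFinset] at he ⊢; exact hsub he
    · simp only [Set.Finite.mem_toFinset] at he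
      obtain ⟨a, ha, a', ha', rfl, -⟩ := he
      exact ⟨a, by simp, ha.1⟩
  have htE : ∀ E ∈ t, ∀ e ∈ E, e ∈ edgesIn B := by
    intro E hE e he
    have := Finset.mem_powerset.1 (Finset.mem_filter.1 hE).1 he
    simpa using this
  have hXdisj : ∀ E ∈ t, ∀ E' ∈ t, E ≠ E' → Disjoint (X E) (X E') := by
    intro E _ E' _ hne
    rw [Set.disjoint_left]
    intro b hb hb'
    exact hne (Finset.coe_injective (hb.symm.trans hb'))
  have h1 : (bern q).real {b | ¬ (grow b K c B ∩ T).Nonempty} ≤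
      ∑ E ∈ t, (bern q).real (X E) * (1 - (ε : ℝ)) ^ E.card := by
    refine bern_le_sum q t X (fun E => {b | ∀ e ∈ E, b (e, some (some c)) = false})
      (fun _ => S0) (fun E => (fun e => (e, some (some c))) '' (E : Set (Sym2 (Zd d)))) _
      (fun E _ => hXdet E) (fun E _ => hS0f) (fun E _ => hdet _ E)
      (fun E _ => E.finite_toSet.image _) ?_ (fun E hE => (hprob _ E ε fun e he => hε e (htE E hE e he)).le) ?_
    · intro E _
      rw [Set.disjoint_left]
      rintro _ ⟨e, -, rfl⟩ ⟨e', -, h⟩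
      simp at h
    · intro b hb
      obtain ⟨E, hE, hbE⟩ := hcover b
      simp only [Set.mem_iUnion]
      refine ⟨E, hE, hbE, fun e he => ?_⟩
      by_contra hbe
      rw [Bool.not_eq_false] at hbe
      have he' : e ∈ pivots (base0 b) K B T := by
        have : pivots (base0 b) K B T = E := hbE
        rw [this]; exact he
      obtain ⟨a, ha, a', ha', rfl, hl, x, hx, y, hy, hxy⟩ := he'
      rw [Set.mem_singleton_iff] at hx; subst hx
      exact hb ⟨y, .inr ⟨a, ha, x, ha', hl, hbe, hxy⟩, hy⟩
  have h2 : ∑ E ∈ t, (bern q).real (X E) * (1 - (p0 : ℝ)) ^ E.card ≤ η := by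
    refine le_trans ?_ hη
    have hb0 := bern_real_base0 q p0 h0 (detBy_sconn B K T).compl hEf
    simp only [Set.compl_ofPred, Set.mem_ofPred_eq] at hb0
    rw [← hb0]
    have heq : ∀ E ∈ t, (bern q).real (X E) * (1 - (p0 : ℝ)) ^ E.card =
        (bern q).real (X E ∩ {b | ∀ e ∈ E, b (e, none) = false}) := by
      intro E hE
      rw [bern_inter q (hXdet E) (hdet none E) hS0f (E.finite_toSet.image _), hprob none E p0 fun e _ => h0 e]
      rw [Set.disjoint_left]
      rintro _ ⟨e, he, rfl⟩ ⟨e', he', h⟩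
      simp only [Prod.mk.injEq, and_true] at h
      subst h
      obtain ⟨v, hv, hvK⟩ := (Finset.mem_filter.1 hE).2 e' he'
      exact (he v hv).2 hvK
    rw [Finset.sum_congr rfl heq]
    refine bern_sum_le q t _ (fun E => S0 ∪ (fun e => (e, none)) '' (E : Set (Sym2 (Zd d))))
      (fun E _ => ((hXdet E).mono Set.subset_union_left).inter
        ((hdet none E).mono Set.subset_union_right))
      (fun E _ => hS0f.union (E.finite_toSet.image _))
      (fun E hE E' hE' hne => (hXdisj E hE E' hE' hne).mono Set.inter_subset_left Set.inter_subset_left) ?_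
    rintro E hE b ⟨hbX, hbE⟩ ⟨x, hx, y, hy, hxy⟩
    have hyK : y ∉ K := fun hyK => hKT ⟨y, hyK, hy⟩
    obtain ⟨a, a', ha, haa, ha', -, h⟩ := Conn.last_exit hxy hx hyK
    have : s(a, a') ∈ (E : Set (Sym2 (Zd d))) := by
      have hh : pivots (base0 b) K B T = E := hbX
      rw [← hh]
      exact ⟨a, ha.symm, a', ha', rfl, haa.1, a', rfl, y, hy, h⟩
    have h3 := hbE _ this
    have h4 : b (s(a, a'), none) = true := haa.2
    rw [h3] at h4; exact absurd h4 (by simp)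
  have hXsum : ∑ E ∈ t, (bern q).real (X E) ≤ 1 :=
    (bern_sum_le q t X (fun _ => S0) (fun E _ => hXdet E) (fun E _ => hS0f) hXdisj
      (fun E _ => Set.subset_univ _)).trans measureReal_le_one
  have hterm : ∀ E ∈ t, (bern q).real (X E) * (1 - (ε : ℝ)) ^ E.card ≤
      (bern q).real (X E) * (1 - (ε : ℝ)) ^ J +
        ((1 - (p0 : ℝ)) ^ J)⁻¹ * ((bern q).real (X E) * (1 - (p0 : ℝ)) ^ E.card) := by
    intro E _
    have hn : 0 ≤ (bern q).real (X E) := measureReal_nonneg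
    rcases le_total J E.card with h | h
    · have := pow_le_pow_of_le_one hε0 hε1 h
      have h5 : 0 ≤ ((1 - (p0 : ℝ)) ^ J)⁻¹ * ((bern q).real (X E) * (1 - (p0 : ℝ)) ^ E.card) := by
        positivity
      nlinarith
    · have h6 := pow_le_pow_of_le_one hp0'.le hp1 h
      have h7 : 1 ≤ ((1 - (p0 : ℝ)) ^ J)⁻¹ * (1 - (p0 : ℝ)) ^ E.card := by
        rw [inv_mul_eq_div, one_le_div (by positivity)]; exact h6
      have h8 : (1 - (ε : ℝ)) ^ E.card ≤ 1 := pow_le_one₀ hε0 hε1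
      have h9 : 0 ≤ (1 - (ε : ℝ)) ^ J := by positivity
      calc (bern q).real (X E) * (1 - (ε : ℝ)) ^ E.card ≤ (bern q).real (X E) * 1 := by gcongr
        _ ≤ (bern q).real (X E) * (1 - (ε : ℝ)) ^ J + (bern q).real (X E) *
          (((1 - (p0 : ℝ)) ^ J)⁻¹ * (1 - (p0 : ℝ)) ^ E.card) := by nlinarith
        _ = _ := by ring
  refine h1.trans ((Finset.sum_le_sum hterm).trans ?_)
  rw [Finset.sum_add_distrib, ← Finset.mul_sum, ← Finset.sum_mul]
  have h10 : 0 ≤ (1 - (ε : ℝ)) ^ J := by positivity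
  gcongr
  nlinarith

end labels

section coarse

variable {d : ℕ} {κ : Type*}

/-- The potential measuring the distance from `x` to the cell centred at `z`. -/
def pot (z : Zd d) (a : ℤ) (x : Zd d) : ℤ := ∑ l, max |x l - z l| a

lemma le_pot (z : Zd d) {a : ℤ} (ha : 0 ≤ a) (x : Zd d) (l : Fin d) : |x l - z l| ≤ pot z a x :=
  (le_max_left _ a).trans (Finset.single_le_sum (f := fun l => max |x l - z l| a)
    (fun _ _ => le_max_of_le_right ha) (Finset.mem_univ l))

lemma pot_le (z x : Zd d) {a b : ℤ} (hab : a ≤ b) (h : ∀ l, |x l - z l| ≤ b) :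
    pot z a x ≤ d * b := by
  have : pot z a x ≤ ∑ _l : Fin d, b := Finset.sum_le_sum fun l _ => max_le (h l) hab
  simpa using this

lemma pot_step (z x y : Zd d) (L n : ℕ) (hn : n ≤ L) (i : Fin d) (hi : 2 * (L : ℤ) < |x i - z i|)
    (σ : Fin d → ℤˣ) (hσ : ∀ l, (σ l : ℤ) * (x l - z l) = - |x l - z l|)
    (hy : y ∈ Tgt x i σ L n) : pot z (L + n) y + L ≤ pot z (L + n) x + d * n := by
  have hsq : ∀ l, (σ l : ℤ) = 1 ∨ (σ l : ℤ) = -1 := fun l => by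
    rcases Int.units_eq_one_or (σ l) with h | h <;> simp [h]
  have hl : ∀ l, max |y l - z l| ((L : ℤ) + n) + (if l = i then (L : ℤ) else 0) ≤
      max |x l - z l| ((L : ℤ) + n) + n := by
    intro l
    have h1 := hy.1
    obtain ⟨h2, h3⟩ := hy.2 l
    have h4 := hσ l
    split_ifs with hli
    · subst hli
      rw [max_eq_left (by omega : (L : ℤ) + n ≤ |x l - z l|)]
      have : |y l - z l| ≤ |x l - z l| - L + n := by
        rcases hsq l with h | h <;> rw [h] at h1 h2 h3 h4 <;> rw [abs_le] <;> constructor <;> omega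
      have : max |y l - z l| ((L : ℤ) + n) ≤ |x l - z l| - L + n := max_le this (by omega)
      omega
    · have h5 : |y l - z l| ≤ max |x l - z l| ((L : ℤ) + n) + n := by
        have := le_max_left |x l - z l| ((L : ℤ) + n)
        have := le_max_right |x l - z l| ((L : ℤ) + n)
        have := abs_nonneg (x l - z l)
        rcases hsq l with h | h <;> rw [h] at h2 h3 h4 <;> rw [abs_le] <;> constructor <;> omega
      have := le_max_right |x l - z l| ((L : ℤ) + n)
      have := max_le h5 (by omega : (L : ℤ) + n ≤ max |x l - z l| ((L : ℤ) + n) + n)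
      omega
  have := Finset.sum_le_sum fun l (_ : l ∈ Finset.univ) => hl l
  rw [Finset.sum_add_distrib, Finset.sum_add_distrib] at this
  simpa [pot] using this

lemma exists_sign (t : ℤ) : ∃ s : ℤˣ, (s : ℤ) * t = -|t| := by
  rcases le_total 0 t with h | h
  · exact ⟨-1, by simp [abs_of_nonneg h]⟩
  · exact ⟨1, by simp [abs_of_nonpos h]⟩

/-- Steering the explored set into a given cell. -/
lemma renorm_aux [DecidableEq κ] (q : Lab d κ → unitInterval) {R T : Set (Zd d)} (hR : R.Finite)
    (z : Zd d) (L n ρ : ℕ) (hL : 2 * d * n ≤ L) (hn : n ≤ L) (hρ : 3 * d + 2 ≤ ρ)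
    (hzR : ball z (ρ * L) ⊆ R) {η : ℝ} (hη : 0 ≤ η) (K0 : Set (Zd d))
    (hK0 : ∃ u ∈ K0, ∃ v ∈ K0, 2 * n ≤ dst u v) (Y : Finset κ) {vg vb : ℝ} (hgb : vg ≤ vb)
    (hvb : ∀ K, K0 ⊆ K → ConnLat K → val q R T K Y ≤ vb)
    (hvg : ∀ K, K0 ⊆ K → ConnLat K → (K ∩ ball z (2 * L)).Nonempty → val q R T K Y ≤ vg)
    (m : ℕ) : ∀ cs : Finset κ, cs.card = m → Disjoint cs Y →
    (∀ c ∈ cs, ∀ K x, ConnLat K → x ∈ K → (∃ y ∈ K, n ≤ dst y x) →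
      ball x (L + n) ⊆ ball z (ρ * L) → ∀ i σ,
      (bern q).real {b | ¬ (grow b K c (ball x (L + n)) ∩ Tgt x i σ L n).Nonempty} ≤ η) →
    ∀ K x, K0 ⊆ K → ConnLat K → x ∈ K → pot z (L + n) x ≤ 3 * d * L →
      2 * pot z (L + n) x ≤ 4 * L + m * L →
      val q R T K (cs ∪ Y) ≤ vg + m * η * (vb - vg) := by
  induction m with
  | zero =>
    intro cs hcs _ _ K x hK hKc hx _ hpot
    rw [Finset.card_eq_zero] at hcs
    subst hcs
    have : x ∈ ball z (2 * L) := by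
      rw [mem_ball]; intro l
      have := le_pot z (by positivity : (0 : ℤ) ≤ L + n) x l
      push_cast at *; linarith
    simpa using hvg K hK hKc ⟨x, hx, this⟩
  | succ m ih =>
    intro cs hcs hdis hmic K x hK hKc hx hp1 hp2
    have hdiam : ∃ y ∈ K, n ≤ dst y x := by
      obtain ⟨u, hu, v, hv, huv⟩ := hK0
      have h1 := dst_triangle u x v
      rw [dst_comm x v] at h1
      by_cases h : n ≤ dst u x
      · exact ⟨u, hK hu, h⟩
      · exact ⟨v, hK hv, by omega⟩
    have hbx : ball x (L + n) ⊆ ball z (ρ * L) := by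
      refine ball_subset ?_
      have : dst x z ≤ 3 * d * L := by
        rw [dst_le]; intro l
        have := le_pot z (by positivity : (0 : ℤ) ≤ L + n) x l
        push_cast; linarith
      calc L + n + dst x z ≤ 2 * L + 3 * d * L := by omega
        _ = (3 * d + 2) * L := by ring
        _ ≤ ρ * L := Nat.mul_le_mul_right _ hρ
    obtain ⟨c, hc⟩ : cs.Nonempty := by rw [← Finset.card_pos]; omega
    by_cases hcell : x ∈ ball z (2 * L)
    · refine (val_anti q R T K Finset.subset_union_right).trans
        ((hvg K hK hKc ⟨x, hx, hcell⟩).trans ?_)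
      have : 0 ≤ ((m + 1 : ℕ) : ℝ) * η * (vb - vg) :=
        mul_nonneg (by positivity) (by linarith)
      linarith
    · rw [mem_ball] at hcell
      push Not at hcell
      obtain ⟨i, hi⟩ := hcell
      choose σ hσ using fun l => exists_sign (x l - z l)
      have hcY : c ∉ Y := Finset.disjoint_left.1 hdis hc
      have herase : (cs ∪ Y).erase c = cs.erase c ∪ Y := by
        rw [Finset.erase_union_distrib, Finset.erase_eq_of_notMem hcY]
      by_cases hsmall : vg + m * η * (vb - vg) ≤ vb
      · have hstep := val_step q (R := R) (T := T) (K := K) (B := ball x (L + n)) (Y := cs ∪ Y)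
          (c := c) (Finset.mem_union_left _ hc) (hbx.trans hzR) hR hKc
          (fun K' => (K' ∩ Tgt x i σ L n).Nonempty) hsmall ?_ ?_
        · have hb := hmic c hc K x hKc hx hdiam hbx i σ
          refine hstep.trans ?_
          have h0 : 0 ≤ m * η * (vb - vg) := mul_nonneg (by positivity) (by linarith)
          have h1 : (vb - (vg + m * η * (vb - vg))) *
              (bern q).real {b | ¬ (grow b K c (ball x (L + n)) ∩ Tgt x i σ L n).Nonempty} ≤
              (vb - vg) * η := by
            apply mul_le_mul _ hb measureReal_nonneg (by linarith)
            linarith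
          push_cast
          linarith
        · intro K' h1 h2 h3
          rw [herase]
          exact (val_anti q R T K' Finset.subset_union_right).trans (hvb K' (hK.trans h1) h3)
        · rintro K' h1 h2 h3 ⟨y, hy, hyT⟩
          rw [herase]
          have hps := pot_step z x y L n hn i (by exact_mod_cast hi) σ hσ hyT
          have hL' : 2 * (d : ℤ) * n ≤ L := by exact_mod_cast hL
          refine ih (cs.erase c) (by rw [Finset.card_erase_of_mem hc]; omega)
            (Finset.disjoint_of_subset_left (Finset.erase_subset _ _) hdis)
            (fun c' hc' => hmic c' (Finset.mem_of_mem_erase hc')) K' y (hK.trans h1) h3 hy ?_ ?_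
          · linarith [(Nat.cast_nonneg d : (0 : ℤ) ≤ d), (Nat.cast_nonneg L : (0 : ℤ) ≤ L)]
          · push_cast at hp2; linarith
      · push Not at hsmall
        refine (val_anti q R T K Finset.subset_union_right).trans ((hvb K hK hKc).trans ?_)
        have : 0 ≤ η * (vb - vg) := mul_nonneg hη (by linarith)
        push_cast
        linarith

/-- The colours with which one can explore around `z`. -/
def GoodColor (q : Lab d κ → unitInterval) (z : Zd d) (L n ρ : ℕ) (η : ℝ) (c : κ) : Prop :=
  ∀ K x, ConnLat K → x ∈ K → (∃ y ∈ K, n ≤ dst y x) → ball x (L + n) ⊆ ball z (ρ * L) → ∀ i σ,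
    (bern q).real {b | ¬ (grow b K c (ball x (L + n)) ∩ Tgt x i σ L n).Nonempty} ≤ η

lemma renorm_step [DecidableEq κ] (q : Lab d κ → unitInterval) {R T : Set (Zd d)} (hR : R.Finite)
    (z z' : Zd d) (L n ρ : ℕ) (hL : 2 * d * n ≤ L) (hn : n ≤ L) (hρ : 3 * d + 2 ≤ ρ)
    (hzR : ball z (ρ * L) ⊆ R) (hz : dst z' z ≤ L) {η : ℝ} (hη : 0 ≤ η) (K0 : Set (Zd d))
    (hK0 : ∃ u ∈ K0, ∃ v ∈ K0, 2 * n ≤ dst u v) (Y cs : Finset κ) (hcs : cs.card = 6 * d)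
    (hdis : Disjoint cs Y) (hmic : ∀ c ∈ cs, GoodColor q z L n ρ η c) {vg vb : ℝ} (hgb : vg ≤ vb)
    (hvb : ∀ K, K0 ⊆ K → ConnLat K → val q R T K Y ≤ vb)
    (hvg : ∀ K, K0 ⊆ K → ConnLat K → (K ∩ ball z (2 * L)).Nonempty → val q R T K Y ≤ vg)
    (hK : ConnLat K0) (hKz : (K0 ∩ ball z' (2 * L)).Nonempty) :
    val q R T K0 (cs ∪ Y) ≤ vg + ((6 * d : ℕ) : ℝ) * η * (vb - vg) := by
  obtain ⟨x, hx, hxz⟩ := hKz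
  have h3 : dst x z ≤ 3 * L := by
    have := dst_triangle x z' z
    have h : dst x z' ≤ 2 * L := hxz
    omega
  have hpot : pot z (L + n) x ≤ d * (3 * L : ℕ) := pot_le z x (by push_cast; omega) (dst_le.1 h3)
  push_cast at hpot
  refine renorm_aux q hR z L n ρ hL hn hρ hzR hη K0 hK0 Y hgb hvb hvg (6 * d) cs hcs hdis hmic K0 x
    subset_rfl hK hx (by linarith) ?_
  push_cast
  have : (0 : ℤ) ≤ L := by positivity
  linarith

open Classical in
/-- Weight of the obstructions avoiding the active cells `A`, given the dead cells `D`. -/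
noncomputable def obsW (𝓕 : Finset (Finset (Zd d))) (η : ℝ) (A D : Finset (Zd d)) : ℝ :=
  ∑ F ∈ 𝓕.filter (fun F => Disjoint F A), η ^ (F \ D).card

lemma obsW_insert (𝓕 : Finset (Finset (Zd d))) {η : ℝ} {A D : Finset (Zd d)}
    {v : Zd d} (hD : v ∉ D) :
    obsW 𝓕 η (insert v A) D + η * (obsW 𝓕 η A (insert v D) - obsW 𝓕 η (insert v A) D) =
      obsW 𝓕 η A D := by
  classical
  have hX : ∀ D' : Finset (Zd d), obsW 𝓕 η A D' =
      (∑ F ∈ (𝓕.filter (fun F => Disjoint F A)).filter (fun F => v ∉ F), η ^ (F \ D').card) +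
      ∑ F ∈ (𝓕.filter (fun F => Disjoint F A)).filter (fun F => ¬ v ∉ F), η ^ (F \ D').card :=
    fun D' => by
      rw [obsW]
      convert (Finset.sum_filter_add_sum_filter_not _ (fun F => v ∉ F) _).symm using 2
  have h1 : obsW 𝓕 η (insert v A) D =
      ∑ F ∈ (𝓕.filter (fun F => Disjoint F A)).filter (fun F => v ∉ F), η ^ (F \ D).card := by
    rw [obsW]
    refine Finset.sum_congr ?_ fun _ _ => rfl
    ext F
    simp only [Finset.mem_filter, Finset.disjoint_insert_right]
    tauto
  have h2 : ∀ F ∈ (𝓕.filter (fun F => Disjoint F A)).filter (fun F => v ∉ F),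
      η ^ (F \ insert v D).card = η ^ (F \ D).card := by
    intro F hF
    have hv := (Finset.mem_filter.1 hF).2
    congr 2
    ext w; simp only [Finset.mem_sdiff, Finset.mem_insert, not_or]
    constructor
    · rintro ⟨h, -, h'⟩; exact ⟨h, h'⟩
    · rintro ⟨h, h'⟩; exact ⟨h, fun e => hv (e ▸ h), h'⟩
  have h3 : ∀ F ∈ (𝓕.filter (fun F => Disjoint F A)).filter (fun F => ¬ v ∉ F),
      η * η ^ (F \ insert v D).card = η ^ (F \ D).card := by
    intro F hF
    have hv := not_not.1 (Finset.mem_filter.1 hF).2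
    rw [← pow_succ']
    congr 1
    have : F \ D = insert v (F \ insert v D) := by
      ext w; simp only [Finset.mem_sdiff, Finset.mem_insert, not_or]
      constructor
      · rintro ⟨h, h'⟩
        by_cases e : w = v
        · exact .inl e
        · exact .inr ⟨h, e, h'⟩
      · rintro (rfl | ⟨h, -, h'⟩)
        · exact ⟨hv, hD⟩
        · exact ⟨h, h'⟩
    rw [this, Finset.card_insert_of_notMem (by simp)]
  rw [h1, hX D, hX (insert v D), Finset.sum_congr rfl h2, ← Finset.sum_congr rfl h3, ← Finset.mul_sum]
  ring

lemma obsW_nonneg (𝓕 : Finset (Finset (Zd d))) {η : ℝ} (hη : 0 ≤ η) (A D : Finset (Zd d)) :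
    0 ≤ obsW 𝓕 η A D := Finset.sum_nonneg fun _ _ => by positivity

lemma obsW_le (𝓕 : Finset (Finset (Zd d))) {η : ℝ} (hη : 0 < η) (hη1 : η ≤ 1)
    {A D : Finset (Zd d)} {v : Zd d} : obsW 𝓕 η (insert v A) D ≤ obsW 𝓕 η A (insert v D) := by
  classical
  calc obsW 𝓕 η (insert v A) D ≤ obsW 𝓕 η A D := by
        refine Finset.sum_le_sum_of_subset_of_nonneg ?_ fun _ _ _ => by positivity
        intro F
        simp only [Finset.mem_filter, Finset.disjoint_insert_right]
        tauto
    _ ≤ _ := Finset.sum_le_sum fun F _ => pow_le_pow_of_le_one hη.le hη1 <|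
        Finset.card_le_card (Finset.sdiff_subset_sdiff subset_rfl (Finset.subset_insert _ _))

/-- The coarse-grained exploration. -/
lemma coarse [DecidableEq κ] (q : Lab d κ → unitInterval) {R T : Set (Zd d)} (hR : R.Finite)
    (rect tgt : Finset (Zd d)) (z : Zd d → Zd d) (cols : Zd d → Finset κ) (L n ρ : ℕ)
    (hL : 2 * d * n ≤ L) (hn : n ≤ L) (hρ : 3 * d + 2 ≤ ρ)
    (hzR : ∀ v ∈ rect, ball (z v) (ρ * L) ⊆ R)
    (hz : ∀ u v, latAdj u v → dst (z u) (z v) ≤ L)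
    (hT : ∀ v ∈ tgt, ball (z v) (2 * L) ⊆ T)
    {η1 η : ℝ} (hη1 : 0 ≤ η1) (hη : 0 < η) (hηle : η ≤ 1) (hηη : ((6 * d : ℕ) : ℝ) * η1 ≤ η)
    (hcard : ∀ v ∈ rect, (cols v).card = 6 * d)
    (hdis : ∀ u ∈ rect, ∀ v ∈ rect, u ≠ v → Disjoint (cols u) (cols v))
    (hmic : ∀ v ∈ rect, ∀ c ∈ cols v, GoodColor q (z v) L n ρ η1 c)
    (𝓕 : Finset (Finset (Zd d))) (o : Zd d)
    (hbase : ∀ A D : Finset (Zd d), A ⊆ rect → D ⊆ rect → Disjoint A D → o ∈ A →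
      (∀ v ∈ rect, v ∉ A → v ∉ D → ∀ u ∈ A, ¬ latAdj u v) → Disjoint A tgt →
      ∃ F ∈ 𝓕, Disjoint F A ∧ F ⊆ D)
    (K0 : Set (Zd d)) (hK0 : ∃ u ∈ K0, ∃ v ∈ K0, 2 * n ≤ dst u v) (m : ℕ) :
    ∀ A D : Finset (Zd d), A ⊆ rect → D ⊆ rect → Disjoint A D → o ∈ A →
      (rect \ (A ∪ D)).card = m → ∀ K, K0 ⊆ K → ConnLat K →
      (∀ v ∈ A, (K ∩ ball (z v) (2 * L)).Nonempty) →
      val q R T K ((rect \ (A ∪ D)).biUnion cols) ≤ obsW 𝓕 η A D := by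
  classical
  induction m with
  | zero =>
    intro A D hA hD hAD ho hm K hK hKc hKA
    by_cases htg : Disjoint A tgt
    · rw [Finset.card_eq_zero, Finset.sdiff_eq_empty_iff_subset] at hm
      obtain ⟨F, hF, hFA, hFD⟩ := hbase A D hA hD hAD ho (fun v hv h1 h2 => by
        have := hm hv; simp [h1, h2] at this) htg
      refine (val_le_one _ _ _ _ _).trans ?_
      have : (1 : ℝ) = η ^ (F \ D).card := by
        rw [Finset.sdiff_eq_empty_iff_subset.2 hFD]; simp
      rw [this, obsW]
      exact Finset.single_le_sum (f := fun F => η ^ (F \ D).card) (fun _ _ => by positivity)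
        (Finset.mem_filter.2 ⟨hF, hFA⟩)
    · rw [Finset.not_disjoint_iff] at htg
      obtain ⟨v, hv, hvt⟩ := htg
      rw [val_eq_zero q _ ((hKA v hv).mono (Set.inter_subset_inter_right _ (hT v hvt)))]
      exact obsW_nonneg _ hη.le _ _
  | succ m ih =>
    intro A D hA hD hAD ho hm K hK hKc hKA
    by_cases htg : Disjoint A tgt
    swap
    · rw [Finset.not_disjoint_iff] at htg
      obtain ⟨v, hv, hvt⟩ := htg
      rw [val_eq_zero q _ ((hKA v hv).mono (Set.inter_subset_inter_right _ (hT v hvt)))]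
      exact obsW_nonneg _ hη.le _ _
    by_cases hadj : ∀ v ∈ rect, v ∉ A → v ∉ D → ∀ u ∈ A, ¬ latAdj u v
    · obtain ⟨F, hF, hFA, hFD⟩ := hbase A D hA hD hAD ho hadj htg
      refine (val_le_one _ _ _ _ _).trans ?_
      have : (1 : ℝ) = η ^ (F \ D).card := by
        rw [Finset.sdiff_eq_empty_iff_subset.2 hFD]; simp
      rw [this, obsW]
      exact Finset.single_le_sum (f := fun F => η ^ (F \ D).card) (fun _ _ => by positivity)
        (Finset.mem_filter.2 ⟨hF, hFA⟩)
    · push Not at hadj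
      obtain ⟨v, hv, hvA, hvD, u, hu, huv⟩ := hadj
      set S := rect \ (A ∪ D) with hS
      have hvS : v ∈ S := by simp [hS, hv, hvA, hvD]
      have hS1 : rect \ (insert v A ∪ D) = S.erase v := by
        ext w; simp only [hS, Finset.mem_sdiff, Finset.mem_union, Finset.mem_insert, Finset.mem_erase]
        tauto
      have hS2 : rect \ (A ∪ insert v D) = S.erase v := by
        ext w; simp only [hS, Finset.mem_sdiff, Finset.mem_union, Finset.mem_insert, Finset.mem_erase]
        tauto
      have hSv : S.biUnion cols = cols v ∪ (S.erase v).biUnion cols := by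
        rw [← Finset.biUnion_insert, Finset.insert_erase hvS]
      have hcm : (S.erase v).card = m := by rw [Finset.card_erase_of_mem hvS]; omega
      have hdj : Disjoint (cols v) ((S.erase v).biUnion cols) := by
        rw [Finset.disjoint_biUnion_right]
        intro w hw
        exact hdis v hv w (Finset.mem_sdiff.1 (Finset.mem_of_mem_erase hw)).1
          (Finset.ne_of_mem_erase hw).symm
      have hgb := obsW_le 𝓕 hη hηle (A := A) (D := D) (v := v)
      rw [hSv]
      have hmac := renorm_step q hR (z v) (z u) L n ρ hL hn hρ (T := T) (hzR v hv) (hz u v huv) hη1 K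
        (by obtain ⟨a, ha, b, hb, h⟩ := hK0; exact ⟨a, hK ha, b, hK hb, h⟩)
        ((S.erase v).biUnion cols) (cols v) (hcard v hv) hdj (hmic v hv) hgb ?_ ?_ hKc (hKA u hu)
      · refine hmac.trans ?_
        rw [← obsW_insert 𝓕 hvD (A := A)]
        have : 0 ≤ obsW 𝓕 η A (insert v D) - obsW 𝓕 η (insert v A) D := by linarith
        gcongr
      · intro K' h1 h2
        rw [← hS2]
        refine ih A (insert v D) hA (Finset.insert_subset hv hD) ?_ ho (by rw [hS2, hcm]) K'
          (hK.trans h1) h2 fun w hw => (hKA w hw).mono (Set.inter_subset_inter_left _ h1)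
        rw [Finset.disjoint_insert_right]; exact ⟨hvA, hAD⟩
      · intro K' h1 h2 h3
        rw [← hS1]
        refine ih (insert v A) D (Finset.insert_subset hv hA) hD ?_ (Finset.mem_insert_of_mem ho)
          (by rw [hS1, hcm]) K' (hK.trans h1) h2 fun w hw => ?_
        · rw [Finset.disjoint_insert_left]; exact ⟨hvD, hAD⟩
        · rcases Finset.mem_insert.1 hw with rfl | hw
          · exact h3
          · exact (hKA w hw).mono (Set.inter_subset_inter_left _ h1)

end coarse

section rectangle

variable {d : ℕ}

/-- The component of a set `S` in the lattice restricted to `R`. -/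
def latHull (R S : Set (Zd d)) : Set (Zd d) := {y | ∃ x ∈ S, ReflTransGen (restr latAdj R) x y}

lemma restr_latAdj_symm {R : Set (Zd d)} (a b : Zd d) (h : restr latAdj R a b) :
    restr latAdj R b a := ⟨h.1.symm, h.2.2, h.2.1⟩

lemma latHull_closed {R S : Set (Zd d)} {a b : Zd d} (ha : a ∈ latHull R S) (haR : a ∈ R)
    (hb : b ∈ R) (hab : latAdj a b) : b ∈ latHull R S := by
  obtain ⟨x, hx, h⟩ := ha
  exact ⟨x, hx, h.tail ⟨hab, haR, hb⟩⟩

lemma latHull_subset {R S : Set (Zd d)} (hS : S ⊆ R) : latHull R S ⊆ R := by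
  rintro y ⟨x, hx, h⟩; exact rtg_mem h (hS hx)

lemma connLat_latHull {R S : Set (Zd d)} (hc : ConnLat S) :
    ConnLat (latHull R S) := by
  have key : ∀ x ∈ S, ∀ y, ReflTransGen (restr latAdj R) x y →
      ReflTransGen (restr latAdj (latHull R S)) x y := by
    intro x hx y h
    refine rtg_mono ?_ (rtg_restr_closed h (S := latHull R S) ?_ ⟨x, hx, .refl⟩)
    · rintro a b ⟨h1, h2, h3⟩; exact ⟨h1.1, h2, h3⟩
    · rintro a b ha ⟨h1, h2, h3⟩; exact latHull_closed ha h2 h3 h1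
  rintro y ⟨x, hx, h⟩ y' ⟨x', hx', h'⟩
  refine (rtg_symm restr_latAdj_symm (key x hx y h)).trans (ReflTransGen.trans ?_ (key x' hx' y' h'))
  exact rtg_mono (restr_mono (fun _ _ _ _ h => h) fun a ha => ⟨a, ha, .refl⟩) (hc x hx x' hx')

/-- The coarse box. -/
noncomputable def rectN (N : Fin d → ℕ) : Finset (Zd d) := Finset.Icc 0 fun l => (N l : ℤ)

lemma mem_rectN {N : Fin d → ℕ} {v : Zd d} : v ∈ rectN N ↔ ∀ l, 0 ≤ v l ∧ v l ≤ N l := by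
  simp only [rectN, Finset.mem_Icc, Pi.le_def, Pi.zero_apply]
  exact ⟨fun h l => ⟨h.1 l, h.2 l⟩, fun h => ⟨fun l => (h l).1, fun l => (h l).2⟩⟩

lemma coe_rectN (N : Fin d → ℕ) : (rectN N : Set (Zd d)) = Set.Icc 0 fun l => (N l : ℤ) := by
  simp [rectN]

/-- The target column. -/
noncomputable def tgtN (j : Fin d) (N : Fin d → ℕ) : Finset (Zd d) := (rectN N).filter fun v => ∀ l, l ≠ j → v l = N l

open Classical in
/-- Blocking sets of dead cells. -/
noncomputable def blockers (j : Fin d) (N : Fin d → ℕ) : Finset (Finset (Zd d)) :=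
  (rectN N).powerset.filter fun F => RConn starAdj (F : Set (Zd d)) ∧
    (N j + 1 ≤ F.card ∨ ∃ t : ℕ, 1 ≤ t ∧ t ≤ F.card ∧ (Pi.single j (t : ℤ) : Zd d) ∈ F)

lemma exists_blocker (j : Fin d) (N : Fin d → ℕ) (A D : Finset (Zd d)) (hA : A ⊆ rectN N)
    (ho : (0 : Zd d) ∈ A)
    (hcl : ∀ v ∈ rectN N, v ∉ A → v ∉ D → ∀ u ∈ A, ¬ latAdj u v) (htg : Disjoint A (tgtN j N)) :
    ∃ F ∈ blockers j N, Disjoint F A ∧ F ⊆ D := by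
  classical
  set I : Set (Zd d) := Set.Icc 0 fun l => (N l : ℤ) with hI
  have hAI : (A : Set (Zd d)) ⊆ I := by rw [hI, ← coe_rectN]; exact_mod_cast hA
  set A0 := latHull (A : Set (Zd d)) {0} with hA0
  have h0A : ({0} : Set (Zd d)) ⊆ A := by simpa using ho
  have hA0A : A0 ⊆ A := latHull_subset h0A
  have hA0c : ConnLat A0 := connLat_latHull (by
    rintro x rfl y rfl; exact .refl)
  have h0A0 : (0 : Zd d) ∈ A0 := ⟨0, rfl, .refl⟩
  have htgt_eq : (tgtN j N : Set (Zd d)) =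
      Set.Icc (Function.update (fun l => (N l : ℤ)) j 0) (fun l => (N l : ℤ)) := by
    ext v
    simp only [tgtN, Finset.coe_filter, mem_rectN, Set.mem_ofPred_eq, Set.mem_Icc, Pi.le_def]
    constructor
    · rintro ⟨h1, h2⟩
      refine ⟨fun l => ?_, fun l => (h1 l).2⟩
      by_cases hl : l = j
      · subst hl; simpa using (h1 l).1
      · simp [hl, h2 l hl]
    · rintro ⟨h1, h2⟩
      refine ⟨fun l => ⟨?_, h2 l⟩, fun l hl => ?_⟩
      · have := h1 l
        by_cases hl : l = j
        · subst hl; simpa using this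
        · simp only [Function.update_of_ne hl] at this; omega
      · have := h1 l
        simp only [Function.update_of_ne hl] at this
        exact le_antisymm (h2 l) this
  have htI : (tgtN j N : Set (Zd d)) ⊆ I \ A0 := by
    intro v hv
    refine ⟨?_, fun hv' => Finset.disjoint_left.1 htg (hA0A hv') hv⟩
    rw [hI, ← coe_rectN]; exact (Finset.mem_filter.1 hv).1
  set W := latHull (I \ A0) (tgtN j N : Set (Zd d)) with hW
  have hWI : W ⊆ I \ A0 := latHull_subset htI
  have hWc : ConnLat W := by
    refine connLat_latHull ?_
    rw [htgt_eq]
    exact fun x hx y hy => Icc_latConn _ _ x y hx hy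
  have hIW : I \ (I \ W) = W := by
    rw [Set.sdiff_sdiff_right_self]; exact Set.inter_eq_right.2 (hWI.trans Set.sdiff_subset)
  have hA0V : A0 ⊆ I \ W := fun x hx => ⟨hAI (hA0A hx), fun hxW => (hWI hxW).2 hx⟩
  have hVc : ConnLat (I \ W) := by
    have key : ∀ v ∈ I \ W, ∃ u ∈ A0, ReflTransGen (restr latAdj (I \ W)) v u := by
      intro v hv
      by_cases hvA : v ∈ A0
      · exact ⟨v, hvA, .refl⟩
      · have hp := Icc_latConn 0 (fun l => (N l : ℤ)) v 0 hv.1 (hAI (hA0A h0A0))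
        obtain ⟨a, b, h1, h2, h3, h4, -⟩ := rtg_exit hp (S := A0ᶜ) hvA (by simpa using h0A0)
        rw [Set.mem_compl_iff, not_not] at h4
        have hclos : ∀ a b, a ∈ I \ W → restr (restr latAdj I) A0ᶜ a b → b ∈ I \ W := by
          rintro a b ha ⟨⟨hab, haI, hbI⟩, haA, hbA⟩
          refine ⟨hbI, fun hbW => ha.2 ?_⟩
          exact latHull_closed hbW ⟨hbI, hbA⟩ ⟨haI, haA⟩ hab.symm
        have h5 := rtg_restr_closed h1 hclos hv
        have ha := rtg_of_closed h1 hclos hv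
        refine ⟨b, h4, ReflTransGen.tail (rtg_mono ?_ h5) ⟨h3.1, ha, hA0V h4⟩⟩
        rintro x y ⟨hxy, hx, hy⟩
        exact ⟨hxy.1.1, hx, hy⟩
    intro x hx y hy
    obtain ⟨u, hu, h1⟩ := key x hx
    obtain ⟨v, hv, h2⟩ := key y hy
    exact h1.trans ((rtg_mono (restr_mono (fun _ _ _ _ h => h) hA0V) (hA0c u hu v hv)).trans
      (rtg_symm restr_latAdj_symm h2))
  set F : Set (Zd d) := {x | x ∈ I \ (I \ W) ∧ ∃ v ∈ I \ W, latAdj x v} with hF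
  have hFs : RConn starAdj F := by
    refine boundary_starConn_Icc 0 (fun l => (N l : ℤ)) (fun l => by simp) (I \ W) Set.sdiff_subset hVc ?_
    rw [← hI, hIW]; exact hWc
  have hFW : F ⊆ W := fun x hx => by have := hx.1; rwa [hIW] at this
  have hFadj : ∀ x ∈ F, ∃ v ∈ A0, latAdj x v := by
    rintro x hx
    obtain ⟨v, hv, hxv⟩ := hx.2
    refine ⟨v, ?_, hxv⟩
    by_contra hvA
    have hxW := hFW hx
    exact hv.2 (latHull_closed hxW (hWI hxW) ⟨hv.1, hvA⟩ hxv)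
  have hFA : ∀ x ∈ F, x ∉ A := by
    intro x hx hxA
    obtain ⟨v, hv, hxv⟩ := hFadj x hx
    exact (hWI (hFW hx)).2 (latHull_closed hv (hA0A hv) hxA hxv.symm)
  have hFD : ∀ x ∈ F, x ∈ D := by
    intro x hx
    obtain ⟨v, hv, hxv⟩ := hFadj x hx
    by_contra hxD
    refine hcl x ?_ (hFA x hx) hxD v (hA0A hv) hxv.symm
    rw [← Finset.mem_coe, coe_rectN]; exact (hWI (hFW hx)).1
  have hFfin : F.Finite := D.finite_toSet.subset hFD
  -- crossing principle along a connected subset of the box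
  have hcross : ∀ (lo hi : Zd d), Set.Icc lo hi ⊆ I → ∀ x ∈ Set.Icc lo hi, ∀ y ∈ Set.Icc lo hi,
      x ∈ I \ W → y ∈ W → ∃ f ∈ F, f ∈ Set.Icc lo hi := by
    intro lo hi hsub x hx y hy hxV hyW
    obtain ⟨a, b, -, h2, h3, h4, -⟩ := rtg_exit (Icc_latConn lo hi x y hx hy) (S := I \ W) hxV
      (fun h => h.2 hyW)
    exact ⟨b, ⟨⟨hsub h3.2.2, h4⟩, a, h2, h3.1.symm⟩, h3.2.2⟩
  have hIj : ∀ s : ℕ, s ≤ N j → (Pi.single j (s : ℤ) : Zd d) ∈ I := by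
    intro s hs
    constructor <;> intro l <;> by_cases hl : l = j
    · subst hl; simp
    · simp [hl]
    · subst hl; simpa using hs
    · simp [hl]
  have hlevel : ∀ s : ℕ, s ≤ N j → (Pi.single j (s : ℤ) : Zd d) ∈ I \ W → ∃ f ∈ F, f j = s := by
    intro s hs hsV
    suffices h : ∃ f ∈ F, f ∈ Set.Icc (Pi.single j (s : ℤ))
        (Function.update (fun l => (N l : ℤ)) j s) by
      obtain ⟨f, hf, hf'⟩ := h
      refine ⟨f, hf, le_antisymm ?_ ?_⟩
      · simpa using hf'.2 j
      · simpa using hf'.1 j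
    refine hcross (Pi.single j (s : ℤ)) (Function.update (fun l => (N l : ℤ)) j s) ?_
      (Pi.single j (s : ℤ)) ?_ (Function.update (fun l => (N l : ℤ)) j s) ?_ hsV ?_
    · refine Set.Icc_subset_Icc ?_ ?_
      · exact (hIj s hs).1
      · intro l; by_cases hl : l = j
        · subst hl; simpa using hs
        · simp [hl]
    · refine ⟨le_rfl, fun l => ?_⟩
      by_cases hl : l = j
      · subst hl; simp
      · simp [hl]
    · refine ⟨fun l => ?_, le_rfl⟩
      by_cases hl : l = j
      · subst hl; simp
      · simp [hl]
    · refine ⟨_, ?_, .refl⟩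
      rw [htgt_eq]
      constructor <;> intro l <;> by_cases hl : l = j
      · subst hl; simp
      · simp [hl]
      · subst hl; simpa using hs
      · simp [hl]
  have hcardF : ∀ t : ℕ, (∀ s < t, ∃ f ∈ F, f j = (s : ℤ)) → t ≤ hFfin.toFinset.card := by
    intro t ht
    have : (Finset.range t).image (fun s : ℕ => (s : ℤ)) ⊆ hFfin.toFinset.image (fun f => f j) := by
      intro z hz
      simp only [Finset.mem_image, Finset.mem_range, Set.Finite.mem_toFinset] at hz ⊢
      obtain ⟨s, hs, rfl⟩ := hz
      exact ht s hs
    have h := Finset.card_le_card this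
    rw [Finset.card_image_of_injective _ Nat.cast_injective, Finset.card_range] at h
    exact h.trans Finset.card_image_le
  refine ⟨hFfin.toFinset, ?_, ?_, ?_⟩
  · rw [blockers, Finset.mem_filter, Finset.mem_powerset]
    refine ⟨fun x hx => ?_, by simpa using hFs, ?_⟩
    · rw [← Finset.mem_coe, coe_rectN]
      exact (hWI (hFW (by simpa using hx))).1
    · by_cases hex : ∃ t : ℕ, t ≤ N j ∧ (Pi.single j (t : ℤ) : Zd d) ∈ W
      · right
        have hmin := Nat.find_spec hex
        set t := Nat.find hex with ht
        have hbelow : ∀ s < t, (Pi.single j (s : ℤ) : Zd d) ∈ I \ W := fun s hs =>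
          ⟨hIj s (by omega), fun h => Nat.find_min hex hs ⟨by omega, h⟩⟩
        have ht1 : 1 ≤ t := by
          by_contra h
          have h0 : t = 0 := by omega
          rw [h0] at hmin
          have : (Pi.single j ((0 : ℕ) : ℤ) : Zd d) = 0 := by simp
          rw [this] at hmin
          exact (hWI hmin.2).2 h0A0
        refine ⟨t, ht1, hcardF t fun s hs => hlevel s (by omega) (hbelow s hs), ?_⟩
        rw [Set.Finite.mem_toFinset, hF, Set.mem_ofPred_eq, hIW]
        refine ⟨hmin.2, Pi.single j ((t - 1 : ℕ) : ℤ), hbelow _ (by omega), ?_⟩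
        rw [latAdj_iff]
        refine ⟨j, -1, .inr rfl, ?_⟩
        ext l
        by_cases hl : l = j
        · subst hl; simp; omega
        · simp [hl]
      · left
        push Not at hex
        exact hcardF _ fun s hs => hlevel s (by omega) ⟨hIj s (by omega), hex s (by omega)⟩
  · rw [Finset.disjoint_left]
    intro x hx; exact hFA x (by simpa using hx)
  · intro x hx; exact hFD x (by simpa using hx)

lemma sum_blockers (j : Fin d) (N : Fin d → ℕ) {η : ℝ} (hη : 0 ≤ η)
    (hη1 : η * 2 ^ (3 ^ d + 1) ≤ 1 / 8) (hN : ((rectN N).card : ℝ) * (1 / 8) ^ (N j + 1) ≤ 1 / 4) :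
    ∑ F ∈ blockers j N, η ^ F.card ≤ 1 / 2 := by
  classical
  have hC1 : η * 2 ^ (3 ^ d + 1) ≤ 1 := by linarith
  set a := η * 2 ^ (3 ^ d + 1) with ha
  have ha0 : 0 ≤ a := by positivity
  set G1 : Zd d → Finset (Finset (Zd d)) := fun x => (blockers j N).filter
    fun F => x ∈ F ∧ N j + 1 ≤ F.card
  set G2 : ℕ → Finset (Finset (Zd d)) := fun t => (blockers j N).filter
    fun F => (Pi.single j (t : ℤ) : Zd d) ∈ F ∧ t ≤ F.card
  have hconn : ∀ F ∈ blockers j N, RConn starAdj (F : Set (Zd d)) := fun F hF =>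
    (Finset.mem_filter.1 hF).2.1
  have hsub : blockers j N ⊆ (rectN N).biUnion G1 ∪ (Finset.Icc 1 (N j)).biUnion G2 := by
    intro F hF
    have hF' := Finset.mem_filter.1 hF
    rw [Finset.mem_powerset] at hF'
    rw [Finset.mem_union, Finset.mem_biUnion, Finset.mem_biUnion]
    rcases hF'.2.2 with h | ⟨t, h1, h2, h3⟩
    · obtain ⟨x, hx⟩ : F.Nonempty := by rw [← Finset.card_pos]; omega
      exact .inl ⟨x, hF'.1 hx, Finset.mem_filter.2 ⟨hF, hx, h⟩⟩
    · refine .inr ⟨t, ?_, Finset.mem_filter.2 ⟨hF, h3, h2⟩⟩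
      have := (mem_rectN.1 (hF'.1 h3) j).2
      simp at this
      exact Finset.mem_Icc.2 ⟨h1, this⟩
  have s1 : ∀ x, ∑ F ∈ G1 x, η ^ F.card ≤ a ^ (N j + 1) := fun x =>
    animal_sum starAdj starNb (3 ^ d) starNb_card (fun _ _ => mem_starNb) x _ _
      (fun F hF => ⟨(Finset.mem_filter.1 hF).2.1, hconn F (Finset.mem_filter.1 hF).1,
        (Finset.mem_filter.1 hF).2.2⟩) hη hC1
  have s2 : ∀ t, ∑ F ∈ G2 t, η ^ F.card ≤ a ^ t := fun t =>
    animal_sum starAdj starNb (3 ^ d) starNb_card (fun _ _ => mem_starNb) (Pi.single j (t : ℤ)) _ _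
      (fun F hF => ⟨(Finset.mem_filter.1 hF).2.1, hconn F (Finset.mem_filter.1 hF).1,
        (Finset.mem_filter.1 hF).2.2⟩) hη hC1
  have hgeo : ∀ n : ℕ, ∑ t ∈ Finset.Icc 1 n, a ^ t ≤ 1 / 7 - (1 / 7) * (1 / 8) ^ n := by
    intro n
    induction n with
    | zero => simp
    | succ n ih =>
      rw [Finset.sum_Icc_succ_top (by omega)]
      have : a ^ (n + 1) ≤ (1 / 8) ^ (n + 1) := pow_le_pow_left₀ ha0 hη1 _
      have e := pow_succ (1 / 8 : ℝ) n
      rw [e] at this ⊢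
      linarith
  have hbi : ∀ (κ : Type) (s : Finset κ) (G : κ → Finset (Finset (Zd d))),
      ∑ F ∈ s.biUnion G, η ^ F.card ≤ ∑ k ∈ s, ∑ F ∈ G k, η ^ F.card := by
    intro κ s G
    induction s using Finset.induction_on with
    | empty => simp
    | insert k s hk ih =>
      rw [Finset.biUnion_insert, Finset.sum_insert hk]
      have := Finset.sum_union_inter (s₁ := G k) (s₂ := s.biUnion G) (f := fun F => η ^ F.card)
      have h0 : 0 ≤ ∑ F ∈ G k ∩ s.biUnion G, η ^ F.card := Finset.sum_nonneg fun _ _ => by positivity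
      linarith
  calc ∑ F ∈ blockers j N, η ^ F.card
      ≤ ∑ F ∈ (rectN N).biUnion G1 ∪ (Finset.Icc 1 (N j)).biUnion G2, η ^ F.card :=
        Finset.sum_le_sum_of_subset_of_nonneg hsub fun _ _ _ => by positivity
    _ ≤ ∑ F ∈ (rectN N).biUnion G1, η ^ F.card + ∑ F ∈ (Finset.Icc 1 (N j)).biUnion G2, η ^ F.card := by
        have := Finset.sum_union_inter (s₁ := (rectN N).biUnion G1)
          (s₂ := (Finset.Icc 1 (N j)).biUnion G2) (f := fun F => η ^ F.card)
        have h0 : 0 ≤ ∑ F ∈ (rectN N).biUnion G1 ∩ (Finset.Icc 1 (N j)).biUnion G2, η ^ F.card :=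
          Finset.sum_nonneg fun _ _ => by positivity
        linarith
    _ ≤ ∑ x ∈ rectN N, a ^ (N j + 1) + ∑ t ∈ Finset.Icc 1 (N j), a ^ t :=
        add_le_add ((hbi _ _ _).trans (Finset.sum_le_sum fun x _ => s1 x))
          ((hbi _ _ _).trans (Finset.sum_le_sum fun t _ => s2 t))
    _ ≤ 1 / 4 + 1 / 7 := by
        have h1 : ∑ x ∈ rectN N, a ^ (N j + 1) ≤ ((rectN N).card : ℝ) * (1 / 8) ^ (N j + 1) := by
          rw [Finset.sum_const, nsmul_eq_mul]
          have : a ^ (N j + 1) ≤ (1 / 8) ^ (N j + 1) := pow_le_pow_left₀ ha0 hη1 _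
          gcongr
        have h2 := hgeo (N j)
        have : (0 : ℝ) ≤ (1 / 8) ^ N j := by positivity
        linarith
    _ ≤ 1 / 2 := by norm_num

end rectangle

section strip

variable {d : ℕ}

/-- The union of all layers. -/
def merge {κ : Type*} [Fintype κ] (b : Lab d κ → Bool) : Config d :=
  fun e => decide (∃ c, b (e, c) = true)

open Classical in
lemma exists_merge {κ : Type*} [Fintype κ] (B : κ → Set (Zd d)) (p0 p ε : unitInterval) (M : ℕ)
    (hp0 : (p0 : ℝ) < 1) (hε : (ε : ℝ) < 1)
    (hB : ∀ e, (Finset.univ.filter fun c => e ∈ edgesIn (B c)).card ≤ M)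
    (hM : 1 - (p : ℝ) ≤ (1 - p0) * (1 - ε) ^ M) :
    ∃ q : Lab d κ → unitInterval, (∀ e, q (e, none) = p0) ∧
      (∀ c, ∀ e ∈ edgesIn (B c), q (e, some (some c)) = ε) ∧
      (bern q).map merge = bern fun _ => p := by
  have h1 : 0 < 1 - (p0 : ℝ) := by linarith
  have h2 : 0 < 1 - (ε : ℝ) := by linarith
  have h3 : 1 - (ε : ℝ) ≤ 1 := by linarith [ε.2.1]
  have hm : ∀ e, 1 - (p : ℝ) ≤
      (1 - p0) * (1 - ε) ^ (Finset.univ.filter fun c => e ∈ edgesIn (B c)).card := fun e =>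
    hM.trans (by gcongr (1 - (p0 : ℝ)) * ?_; exact pow_le_pow_of_le_one h2.le h3 (hB e))
  have hr : ∀ e, (1 - (1 - (p : ℝ)) /
      ((1 - p0) * (1 - ε) ^ (Finset.univ.filter fun c => e ∈ edgesIn (B c)).card)) ∈
      Set.Icc (0 : ℝ) 1 := by
    intro e
    constructor
    · rw [sub_nonneg, div_le_one (by positivity)]
      exact hm e
    · rw [sub_le_self_iff]
      have := p.2.2
      exact div_nonneg (by linarith) (by positivity)
  refine ⟨fun l => match l with
    | (_, none) => p0
    | (e, some none) => ⟨_, hr e⟩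
    | (e, some (some c)) => if e ∈ edgesIn (B c) then ε else 0, fun _ => rfl,
    fun c e he => by simp [he], ?_⟩
  refine bern_map_merge _ _ fun e => ?_
  rw [Fintype.prod_option, Fintype.prod_option]
  have : ∀ c : κ, (1 - ((if e ∈ edgesIn (B c) then ε else 0 : unitInterval) : ℝ)) =
      if e ∈ edgesIn (B c) then 1 - (ε : ℝ) else 1 := by
    intro c; split_ifs <;> simp
  simp only [this]
  rw [Finset.prod_ite, Finset.prod_const, Finset.prod_const_one, mul_one]
  field_simp
  ring

/-- The segment of length `s` from `w` in direction `j`. -/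
def seg (w : Zd d) (j : Fin d) (s : ℕ) : Set (Zd d) :=
  {x | ∃ t : ℕ, t ≤ s ∧ x = Function.update w j (w j + t)}

lemma seg_latAdj (w : Zd d) (j : Fin d) (t : ℕ) :
    latAdj (Function.update w j (w j + t)) (Function.update w j (w j + (t + 1 : ℕ))) := by
  have := latAdj_update (Function.update w j (w j + t)) j 1 (.inl rfl)
  simpa [add_assoc] using this

lemma seg_path {r : Zd d → Zd d → Prop} (w : Zd d) (j : Fin d) (s : ℕ)
    (h : ∀ t < s, r (Function.update w j (w j + t)) (Function.update w j (w j + (t + 1 : ℕ)))) :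
    ∀ t ≤ s, ReflTransGen (restr r (seg w j s)) w (Function.update w j (w j + t)) := by
  intro t ht
  induction t with
  | zero => simp; exact .refl
  | succ t ih =>
    exact (ih (by omega)).tail ⟨h t (by omega), ⟨t, by omega, rfl⟩, ⟨t + 1, ht, rfl⟩⟩

lemma connLat_seg (w : Zd d) (j : Fin d) (s : ℕ) : ConnLat (seg w j s) := by
  have key := seg_path (r := latAdj) w j s fun t _ => seg_latAdj w j t
  rintro x ⟨t, ht, rfl⟩ y ⟨t', ht', rfl⟩
  exact (rtg_symm restr_latAdj_symm (key t ht)).trans (key t' ht')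

lemma bern_all_true {ι : Type*} (q : ι → unitInterval) (E : Finset ι) (u : unitInterval)
    (h : ∀ i ∈ E, q i = u) : (bern q).real {b | ∀ i ∈ E, b i = true} = (u : ℝ) ^ E.card := by
  have := bern_cyl q E fun _ => true
  rw [measureReal_def, this, ENNReal.toReal_prod, ← Finset.prod_const]
  refine Finset.prod_congr rfl fun i hi => ?_
  rw [h i hi]
  simp [bw, u.2.1]

/-- The centre of the coarse cell `v`. -/
def cellPt (o : Zd d) (σ : Fin d → ℤˣ) (L : ℕ) (v : Zd d) : Zd d := fun l => o l + L * σ l * v l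

lemma cellPt_dst (o : Zd d) (σ : Fin d → ℤˣ) (L : ℕ) (u v : Zd d) (m : ℕ) (h : dst u v ≤ m) :
    dst (cellPt o σ L u) (cellPt o σ L v) ≤ m * L := by
  rw [dst_le] at h ⊢
  intro i
  have : cellPt o σ L u i - cellPt o σ L v i = L * (σ i * (u i - v i)) := by
    simp only [cellPt]; ring
  rw [this, abs_mul, abs_units_mul, Nat.abs_cast]
  have := h i
  push_cast
  nlinarith [Int.natCast_nonneg L]

lemma cellPt_dst_le (o : Zd d) (σ : Fin d → ℤˣ) (L : ℕ) (hL : 0 < L) (u v : Zd d) (m : ℕ)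
    (h : dst (cellPt o σ L u) (cellPt o σ L v) ≤ m * L) : dst u v ≤ m := by
  rw [dst_le] at h ⊢
  intro i
  have e : cellPt o σ L u i - cellPt o σ L v i = L * (σ i * (u i - v i)) := by
    simp only [cellPt]; ring
  have h := h i
  rw [e, abs_mul, abs_units_mul, Nat.abs_cast] at h
  push_cast at h
  have : (0 : ℤ) < L := by exact_mod_cast hL
  nlinarith

lemma ncard_ball (x : Zd d) (m : ℕ) : (ball x m).ncard = (2 * m + 1) ^ d := by
  rw [ball_eq_Icc, ← Finset.coe_Icc, Set.ncard_coe_finset, Pi.card_Icc]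
  simp only [Int.card_Icc]
  rw [Finset.prod_congr rfl (g := fun _ => 2 * m + 1) (fun i _ => by omega)]
  simp

end strip

section strip

variable {d : ℕ}

lemma exists_small_eps {p0 p : unitInterval} (hlt : (p0 : ℝ) < p) (M : ℕ) :
    ∃ ε : unitInterval, (0 : ℝ) < ε ∧ (ε : ℝ) < 1 ∧ 1 - (p : ℝ) ≤ (1 - p0) * (1 - ε) ^ M := by
  have hp0 := p0.2.1
  have hp1 := p.2.2
  have hM : (0 : ℝ) < (M + 2 : ℕ) := by positivity
  have hM2 : (2 : ℝ) ≤ (M + 2 : ℕ) := by push_cast; linarith [Nat.cast_nonneg (α := ℝ) M]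
  set e : ℝ := (p - p0) / (M + 2 : ℕ) with he
  have he0 : 0 < e := div_pos (by linarith) hM
  have hee : (M + 2 : ℕ) * e = p - p0 := by rw [he]; field_simp
  have he1 : e < 1 := by
    nlinarith
  refine ⟨⟨e, he0.le, he1.le⟩, he0, he1, ?_⟩
  have hb := one_add_mul_le_pow (a := -e) (by linarith) M
  have h2 : (M : ℝ) * e ≤ p - p0 := by rw [← hee]; push_cast; nlinarith
  have h3 : 1 - ((p : ℝ) - p0) ≤ (1 - e) ^ M := by
    have : (1 + -e) = 1 - e := by ring
    rw [this] at hb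
    linarith
  have h4 : (1 - (p0 : ℝ)) * (1 - ((p : ℝ) - p0)) ≤ (1 - p0) * (1 - e) ^ M := by
    apply mul_le_mul_of_nonneg_left h3; linarith
  refine le_trans ?_ h4
  nlinarith

lemma strip_core [NeZero d] {p0 p : unitInterval} (hp0 : (0 : ℝ) < p0) (hlt : (p0 : ℝ) < p)
    (h : Perc d p0) :
    ∃ L n ρ : ℕ, 0 < L ∧ 2 ≤ ρ ∧ ∀ (N : Fin d → ℕ) (j : Fin d) (σ : Fin d → ℤˣ) (w : Zd d) (s : ℕ)
      (R T : Set (Zd d)), R.Finite → 2 * n ≤ s →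
      ((rectN N).card : ℝ) * (1 / 8) ^ (N j + 1) ≤ 1 / 4 →
      (∀ v ∈ rectN N, ball (cellPt (Function.update w j (w j + s)) σ L v) (ρ * L) ⊆ R) →
      (∀ v ∈ tgtN j N, ball (cellPt (Function.update w j (w j + s)) σ L v) (2 * L) ⊆ T) →
      (p0 : ℝ) ^ s / 2 ≤ Pr p {ω | SConn ω (R ∪ seg w j s) {w} T} := by
  classical
  have hd : 0 < d := Nat.pos_of_ne_zero (NeZero.ne d)
  have hp01 : (p0 : ℝ) < 1 := hlt.trans_le p.2.2
  set η : ℝ := 1 / 8 / 2 ^ (3 ^ d + 1) with hη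
  have hη0 : 0 < η := by positivity
  have hη8 : η * 2 ^ (3 ^ d + 1) ≤ 1 / 8 := by rw [hη]; field_simp; rfl
  have hηle : η ≤ 1 := by
    have : (1 : ℝ) ≤ 2 ^ (3 ^ d + 1) := one_le_pow₀ (by norm_num)
    nlinarith
  set η1 : ℝ := η / (6 * d : ℕ) with hη1
  have hd6 : (0 : ℝ) < (6 * d : ℕ) := by positivity
  have hη10 : 0 < η1 := by positivity
  have hηη : ((6 * d : ℕ) : ℝ) * η1 ≤ η := by rw [hη1]; field_simp; rfl
  set ρ := 3 * d + 2 with hρ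
  set M := (2 * (2 * ρ) + 1) ^ d * (6 * d) with hM
  obtain ⟨ε, hε0, hε1, hεM⟩ := exists_small_eps hlt M
  obtain ⟨J, hJ⟩ := exists_pow_lt_of_lt_one (half_pos hη10) (show 1 - (ε : ℝ) < 1 by linarith)
  have hpJ : 0 < (1 - (p0 : ℝ)) ^ J := pow_pos (by linarith) _
  obtain ⟨n, L0, hseed⟩ := seed_estimate hp0 h (η := η1 / 2 * (1 - (p0 : ℝ)) ^ J) (by positivity)
  set L := max L0 (max (2 * d * n) (max n 1)) with hL
  refine ⟨L, n, ρ, by omega, by omega, ?_⟩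
  intro N j σ w s R T hR hs hN hRb hTb
  set o := Function.update w j (w j + s) with ho
  set z := cellPt o σ L with hz
  let κ := ↥(rectN N) × Fin (6 * d)
  let B : κ → Set (Zd d) := fun c => ball (z c.1) (ρ * L)
  have hBM : ∀ e, (Finset.univ.filter fun c => e ∈ edgesIn (B c)).card ≤ M := by
    intro e
    obtain ⟨x, hx⟩ : ∃ x, x ∈ e := by
      induction e with | _ a b => exact ⟨a, by simp⟩
    by_cases hne : (Finset.univ.filter fun c => e ∈ edgesIn (B c)).Nonempty
    · obtain ⟨c0, hc0⟩ := hne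
      have hc0 := (Finset.mem_filter.1 hc0).2 x hx
      have key : (Finset.univ.filter fun c => e ∈ edgesIn (B c)).image
          (fun c : κ => ((c.1 : Zd d), c.2)) ⊆
          (ball_finite (c0.1 : Zd d) (2 * ρ)).toFinset ×ˢ (Finset.univ : Finset (Fin (6 * d))) := by
        intro y hy
        obtain ⟨c, hc, rfl⟩ := Finset.mem_image.1 hy
        have hc := (Finset.mem_filter.1 hc).2 x hx
        rw [Finset.mem_product]
        refine ⟨?_, Finset.mem_univ _⟩
        rw [Set.Finite.mem_toFinset]
        refine cellPt_dst_le o σ L (by omega) _ _ _ ?_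
        have h1 : dst x (z c.1) ≤ ρ * L := hc
        have h2 : dst x (z c0.1) ≤ ρ * L := hc0
        have h3 := dst_triangle (z c.1) x (z c0.1)
        rw [dst_comm] at h1
        calc _ ≤ ρ * L + ρ * L := by exact h3.trans (add_le_add h1 h2)
          _ = 2 * ρ * L := by ring
      have hcard := Finset.card_le_card key
      rw [Finset.card_image_of_injective _ (fun a b hab => by
          simp only [Prod.mk.injEq] at hab
          exact Prod.ext (Subtype.ext hab.1) hab.2), Finset.card_product, Finset.card_univ,
        Fintype.card_fin, ← Set.ncard_eq_toFinset_card _ (ball_finite _ _), ncard_ball] at hcard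
      exact hcard
    · rw [Finset.not_nonempty_iff_eq_empty.1 hne]; simp
  obtain ⟨q, hq0, hqB, hqm⟩ := exists_merge B p0 p ε M hp01 hε1 hBM hεM
  let cols : Zd d → Finset κ := fun v => Finset.univ.filter fun c => (c.1 : Zd d) = v
  have hcols : ∀ v c, c ∈ cols v ↔ (c.1 : Zd d) = v := fun v c => by simp [cols]
  have hgood : ∀ v ∈ rectN N, ∀ c ∈ cols v, GoodColor q (z v) L n ρ η1 c := by
    intro v hv c hc K x hK hx hy hsub i σ'
    rw [hcols] at hc
    have hB' : ball x (L + n) ⊆ B c := by rw [← hc] at hsub; exact hsub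
    refine (micro q p0 ε hq0 hp01 c (ball_finite _ _)
      (fun e he => hqB c e (edgesIn_mono hB' he)) K (Tgt x i σ' L n) J
      (hseed L (by omega) K x hK hx hy i σ')).trans ?_
    have : ((1 - (p0 : ℝ)) ^ J)⁻¹ * (η1 / 2 * (1 - (p0 : ℝ)) ^ J) = η1 / 2 := by
      field_simp
    rw [this]
    linarith
  have hcoarse := coarse q hR (rectN N) (tgtN j N) z cols L n ρ (T := T) (by omega) (by omega) le_rfl hRb
    (fun u v huv => by simpa using cellPt_dst o σ L u v 1 huv.dst_le) hTb hη10.le hη0 hηle hηη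
    (fun v hv => by
      have : cols v = (Finset.univ : Finset (Fin (6 * d))).image
          (fun i => ((⟨v, hv⟩, i) : κ)) := by
        ext c
        rw [hcols]
        simp only [Finset.mem_image, Finset.mem_univ, true_and]
        constructor
        · rintro rfl; exact ⟨c.2, rfl⟩
        · rintro ⟨i, rfl⟩; rfl
      rw [this, Finset.card_image_of_injective _ (fun a b hab => (Prod.mk.inj hab).2)]
      simp)
    (fun u _ v _ huv => by
      rw [Finset.disjoint_left]
      intro c hc hc'
      rw [hcols] at hc hc'
      exact huv (hc.symm.trans hc'))
    hgood (blockers j N) 0 (fun A D hA _ _ => exists_blocker j N A D hA) (seg w j s)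
    ⟨w, ⟨0, by omega, by simp⟩, o, ⟨s, le_rfl, rfl⟩, by
      have := abs_le_dst w o j
      have e : w j - o j = -(s : ℤ) := by simp [ho]
      rw [e, abs_neg, Nat.abs_cast] at this
      omega⟩
    _ {0} ∅ (by simp [mem_rectN]) (by simp) (by simp) (by simp) rfl (seg w j s) subset_rfl
    (connLat_seg w j s)
    (by
      intro v hv
      rw [Finset.mem_singleton] at hv
      subst hv
      refine ⟨o, ⟨s, le_rfl, rfl⟩, ?_⟩
      have : z 0 = o := by ext l; simp [hz, cellPt]
      rw [this]; exact self_mem_ball _ _)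
  have hhalf : val q R T (seg w j s) Finset.univ ≤ 1 / 2 := by
    refine (val_anti q R T _ (Finset.subset_univ _)).trans (hcoarse.trans ?_)
    refine le_trans ?_ (sum_blockers j N hη0.le hη8 hN)
    simp only [obsW, Finset.sdiff_empty]
    exact Finset.sum_le_sum_of_subset_of_nonneg (Finset.filter_subset _ _) fun _ _ _ => by positivity
  set E : Finset (Lab d κ) := (Finset.range s).image fun t : ℕ =>
    (s(Function.update w j (w j + t), Function.update w j (w j + (t + 1 : ℕ))), none) with hE
  have hEcard : E.card ≤ s := Finset.card_image_le.trans (by simp)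
  have hEp : (p0 : ℝ) ^ s ≤ (bern q).real {b | ∀ i ∈ E, b i = true} := by
    rw [bern_all_true q E p0 (by
      intro i hi
      obtain ⟨t, -, rfl⟩ := Finset.mem_image.1 hi
      exact hq0 _)]
    exact pow_le_pow_of_le_one hp0.le hp01.le hEcard
  have hind := bern_inter q (S := (E : Set (Lab d κ))) (T := failLab R (seg w j s) Finset.univ)
    (A := {b | ∀ i ∈ E, b i = true}) (B := (failSet R T (seg w j s) Finset.univ)ᶜ)
    (fun b b' hb => forall₂_congr fun i hi => by rw [hb i hi])
    (detBy_failSet _ _ _ _).compl E.finite_toSet (failLab_finite hR _ _) (by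
      rw [Set.disjoint_left]
      intro l hl hl'
      obtain ⟨t, ht, rfl⟩ := Finset.mem_image.1 hl
      rcases hl'.2 with ⟨-, h2⟩ | ⟨c, -, h2⟩
      · exact h2 _ (Sym2.mem_mk_left _ _) ⟨t, (Finset.mem_range.1 ht).le, rfl⟩
      · cases h2)
  rw [bern_compl q (detBy_failSet _ _ _ _) (failLab_finite hR _ _)] at hind
  have hsegfin : (seg w j s).Finite := by
    refine (Set.finite_range fun t : Fin (s + 1) => Function.update w j (w j + (t : ℕ))).subset ?_
    rintro x ⟨t, ht, rfl⟩
    exact ⟨⟨t, by omega⟩, rfl⟩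
  have hmm : Measurable (merge : (Lab d κ → Bool) → Config d) := by
    refine measurable_pi_lambda _ fun e => ?_
    refine measurable_to_bool ?_
    have : (fun b : Lab d κ → Bool => merge b e) ⁻¹' {true} =
        ⋃ c, {b : Lab d κ → Bool | b (e, c) = true} := by
      ext b; simp [merge]
    rw [this]
    exact MeasurableSet.iUnion fun c => (measurable_pi_apply _) (measurableSet_singleton _)
  have hdet := detBy_sconn (R ∪ seg w j s) {w} T
  rw [Pr, ← hqm, map_measureReal_apply hmm
    (hdet.measurableSet (edgesIn_finite (hR.union hsegfin)))]
  have hval : (1 : ℝ) / 2 ≤ 1 - (bern q).real (failSet R T (seg w j s) Finset.univ) := by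
    have := hhalf
    rw [val] at this
    linarith
  calc (p0 : ℝ) ^ s / 2 = (p0 : ℝ) ^ s * (1 / 2) := by ring
    _ ≤ (bern q).real {b | ∀ i ∈ E, b i = true} *
        (1 - (bern q).real (failSet R T (seg w j s) Finset.univ)) :=
        mul_le_mul hEp hval (by norm_num) measureReal_nonneg
    _ ≤ _ := by
        rw [← hind]
        refine measureReal_mono ?_ (measure_ne_top _ _)
        rintro b ⟨hb1, hb2⟩
        have hb2 : SConn (env b (seg w j s) Finset.univ) R (seg w j s) T := by
          by_contra hcon; exact hb2 hcon
        obtain ⟨x, ⟨t, ht, rfl⟩, y, hy, hxy⟩ := hb2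
        refine ⟨w, rfl, y, hy, Conn.trans (y := Function.update w j (w j + t)) ?_ ?_⟩
        · have := seg_path (r := openAdj (merge b)) w j s (fun t ht => ⟨seg_latAdj w j t, by
            simp only [merge, decide_eq_true_eq]
            exact ⟨none, hb1 _ (Finset.mem_image.2 ⟨t, Finset.mem_range.2 ht, rfl⟩)⟩⟩) t ht
          exact rtg_mono (restr_mono (fun _ _ _ _ h => h) Set.subset_union_right) this
        · refine hxy.mono Set.subset_union_left fun a _ b' _ hab => ?_
          rw [env_eq_true] at hab
          simp only [merge, decide_eq_true_eq]
          rcases hab with ⟨-, h⟩ | ⟨c, -, h⟩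
          · exact ⟨_, h⟩
          · exact ⟨_, h⟩

end strip

section strip

variable {d : ℕ}

/-- The slab used to travel from `w` to the column above `y`. -/
def slab (w y : Zd d) (j : Fin d) (h : ℕ) : Set (Zd d) :=
  {x | w j < x j ∧ x j ≤ w j + h ∧
    ∀ l, l ≠ j → min (w l) (y l) - h ≤ x l ∧ x l ≤ max (w l) (y l) + h}

/-- The part of the slab near the column above `y`. -/
def window (w y : Zd d) (j : Fin d) (h : ℕ) : Set (Zd d) :=
  {x | w j < x j ∧ x j ≤ w j + h ∧ ∀ l, l ≠ j → |x l - y l| ≤ h}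

lemma slab_finite (w y : Zd d) (j : Fin d) (h : ℕ) : (slab w y j h).Finite := by
  refine (Set.finite_Icc (fun i => min (w i) (y i) - h) (fun i => max (w i) (y i) + h)).subset
    fun x hx => ⟨fun i => ?_, fun i => ?_⟩ <;> by_cases hi : i = j
  · subst hi; have := hx.1; simp only; omega
  · exact (hx.2.2 i hi).1
  · subst hi; have := hx.2.1; simp only; omega
  · exact (hx.2.2 i hi).2

lemma poly_mul_exp_small (L d : ℕ) : ∃ m0 : ℕ, ∀ m ≥ m0, ∀ h : ℕ, h ≤ 2 * L * m →
    ((12 * h ^ 2 + 1 : ℕ) : ℝ) ^ d * (1 / 8) ^ m ≤ 1 / 4 := by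
  have h1 := tendsto_pow_const_mul_const_pow_of_abs_lt_one (2 * d) (r := 1 / 8)
    (by rw [abs_of_pos] <;> norm_num)
  have h2 := h1.const_mul ((48 * (L : ℝ) ^ 2 + 1) ^ d)
  rw [mul_zero] at h2
  obtain ⟨m0, hm0⟩ := Filter.eventually_atTop.1 (h2.eventually_le_const (show (0 : ℝ) < 1 / 4 by norm_num))
  refine ⟨m0 + 1, fun m hm h hh => (le_trans ?_ (hm0 m (by omega)))⟩
  rw [← mul_assoc, pow_mul, ← mul_pow]
  have hh' : (h : ℝ) ≤ 2 * L * m := by exact_mod_cast hh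
  have hm1 : (1 : ℝ) ≤ m := by exact_mod_cast (by omega : 1 ≤ m)
  gcongr
  push_cast
  have : (h : ℝ) ^ 2 ≤ (2 * L * m) ^ 2 := by gcongr
  nlinarith

lemma strip [NeZero d] {p0 p : unitInterval} (hp0 : (0 : ℝ) < p0) (hlt : (p0 : ℝ) < p)
    (hP : Perc d p0) :
    ∃ c > (0 : ℝ), ∃ h0 : ℕ, ∀ h ≥ h0, ∀ (j : Fin d) (w y : Zd d),
      (∀ l, l ≠ j → |y l - w l| ≤ 12 * (h : ℤ) ^ 2) →
      c ≤ Pr p {ω | SConn ω ({w} ∪ slab w y j h) {w} (window w y j h)} := by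
  obtain ⟨L, n, ρ, hL, hρ2, hcore⟩ := strip_core hp0 hlt hP
  obtain ⟨m0, hm0⟩ := poly_mul_exp_small L d
  set s := max (ρ * L + 1) (2 * n) with hs
  refine ⟨(p0 : ℝ) ^ s / 2, by positivity, 2 * (s + ρ * L) + 2 * L * m0 + 3 * L, ?_⟩
  intro h hh j w y hy
  have hh1 : 2 * (s + ρ * L) ≤ h := by omega
  have hh2 : 2 * L * m0 ≤ h := by omega
  have hh3 : 3 * L ≤ h := by omega
  have hsρ : ρ * L + 1 ≤ s := by omega
  have hLd : ∀ a : ℕ, L * (a / L) ≤ a ∧ a < L * (a / L) + L := fun a =>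
    ⟨Nat.mul_div_le a L, by have := Nat.lt_mul_div_succ a hL; rw [mul_add] at this; omega⟩
  set N : Fin d → ℕ := fun l => if l = j then (h - (s + ρ * L)) / L else (y l - w l).natAbs / L
    with hN
  have hNj : N j = (h - (s + ρ * L)) / L := by simp [hN]
  have hNl : ∀ l, l ≠ j → N l = (y l - w l).natAbs / L := fun l hl => by simp [hN, hl]
  have hsg : ∀ l, ∃ u : ℤˣ, (l = j → u = 1) ∧ (l ≠ j → (u : ℤ) * (y l - w l) = |y l - w l|) := by
    intro l
    obtain ⟨u, hu⟩ := exists_sign (y l - w l)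
    by_cases hl : l = j
    · exact ⟨1, by simp [hl]⟩
    · exact ⟨-u, by simp [hl], fun _ => by push_cast; rw [neg_mul, hu, neg_neg]⟩
  choose σ hσj hσl using hsg
  have hσ1 : σ j = 1 := hσj j rfl
  set o := Function.update w j (w j + s) with ho
  have hoj : o j = w j + s := by simp [ho]
  have hol : ∀ l, l ≠ j → o l = w l := fun l hl => by simp [ho, hl]
  have hzj : ∀ v ∈ rectN N, ∀ x ∈ ball (cellPt o σ L v) (ρ * L),
      w j < x j ∧ x j ≤ w j + h := by
    intro v hv x hx
    rw [mem_ball] at hx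
    have hx := abs_le.1 (hx j)
    have hv := mem_rectN.1 hv j
    rw [hNj] at hv
    simp only [cellPt, hoj, hσ1, Units.val_one, mul_one] at hx
    have h1 := (hLd (h - (s + ρ * L))).1
    have h2 : (L : ℤ) * v j ≤ L * ((h - (s + ρ * L)) / L : ℕ) := by
      apply mul_le_mul_of_nonneg_left hv.2; positivity
    have h3 : 0 ≤ (L : ℤ) * v j := mul_nonneg (by positivity) hv.1
    zify [show s + ρ * L ≤ h by omega] at h1 h2
    push_cast at *
    constructor <;> linarith
  have hzl : ∀ v ∈ rectN N, ∀ l, l ≠ j → ∀ x ∈ ball (cellPt o σ L v) (ρ * L),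
      min (w l) (y l) - h ≤ x l ∧ x l ≤ max (w l) (y l) + h := by
    intro v hv l hl x hx
    rw [mem_ball] at hx
    have hx := abs_le.1 (hx l)
    have hv := mem_rectN.1 hv l
    rw [hNl l hl] at hv
    simp only [cellPt, hol l hl] at hx
    have h1 := (hLd (y l - w l).natAbs).1
    have h2 : (L : ℤ) * v l ≤ L * ((y l - w l).natAbs / L : ℕ) := by
      apply mul_le_mul_of_nonneg_left hv.2; positivity
    have h3 : 0 ≤ (L : ℤ) * v l := mul_nonneg (by positivity) hv.1
    have h4 := hσl l hl
    have h5 : ((ρ * L : ℕ) : ℤ) ≤ h := by exact_mod_cast (by omega : ρ * L ≤ h)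
    have h6 : (L : ℤ) * ((y l - w l).natAbs / L : ℕ) ≤ |y l - w l| := by
      rw [Int.abs_eq_natAbs]; exact_mod_cast h1
    rcases Int.units_eq_one_or (σ l) with hu | hu <;> rw [hu] at hx h4
    · simp only [Units.val_one, mul_one, one_mul] at hx h4
      constructor <;> omega
    · simp only [Units.val_neg, Units.val_one, mul_neg, mul_one, neg_mul, one_mul] at hx h4
      constructor <;> omega
  have htg : ∀ v ∈ tgtN j N, ball (cellPt o σ L v) (2 * L) ⊆ window w y j h := by
    intro v hv x hx
    have hv' := Finset.mem_filter.1 hv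
    have hx' := ball_subset (x := cellPt o σ L v) (y := cellPt o σ L v) (m := 2 * L) (n := ρ * L)
      (by rw [dst_self]; nlinarith) hx
    obtain ⟨h1, h2⟩ := hzj v hv'.1 x hx'
    refine ⟨h1, h2, fun l hl => ?_⟩
    rw [mem_ball] at hx
    have hx := abs_le.1 (hx l)
    have hv := hv'.2 l hl
    rw [hNl l hl] at hv
    simp only [cellPt, hol l hl, hv] at hx
    have h3 := hLd (y l - w l).natAbs
    have h4 := hσl l hl
    have h6 : (L : ℤ) * ((y l - w l).natAbs / L : ℕ) ≤ |y l - w l| := by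
      rw [Int.abs_eq_natAbs]; exact_mod_cast h3.1
    have h7 : |y l - w l| < (L : ℤ) * ((y l - w l).natAbs / L : ℕ) + L := by
      rw [Int.abs_eq_natAbs]; exact_mod_cast h3.2
    rw [abs_le]
    rcases Int.units_eq_one_or (σ l) with hu | hu <;> rw [hu] at hx h4
    · simp only [Units.val_one, mul_one, one_mul] at hx h4
      constructor <;> omega
    · simp only [Units.val_neg, Units.val_one, mul_neg, mul_one, neg_mul, one_mul] at hx h4
      constructor <;> omega
  have hcard : ((rectN N).card : ℝ) * (1 / 8) ^ (N j + 1) ≤ 1 / 4 := by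
    have hh' : h ≤ 2 * L * (N j + 1) := by
      have := (hLd (h - (s + ρ * L))).2
      rw [hNj]
      have e : 2 * L * ((h - (s + ρ * L)) / L + 1) = 2 * (L * ((h - (s + ρ * L)) / L) + L) := by ring
      rw [e]; omega
    refine le_trans ?_ (hm0 (N j + 1) ?_ h hh')
    · gcongr
      rw [rectN, Pi.card_Icc]
      have : ∀ l ∈ Finset.univ, (Finset.Icc ((0 : Zd d) l) (N l : ℤ)).card ≤ 12 * h ^ 2 + 1 := by
        intro l _
        simp only [Pi.zero_apply, Int.card_Icc]
        have : N l ≤ 12 * h ^ 2 := by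
          by_cases hl : l = j
          · subst hl
            rw [hNj]
            calc _ ≤ h - (s + ρ * L) := Nat.div_le_self _ _
              _ ≤ h := Nat.sub_le _ _
              _ ≤ 12 * h ^ 2 := by nlinarith
          · rw [hNl l hl]
            refine (Nat.div_le_self _ _).trans ?_
            have := hy l hl
            rw [Int.abs_eq_natAbs] at this
            exact_mod_cast this
        omega
      have := Finset.prod_le_prod' this
      simpa using (by exact_mod_cast this :
        ((∏ l, (Finset.Icc ((0 : Zd d) l) (N l : ℤ)).card : ℕ) : ℝ) ≤ ((∏ _l : Fin d, (12 * h ^ 2 + 1) : ℕ) : ℝ))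
    · by_contra hlt
      have : 2 * L * (N j + 1) < 2 * L * m0 := Nat.mul_lt_mul_of_pos_left (by omega) (by omega)
      omega
  refine (hcore N j σ w s (slab w y j h) (window w y j h) (slab_finite w y j h) (le_max_right _ _)
    hcard (fun v hv x hx => ⟨(hzj v hv x hx).1, (hzj v hv x hx).2, fun l hl => hzl v hv l hl x hx⟩)
    htg).trans (Pr_mono p ?_)
  rintro ω ⟨x, hx, y', hy', hc⟩
  refine ⟨x, hx, y', hy', hc.mono_set ?_⟩
  rintro z (hz | ⟨t, ht, rfl⟩)
  · exact .inr hz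
  · rcases Nat.eq_zero_or_pos t with rfl | ht0
    · left; simp
    · right
      refine ⟨by simpa using ht0, by simp; omega, fun l hl => ?_⟩
      simp only [Function.update_of_ne hl]
      omega

end strip

lemma bern_tip {ι κ : Type*} [Countable κ] (q : ι → unitInterval) (t : Finset κ)
    {A A' : Set (ι → Bool)} {S : Set ι} (G F : κ → Set (ι → Bool)) (T : κ → Set ι) {c : ℝ}
    (hS : S.Finite) (hA : DetBy S A) (hG : ∀ k, DetBy S (G k))
    (hF : ∀ k ∈ t, DetBy (T k) (F k)) (hT : ∀ k ∈ t, (T k).Finite)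
    (hd : ∀ k ∈ t, Disjoint S (T k)) (hc0 : 0 ≤ c) (hc : ∀ k ∈ t, (bern q).real (F k) ≤ c)
    (hAG : A ⊆ ⋃ k ∈ t, G k) (hA' : A' ⊆ A) (hAF : ∀ ω ∈ A', ∀ k ∈ t, ω ∈ G k → ω ∈ F k) :
    (bern q).real A' ≤ c * (bern q).real A := by
  classical
  obtain ⟨f, hf⟩ := exists_injective_nat κ
  set E : κ → Set (ι → Bool) := fun k =>
    (A ∩ G k) ∩ ⋂ k' ∈ t.filter fun k' => f k' < f k, (G k')ᶜ with hE
  have hEdet : ∀ k, DetBy S (E k) := fun k => (hA.inter (hG k)).inter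
    (DetBy.iInter fun k' => DetBy.iInter fun _ => (hG k').compl)
  have h1 := bern_le_sum q t E F (fun _ => S) T (fun _ => c) (A := A') (fun k _ => hEdet k)
    (fun _ _ => hS) hF hT hd hc (by
      intro ω hω
      obtain ⟨k0, hk0⟩ := Set.mem_iUnion.1 (hAG (hA' hω))
      obtain ⟨hk0, hωk0⟩ := Set.mem_iUnion.1 hk0
      obtain ⟨k, hk, hmin⟩ := (t.filter fun k => ω ∈ G k).exists_min_image f
        ⟨k0, Finset.mem_filter.2 ⟨hk0, hωk0⟩⟩
      rw [Finset.mem_filter] at hk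
      refine Set.mem_iUnion₂.2 ⟨k, hk.1, ⟨⟨hA' hω, hk.2⟩, ?_⟩, hAF ω hω k hk.1 hk.2⟩
      refine Set.mem_iInter₂.2 fun k' hk' hG' => ?_
      rw [Finset.mem_filter] at hk'
      exact absurd (hmin k' (Finset.mem_filter.2 ⟨hk'.1, hG'⟩)) (not_le.2 hk'.2))
  have h2 := bern_sum_le q t E (fun _ => S) (A := A) (fun k _ => hEdet k) (fun _ _ => hS) (by
      intro k hk l hl hkl
      rw [Set.disjoint_left]
      intro ω h h'
      rcases lt_or_gt_of_ne (hf.ne hkl) with hlt | hlt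
      · exact (Set.mem_iInter₂.1 h'.2 k (Finset.mem_filter.2 ⟨hk, hlt⟩)) h.1.2
      · exact (Set.mem_iInter₂.1 h.2 l (Finset.mem_filter.2 ⟨hl, hlt⟩)) h'.1.2)
    (fun k _ ω h => h.1.1)
  rw [← Finset.sum_mul, mul_comm] at h1
  exact h1.trans (mul_le_mul_of_nonneg_left h2 hc0)

section annulus

variable {d : ℕ}

lemma detBy_sconn_off_diag (R S T : Set (Zd d)) :
    DetBy {e ∈ edgesIn R | ¬ e.IsDiag} {ω | SConn ω R S T} := by
  intro ω ω' h
  refine exists_congr fun x => and_congr_right fun _ => exists_congr fun y =>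
    and_congr_right fun _ => ?_
  have key : ∀ ω ω' : Config d, (∀ e ∈ {e ∈ edgesIn R | ¬ e.IsDiag}, ω e = ω' e) →
      Conn ω R x y → Conn ω' R x y := by
    intro ω ω' h hc
    refine rtg_mono (restr_mono (fun a ha b hb hab => ⟨hab.1, ?_⟩) subset_rfl) hc
    rw [← h s(a, b) ⟨mem_edgesIn.2 ⟨ha, hb⟩, by
      rw [Sym2.mk_isDiag_iff]; exact hab.1.ne⟩]
    exact hab.2
  exact ⟨key ω ω' h, key ω' ω fun e he => (h e he).symm⟩

lemma openAdj_le {ω : Config d} {a b : Zd d} (h : openAdj ω a b) (j : Fin d) : b j ≤ a j + 1 := by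
  have := h.1.abs_le j
  rw [abs_le] at this
  omega

section hit

variable {u : Zd d} {m s h : ℕ} {j : Fin d} {α β : ℤ} {y z : Zd d}

/-- The window around the line through `y` in direction `j`. -/
def hitWin (j : Fin d) (α β : ℤ) (y : Zd d) (h : ℕ) : Set (Zd d) :=
  {x | α ≤ x j ∧ x j ≤ α + β ∧ ∀ l, l ≠ j → |x l - y l| ≤ h}

/-- The cluster of `z` crosses but does not hit the window. -/
def missSet (u : Zd d) (m s h : ℕ) (j : Fin d) (α β : ℤ) (y z : Zd d) : Set (Config d) :=
  {ω | SConn ω (ball u m) {z} {x | α + β ≤ x j} ∧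
    ¬ SConn ω (ball u (m + s)) {z} (hitWin j α β y h)}

lemma miss_bound {p : unitInterval} {c : ℝ}
    (hst : ∀ (j : Fin d) (w y : Zd d), (∀ l, l ≠ j → |y l - w l| ≤ 12 * (h : ℤ) ^ 2) →
      c ≤ Pr p {ω | SConn ω ({w} ∪ slab w y j h) {w} (window w y j h)})
    (hc1 : c ≤ 1) (hm : m ≤ 4 * h ^ 2) (hhs : h ≤ s) (hy : y ∈ ball u m) (hz : z j ≤ α)
    (hzm : z ∈ ball u m) (k : ℕ) (hk : (k : ℤ) * (h + 1) ≤ β) :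
    Pr p (missSet u m s h j α β y z) ≤ (1 - c) ^ k := by
  classical
  set lev : ℕ → ℤ := fun i => α + i * (h + 1) with hlev
  set R : ℕ → Set (Zd d) := fun i => ball u m ∩ {x | x j ≤ lev i} with hR
  set D : ℕ → Set (Zd d) := fun i => ball u (m + s) ∩ {x | x j ≤ lev i} with hD
  have hRD : ∀ i, R i ⊆ D i := fun i x hx =>
    ⟨ball_subset (by rw [dst_self]; omega) hx.1, hx.2⟩
  have hDfin : ∀ i, (D i).Finite := fun i => (ball_finite _ _).subset Set.inter_subset_left
  have hDmono : ∀ i, D i ⊆ D (i + 1) := fun i x hx => ⟨hx.1, hx.2.trans (by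
    change α + (i : ℤ) * (h + 1) ≤ α + ((i + 1 : ℕ) : ℤ) * (h + 1)
    push_cast; nlinarith)⟩
  set Fk : ℕ → Set (Config d) := fun i =>
    {ω | SConn ω (R i) {z} {x | x j = lev i ∧ x ∈ ball u m}} ∩
      {ω | ¬ SConn ω (D i) {z} (hitWin j α β y h)} with hFk
  have hFdet : ∀ i, DetBy (edgesIn (D i)) (Fk i) := fun i =>
    ((detBy_sconn (R i) {z} _).mono (edgesIn_mono (hRD i))).inter (detBy_sconn (D i) _ _).compl
  have htip : ∀ (ω : Config d) (S : Set (Zd d)) (i : ℕ), S ⊆ ball u m →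
      SConn ω S {z} {x | lev i ≤ x j} →
      SConn ω (R i) {z} {x | x j = lev i ∧ x ∈ ball u m} := by
    rintro ω S i hS ⟨z', hz', x, hx, hc⟩
    obtain rfl : z' = z := hz'
    have hzl : z' j ≤ lev i := by
      have : (0 : ℤ) ≤ i * (h + 1) := by positivity
      have h2 : lev i = α + i * (h + 1) := rfl
      omega
    by_cases hzx : z' j = lev i
    · exact ⟨z', rfl, z', ⟨hzx, hzm⟩, .refl _⟩
    · have hx : lev i ≤ x j := hx
      obtain ⟨a, b, h1, h2, h3, h4, h5, -⟩ := hc.exit (S := {x | x j < lev i})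
        (by simp only [Set.mem_ofPred_eq]; omega) (by simp only [Set.mem_ofPred_eq]; omega)
      have hb := openAdj_le h3 j
      have ha : a j < lev i := h2.2
      have hb' : ¬ b j < lev i := h5
      refine ⟨z', rfl, b, ⟨by omega, hS h4⟩, ?_⟩
      have hsub : S ∩ {x | x j < lev i} ⊆ R i := fun x hx => by
        have h6 : x j < lev i := hx.2
        exact ⟨hS hx.1, h6.le⟩
      refine (h1.mono_set hsub).trans (Conn.single h3 ?_ ?_)
      · exact hsub h2
      · exact ⟨hS h4, by simp only [Set.mem_ofPred_eq]; omega⟩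
  have hstep : ∀ i, i < k → Pr p (Fk (i + 1)) ≤ (1 - c) * Pr p (Fk i) := by
    intro i hi
    have hlevi : lev (i + 1) = lev i + (h + 1) := by simp only [hlev]; push_cast; ring
    have hlev0 : α ≤ lev i := by
      simp only [hlev]; have : (0 : ℤ) ≤ i * (h + 1) := by positivity
      omega
    have hlevk : lev i + (h + 1) ≤ α + β := by
      rw [← hlevi]; simp only [hlev]
      have : ((i + 1 : ℕ) : ℤ) * (h + 1) ≤ k * (h + 1) := by
        apply mul_le_mul_of_nonneg_right _ (by positivity); exact_mod_cast hi
      linarith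
    set tf : Finset (Zd d) := (ball_finite u m).toFinset.filter fun w => w j = lev i with htf
    have hmt : ∀ w, w ∈ tf ↔ w ∈ ball u m ∧ w j = lev i := fun w => by simp [htf]
    refine bern_tip (fun _ => p) tf (S := edgesIn (D i)) (fun w => {ω | Conn ω (R i) z w})
      (fun w => {ω | ¬ SConn ω ({w} ∪ slab w y j h) {w} (window w y j h)})
      (fun w => {e ∈ edgesIn ({w} ∪ slab w y j h) | ¬ e.IsDiag})
      (edgesIn_finite (hDfin i)) (hFdet i)
      (fun w => (detBy_conn _ _ _).mono (edgesIn_mono (hRD i)))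
      (fun w _ => (detBy_sconn_off_diag _ _ _).compl)
      (fun w _ => (edgesIn_finite ((Set.finite_singleton w).union (slab_finite _ _ _ _))).subset
        fun e he => he.1) ?_ (by linarith) ?_ ?_ ?_ ?_
    · intro w hw
      rw [hmt] at hw
      rw [Set.disjoint_left]
      intro e
      induction e with | _ a b
      rintro h1 ⟨h2, h3⟩
      rw [mem_edgesIn] at h1 h2
      have key : ∀ x, x ∈ D i → x ∈ ({w} ∪ slab w y j h : Set (Zd d)) → x = w := by
        rintro x hx (hx' | hx')
        · exact hx'
        · have h5 := hx.2
          have h6 := hx'.1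
          simp only [Set.mem_ofPred_eq] at h5
          omega
      apply h3
      rw [Sym2.mk_isDiag_iff, key a h1.1 h2.1, key b h1.2 h2.2]
    · intro w hw
      rw [hmt] at hw
      have hfin : (edgesIn ({w} ∪ slab w y j h)).Finite :=
        edgesIn_finite ((Set.finite_singleton w).union (slab_finite _ _ _ _))
      have := bern_compl (fun _ => p) (detBy_sconn ({w} ∪ slab w y j h) {w} (window w y j h)) hfin
      have h2 := hst j w y fun l _ => by
        have h1 := (mem_ball.1 hy) l
        have h2 := (mem_ball.1 hw.1) l
        have hm' : (m : ℤ) ≤ 4 * h ^ 2 := by exact_mod_cast hm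
        rw [abs_le] at *
        constructor <;> nlinarith
      rw [Pr] at h2
      change (bern fun _ => p).real {ω | SConn ω ({w} ∪ slab w y j h) {w} (window w y j h)}ᶜ ≤ 1 - c
      linarith
    · rintro ω ⟨⟨z', rfl, w, hw, hc⟩, -⟩
      exact Set.mem_iUnion₂.2 ⟨w, (hmt w).2 ⟨hw.2, hw.1⟩, hc⟩
    · rintro ω ⟨⟨z', rfl, w, hw, hc⟩, h2⟩
      refine ⟨htip ω (R (i + 1)) i Set.inter_subset_left ⟨z', rfl, w, ?_, hc⟩, fun h3 => h2 ?_⟩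
      · have := hw.1
        simp only [Set.mem_ofPred_eq]; omega
      · obtain ⟨a, ha, b, hb, hab⟩ := h3
        exact ⟨a, ha, b, hb, hab.mono_set (hDmono i)⟩
    · rintro ω ⟨-, h2⟩ w hw hzw ⟨w', rfl, x, hx, hwx⟩
      rw [hmt] at hw
      have hwD : w' ∈ D (i + 1) := hDmono i (hRD i ⟨hw.1, hw.2.le⟩)
      refine h2 ⟨z, rfl, x, ?_, ((Conn.mono_set hzw (hRD i)).mono_set (hDmono i)).trans
        (hwx.mono_set ?_)⟩
      · refine ⟨?_, ?_, hx.2.2⟩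
        · have := hx.1; omega
        · have := hx.2.1; omega
      · rintro v (hv | hv)
        · rw [hv]; exact hwD
        · refine ⟨?_, ?_⟩
          · rw [mem_ball]
            intro l
            have h1 := abs_le.1 ((mem_ball.1 hy) l)
            have h3 := abs_le.1 ((mem_ball.1 hw.1) l)
            push_cast
            rw [abs_le]
            by_cases hl : l = j
            · subst hl
              have h5 := hv.1
              have h6 := hv.2.1
              constructor <;> omega
            · have h5 := hv.2.2 l hl
              constructor <;> omega
          · have := hv.2.1
            simp only [Set.mem_ofPred_eq]; omega
  have hind : ∀ i, i ≤ k → Pr p (Fk i) ≤ (1 - c) ^ i := by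
    intro i hi
    induction i with
    | zero => simpa using Pr_le_one p _
    | succ i ih =>
      refine (hstep i hi).trans ?_
      rw [pow_succ, mul_comm]
      exact mul_le_mul_of_nonneg_right (ih (by omega)) (by linarith)
  refine (Pr_mono p ?_).trans (hind k le_rfl)
  rintro ω ⟨⟨z', rfl, x, hx, hc⟩, h2⟩
  refine ⟨htip ω _ k subset_rfl ⟨z', rfl, x, ?_, hc⟩, fun h3 => h2 ?_⟩
  · simp only [Set.mem_ofPred_eq, hlev] at hx ⊢; linarith
  · obtain ⟨a, ha, b, hb, hab⟩ := h3
    exact ⟨a, ha, b, hb, hab.mono_set Set.inter_subset_left⟩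

end hit

/-- Good event around `u` at scale `s`: any cluster of diameter at least `s` in the box of radius
`3s` comes close to every point of the box of radius `2s`. -/
def goodSet (u : Zd d) (s : ℕ) : Set (Config d) :=
  {ω | ∀ z z', Conn ω (ball u (3 * s)) z z' → s ≤ dst z z' →
    ∀ y ∈ ball u (2 * s), SConn ω (ball u (5 * s)) {z} (ball y (s / 10))}

lemma detBy_goodSet (u : Zd d) (s : ℕ) : DetBy (edgesIn (ball u (5 * s))) (goodSet u s) := by
  have key : ∀ ω ω' : Config d, (∀ e ∈ edgesIn (ball u (5 * s)), ω e = ω' e) →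
      ω ∈ goodSet u s → ω' ∈ goodSet u s := by
    intro ω ω' h hω z z' hz hd y hy
    have h1 : Conn ω (ball u (3 * s)) z z' :=
      ((detBy_conn (ball u (3 * s)) z z').mono (edgesIn_mono (ball_subset (by
        rw [dst_self]; omega))) ω ω' h).2 hz
    exact (detBy_sconn (ball u (5 * s)) {z} _ ω ω' h).1 (hω z z' h1 hd y hy)
  exact fun ω ω' h => ⟨key ω ω' h, key ω' ω fun e he => (h e he).symm⟩

lemma good_of_not_miss (hd : 2 ≤ d) {u : Zd d} {s h : ℕ} {β : ℤ} (hs : 0 < s) (hβ : β ≤ (s / 10 : ℕ))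
    (hh : h ≤ s / 10) {ω : Config d}
    (h3 : ∀ j, ∀ y ∈ ball u (3 * s), ∀ z ∈ ball u (3 * s),
      ω ∉ missSet u (3 * s) s h j (z j) β y z)
    (h4 : ∀ j, ∀ y ∈ ball u (4 * s), ∀ z ∈ ball u (4 * s), z j ≤ y j →
      ω ∉ missSet u (4 * s) s h j (y j) β y z) : ω ∈ goodSet u s := by
  have : NeZero d := ⟨by omega⟩
  have main : ∀ (j : Fin d) (z z' : Zd d), Conn ω (ball u (3 * s)) z z' → z ∈ ball u (3 * s) →
      z j + s ≤ z' j → ∀ y ∈ ball u (2 * s), SConn ω (ball u (5 * s)) {z} (ball y (s / 10)) := by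
    intro j z z' hc hz hj y hy
    obtain ⟨l, hl⟩ : ∃ l : Fin d, l ≠ j := by
      have : Nontrivial (Fin d) := Fin.nontrivial_iff_two_le.2 hd
      exact exists_ne j
    have far : ∀ t : ℤ, |t| = 3 * s → ∃ a, |a l - (u l + t)| ≤ h ∧ Conn ω (ball u (4 * s)) z a := by
      intro t ht
      by_contra hcon
      refine h3 j (Function.update u l (u l + t)) ?_ z hz ⟨⟨z, rfl, z', ?_, hc⟩, ?_⟩
      · rw [mem_ball]
        intro i
        by_cases hi : i = l
        · subst hi; simp [ht]
        · simp [hi]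
      · simp only [Set.mem_ofPred_eq]; omega
      · rintro ⟨w, rfl, a, ha, hwa⟩
        refine hcon ⟨a, ?_, ?_⟩
        · have := ha.2.2 l hl
          simpa using this
        · exact hwa.mono_set (ball_subset (by rw [dst_self]; omega))
    obtain ⟨a, ha, hza⟩ := far (-(3 * s)) (by rw [abs_neg, abs_of_nonneg (by positivity)])
    obtain ⟨a', ha', hza'⟩ := far (3 * s) (by rw [abs_of_nonneg (by positivity)])
    have hyl := abs_le.1 (mem_ball.1 hy l)
    rw [abs_le] at ha ha'
    push_cast at hyl
    by_contra hcon
    refine h4 l y (ball_subset (by rw [dst_self]; omega) hy) a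
      (hza.mem (ball_subset (by rw [dst_self]; omega) hz)) (by omega)
      ⟨⟨a, rfl, a', ?_, hza.symm.trans hza'⟩, ?_⟩
    · simp only [Set.mem_ofPred_eq]; omega
    · rintro ⟨w, rfl, x, hx, hwx⟩
      refine hcon ⟨z, rfl, x, ?_, (hza.mono_set (ball_subset (by rw [dst_self]; omega))).trans
        (hwx.mono_set (ball_subset (by rw [dst_self]; omega)))⟩
      rw [mem_ball]
      intro i
      by_cases hi : i = l
      · subst hi
        have h1 := hx.1
        have h2 := hx.2.1
        rw [abs_le]; constructor <;> omega
      · exact (hx.2.2 i hi).trans (by exact_mod_cast hh)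
  intro z z' hc hd y hy
  obtain ⟨j, hj⟩ := exists_eq_dst z z'
  have hne : z ≠ z' := by
    rintro rfl
    rw [dst_self] at hd; omega
  have hz' : z' ∈ ball u (3 * s) := by
    rcases ReflTransGen.cases_tail hc with h | ⟨b, -, hb⟩
    · exact absurd h.symm hne
    · exact hb.2.2
  have hz : z ∈ ball u (3 * s) := by
    rcases ReflTransGen.cases_head hc with h | ⟨b, hb, -⟩
    · exact absurd h hne
    · exact hb.2.1
  rcases le_total (z j) (z' j) with hle | hle
  · refine main j z z' hc hz ?_ y hy
    rw [abs_of_nonpos (by omega)] at hj; omega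
  · obtain ⟨w, rfl, x, hx, hwx⟩ := main j z' z hc.symm hz' (by
      rw [abs_of_nonneg (by omega)] at hj; omega) y hy
    exact ⟨z, rfl, x, hx, (hc.mono_set (ball_subset (by rw [dst_self]; omega))).trans hwx⟩

lemma exists_good (hd : 2 ≤ d) {p0 p : unitInterval} (hp0 : 0 < p0) (hlt : p0 < p)
    (hP : Perc d p0) {ε : ℝ} (hε : 0 < ε) :
    ∃ s : ℕ, 10 ≤ s ∧ ∀ u : Zd d, Pr p (goodSet u s)ᶜ ≤ ε := by
  classical
  have : NeZero d := ⟨by omega⟩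
  obtain ⟨c, hc, h0, hst⟩ := strip hp0 hlt hP
  have hc1 : c ≤ 1 := (hst h0 le_rfl 0 0 0 (fun l _ => by simp)).trans (Pr_le_one p _)
  have hlim := (tendsto_pow_const_mul_const_pow_of_abs_lt_one (4 * d) (r := 1 - c)
    (by rw [abs_of_nonneg] <;> linarith)).const_mul (2 * d * (12801 : ℝ) ^ (2 * d))
  rw [mul_zero] at hlim
  obtain ⟨t, ht, ht1⟩ := ((hlim.eventually_le_const hε).and
    (Filter.eventually_ge_atTop (h0 + 1))).exists
  set s : ℕ := (40 * t) ^ 2 with hs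
  have hs1 : s = 1600 * (t * t) := by rw [hs]; ring
  have htt : t ≤ t * t := Nat.le_mul_self t
  have h10 : s / 10 = 160 * (t * t) := by omega
  refine ⟨s, by omega, fun u => ?_⟩
  set b : Finset (Zd d) := (ball_finite u (4 * s)).toFinset with hb
  have hmb : ∀ x, x ∈ b ↔ x ∈ ball u (4 * s) := fun x => by simp [hb]
  have hbc : b.card = (8 * s + 1) ^ d := by
    rw [hb, ← Set.ncard_eq_toFinset_card _ (ball_finite u (4 * s)), ncard_ball]
    congr 1; ring
  set I : Finset (Fin d × Zd d × Zd d) := Finset.univ ×ˢ b ×ˢ b with hI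
  have h34 : ball u (3 * s) ⊆ ball u (4 * s) := ball_subset (by rw [dst_self]; omega)
  set E3 : Fin d × Zd d × Zd d → Set (Config d) := fun i =>
    {ω | i.2.1 ∈ ball u (3 * s) ∧ i.2.2 ∈ ball u (3 * s) ∧
      ω ∈ missSet u (3 * s) s (40 * t) i.1 (i.2.2 i.1) (80 * (t * t) : ℕ) i.2.1 i.2.2} with hE3
  set E4 : Fin d × Zd d × Zd d → Set (Config d) := fun i =>
    {ω | i.2.1 ∈ ball u (4 * s) ∧ i.2.2 ∈ ball u (4 * s) ∧ i.2.2 i.1 ≤ i.2.1 i.1 ∧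
      ω ∈ missSet u (4 * s) s (40 * t) i.1 (i.2.1 i.1) (80 * (t * t) : ℕ) i.2.1 i.2.2} with hE4
  have hst' := hst (40 * t) (by omega)
  have hkb : (t : ℤ) * ((40 * t : ℕ) + 1) ≤ (80 * (t * t) : ℕ) := by
    have : (t : ℤ) ≤ t * t := by exact_mod_cast htt
    push_cast; nlinarith
  have hpow : (0 : ℝ) ≤ (1 - c) ^ t := pow_nonneg (by linarith) _
  have hb3 : ∀ i, Pr p (E3 i) ≤ (1 - c) ^ t := by
    intro i
    by_cases h : i.2.1 ∈ ball u (3 * s) ∧ i.2.2 ∈ ball u (3 * s)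
    · exact (Pr_mono p fun ω hω => hω.2.2).trans
        (miss_bound hst' hc1 (by omega) (by omega) h.1 le_rfl h.2 t hkb)
    · have : E3 i = ∅ := by
        ext ω; simp only [hE3, Set.mem_ofPred_eq, Set.mem_empty_iff_false, iff_false]; tauto
      rw [this, Pr, measureReal_empty]; exact hpow
  have hb4 : ∀ i, Pr p (E4 i) ≤ (1 - c) ^ t := by
    intro i
    by_cases h : i.2.1 ∈ ball u (4 * s) ∧ i.2.2 ∈ ball u (4 * s) ∧ i.2.2 i.1 ≤ i.2.1 i.1
    · exact (Pr_mono p fun ω hω => hω.2.2.2).trans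
        (miss_bound hst' hc1 (by omega) (by omega) h.1 h.2.2 h.2.1 t hkb)
    · have : E4 i = ∅ := by
        ext ω; simp only [hE4, Set.mem_ofPred_eq, Set.mem_empty_iff_false, iff_false]; tauto
      rw [this, Pr, measureReal_empty]; exact hpow
  have hsub : (goodSet u s)ᶜ ⊆ (⋃ i ∈ I, E3 i) ∪ ⋃ i ∈ I, E4 i := by
    intro ω hω
    by_contra hcon
    rw [Set.mem_union, not_or] at hcon
    refine hω (good_of_not_miss hd (h := 40 * t) (β := (80 * (t * t) : ℕ)) (by omega) ?_
      (by omega) ?_ ?_)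
    · rw [h10]; exact_mod_cast (by omega)
    · intro j y hy z hz hm
      refine hcon.1 (Set.mem_iUnion₂.2 ⟨(j, y, z), ?_, hy, hz, hm⟩)
      simp only [hI, Finset.mem_product, Finset.mem_univ, true_and, hmb]
      exact ⟨h34 hy, h34 hz⟩
    · intro j y hy z hz hzy hm
      refine hcon.2 (Set.mem_iUnion₂.2 ⟨(j, y, z), ?_, hy, hz, hzy, hm⟩)
      simp only [hI, Finset.mem_product, Finset.mem_univ, true_and, hmb]
      exact ⟨hy, hz⟩
  have hcard : (I.card : ℝ) = d * ((8 * s + 1) ^ d * (8 * s + 1) ^ d) := by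
    simp [hI, Finset.card_product, hbc]
  have hsum : Pr p (goodSet u s)ᶜ ≤ I.card * (1 - c) ^ t + I.card * (1 - c) ^ t := by
    refine (Pr_mono p hsub).trans ((Pr_union_le p _ _).trans (add_le_add ?_ ?_))
    · refine (Pr_biUnion_le p I E3).trans ((Finset.sum_le_sum fun i _ => hb3 i).trans ?_)
      simp
    · refine (Pr_biUnion_le p I E4).trans ((Finset.sum_le_sum fun i _ => hb4 i).trans ?_)
      simp
  refine hsum.trans (le_trans ?_ ht)
  have h8 : (8 * s + 1 : ℝ) ≤ 12801 * (t : ℝ) ^ 2 := by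
    have : 8 * s + 1 ≤ 12801 * (t * t) := by omega
    have h2 : ((8 * s + 1 : ℕ) : ℝ) ≤ (12801 * (t * t) : ℕ) := by exact_mod_cast this
    push_cast at h2; nlinarith
  have h9 : (8 * s + 1 : ℝ) ^ d * (8 * s + 1 : ℝ) ^ d ≤ 12801 ^ (2 * d) * (t : ℝ) ^ (4 * d) := by
    rw [← pow_add, ← two_mul]
    refine (pow_le_pow_left₀ (by positivity) h8 _).trans (le_of_eq ?_)
    rw [mul_pow, ← pow_mul]; congr 2; ring
  rw [hcard]
  have h11 : (d : ℝ) * ((8 * s + 1 : ℝ) ^ d * (8 * s + 1 : ℝ) ^ d) ≤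
      d * (12801 ^ (2 * d) * (t : ℝ) ^ (4 * d)) := mul_le_mul_of_nonneg_left h9 (by positivity)
  calc _ = 2 * ((d : ℝ) * ((8 * s + 1 : ℝ) ^ d * (8 * s + 1 : ℝ) ^ d)) * (1 - c) ^ t := by ring
    _ ≤ 2 * (d * (12801 ^ (2 * d) * (t : ℝ) ^ (4 * d))) * (1 - c) ^ t := by gcongr
    _ = _ := by ring

/-- A discrete Loomis–Whitney inequality. -/
lemma loomis_whitney (hd : 2 ≤ d) (V F : Finset (Zd d))
    (h : ∀ i, ∀ v ∈ V, ∃ t : ℤ, Function.update v i t ∈ F) :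
    V.card ^ (d - 1) ≤ F.card ^ d := by
  classical
  have hpi : (Measure.pi fun _ : Fin d => (Measure.count : Measure ℤ)) = Measure.count := by
    refine Measure.ext_of_singleton fun a => ?_
    rw [Measure.pi_singleton, Measure.count_singleton]
    simp
  have hd1 : (1 : ℝ) < d := by exact_mod_cast (by omega : 1 < d)
  have hconj : Real.HolderConjugate (Fintype.card (Fin d)) ((d : ℝ) / (d - 1)) := by
    rw [Fintype.card_fin]
    exact Real.HolderConjugate.conjExponent hd1
  have key := lintegral_prod_lintegral_pow_le (fun _ : Fin d => (Measure.count : Measure ℤ)) hconj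
    (f := Set.indicator (F : Set (Zd d)) 1) (measurable_one.indicator F.measurableSet)
  rw [hpi, lintegral_indicator_one F.measurableSet, Measure.count_apply_finset] at key
  have hlow : (V.card : ℝ≥0∞) ≤ (F.card : ℝ≥0∞) ^ ((d : ℝ) / (d - 1)) := by
    refine le_trans ?_ key
    rw [← Measure.count_apply_finset V, ← lintegral_indicator_one V.measurableSet]
    refine lintegral_mono fun x => ?_
    by_cases hx : x ∈ V
    · rw [Set.indicator_of_mem (by exact_mod_cast hx), Pi.one_apply]
      refine Finset.one_le_prod' fun i _ => ?_
      obtain ⟨t, ht⟩ := h i x hx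
      refine ENNReal.one_le_rpow ?_ (by
        rw [Fintype.card_fin]; exact div_pos one_pos (by linarith))
      calc (1 : ℝ≥0∞) = ∫⁻ u, Set.indicator {t} 1 u ∂Measure.count := by
            rw [lintegral_indicator_one (measurableSet_singleton t), Measure.count_singleton]
        _ ≤ _ := by
            refine lintegral_mono fun u => ?_
            by_cases hu : u = t
            · subst hu
              rw [Set.indicator_of_mem (Set.mem_singleton _), Set.indicator_of_mem ht]
              rfl
            · rw [Set.indicator_of_notMem (by simpa using hu)]; exact zero_le
    · rw [Set.indicator_of_notMem (by exact_mod_cast hx)]; exact zero_le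
  have h2 := ENNReal.rpow_le_rpow hlow (z := ((d - 1 : ℕ) : ℝ)) (by positivity)
  rw [← ENNReal.rpow_mul, Nat.cast_sub (by omega), Nat.cast_one,
    div_mul_cancel₀ _ (by linarith : (d : ℝ) - 1 ≠ 0), ENNReal.rpow_natCast] at h2
  rw [show (d : ℝ) - 1 = ((d - 1 : ℕ) : ℝ) by rw [Nat.cast_sub (by omega)]; simp,
    ENNReal.rpow_natCast] at h2
  exact_mod_cast h2

lemma latConn_of_Icc_subset {S : Set (Zd d)} {x y : Zd d} (h : Set.Icc (x ⊓ y) (x ⊔ y) ⊆ S) :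
    ReflTransGen (restr latAdj S) x y :=
  rtg_mono (restr_mono (fun _ _ _ _ h => h) h)
    (Icc_latConn _ _ x y ⟨inf_le_left, le_sup_left⟩ ⟨inf_le_right, le_sup_right⟩)

/-- The exterior of a box is connected. -/
lemma exterior_conn (hd : 2 ≤ d) (n : ℕ) {x : Zd d} (hx : x ∉ ball 0 n) :
    ReflTransGen (restr latAdj (ball 0 n)ᶜ) x (fun _ => (n : ℤ) + 1) := by
  have hup : ∀ (i : Fin d) (x y : Zd d), (n : ℤ) < x i → (n : ℤ) < y i →
      ReflTransGen (restr latAdj (ball 0 n)ᶜ) x y := fun i x y hx hy =>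
    latConn_of_Icc_subset fun z hz hb => by
      have h1 : x i ⊓ y i ≤ z i := hz.1 i
      have h2 := (abs_le.1 (mem_ball.1 hb i)).2
      simp only [Pi.zero_apply, sub_zero] at h2
      omega
  have hdn : ∀ (i : Fin d) (x y : Zd d), x i < -(n : ℤ) → y i < -(n : ℤ) →
      ReflTransGen (restr latAdj (ball 0 n)ᶜ) x y := fun i x y hx hy =>
    latConn_of_Icc_subset fun z hz hb => by
      have h1 : z i ≤ x i ⊔ y i := hz.2 i
      have h2 := (abs_le.1 (mem_ball.1 hb i)).1
      simp only [Pi.zero_apply, sub_zero] at h2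
      omega
  rw [mem_ball] at hx
  push Not at hx
  obtain ⟨i, hi⟩ := hx
  rw [Pi.zero_apply, sub_zero, lt_abs] at hi
  rcases hi with hi | hi
  · exact hup i _ _ hi (by omega)
  · obtain ⟨j, hj⟩ : ∃ j : Fin d, j ≠ i := by
      have : Nontrivial (Fin d) := Fin.nontrivial_iff_two_le.2 hd
      exact exists_ne i
    refine (hdn i x (Function.update (fun _ => (n : ℤ) + 1) i (-(n : ℤ) - 1)) (by omega)
      (by simp)).trans (hup j _ _ ?_ (by omega))
    simp [hj]

lemma exists_outer_boundary (hd : 2 ≤ d) {V : Set (Zd d)} (hfin : V.Finite) (hne : V.Nonempty)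
    (hV : ConnLat V) :
    ∃ F : Finset (Zd d), (F : Set (Zd d)) ⊆ V ∧ RConn starAdj (F : Set (Zd d)) ∧
      (∀ x ∈ F, ∃ x', latAdj x x' ∧ x' ∉ V) ∧ V.ncard ^ (d - 1) ≤ F.card ^ d := by
  classical
  have : NeZero d := ⟨by omega⟩
  obtain ⟨v0, hv0⟩ := hne
  obtain ⟨n, hn⟩ : ∃ n : ℕ, V ⊆ ball 0 n := by
    obtain ⟨n, hn⟩ := (hfin.image fun v => dst v 0).bddAbove
    exact ⟨n, fun v hv => hn ⟨v, hv, rfl⟩⟩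
  set P : Zd d := fun _ => (n : ℤ) + 1 with hP
  have hPn : P ∉ ball 0 n := fun h => by
    have := (abs_le.1 (mem_ball.1 h 0)).2
    simp [hP] at this
  have hVc : (ball 0 n)ᶜ ⊆ Vᶜ := Set.compl_subset_compl.2 hn
  set W : Set (Zd d) := latHull Vᶜ {P} with hW
  have hWV : W ⊆ Vᶜ := latHull_subset (Set.singleton_subset_iff.2 (hVc hPn))
  have hext : (ball 0 n)ᶜ ⊆ W := fun x hx => ⟨P, rfl, rtg_symm restr_latAdj_symm
    (rtg_mono (restr_mono (fun _ _ _ _ h => h) hVc) (exterior_conn hd n hx))⟩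
  have hWc : ConnLat W := connLat_latHull (by
    rintro x rfl y rfl; exact .refl)
  have hVW : V ⊆ Wᶜ := fun v hv h => hWV h hv
  have hcl : ∀ a b, a ∈ Wᶜ → restr latAdj Vᶜ a b → b ∈ Wᶜ := fun a b ha hab hb =>
    ha (latHull_closed hb hab.2.2 hab.2.1 hab.1.symm)
  have hto : ∀ y ∈ Wᶜ, ReflTransGen (restr latAdj Wᶜ) y v0 := by
    intro y hy
    have hVpath : ∀ b ∈ V, ReflTransGen (restr latAdj Wᶜ) b v0 := fun b hb =>
      rtg_mono (restr_mono (fun _ _ _ _ h => h) hVW) (hV b hb v0 hv0)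
    by_cases hyV : y ∈ V
    · exact hVpath y hyV
    · have hconn : ReflTransGen latAdj y v0 :=
        rtg_mono (fun _ _ h => h.1) (latConn_of_Icc_subset (Set.subset_univ _))
      obtain ⟨a, b, h1, h2, h3, h4, -⟩ := rtg_exit hconn (S := Vᶜ) hyV (by simpa using hv0)
      have h5 := rtg_restr_closed h1 hcl hy
      have ha : a ∈ Wᶜ := rtg_mem h5 hy
      have hb : b ∈ V := by simpa using h4
      refine ((rtg_mono (fun a b h => ⟨h.1.1, h.2⟩) h5).tail ⟨h3, ha, hVW hb⟩).trans (hVpath b hb)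
  have hWcc : ConnLat Wᶜ := fun x hx y hy =>
    (hto x hx).trans (rtg_symm restr_latAdj_symm (hto y hy))
  have hstar := boundary_starConn W hWc hWcc
  set F := {x : Zd d | x ∉ W ∧ ∃ v ∈ W, latAdj x v} with hF
  have hFV : F ⊆ V := by
    rintro x ⟨hx, v, hv, hxv⟩
    by_contra hxV
    exact hx (latHull_closed hv (hWV hv) hxV hxv.symm)
  have hFfin := hfin.subset hFV
  refine ⟨hFfin.toFinset, by simpa using hFV, by simpa using hstar, ?_, ?_⟩
  · intro x hx
    obtain ⟨-, v, hv, hxv⟩ := hFfin.mem_toFinset.1 hx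
    exact ⟨v, hxv, hWV hv⟩
  · rw [Set.ncard_eq_toFinset_card _ hfin]
    refine loomis_whitney hd _ _ fun i v hv => ?_
    rw [Set.Finite.mem_toFinset] at hv
    have hex : ∃ k : ℕ, Function.update v i (v i + k) ∈ W := by
      refine ⟨2 * n + 1, hext fun h => ?_⟩
      have h1 := (abs_le.1 (mem_ball.1 h i)).2
      have h2 := (abs_le.1 (mem_ball.1 (hn hv) i)).1
      simp at h1 h2
      omega
    have h0 : Nat.find hex ≠ 0 := by
      intro h
      have := Nat.find_spec hex
      rw [h] at this
      simp at this
      exact hVW hv this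
    obtain ⟨k, hk⟩ := Nat.exists_eq_succ_of_ne_zero h0
    refine ⟨v i + k, hFfin.mem_toFinset.2 ⟨Nat.find_min hex (by omega), _, Nat.find_spec hex, ?_⟩⟩
    have := latAdj_update (Function.update v i (v i + k)) i 1 (Or.inl rfl)
    rw [Function.update_idem, Function.update_self] at this
    rw [hk]
    convert this using 2
    push_cast; ring

/-- The index of the cell of side `s` containing `y`. -/
def fl (s : ℕ) (y : Zd d) : Zd d := fun i => y i / (s : ℤ)

/-- The corner of the cell of side `s` with index `x`. -/
def corner (s : ℕ) (x : Zd d) : Zd d := fun i => s * x i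

lemma corner_fl {s : ℕ} (hs : 0 < s) (y : Zd d) (i : Fin d) :
    corner s (fl s y) i ≤ y i ∧ y i < corner s (fl s y) i + s := by
  have h1 := Int.emod_nonneg (y i) (b := s) (by omega)
  have h2 := Int.emod_lt_of_pos (y i) (b := s) (by omega)
  have h3 := Int.emod_add_mul_ediv (y i) s
  simp only [corner, fl]
  constructor <;> linarith

lemma fl_eq {s : ℕ} {y x : Zd d} (h : ∀ i, corner s x i ≤ y i ∧ y i < corner s x i + s) :
    fl s y = x := by
  funext i
  obtain ⟨h1, h2⟩ := h i
  have h1 : s * x i ≤ y i := h1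
  have h2 : y i < s * x i + s := h2
  have hs : (0 : ℤ) < s := by omega
  rw [fl, Int.ediv_eq_iff_of_pos hs]
  constructor <;> linarith

lemma fl_step {s : ℕ} (hs : 0 < s) {a b : Zd d} (h : latAdj a b) :
    fl s a = fl s b ∨ latAdj (fl s a) (fl s b) := by
  obtain ⟨i, σ, hσ, rfl⟩ := latAdj_iff.1 h
  have hs' : (0 : ℤ) < s := by exact_mod_cast hs
  have hu : fl s (Function.update a i (a i + σ)) = Function.update (fl s a) i ((a i + σ) / s) := by
    funext j
    by_cases hj : j = i
    · subst hj; simp [fl]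
    · simp [fl, hj]
  rw [hu]
  have hdiv : ∀ t r : ℤ, r ≤ t + s → r / (s : ℤ) ≤ t / s + 1 := fun t r htr => by
    rw [← Int.add_mul_ediv_right t 1 hs'.ne', one_mul]
    exact Int.ediv_le_ediv hs' htr
  have h1 := hdiv (a i) (a i + σ) (by omega)
  have h2 := hdiv (a i + σ) (a i) (by omega)
  rcases (by omega : (a i + σ) / (s : ℤ) = a i / s ∨ (a i + σ) / (s : ℤ) = a i / s + 1 ∨
    (a i + σ) / (s : ℤ) = a i / s + -1) with h | h | h
  · left; rw [h]; exact (Function.update_eq_self i (fl s a)).symm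
  · right; rw [h]; exact latAdj_update (fl s a) i 1 (Or.inl rfl)
  · right; rw [h]; exact latAdj_update (fl s a) i (-1) (Or.inr rfl)

lemma connLat_fl {s : ℕ} (hs : 0 < s) {ω : Config d} {A : Set (Zd d)} (hA : ConnOpen ω A) :
    ConnLat (fl s '' A) := by
  rintro _ ⟨x, hx, rfl⟩ _ ⟨y, hy, rfl⟩
  refine ReflTransGen.lift' (fl s) (fun a b hab => ?_) _ _ (hA x hx y hy)
  rcases fl_step hs hab.1.1 with h | h
  · simp only [Function.onFun, h]; exact .refl
  · exact .single ⟨h, ⟨a, hab.2.1, rfl⟩, ⟨b, hab.2.2, rfl⟩⟩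

lemma ncard_le_fl {s : ℕ} (hs : 0 < s) {A : Set (Zd d)} (hA : A.Finite) :
    A.ncard ≤ s ^ d * (fl s '' A).ncard := by
  classical
  rw [Set.ncard_eq_toFinset_card _ hA, Set.ncard_eq_toFinset_card _ (hA.image _)]
  have : (hA.image (fl s)).toFinset = hA.toFinset.image (fl s) := by ext; simp
  rw [this]
  refine Finset.card_le_mul_card_image _ _ fun x _ => ?_
  have hsub : (hA.toFinset.filter fun y => fl s y = x) ⊆
      Finset.Icc (corner s x) (fun i => corner s x i + (s - 1)) := by
    intro y hy
    rw [Finset.mem_filter] at hy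
    rw [Finset.mem_Icc]
    have h := corner_fl hs y
    rw [hy.2] at h
    exact ⟨fun i => (h i).1, fun i => by have := (h i).2; simp only; omega⟩
  refine (Finset.card_le_card hsub).trans ?_
  rw [Pi.card_Icc]
  refine (Finset.prod_le_pow_card _ _ s fun i _ => ?_).trans (by simp)
  rw [Int.card_Icc]; omega

lemma exists_bdry_edge {s : ℕ} (hs : 10 ≤ s) {ω : Config d} {A : Set (Zd d)} (hA : ConnOpen ω A)
    {x x' : Zd d} (hx : x ∈ fl s '' A) (hxx : latAdj x x') (hx' : x' ∉ fl s '' A)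
    (hg : ω ∈ goodSet (corner s x) s) (hbig : ¬ A ⊆ ball (corner s x) (3 * s)) :
    ∃ e ∈ bdry ω A, e.1 ∈ ball (corner s x) (5 * s) := by
  obtain ⟨a, haA, rfl⟩ := hx
  set u := corner s (fl s a) with hu
  have hau : a ∈ ball u s := by
    rw [mem_ball]
    intro i
    have : u i ≤ a i ∧ a i < u i + s := corner_fl (by omega) a i
    rw [abs_le]; constructor <;> omega
  have ha3 : a ∈ ball u (3 * s) := ball_subset (by rw [dst_self]; omega) hau
  obtain ⟨w, hwA, hw⟩ := Set.not_subset.1 hbig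
  obtain ⟨b, b', h1, h2, h3, h4, -⟩ := rtg_exit (hA a haA w hwA) (S := ball u (3 * s)) ha3 hw
  have hab : Conn ω (ball u (3 * s)) a b :=
    rtg_mono (fun a b h => ⟨h.1.1, h.2⟩) h1
  have hdab : s ≤ dst a b := by
    have e1 : ¬ dst b' u ≤ 3 * s := h4
    have e2 : dst b b' ≤ 1 := h3.1.1.dst_le
    have e3 : dst a u ≤ s := hau
    have e4 := dst_triangle b' b u
    have e5 := dst_triangle b a u
    rw [dst_comm] at e2
    rw [dst_comm b a] at e5
    omega
  set y : Zd d := fun i => corner s x' i + (s / 2 : ℕ) with hy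
  have hyu : y ∈ ball u (2 * s) := by
    rw [mem_ball]
    intro i
    have h5 := abs_le.1 (hxx.abs_le i)
    have hs' : (0 : ℤ) ≤ s := by positivity
    have e1 : (s : ℤ) * (fl s a i - x' i) ≤ s * 1 := mul_le_mul_of_nonneg_left h5.2 hs'
    have e2 : (s : ℤ) * (-1) ≤ s * (fl s a i - x' i) := mul_le_mul_of_nonneg_left h5.1 hs'
    rw [mul_sub] at e1 e2
    simp only [hy, hu, corner]
    rw [abs_le]; constructor <;> omega
  obtain ⟨_, rfl, z, hz, hc⟩ := hg a b hab hdab y hyu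
  have hzx : fl s z = x' := fl_eq fun i => by
    have := abs_le.1 (mem_ball.1 hz i)
    simp only [hy] at this
    constructor <;> omega
  have hzA : z ∉ A := fun h => hx' ⟨z, h, hzx⟩
  obtain ⟨e, e', g1, g2, g3, -, g5, -⟩ := hc.exit (S := A) haA hzA
  exact ⟨(e, e'), ⟨g3, g2.2, g5⟩, g2.1⟩

/-- The set of bad cells. -/
def badC (s : ℕ) (ω : Config d) : Set (Zd d) := {x | ω ∉ goodSet (corner s x) s}

lemma exists_residue_class (m : ℕ) [NeZero m] (B : Finset (Zd d)) :
    ∃ B' ⊆ B, B.card ≤ m ^ d * B'.card ∧ ∀ x ∈ B', ∀ y ∈ B', ∀ i, (m : ℤ) ∣ x i - y i := by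
  classical
  set f : Zd d → (Fin d → ZMod m) := fun x i => x i with hf
  have hpos : (0 : ℚ) < (m : ℚ) ^ d := pow_pos (by exact_mod_cast Nat.pos_of_neZero m) _
  obtain ⟨y, -, hy⟩ := Finset.exists_le_card_fiber_of_nsmul_le_card_of_maps_to
    (s := B) (t := Finset.univ) (f := f) (b := (B.card : ℚ) / m ^ d)
    (fun _ _ => Finset.mem_univ _) Finset.univ_nonempty (by
      rw [Finset.card_univ, Fintype.card_fun, ZMod.card, Fintype.card_fin, nsmul_eq_mul]
      push_cast
      rw [mul_div_cancel₀ _ hpos.ne'])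
  refine ⟨B.filter fun x => f x = y, Finset.filter_subset _ _, ?_, ?_⟩
  · rw [div_le_iff₀ hpos] at hy
    have : (B.card : ℚ) ≤ ((m ^ d * (B.filter fun x => f x = y).card : ℕ) : ℚ) := by
      push_cast; linarith
    exact_mod_cast this
  · intro a ha b hb i
    rw [Finset.mem_filter] at ha hb
    have : f a i = f b i := by rw [ha.2, hb.2]
    simp only [hf] at this
    rw [← ZMod.intCast_zmod_eq_zero_iff_dvd]
    push_cast
    rw [this, sub_self]

lemma Pr_all_bad [NeZero d] {p : unitInterval} {s : ℕ} (hs : 0 < s) {θ : ℝ} (hθ : 0 ≤ θ) (hθ1 : θ ≤ 1)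
    (hq : ∀ u : Zd d, Pr p (goodSet u s)ᶜ ≤ θ ^ (2 * 11 ^ d)) (B : Finset (Zd d)) :
    Pr p {ω | ∀ x ∈ B, x ∈ badC s ω} ≤ θ ^ (2 * B.card) := by
  obtain ⟨B', hB', hcard, hres⟩ := exists_residue_class 11 B
  have h1 : Pr p {ω : Config d | ∀ x ∈ B, x ∈ badC s ω} ≤
      Pr p (⋂ x ∈ B', (goodSet (corner s x) s)ᶜ) :=
    Pr_mono p fun ω h => Set.mem_iInter₂.2 fun x hx => h x (hB' hx)
  refine h1.trans ?_
  rw [Pr, bern_biInter (fun _ => p) B' (fun x => edgesIn (ball (corner s x) (5 * s))) _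
    (fun x _ => (detBy_goodSet _ _).compl) (fun x _ => edgesIn_finite (ball_finite _ _)) ?_]
  · calc ∏ x ∈ B', (bern fun _ => p).real (goodSet (corner s x) s)ᶜ
        ≤ ∏ x ∈ B', θ ^ (2 * 11 ^ d) :=
          Finset.prod_le_prod (fun _ _ => measureReal_nonneg) fun x _ => hq _
      _ = θ ^ (2 * 11 ^ d * B'.card) := by rw [Finset.prod_const, ← pow_mul]
      _ ≤ _ := pow_le_pow_of_le_one hθ hθ1 (by rw [mul_assoc]; omega)
  · intro x hx y hy hxy
    refine edgesIn_disjoint (ball_disjoint ?_)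
    obtain ⟨i, hi⟩ := Function.ne_iff.1 hxy
    have h2 : (11 : ℤ) ≤ |x i - y i| := by
      have := Int.le_of_dvd (abs_pos.2 (sub_ne_zero.2 hi)) ((dvd_abs _ _).2 (hres x hx y hy i))
      exact_mod_cast this
    have h3 := abs_le_dst (corner s x) (corner s y) i
    simp only [corner, ← mul_sub, abs_mul, Nat.abs_cast] at h3
    have h4 : (s : ℤ) * 11 ≤ s * |x i - y i| := mul_le_mul_of_nonneg_left h2 (by positivity)
    omega

/-- Some star-connected set of `k` cells in the box of radius `R` has a bad half. -/
def badAnimal (d s R k : ℕ) : Set (Config d) :=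
  {ω | ∃ F : Finset (Zd d), (F : Set (Zd d)) ⊆ ball 0 R ∧ RConn starAdj (F : Set (Zd d)) ∧
    F.card = k ∧ ∃ B ⊆ F, k ≤ 2 * B.card ∧ ∀ x ∈ B, x ∈ badC s ω}

lemma Pr_badAnimal [NeZero d] {p : unitInterval} {s : ℕ} (hs : 0 < s) {θ : ℝ} (hθ : 0 ≤ θ)
    (hθ1 : 2 * θ * 2 ^ (3 ^ d + 1) ≤ 1 / 2)
    (hq : ∀ u : Zd d, Pr p (goodSet u s)ᶜ ≤ θ ^ (2 * 11 ^ d)) (R k : ℕ) (hk : 0 < k) :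
    Pr p (badAnimal d s R k) ≤ (2 * R + 1) ^ d * (1 / 2) ^ k := by
  classical
  have hθ2 : θ ≤ 1 := by
    have : (1 : ℝ) ≤ 2 ^ (3 ^ d + 1) := one_le_pow₀ (by norm_num)
    nlinarith
  set b := (ball_finite (0 : Zd d) R).toFinset with hb
  have hbc : (b.card : ℝ) = (2 * R + 1) ^ d := by
    rw [hb, ← Set.ncard_eq_toFinset_card _ (ball_finite _ _), ncard_ball]; push_cast; rfl
  set 𝒢 : Zd d → Finset (Finset (Zd d)) := fun x => b.powerset.filter fun F =>
    x ∈ F ∧ RConn starAdj (F : Set (Zd d)) ∧ F.card = k with h𝒢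
  set E : Finset (Zd d) → Set (Config d) := fun F =>
    ⋃ B ∈ F.powerset.filter fun B => F.card ≤ 2 * B.card, {ω | ∀ x ∈ B, x ∈ badC s ω} with hE
  have hEF : ∀ F, Pr p (E F) ≤ (2 * θ) ^ F.card := by
    intro F
    calc Pr p (E F) ≤ ∑ B ∈ F.powerset.filter fun B => F.card ≤ 2 * B.card, θ ^ F.card := by
          refine (Pr_biUnion_le p _ _).trans (Finset.sum_le_sum fun B hB => ?_)
          rw [Finset.mem_filter] at hB
          exact (Pr_all_bad hs hθ hθ2 hq B).trans (pow_le_pow_of_le_one hθ hθ2 hB.2)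
      _ ≤ 2 ^ F.card * θ ^ F.card := by
          rw [Finset.sum_const, nsmul_eq_mul]
          refine mul_le_mul_of_nonneg_right ?_ (by positivity)
          have := Finset.card_filter_le F.powerset fun B => F.card ≤ 2 * B.card
          rw [Finset.card_powerset] at this
          exact_mod_cast this
      _ = _ := by rw [mul_pow]
  have hsub : badAnimal d s R k ⊆ ⋃ x ∈ b, ⋃ F ∈ 𝒢 x, E F := by
    rintro ω ⟨F, hFR, hF, hFk, B, hBF, hB, hbad⟩
    obtain ⟨x, hx⟩ := Finset.card_pos.1 (hFk ▸ hk)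
    have hFb : F ⊆ b := fun y hy => by rw [hb, Set.Finite.mem_toFinset]; exact hFR hy
    refine Set.mem_iUnion₂.2 ⟨x, hFb hx, Set.mem_iUnion₂.2 ⟨F, ?_, Set.mem_iUnion₂.2 ⟨B, ?_, hbad⟩⟩⟩
    · exact Finset.mem_filter.2 ⟨Finset.mem_powerset.2 hFb, hx, hF, hFk⟩
    · exact Finset.mem_filter.2 ⟨Finset.mem_powerset.2 hBF, hFk ▸ hB⟩
  calc Pr p (badAnimal d s R k) ≤ ∑ x ∈ b, ∑ F ∈ 𝒢 x, (2 * θ) ^ F.card :=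
        (Pr_mono p hsub).trans ((Pr_biUnion_le p _ _).trans (Finset.sum_le_sum fun x _ =>
          (Pr_biUnion_le p _ _).trans (Finset.sum_le_sum fun F _ => hEF F)))
    _ ≤ ∑ x ∈ b, (1 / 2 : ℝ) ^ k := Finset.sum_le_sum fun x _ =>
        (animal_sum starAdj starNb (3 ^ d) starNb_card (fun _ _ => mem_starNb) x _ k
          (fun F hF => by
            obtain ⟨-, h1, h2, h3⟩ := Finset.mem_filter.1 hF
            exact ⟨h1, h2, h3.ge⟩) (by positivity) (hθ1.trans (by norm_num))).trans
          (pow_le_pow_left₀ (by positivity) hθ1 k)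
    _ = _ := by rw [Finset.sum_const, nsmul_eq_mul, hbc]

lemma ae_not_badAnimal [NeZero d] {p : unitInterval} {s : ℕ} (hs : 0 < s) {θ : ℝ} (hθ : 0 ≤ θ)
    (hθ1 : 2 * θ * 2 ^ (3 ^ d + 1) ≤ 1 / 2)
    (hq : ∀ u : Zd d, Pr p (goodSet u s)ᶜ ≤ θ ^ (2 * 11 ^ d)) (a : ℕ) :
    ∀ᵐ ω ∂(bern fun _ : Sym2 (Zd d) => p), ∀ᶠ k in Filter.atTop,
      ω ∉ badAnimal d s ((k ^ 2 * a) ^ d) k := by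
  have hsum : Summable fun k : ℕ => ((2 * a ^ d + 1) ^ d * 2 : ℝ) *
      (((k + 1 : ℕ) : ℝ) ^ (2 * d * d) * (1 / 2) ^ (k + 1)) := by
    refine Summable.mul_left _ ?_
    exact (summable_nat_add_iff (f := fun k : ℕ => (k : ℝ) ^ (2 * d * d) * (1 / 2 : ℝ) ^ k) 1).2
      (summable_pow_mul_geometric_of_norm_lt_one _ (by norm_num))
  have hb : ∀ k : ℕ, 0 < k → Pr p (badAnimal d s ((k ^ 2 * a) ^ d) k) ≤
      ((2 * a ^ d + 1) ^ d * 2 : ℝ) * (((k + 1 : ℕ) : ℝ) ^ (2 * d * d) * (1 / 2) ^ (k + 1)) := by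
    intro k hk
    refine (Pr_badAnimal hs hθ hθ1 hq _ k hk).trans ?_
    have h1 : (2 * (((k ^ 2 * a) ^ d : ℕ) : ℝ) + 1) ≤
        (2 * a ^ d + 1) * ((k + 1 : ℕ) : ℝ) ^ (2 * d) := by
      have h2 : (k : ℝ) ^ (2 * d) ≤ ((k + 1 : ℕ) : ℝ) ^ (2 * d) :=
        pow_le_pow_left₀ (by positivity) (by push_cast; linarith) _
      have h3 : (1 : ℝ) ≤ ((k + 1 : ℕ) : ℝ) ^ (2 * d) :=
        one_le_pow₀ (by push_cast; linarith [Nat.cast_nonneg (α := ℝ) k])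
      have h4 : (((k ^ 2 * a) ^ d : ℕ) : ℝ) = (k : ℝ) ^ (2 * d) * a ^ d := by
        push_cast; rw [mul_pow, ← pow_mul]
      rw [h4, add_mul]
      have h5 : (0 : ℝ) ≤ a ^ d := by positivity
      nlinarith
    calc _ ≤ ((2 * a ^ d + 1) * ((k + 1 : ℕ) : ℝ) ^ (2 * d)) ^ d * (1 / 2) ^ k := by gcongr
      _ = _ := by rw [mul_pow, ← pow_mul, pow_succ (1 / 2 : ℝ) k]; ring
  have := ae_eventually_notMem (μ := bern fun _ : Sym2 (Zd d) => p)
    (s := fun k : ℕ => if 0 < k then badAnimal d s ((k ^ 2 * a) ^ d) k else ∅) (by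
      refine ne_top_of_le_ne_top hsum.tsum_ofReal_ne_top (ENNReal.tsum_le_tsum fun k => ?_)
      split_ifs with hk
      · rw [← ENNReal.ofReal_toReal (measure_ne_top (bern fun _ : Sym2 (Zd d) => p) _)]
        exact ENNReal.ofReal_le_ofReal (hb k hk)
      · simp)
  filter_upwards [this] with ω hω
  filter_upwards [hω, Filter.eventually_gt_atTop 0] with k hk hk0
  simpa [hk0] using hk

lemma bdry_finite {ω : Config d} {A : Set (Zd d)} (hA : A.Finite) : (bdry ω A).Finite := by
  have h : (⋃ x ∈ A, (fun y => (x, y)) '' ball x 1).Finite :=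
    hA.biUnion fun x _ => (ball_finite x 1).image _
  refine h.subset fun e he => Set.mem_iUnion₂.2 ⟨e.1, he.2.1, e.2, ?_, rfl⟩
  have := he.1.1.dst_le
  rw [dst_comm] at this
  exact this

lemma card_le_bdry {s : ℕ} (hs : 0 < s) {ω : Config d} {A : Set (Zd d)} (hA : A.Finite)
    (G : Finset (Zd d)) (h : ∀ x ∈ G, ∃ e ∈ bdry ω A, e.1 ∈ ball (corner s x) (5 * s)) :
    G.card ≤ 13 ^ d * (bdry ω A).ncard := by
  classical
  choose! g hg hgb using h
  have hfin := bdry_finite (ω := ω) hA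
  rw [Set.ncard_eq_toFinset_card _ hfin]
  refine Finset.card_le_mul_card_image_of_maps_to (f := g)
    (fun x hx => hfin.mem_toFinset.2 (hg x hx)) _ fun e _ => ?_
  have hsub : (G.filter fun x => g x = e) ⊆ (ball_finite (fl s e.1) 6).toFinset := by
    intro x hx
    rw [Finset.mem_filter] at hx
    rw [Set.Finite.mem_toFinset, mem_ball]
    intro i
    have h1 := abs_le.1 (mem_ball.1 (hgb x hx.1) i)
    rw [hx.2] at h1
    have h2 := corner_fl hs e.1 i
    simp only [corner] at h1 h2
    push_cast at h1 ⊢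
    have hs' : (0 : ℤ) < s := by exact_mod_cast hs
    rw [abs_le]
    constructor
    · refine le_of_mul_le_mul_left ?_ hs'; rw [mul_sub]; linarith
    · refine le_of_mul_le_mul_left ?_ hs'; rw [mul_sub]; linarith
  refine (Finset.card_le_card hsub).trans (le_of_eq ?_)
  rw [← Set.ncard_eq_toFinset_card _ (ball_finite _ _), ncard_ball]

/-- Isoperimetric inequality for large connected sets of open edges. -/
theorem isoperimetry (hd : 2 ≤ d) {p0 p : unitInterval} (hp0 : 0 < p0) (hlt : p0 < p)
    (hP : Perc d p0) :
    ∃ K : ℕ, ∀ᵐ ω ∂(bern fun _ : Sym2 (Zd d) => p), ∃ v0 : ℕ, ∀ v ≥ v0,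
      ∀ A : Set (Zd d), A ⊆ box d v → ConnOpen ω A → v ≤ A.ncard ^ d →
        A.ncard ^ (d - 1) ≤ K * (bdry ω A).ncard ^ d := by
  classical
  have : NeZero d := ⟨by omega⟩
  set θ : ℝ := (1 / 2) ^ (3 ^ d + 3) with hθ
  have hθ0 : 0 < θ := by positivity
  have hθ1 : 2 * θ * 2 ^ (3 ^ d + 1) ≤ 1 / 2 := by
    have : ((1 : ℝ) / 2) ^ (3 ^ d + 1) * 2 ^ (3 ^ d + 1) = 1 := by
      rw [← mul_pow]; norm_num
    have h2 : θ = (1 / 2) ^ (3 ^ d + 1) * (1 / 4) := by rw [hθ, pow_add, pow_add]; ring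
    rw [h2]; linarith
  obtain ⟨s, hs10, hgood⟩ := exists_good hd hp0 hlt hP (pow_pos hθ0 (2 * 11 ^ d))
  have hs : 0 < s := by omega
  refine ⟨s ^ (d * (d - 1)) * (2 * 13 ^ d) ^ d, ?_⟩
  filter_upwards [ae_not_badAnimal hs hθ0.le hθ1 hgood (s ^ d)] with ω hω
  obtain ⟨k0, hk0⟩ := Filter.eventually_atTop.1 hω
  refine ⟨(max (k0 ^ 2 * s ^ d) ((6 * s + 1) ^ d)) ^ d + 1, fun v hv A hAv hA hvA => ?_⟩
  have hAfin : A.Finite := (ball_finite 0 v).subset (by rw [← box_eq_ball]; exact hAv)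
  have hAbig : max (k0 ^ 2 * s ^ d) ((6 * s + 1) ^ d) < A.ncard := by
    by_contra hcon
    have := Nat.pow_le_pow_left (not_lt.1 hcon) d
    omega
  rw [max_lt_iff] at hAbig
  have hAne : A.Nonempty := Set.nonempty_of_ncard_ne_zero (by omega)
  set V := fl s '' A with hV
  have hVfin : V.Finite := hAfin.image _
  have hAV : A.ncard ≤ s ^ d * V.ncard := ncard_le_fl hs hAfin
  obtain ⟨F, hFV, hFc, hFb, hFcard⟩ := exists_outer_boundary hd hVfin (hAne.image _) (connLat_fl hs hA)
  set k := F.card with hk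
  have hVpos : 0 < V.ncard := (Set.ncard_pos hVfin).2 (hAne.image _)
  have hkpos : 0 < k := by
    by_contra h
    have h0 : k = 0 := by omega
    have := Nat.pow_pos (n := d - 1) hVpos
    rw [h0, zero_pow (by omega)] at hFcard
    omega
  have hVk : V.ncard ≤ k ^ 2 := by
    rw [← Nat.pow_le_pow_iff_left (n := d - 1) (by omega), ← pow_mul]
    exact hFcard.trans (Nat.pow_le_pow_right hkpos (by omega))
  have hAk : A.ncard ≤ k ^ 2 * s ^ d := by
    calc _ ≤ s ^ d * V.ncard := hAV
      _ ≤ s ^ d * k ^ 2 := Nat.mul_le_mul_left _ hVk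
      _ = _ := mul_comm _ _
  have hkk0 : k0 ≤ k := by
    by_contra h
    have : k ^ 2 * s ^ d ≤ k0 ^ 2 * s ^ d :=
      Nat.mul_le_mul_right _ (Nat.pow_le_pow_left (by omega) 2)
    omega
  have hFR : (F : Set (Zd d)) ⊆ ball 0 ((k ^ 2 * s ^ d) ^ d) := by
    intro x hx
    obtain ⟨a, ha, rfl⟩ := hFV hx
    have hR : v ≤ (k ^ 2 * s ^ d) ^ d := hvA.trans (Nat.pow_le_pow_left hAk d)
    rw [mem_ball]
    intro i
    have h1 := abs_le.1 (hAv ha i)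
    have h2 := corner_fl hs a i
    simp only [corner] at h2
    have hs' : (0 : ℤ) < s := by exact_mod_cast hs
    have hv0 : (0 : ℤ) ≤ v := by positivity
    have h3 : |fl s a i| ≤ (v : ℤ) := by
      rw [abs_le]
      constructor
      · by_contra h; push Not at h
        have := mul_le_mul_of_nonneg_left (show fl s a i ≤ -(v : ℤ) - 1 by omega) hs'.le
        nlinarith
      · by_contra h; push Not at h
        have := mul_le_mul_of_nonneg_left (show (v : ℤ) + 1 ≤ fl s a i by omega) hs'.le
        nlinarith
    simp only [Pi.zero_apply, sub_zero]
    exact h3.trans (by exact_mod_cast hR)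
  set B := F.filter fun x => x ∈ badC s ω with hB
  set G := F.filter fun x => ¬ x ∈ badC s ω with hG
  have hBG : B.card + G.card = k := Finset.card_filter_add_card_filter_not _
  have hBk : 2 * B.card < k := by
    by_contra h
    exact hk0 k hkk0 ⟨F, hFR, hFc, rfl, B, Finset.filter_subset _ _, not_lt.1 h, fun x hx =>
      (Finset.mem_filter.1 hx).2⟩
  have hGb : G.card ≤ 13 ^ d * (bdry ω A).ncard := by
    refine card_le_bdry hs hAfin G fun x hx => ?_
    obtain ⟨hxF, hxg⟩ := Finset.mem_filter.1 hx
    obtain ⟨x', hxx, hx'⟩ := hFb x hxF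
    refine exists_bdry_edge hs10 hA (hFV hxF) hxx hx' (not_not.1 hxg) fun hsub => ?_
    have := Set.ncard_le_ncard hsub (ball_finite _ _)
    rw [ncard_ball, show 2 * (3 * s) + 1 = 6 * s + 1 by ring] at this
    omega
  calc A.ncard ^ (d - 1) ≤ (s ^ d * V.ncard) ^ (d - 1) := Nat.pow_le_pow_left hAV _
    _ = s ^ (d * (d - 1)) * V.ncard ^ (d - 1) := by rw [mul_pow, pow_mul]
    _ ≤ s ^ (d * (d - 1)) * k ^ d := Nat.mul_le_mul_left _ hFcard
    _ ≤ s ^ (d * (d - 1)) * (2 * 13 ^ d * (bdry ω A).ncard) ^ d :=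
        Nat.mul_le_mul_left _ (Nat.pow_le_pow_left (by rw [mul_assoc]; omega) _)
    _ = _ := by rw [mul_pow]; ring

end annulus

section network

variable {X : Type*}

/-- Weighted inner product on a finite set. -/
def ip (F : Finset X) (ν : X → ℝ) (f g : X → ℝ) : ℝ := ∑ x ∈ F, ν x * f x * g x

/-- Kernel operator killed outside a finite set. -/
def kop (F : Finset X) (s : X → X → ℝ) (f : X → ℝ) (x : X) : ℝ := ∑ y ∈ F, s x y * f y

variable {F : Finset X} {ν : X → ℝ} {s : X → X → ℝ}

lemma ip_comm (f g : X → ℝ) : ip F ν f g = ip F ν g f :=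
  Finset.sum_congr rfl fun x _ => by ring

lemma ip_kop (f g : X → ℝ) :
    ip F ν f (kop F s g) = ∑ x ∈ F, ∑ y ∈ F, ν x * s x y * f x * g y := by
  refine Finset.sum_congr rfl fun x _ => ?_
  rw [kop, Finset.mul_sum]
  exact Finset.sum_congr rfl fun y _ => by ring

lemma ip_kop_symm (hrev : ∀ x ∈ F, ∀ y ∈ F, ν x * s x y = ν y * s y x) (f g : X → ℝ) :
    ip F ν f (kop F s g) = ip F ν (kop F s f) g := by
  rw [ip_comm (kop F s f), ip_kop, ip_kop, Finset.sum_comm]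
  exact Finset.sum_congr rfl fun x hx => Finset.sum_congr rfl fun y hy => by
    rw [hrev y hy x hx]; ring

lemma ip_self_nonneg (hν : ∀ x ∈ F, 0 ≤ ν x) (f : X → ℝ) : 0 ≤ ip F ν f f :=
  Finset.sum_nonneg fun x hx => by
    rw [mul_assoc]; exact mul_nonneg (hν x hx) (mul_self_nonneg _)

lemma ip_cauchy (hν : ∀ x ∈ F, 0 ≤ ν x) (f g : X → ℝ) :
    ip F ν f g ^ 2 ≤ ip F ν f f * ip F ν g g :=
  Finset.sum_sq_le_sum_mul_sum_of_sq_le_mul F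
    (fun x hx => by rw [mul_assoc]; exact mul_nonneg (hν x hx) (mul_self_nonneg _))
    (fun x hx => by rw [mul_assoc]; exact mul_nonneg (hν x hx) (mul_self_nonneg _))
    (fun x _ => le_of_eq (by ring))

lemma norm_kop_le (hrev : ∀ x ∈ F, ∀ y ∈ F, ν x * s x y = ν y * s y x) {κ : ℝ} (hκ : 0 < κ)
    (h : ∀ f : X → ℝ, |ip F ν f (kop F s f)| ≤ κ * ip F ν f f) (f : X → ℝ) :
    ip F ν (kop F s f) (kop F s f) ≤ κ ^ 2 * ip F ν f f := by
  set g := kop F s f with hg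
  have h1 := (abs_le.1 (h fun x => κ * f x + g x)).2
  have h2 := (abs_le.1 (h fun x => κ * f x - g x)).1
  have h3 : ip F ν g (kop F s f) = ip F ν g g := rfl
  have h4 : ip F ν f (kop F s g) = ip F ν g g := by rw [ip_kop_symm hrev]
  have hk : ∀ σ : ℝ, kop F s (fun x => κ * f x + σ * g x) = fun x => κ * g x + σ * kop F s g x := by
    intro σ
    funext x
    change ∑ y ∈ F, s x y * (κ * f y + σ * g y) =
      κ * ∑ y ∈ F, s x y * f y + σ * ∑ y ∈ F, s x y * g y
    rw [Finset.mul_sum, Finset.mul_sum, ← Finset.sum_add_distrib]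
    exact Finset.sum_congr rfl fun y _ => by ring
  have hip : ∀ (c : ℝ) (u v w z : X → ℝ) (σ : ℝ),
      ip F ν (fun x => c * u x + σ * v x) (fun x => c * w x + σ * z x) =
      c ^ 2 * ip F ν u w + c * σ * (ip F ν u z + ip F ν v w) + σ ^ 2 * ip F ν v z := by
    intro c u v w z σ
    simp only [ip, Finset.mul_sum, ← Finset.sum_add_distrib]
    exact Finset.sum_congr rfl fun y _ => by ring
  have e1 : (fun x => κ * f x + g x) = fun x => κ * f x + 1 * g x := by funext x; ring
  have e2 : (fun x => κ * f x - g x) = fun x => κ * f x + (-1) * g x := by funext x; ring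
  rw [e1, hk, hip, hip, h4, ip_comm g f] at h1
  rw [e2, hk, hip, hip, h4, ip_comm g f] at h2
  have h5 : 4 * (κ * ip F ν g g) ≤ 2 * κ * (κ ^ 2 * ip F ν f f + ip F ν g g) := by linarith
  have h6 : 2 * ip F ν g g ≤ κ ^ 2 * ip F ν f f + ip F ν g g := by
    refine le_of_mul_le_mul_left ?_ (by linarith : 0 < 2 * κ)
    linarith
  linarith

lemma coarea [DecidableEq X] {U : Finset X} (hFU : F ⊆ U) {a : X → X → ℝ} (ha : ∀ x y, 0 ≤ a x y) {h : ℝ}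
    (hiso : ∀ A ⊆ F, h * ∑ x ∈ A, ν x ≤ ∑ x ∈ A, ∑ y ∈ U \ A, a x y) (g : X → ℝ)
    (hg : ∀ x, 0 ≤ g x) (hgF : ∀ x, x ∉ F → g x = 0) :
    h * ∑ x ∈ F, ν x * g x ≤ ∑ x ∈ U, ∑ y ∈ U, a x y * max (g x - g y) 0 := by
  classical
  have hind : ∀ u v : ℝ, Integrable (Set.indicator (Set.Ico u v) (1 : ℝ → ℝ)) := fun u v =>
    (integrable_indicator_iff measurableSet_Ico).2
      (integrableOn_const (by simp [Real.volume_Ico]) (by simp))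
  have hint : ∀ u v : ℝ, ∫ t, Set.indicator (Set.Ico u v) (1 : ℝ → ℝ) t = max (v - u) 0 := by
    intro u v
    rw [integral_indicator_one measurableSet_Ico, Real.volume_real_Ico]
  have hL : h * ∑ x ∈ F, ν x * g x =
      ∫ t, h * ∑ x ∈ F, ν x * Set.indicator (Set.Ico 0 (g x)) (1 : ℝ → ℝ) t := by
    rw [integral_const_mul, integral_finsetSum _ fun x _ => (hind _ _).const_mul _]
    congr 1
    refine Finset.sum_congr rfl fun x _ => ?_
    rw [integral_const_mul, hint, sub_zero, max_eq_left (hg x)]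
  have hR : ∑ x ∈ U, ∑ y ∈ U, a x y * max (g x - g y) 0 =
      ∫ t, ∑ x ∈ U, ∑ y ∈ U, a x y * Set.indicator (Set.Ico (g y) (g x)) (1 : ℝ → ℝ) t := by
    rw [integral_finsetSum _ fun x _ => integrable_finsetSum _ fun y _ =>
      (hind _ _).const_mul _]
    refine Finset.sum_congr rfl fun x _ => ?_
    rw [integral_finsetSum _ fun y _ => (hind _ _).const_mul _]
    refine Finset.sum_congr rfl fun y _ => ?_
    rw [integral_const_mul, hint]
  rw [hL, hR]
  refine integral_mono ((integrable_finsetSum _ fun x _ => (hind _ _).const_mul _).const_mul _)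
    (integrable_finsetSum _ fun x _ => integrable_finsetSum _ fun y _ =>
      (hind _ _).const_mul _) fun t => ?_
  have hRnn : ∀ x y, 0 ≤ a x y * Set.indicator (Set.Ico (g y) (g x)) (1 : ℝ → ℝ) t := fun x y =>
    mul_nonneg (ha x y) (Set.indicator_nonneg (fun _ _ => zero_le_one) _)
  rcases lt_or_ge t 0 with ht | ht
  · have : ∑ x ∈ F, ν x * Set.indicator (Set.Ico 0 (g x)) (1 : ℝ → ℝ) t = 0 :=
      Finset.sum_eq_zero fun x _ => by
        rw [Set.indicator_of_notMem (fun h => absurd h.1 (not_le.2 ht)), mul_zero]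
    simp only [this, mul_zero]
    exact Finset.sum_nonneg fun x _ => Finset.sum_nonneg fun y _ => hRnn x y
  · set A := F.filter fun x => t < g x with hA
    have h1 : ∑ x ∈ F, ν x * Set.indicator (Set.Ico 0 (g x)) (1 : ℝ → ℝ) t = ∑ x ∈ A, ν x := by
      rw [hA, Finset.sum_filter]
      refine Finset.sum_congr rfl fun x _ => ?_
      by_cases hx : t < g x
      · rw [Set.indicator_of_mem (show t ∈ Set.Ico 0 (g x) from ⟨ht, hx⟩), if_pos hx]; simp
      · rw [Set.indicator_of_notMem (fun h : t ∈ Set.Ico 0 (g x) => hx h.2), if_neg hx, mul_zero]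
    simp only [h1]
    refine (hiso A (Finset.filter_subset _ _)).trans ?_
    calc ∑ x ∈ A, ∑ y ∈ U \ A, a x y
        = ∑ x ∈ A, ∑ y ∈ U \ A, a x y * Set.indicator (Set.Ico (g y) (g x)) (1 : ℝ → ℝ) t := by
          refine Finset.sum_congr rfl fun x hx => Finset.sum_congr rfl fun y hy => ?_
          rw [Set.indicator_of_mem, Pi.one_apply, mul_one]
          refine ⟨?_, (Finset.mem_filter.1 hx).2⟩
          by_cases hyF : y ∈ F
          · by_contra hc
            exact (Finset.mem_sdiff.1 hy).2 (Finset.mem_filter.2 ⟨hyF, not_le.1 hc⟩)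
          · rw [hgF y hyF]; exact ht
      _ ≤ ∑ x ∈ A, ∑ y ∈ U, a x y * Set.indicator (Set.Ico (g y) (g x)) (1 : ℝ → ℝ) t :=
          Finset.sum_le_sum fun x _ => Finset.sum_le_sum_of_subset_of_nonneg
            Finset.sdiff_subset fun y _ _ => hRnn x y
      _ ≤ _ := Finset.sum_le_sum_of_subset_of_nonneg ((Finset.filter_subset _ _).trans hFU)
            fun x _ _ => Finset.sum_nonneg fun y _ => hRnn x y

/-- Cheeger's inequality for the killed kernel. -/
lemma cheeger [DecidableEq X] {U : Finset X} (hFU : F ⊆ U) {a : X → X → ℝ} (ha : ∀ x y, 0 ≤ a x y)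
    (hsym : ∀ x y, a x y = a y x) (hν : ∀ x ∈ F, ν x = ∑ y ∈ U, a x y) {h : ℝ} (hh : 0 ≤ h)
    (hiso : ∀ A ⊆ F, h * ∑ x ∈ A, ν x ≤ ∑ x ∈ A, ∑ y ∈ U \ A, a x y) (f : X → ℝ)
    (hf : ∀ x, 0 ≤ f x) (hfF : ∀ x, x ∉ F → f x = 0) :
    (∑ x ∈ F, ∑ y ∈ F, a x y * f x * f y) ^ 2 ≤ (1 - h ^ 2) * (∑ x ∈ F, ν x * f x ^ 2) ^ 2 := by
  have hco := coarea hFU ha hiso (fun x => f x ^ 2) (fun x => sq_nonneg _)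
    (fun x hx => by rw [hfF x hx]; norm_num)
  set N := ∑ x ∈ F, ν x * f x ^ 2 with hN
  set D := ∑ x ∈ F, ∑ y ∈ F, a x y * f x * f y with hD
  have hNnn : 0 ≤ N := Finset.sum_nonneg fun x hx => by
    rw [hν x hx]
    exact mul_nonneg (Finset.sum_nonneg fun y _ => ha x y) (sq_nonneg _)
  have hNU : ∑ x ∈ U, ∑ y ∈ U, a x y * f x ^ 2 = N := by
    rw [hN, ← Finset.sum_subset hFU fun x _ hx => by
      simp [hfF x hx]]
    refine Finset.sum_congr rfl fun x hx => ?_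
    rw [hν x hx, Finset.sum_mul]
  have hNU' : ∑ x ∈ U, ∑ y ∈ U, a x y * f y ^ 2 = N := by
    rw [Finset.sum_comm, ← hNU]
    exact Finset.sum_congr rfl fun x _ => Finset.sum_congr rfl fun y _ => by rw [hsym]
  have hDU : ∑ x ∈ U, ∑ y ∈ U, a x y * f x * f y = D := by
    rw [hD, ← Finset.sum_subset hFU fun x _ hx => by simp [hfF x hx]]
    refine Finset.sum_congr rfl fun x _ => ?_
    rw [← Finset.sum_subset hFU fun y _ hy => by simp [hfF y hy]]
  have hS : ∑ x ∈ U, ∑ y ∈ U, a x y * max (f x ^ 2 - f y ^ 2) 0 =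
      1 / 2 * ∑ i ∈ U ×ˢ U, a i.1 i.2 * (|f i.1 - f i.2| * (f i.1 + f i.2)) := by
    rw [Finset.sum_product]
    have : ∀ x y, a x y * max (f x ^ 2 - f y ^ 2) 0 =
        1 / 2 * (a x y * (|f x - f y| * (f x + f y))) +
          1 / 2 * (a x y * f x ^ 2) - 1 / 2 * (a x y * f y ^ 2) := by
      intro x y
      have h1 : |f x - f y| * (f x + f y) = |f x ^ 2 - f y ^ 2| := by
        rw [← abs_of_nonneg (add_nonneg (hf x) (hf y)), ← abs_mul]
        congr 1
        ring
      have h2 : max (f x ^ 2 - f y ^ 2) 0 = 1 / 2 * (|f x ^ 2 - f y ^ 2| + (f x ^ 2 - f y ^ 2)) := by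
        rcases le_total (f x ^ 2 - f y ^ 2) 0 with h | h
        · rw [max_eq_right h, abs_of_nonpos h]; ring
        · rw [max_eq_left h, abs_of_nonneg h]; ring
      rw [h1, h2]; ring
    simp only [this, Finset.sum_sub_distrib, Finset.sum_add_distrib, ← Finset.mul_sum]
    rw [hNU, hNU']; ring
  have hCS := Finset.sum_sq_le_sum_mul_sum_of_sq_le_mul (U ×ˢ U)
    (r := fun i => a i.1 i.2 * (|f i.1 - f i.2| * (f i.1 + f i.2)))
    (f := fun i => a i.1 i.2 * (f i.1 - f i.2) ^ 2) (g := fun i => a i.1 i.2 * (f i.1 + f i.2) ^ 2)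
    (fun i _ => mul_nonneg (ha _ _) (sq_nonneg _)) (fun i _ => mul_nonneg (ha _ _) (sq_nonneg _))
    (fun i _ => le_of_eq (by rw [mul_pow, mul_pow, sq_abs]; ring))
  have hm : ∑ i ∈ U ×ˢ U, a i.1 i.2 * (f i.1 - f i.2) ^ 2 = 2 * N - 2 * D := by
    rw [Finset.sum_product]
    have : ∀ x y, a x y * (f x - f y) ^ 2 =
        a x y * f x ^ 2 + a x y * f y ^ 2 - 2 * (a x y * f x * f y) := fun x y => by ring
    simp only [this, Finset.sum_sub_distrib, Finset.sum_add_distrib, ← Finset.mul_sum]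
    rw [hNU, hNU', hDU]; ring
  have hp : ∑ i ∈ U ×ˢ U, a i.1 i.2 * (f i.1 + f i.2) ^ 2 = 2 * N + 2 * D := by
    rw [Finset.sum_product]
    have : ∀ x y, a x y * (f x + f y) ^ 2 =
        a x y * f x ^ 2 + a x y * f y ^ 2 + 2 * (a x y * f x * f y) := fun x y => by ring
    simp only [this, Finset.sum_add_distrib, ← Finset.mul_sum]
    rw [hNU, hNU', hDU]; ring
  rw [hm, hp] at hCS
  rw [hS] at hco
  have h1 : (h * N) ^ 2 ≤ (1 / 2 * ∑ i ∈ U ×ˢ U, a i.1 i.2 * (|f i.1 - f i.2| * (f i.1 + f i.2))) ^ 2 :=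
    pow_le_pow_left₀ (mul_nonneg hh hNnn) hco 2
  nlinarith

end network

section walk

variable {d : ℕ}

/-- The indicator of an open edge. -/
noncomputable def conduct (ω : Config d) (x y : Zd d) : ℝ :=
  Set.indicator {q : Zd d × Zd d | openAdj ω q.1 q.2} 1 (x, y)

lemma conduct_of_open {ω : Config d} {x y : Zd d} (h : openAdj ω x y) : conduct ω x y = 1 :=
  Set.indicator_of_mem (s := {q : Zd d × Zd d | openAdj ω q.1 q.2}) h _

lemma conduct_of_not_open {ω : Config d} {x y : Zd d} (h : ¬ openAdj ω x y) :
    conduct ω x y = 0 :=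
  Set.indicator_of_notMem (s := {q : Zd d × Zd d | openAdj ω q.1 q.2}) h _

lemma conduct_nonneg (ω : Config d) (x y : Zd d) : 0 ≤ conduct ω x y :=
  Set.indicator_nonneg (fun _ _ => zero_le_one) _

lemma conduct_symm (ω : Config d) (x y : Zd d) : conduct ω x y = conduct ω y x := by
  by_cases h : openAdj ω x y
  · rw [conduct_of_open h, conduct_of_open h.symm]
  · rw [conduct_of_not_open h, conduct_of_not_open fun h' => h h'.symm]

lemma openNbrs_subset (ω : Config d) (x : Zd d) : {y | openAdj ω x y} ⊆ ball x 1 := by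
  intro y hy
  rw [mem_ball]
  intro i
  have := latAdj.abs_le hy.1 i
  rw [abs_sub_comm]
  exact_mod_cast this

lemma openNbrs_finite (ω : Config d) (x : Zd d) : {y | openAdj ω x y}.Finite :=
  (ball_finite x 1).subset (openNbrs_subset ω x)

lemma nu_le (ω : Config d) (x : Zd d) : nu ω x ≤ 3 ^ d := by
  have := Set.ncard_le_ncard (openNbrs_subset ω x) (ball_finite x 1)
  rwa [ncard_ball] at this

lemma nu_pos {ω : Config d} {x y : Zd d} (h : openAdj ω x y) : 0 < nu ω x :=
  (Set.ncard_pos (openNbrs_finite ω x)).2 ⟨y, h⟩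

lemma nu_mul_step (ω : Config d) (x y : Zd d) : (nu ω x : ℝ) * step ω x y = conduct ω x y := by
  by_cases h : openAdj ω x y
  · have : (nu ω x : ℝ) ≠ 0 := by exact_mod_cast (nu_pos h).ne'
    rw [conduct_of_open h, step, if_pos h, mul_inv_cancel₀ this]
  · rw [conduct_of_not_open h, step, if_neg h, mul_zero]

lemma step_nonneg (ω : Config d) (x y : Zd d) : 0 ≤ step ω x y := by
  rw [step]; split_ifs <;> positivity

lemma openAdj_of_step_ne_zero {ω : Config d} {x y : Zd d} (h : step ω x y ≠ 0) :
    openAdj ω x y := by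
  by_contra hc
  exact h (if_neg hc)

lemma le_step {ω : Config d} {x y : Zd d} (h : openAdj ω x y) : ((3 : ℝ) ^ d)⁻¹ ≤ step ω x y := by
  rw [step, if_pos h]
  have := nu_pos h
  exact inv_anti₀ (by exact_mod_cast this) (by exact_mod_cast nu_le ω x)

lemma sum_conduct_le (ω : Config d) (x : Zd d) (U : Finset (Zd d)) :
    ∑ y ∈ U, conduct ω x y ≤ nu ω x := by
  classical
  have : ∑ y ∈ U, conduct ω x y = ((U.filter fun y => openAdj ω x y).card : ℝ) := by
    rw [Finset.card_eq_sum_ones, Finset.sum_filter]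
    push_cast
    refine Finset.sum_congr rfl fun y _ => ?_
    split_ifs with h
    · rw [conduct_of_open h]
    · rw [conduct_of_not_open h]
  rw [this, nu, ← Set.ncard_coe_finset]
  exact_mod_cast Set.ncard_le_ncard (fun y hy => (Finset.mem_filter.1 hy).2)
    (openNbrs_finite ω x)

lemma sum_conduct_eq (ω : Config d) (x : Zd d) {U : Finset (Zd d)}
    (hU : ∀ y, openAdj ω x y → y ∈ U) : (nu ω x : ℝ) = ∑ y ∈ U, conduct ω x y := by
  classical
  have : ∑ y ∈ U, conduct ω x y = ((U.filter fun y => openAdj ω x y).card : ℝ) := by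
    rw [Finset.card_eq_sum_ones, Finset.sum_filter]
    push_cast
    refine Finset.sum_congr rfl fun y _ => ?_
    split_ifs with h
    · rw [conduct_of_open h]
    · rw [conduct_of_not_open h]
  rw [this, nu, ← Set.ncard_coe_finset]
  congr 2
  ext y
  simpa using fun h => hU y h

lemma sum_step_le (ω : Config d) (x : Zd d) (U : Finset (Zd d)) : ∑ y ∈ U, step ω x y ≤ 1 := by
  rcases (nu ω x).eq_zero_or_pos with h | h
  · refine (Finset.sum_nonpos fun y _ => ?_).trans zero_le_one
    rw [step, h]; simp
  · have hp : (0 : ℝ) < nu ω x := by exact_mod_cast h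
    refine le_of_mul_le_mul_left ?_ hp
    rw [Finset.mul_sum, mul_one]
    simp only [nu_mul_step]
    exact sum_conduct_le ω x U

lemma pathW_nonneg {n : ℕ} (ω : Config d) (γ : Fin (n + 1) → Zd d) : 0 ≤ pathW ω γ :=
  Finset.prod_nonneg fun _ _ => step_nonneg _ _ _

lemma openAdj_of_pathW_ne_zero {n : ℕ} {ω : Config d} {γ : Fin (n + 1) → Zd d}
    (h : pathW ω γ ≠ 0) (i : Fin n) : openAdj ω (γ i.castSucc) (γ i.succ) :=
  openAdj_of_step_ne_zero (Finset.prod_ne_zero_iff.1 h i (Finset.mem_univ i))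

/-- The paths of length `n` from `x` inside a finite set. -/
def pathsIn (F : Finset (Zd d)) (n : ℕ) (x : Zd d) : Finset (Fin (n + 1) → Zd d) :=
  (Fintype.piFinset fun _ : Fin (n + 1) => F).filter fun γ => γ 0 = x

lemma mem_pathsIn {F : Finset (Zd d)} {n : ℕ} {x : Zd d} {γ : Fin (n + 1) → Zd d} :
    γ ∈ pathsIn F n x ↔ (∀ i, γ i ∈ F) ∧ γ 0 = x := by
  simp [pathsIn]

/-- The probability that the walk from `x` stays in `F` up to time `n`. -/
noncomputable def surv (ω : Config d) (F : Finset (Zd d)) (n : ℕ) (x : Zd d) : ℝ :=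
  ∑ γ ∈ pathsIn F n x, pathW ω γ

lemma surv_nonneg (ω : Config d) (F : Finset (Zd d)) (n : ℕ) (x : Zd d) : 0 ≤ surv ω F n x :=
  Finset.sum_nonneg fun _ _ => pathW_nonneg _ _

lemma surv_zero (ω : Config d) {F : Finset (Zd d)} {x : Zd d} (hx : x ∈ F) :
    surv ω F 0 x = 1 := by
  have : pathsIn F 0 x = {fun _ => x} := by
    ext γ
    rw [mem_pathsIn, Finset.mem_singleton]
    constructor
    · rintro ⟨_, h⟩
      funext i
      rw [← h]; exact congrArg γ (Fin.eq_zero i)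
    · rintro rfl
      exact ⟨fun _ => hx, rfl⟩
  rw [surv, this, Finset.sum_singleton, pathW, Finset.univ_eq_empty, Finset.prod_empty]

lemma surv_succ (ω : Config d) {F : Finset (Zd d)} (n : ℕ) {x : Zd d} (hx : x ∈ F) :
    surv ω F (n + 1) x = ∑ y ∈ F, step ω x y * surv ω F n y := by
  have h1 : ∑ y ∈ F, step ω x y * surv ω F n y =
      ∑ γ ∈ Fintype.piFinset fun _ : Fin (n + 1) => F, step ω x (γ 0) * pathW ω γ := by
    rw [← Finset.sum_fiberwise_of_maps_to (g := fun γ : Fin (n + 1) → Zd d => γ 0) (t := F)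
      fun γ hγ => (Fintype.mem_piFinset.1 hγ) 0]
    refine Finset.sum_congr rfl fun y _ => ?_
    rw [surv, Finset.mul_sum]
    exact Finset.sum_congr rfl fun γ hγ => by rw [(mem_pathsIn.1 hγ).2]
  rw [h1, surv]
  refine Finset.sum_bij' (fun γ _ => Fin.tail γ) (fun γ _ => Fin.cons x γ) ?_ ?_ ?_ ?_ ?_
  · intro γ hγ
    exact Fintype.mem_piFinset.2 fun i => (mem_pathsIn.1 hγ).1 i.succ
  · intro γ hγ
    refine mem_pathsIn.2 ⟨fun i => ?_, rfl⟩
    refine Fin.cases ?_ (fun j => ?_) i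
    · exact hx
    · exact Fintype.mem_piFinset.1 hγ j
  · intro γ hγ
    rw [← (mem_pathsIn.1 hγ).2]
    exact Fin.cons_self_tail γ
  · intro γ _
    exact Fin.tail_cons _ _
  · intro γ hγ
    rw [pathW, Fin.prod_univ_succ, ← (mem_pathsIn.1 hγ).2]
    rfl

lemma surv_eq_kop (ω : Config d) (F : Finset (Zd d)) (n : ℕ) :
    ∀ x ∈ F, surv ω F n x = (kop F (step ω))^[n] 1 x := by
  induction n with
  | zero => exact fun x hx => surv_zero ω hx
  | succ n ih =>
    intro x hx
    rw [surv_succ ω n hx, Function.iterate_succ_apply', kop]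
    exact Finset.sum_congr rfl fun y hy => by rw [ih y hy]

lemma surv_succ_le (ω : Config d) (F : Finset (Zd d)) (n : ℕ) :
    ∀ x ∈ F, surv ω F (n + 1) x ≤ surv ω F n x := by
  induction n with
  | zero =>
    intro x hx
    rw [surv_succ ω 0 hx, surv_zero ω hx]
    refine le_trans (Finset.sum_le_sum fun y hy => ?_) (sum_step_le ω x F)
    rw [surv_zero ω hy, mul_one]
  | succ n ih =>
    intro x hx
    rw [surv_succ ω (n + 1) hx, surv_succ ω n hx]
    exact Finset.sum_le_sum fun y hy => mul_le_mul_of_nonneg_left (ih y hy) (step_nonneg _ _ _)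

lemma surv_anti (ω : Config d) (F : Finset (Zd d)) {x : Zd d} (hx : x ∈ F) :
    Antitone fun n => surv ω F n x :=
  antitone_nat_of_succ_le fun n => surv_succ_le ω F n x hx

lemma surv_le_one (ω : Config d) {F : Finset (Zd d)} {x : Zd d} (hx : x ∈ F) (n : ℕ) :
    surv ω F n x ≤ 1 :=
  (surv_anti ω F hx (Nat.zero_le n)).trans (surv_zero ω hx).le

/-- The sites reachable in `n` steps. -/
noncomputable def reach (d n : ℕ) : Finset (Zd d) := (ball_finite (0 : Zd d) n).toFinset

lemma mem_reach_of_pathW {n : ℕ} {ω : Config d} {γ : Fin (n + 1) → Zd d} (h0 : γ 0 = 0)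
    (h : pathW ω γ ≠ 0) : γ ∈ pathsIn (reach d n) n 0 := by
  refine mem_pathsIn.2 ⟨fun i => ?_, h0⟩
  have key : ∀ k (hk : k < n + 1), ∀ j, |γ ⟨k, hk⟩ j - 0| ≤ k := by
    intro k
    induction k with
    | zero => intro _ j; simp [h0]
    | succ k ih =>
      intro hk j
      have h1 := ih (by omega) j
      have h2 := latAdj.abs_le (openAdj_of_pathW_ne_zero h ⟨k, by omega⟩).1 j
      simp only [Fin.castSucc_mk, Fin.succ_mk] at h2
      push_cast
      rw [abs_le] at *
      constructor <;> linarith [h1.1, h1.2, h2.1, h2.2]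
  rw [reach, Set.Finite.mem_toFinset, mem_ball]
  intro j
  refine (key i i.2 j).trans ?_
  have := i.2
  omega

lemma laplaceN_eq (ω : Config d) (α : ℝ) (n : ℕ) :
    LaplaceN ω α n = ∑ γ ∈ pathsIn (reach d n) n 0, pathW ω γ * α ^ visits γ := by
  rw [LaplaceN, tsum_eq_sum (s := pathsIn (reach d n) n 0)]
  · exact Finset.sum_congr rfl fun γ hγ => Set.indicator_of_mem (s := {γ : _ → Zd d | γ 0 = 0})
      (mem_pathsIn.1 hγ).2 _
  · intro γ hγ
    by_cases h0 : γ 0 = 0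
    · rw [Set.indicator_of_mem (s := {γ : _ → Zd d | γ 0 = 0}) h0]
      by_contra hc
      exact hγ (mem_reach_of_pathW h0 (left_ne_zero_of_mul hc))
    · exact Set.indicator_of_notMem (s := {γ : _ → Zd d | γ 0 = 0}) h0 _

lemma visits_eq_card {n : ℕ} (γ : Fin (n + 1) → Zd d) :
    visits γ = (Finset.univ.image γ).card := by
  rw [visits, ← Set.ncard_coe_finset, Finset.coe_image, Finset.coe_univ, Set.image_univ]

/-- Confining the walk to `F` bounds the Laplace transform from below. -/
lemma le_laplaceN (ω : Config d) {α : ℝ} (hα : 0 ≤ α) (hα1 : α ≤ 1) (F : Finset (Zd d)) (n : ℕ) :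
    α ^ F.card * surv ω F n 0 ≤ LaplaceN ω α n := by
  rw [laplaceN_eq, surv, Finset.mul_sum]
  calc ∑ γ ∈ pathsIn F n 0, α ^ F.card * pathW ω γ
      ≤ ∑ γ ∈ pathsIn F n 0, pathW ω γ * α ^ visits γ := by
        refine Finset.sum_le_sum fun γ hγ => ?_
        rw [mul_comm]
        refine mul_le_mul_of_nonneg_left (pow_le_pow_of_le_one hα hα1 ?_) (pathW_nonneg _ _)
        rw [visits_eq_card]
        refine Finset.card_le_card fun z hz => ?_
        obtain ⟨i, _, rfl⟩ := Finset.mem_image.1 hz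
        exact (mem_pathsIn.1 hγ).1 i
    _ ≤ _ := by
        rw [← Finset.sum_filter_ne_zero]
        refine Finset.sum_le_sum_of_subset_of_nonneg (fun γ hγ => ?_) fun γ _ _ =>
          mul_nonneg (pathW_nonneg _ _) (pow_nonneg hα _)
        obtain ⟨hγ, h⟩ := Finset.mem_filter.1 hγ
        exact mem_reach_of_pathW (mem_pathsIn.1 hγ).2 (left_ne_zero_of_mul h)

/-- Splitting the Laplace transform according to the range of the walk. -/
lemma laplaceN_le (ω : Config d) {α : ℝ} (hα : 0 ≤ α) (hα1 : α ≤ 1) (m n : ℕ) {B : ℝ}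
    (hB0 : 0 ≤ B)
    (hB : ∀ F : Finset (Zd d), 0 ∈ F → (∀ y ∈ F, ReflTransGen (restr (openAdj ω) ↑F) 0 y) →
      F.card ≤ m → surv ω F n 0 ≤ B) :
    LaplaceN ω α n ≤ α ^ m + (2 ^ (3 ^ d + 1)) ^ m * B := by
  classical
  set P := pathsIn (reach d n) n 0 with hP
  have h0 : (0 : Zd d) ∈ reach d n := by
    rw [reach, Set.Finite.mem_toFinset, mem_ball]; simp
  rw [laplaceN_eq, ← hP]
  set S := P.filter fun γ => visits γ ≤ m ∧ pathW ω γ ≠ 0 with hS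
  set 𝒢 := S.image fun γ => Finset.univ.image γ with h𝒢
  have hpt : ∀ γ ∈ P, pathW ω γ * α ^ visits γ ≤
      α ^ m * pathW ω γ + if visits γ ≤ m ∧ pathW ω γ ≠ 0 then pathW ω γ else 0 := by
    intro γ _
    have hw := pathW_nonneg ω γ
    split_ifs with h
    · have : pathW ω γ * α ^ visits γ ≤ pathW ω γ :=
        mul_le_of_le_one_right hw (pow_le_one₀ hα hα1)
      have := mul_nonneg (pow_nonneg hα m) hw
      linarith
    · rw [add_zero, mul_comm]
      by_cases h' : pathW ω γ = 0
      · rw [h', mul_zero, mul_zero]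
      · have hm : m ≤ visits γ := by
          by_contra hc
          exact h ⟨by omega, h'⟩
        exact mul_le_mul_of_nonneg_right (pow_le_pow_of_le_one hα hα1 hm) hw
  refine (Finset.sum_le_sum hpt).trans ?_
  rw [Finset.sum_add_distrib, ← Finset.mul_sum, ← Finset.sum_filter]
  have h1 : ∑ γ ∈ P, pathW ω γ ≤ 1 := surv_le_one ω h0 n
  have hconn : ∀ F ∈ 𝒢, 0 ∈ F ∧ (∀ y ∈ F, ReflTransGen (restr (openAdj ω) ↑F) 0 y) ∧
      F.card ≤ m := by
    intro F hF
    obtain ⟨γ, hγ, rfl⟩ := Finset.mem_image.1 hF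
    obtain ⟨hγP, hm, hw⟩ := Finset.mem_filter.1 hγ
    have hγ0 := (mem_pathsIn.1 hγP).2
    refine ⟨hγ0 ▸ Finset.mem_image_of_mem γ (Finset.mem_univ 0), ?_, by rwa [← visits_eq_card]⟩
    intro y hy
    obtain ⟨i, _, rfl⟩ := Finset.mem_image.1 hy
    have key : ∀ k (hk : k < n + 1),
        ReflTransGen (restr (openAdj ω) ↑(Finset.univ.image γ)) 0 (γ ⟨k, hk⟩) := by
      intro k
      induction k with
      | zero =>
        intro hk
        have : γ ⟨0, hk⟩ = 0 := hγ0
        rw [this]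
      | succ k ih =>
        intro hk
        refine (ih (by omega)).tail ⟨openAdj_of_pathW_ne_zero hw ⟨k, by omega⟩, ?_, ?_⟩
        · exact Finset.mem_coe.2 (Finset.mem_image_of_mem γ (Finset.mem_univ _))
        · exact Finset.mem_coe.2 (Finset.mem_image_of_mem γ (Finset.mem_univ _))
    exact key i i.2
  have h2 : ∑ γ ∈ S, pathW ω γ ≤ 𝒢.card * B := by
    rw [← Finset.sum_fiberwise_of_maps_to (g := fun γ : Fin (n + 1) → Zd d =>
      Finset.univ.image γ) (t := 𝒢) fun γ hγ => Finset.mem_image_of_mem _ hγ, ← nsmul_eq_mul]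
    refine Finset.sum_le_card_nsmul _ _ _ fun F hF => ?_
    obtain ⟨a, b, c⟩ := hconn F hF
    refine le_trans ?_ (hB F a b c)
    refine Finset.sum_le_sum_of_subset_of_nonneg (fun γ hγ => ?_) fun γ _ _ => pathW_nonneg _ _
    obtain ⟨hγS, rfl⟩ := Finset.mem_filter.1 hγ
    exact mem_pathsIn.2 ⟨fun i => Finset.mem_image_of_mem γ (Finset.mem_univ i),
      (mem_pathsIn.1 (Finset.mem_filter.1 hγS).1).2⟩
  have h3 : (𝒢.card : ℝ) ≤ (2 ^ (3 ^ d + 1)) ^ m := by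
    have hη : (0 : ℝ) < 2 ^ (3 ^ d + 1) := by positivity
    have := animal_sum starAdj starNb (3 ^ d) starNb_card (fun _ _ => mem_starNb) (0 : Zd d) 𝒢 0
      (fun F hF => by
        obtain ⟨a, b, -⟩ := hconn F hF
        refine ⟨a, fun x hx y hy => ?_, Nat.zero_le _⟩
        have hsub : ∀ u v, restr (openAdj ω) (F : Set (Zd d)) u v → restr starAdj (F : Set _) u v :=
          fun u v h => ⟨latAdj.dst_le h.1.1, h.2⟩
        refine (rtg_symm ?_ (rtg_mono hsub (b x hx))).trans (rtg_mono hsub (b y hy))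
        exact fun u v h => ⟨by have := h.1; rwa [starAdj, dst_comm] at this, h.2.2, h.2.1⟩)
      (inv_nonneg.2 hη.le) (inv_mul_cancel₀ hη.ne').le
    rw [pow_zero] at this
    have h3' : (𝒢.card : ℝ) * ((2 : ℝ) ^ (3 ^ d + 1))⁻¹ ^ m ≤ 1 := by
      refine le_trans ?_ this
      rw [← nsmul_eq_mul]
      refine Finset.card_nsmul_le_sum _ _ _ fun F hF => ?_
      exact pow_le_pow_of_le_one (inv_nonneg.2 hη.le)
        (inv_le_one_of_one_le₀ (one_le_pow₀ one_le_two)) (hconn F hF).2.2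
    rw [inv_pow] at h3'
    rwa [← div_eq_mul_inv, div_le_one (pow_pos hη m)] at h3'
  have h4 : α ^ m * ∑ γ ∈ P, pathW ω γ ≤ α ^ m := mul_le_of_le_one_right (pow_nonneg hα m) h1
  have h5 : (𝒢.card : ℝ) * B ≤ (2 ^ (3 ^ d + 1)) ^ m * B := mul_le_mul_of_nonneg_right h3 hB0
  linarith

end walk

section upper

variable {d : ℕ}

/-- A finite connected set containing the origin lies in the box whose size is its cardinality. -/
lemma subset_box_of_conn {ω : Config d} {F : Finset (Zd d)} (h0 : 0 ∈ F)
    (hF : ∀ y ∈ F, ReflTransGen (restr (openAdj ω) ↑F) 0 y) {m : ℕ} (hm : F.card ≤ m) :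
    (F : Set (Zd d)) ⊆ box d m := by
  intro y hy
  have hle : dst y 0 ≤ F.card := by
    have hsub : Finset.range (dst y 0) ⊆ F.image fun z => dst z 0 := by
      intro j hj
      rw [Finset.mem_range] at hj
      rcases j.eq_zero_or_pos with rfl | hj0
      · exact Finset.mem_image.2 ⟨0, h0, dst_self 0⟩
      · obtain ⟨a, b, -, ha, hab, hb, -⟩ := rtg_exit (S := {z | dst z 0 < j}) (hF y hy)
          (show dst (0 : Zd d) 0 < j by rw [dst_self]; exact hj0) (not_lt.2 hj.le)
        refine Finset.mem_image.2 ⟨b, hab.2.2, ?_⟩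
        have h1 := dst_triangle b a 0
        have h2 : dst b a ≤ 1 := by rw [dst_comm]; exact hab.1.1.dst_le
        have h3 : ¬ dst b 0 < j := hb
        have h4 : dst a 0 < j := ha
        show dst b 0 = j
        omega
    have := (Finset.card_le_card hsub).trans Finset.card_image_le
    rwa [Finset.card_range] at this
  rw [box_eq_ball]
  exact hle.trans hm

lemma bdry_nonempty {ω : Config d} (hinf : (cluster ω).Infinite) {A : Set (Zd d)} (hA : A.Finite)
    {x : Zd d} (hx : x ∈ A) (hx0 : x ∈ cluster ω) : (bdry ω A).Nonempty := by
  by_contra hc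
  rw [Set.not_nonempty_iff_eq_empty] at hc
  refine hinf (hA.subset fun y hy => ?_)
  refine rtg_of_closed ((rtg_symm (fun _ _ h => h.symm) hx0).trans hy) (fun a b ha hab => ?_) hx
  by_contra hb
  have : (a, b) ∈ bdry ω A := ⟨hab, ha, hb⟩
  rw [hc] at this
  exact this

/-- The isoperimetric inequality for all connected subsets, at the price of the factor `m`. -/
lemma conn_iso {ω : Config d} (hd : 1 ≤ d) (hinf : (cluster ω).Infinite) {m K : ℕ}
    (hiso : ∀ A : Set (Zd d), A ⊆ box d m → ConnOpen ω A → m ≤ A.ncard ^ d →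
      A.ncard ^ (d - 1) ≤ K * (bdry ω A).ncard ^ d)
    {A : Set (Zd d)} (hA : A ⊆ box d m) (hc : ConnOpen ω A) (hAc : A ⊆ cluster ω)
    (hne : A.Nonempty) (hcard : A.ncard ≤ m) :
    A.ncard ^ d ≤ m * (K + 1) * (bdry ω A).ncard ^ d := by
  have hfin : A.Finite := (box_eq_ball (d := d) m ▸ ball_finite (0 : Zd d) m).subset hA
  obtain ⟨x, hx⟩ := hne
  have hb : 1 ≤ (bdry ω A).ncard ^ d := Nat.one_le_pow _ _
    ((Set.ncard_pos (bdry_finite hfin)).2 (bdry_nonempty hinf hfin hx (hAc hx)))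
  rcases le_total m (A.ncard ^ d) with h | h
  · calc A.ncard ^ d = A.ncard * A.ncard ^ (d - 1) := by rw [← pow_succ', Nat.sub_add_cancel hd]
      _ ≤ m * (K * (bdry ω A).ncard ^ d) := Nat.mul_le_mul hcard (hiso A hA hc h)
      _ ≤ m * (K + 1) * (bdry ω A).ncard ^ d := by
        rw [mul_assoc]; gcongr; omega
  · calc A.ncard ^ d ≤ m * 1 * 1 := by simpa using h
      _ ≤ _ := Nat.mul_le_mul (Nat.mul_le_mul_left m (Nat.le_add_left 1 K)) hb

lemma set_iso {ω : Config d} (hd : 1 ≤ d) (hinf : (cluster ω).Infinite) {m K : ℕ}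
    (hiso : ∀ A : Set (Zd d), A ⊆ box d m → ConnOpen ω A → m ≤ A.ncard ^ d →
      A.ncard ^ (d - 1) ≤ K * (bdry ω A).ncard ^ d) {H : ℝ} (hH : 0 ≤ H)
    (hHm : (m : ℝ) * (K + 1) ≤ H ^ d) (k : ℕ) :
    ∀ A : Set (Zd d), A ⊆ box d m → A ⊆ cluster ω → A.ncard ≤ m → A.ncard ≤ k →
      (A.ncard : ℝ) ≤ H * (bdry ω A).ncard := by
  induction k with
  | zero =>
    intro A _ _ _ hk
    have : A.ncard = 0 := by omega
    rw [this]
    push_cast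
    positivity
  | succ k ih =>
    intro A hA hAc hAm hk
    have hfin : A.Finite := (box_eq_ball (d := d) m ▸ ball_finite (0 : Zd d) m).subset hA
    rcases A.eq_empty_or_nonempty with rfl | ⟨x, hx⟩
    · rw [Set.ncard_empty]; push_cast; positivity
    set B : Set (Zd d) := {y | ReflTransGen (restr (openAdj ω) A) x y} with hB
    have hxB : x ∈ B := ReflTransGen.refl
    have hBA : B ⊆ A := fun y hy => by
      rcases ReflTransGen.cases_tail hy with h | ⟨z, -, hz⟩
      · exact h ▸ hx
      · exact hz.2.2
    have hstep : ∀ a ∈ B, ∀ b ∈ A, openAdj ω a b → b ∈ B := fun a ha b hb hab =>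
      ReflTransGen.tail ha ⟨hab, hBA ha, hb⟩
    have hBconn : ConnOpen ω B := by
      have h1 : ∀ y ∈ B, ReflTransGen (restr (openAdj ω) B) x y := by
        intro y hy
        have hy' : ReflTransGen (restr (openAdj ω) A) x y := hy
        induction hy' with
        | refl => exact .refl
        | tail hb hbc ihb => exact (ihb hb).tail ⟨hbc.1, hb, hy⟩
      intro a ha b hb
      exact (rtg_symm (fun u v h => ⟨h.1.symm, h.2.2, h.2.1⟩) (h1 a ha)).trans (h1 b hb)
    have hBfin := hfin.subset hBA
    have hBcard : B.ncard ≤ m := (Set.ncard_le_ncard hBA hfin).trans hAm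
    have h1 : (B.ncard : ℝ) ≤ H * (bdry ω B).ncard := by
      have := conn_iso hd hinf hiso (hBA.trans hA) hBconn (hBA.trans hAc) ⟨x, hxB⟩ hBcard
      refine le_of_pow_le_pow_left₀ (n := d) (by omega) (by positivity) ?_
      rw [mul_pow]
      refine le_trans ?_ (mul_le_mul_of_nonneg_right hHm (by positivity))
      exact_mod_cast this
    have hcardsum : B.ncard + (A \ B).ncard = A.ncard := by
      rw [add_comm]; exact Set.ncard_sdiff_add_ncard_of_subset hBA hfin
    have hBpos : 0 < B.ncard := (Set.ncard_pos hBfin).2 ⟨x, hxB⟩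
    have h2 := ih (A \ B) (Set.sdiff_subset.trans hA) (Set.sdiff_subset.trans hAc) (by omega)
      (by omega)
    have h3 : (bdry ω B).ncard + (bdry ω (A \ B)).ncard ≤ (bdry ω A).ncard := by
      rw [← Set.ncard_union_eq ?_ (bdry_finite hBfin) (bdry_finite (hfin.subset Set.sdiff_subset))]
      · refine Set.ncard_le_ncard ?_ (bdry_finite hfin)
        rintro ⟨a, b⟩ (⟨h, ha, hb⟩ | ⟨h, ha, hb⟩)
        · exact ⟨h, hBA ha, fun hbA => hb (hstep a ha b hbA h)⟩
        · refine ⟨h, ha.1, fun hbA => ?_⟩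
          by_cases hbB : b ∈ B
          · exact ha.2 (hstep b hbB a ha.1 h.symm)
          · exact hb ⟨hbA, hbB⟩
      · rw [Set.disjoint_left]
        rintro ⟨a, b⟩ h h'
        exact h'.2.1.2 h.2.1
    have h4 : ((bdry ω B).ncard : ℝ) + (bdry ω (A \ B)).ncard ≤ (bdry ω A).ncard := by
      exact_mod_cast h3
    have h5 : (A.ncard : ℝ) = B.ncard + (A \ B).ncard := by exact_mod_cast hcardsum.symm
    nlinarith

/-- Probability of staying in a small connected set. -/
lemma surv_sq_le {ω : Config d} (hd : 1 ≤ d) (hinf : (cluster ω).Infinite) {m K : ℕ}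
    (hiso : ∀ A : Set (Zd d), A ⊆ box d m → ConnOpen ω A → m ≤ A.ncard ^ d →
      A.ncard ^ (d - 1) ≤ K * (bdry ω A).ncard ^ d) {H : ℝ} (hH : 1 ≤ H)
    (hHm : (m : ℝ) * (K + 1) ≤ H ^ d) {F : Finset (Zd d)} (h0 : 0 ∈ F)
    (hF : ∀ y ∈ F, ReflTransGen (restr (openAdj ω) ↑F) 0 y) (hFm : F.card ≤ m) (n : ℕ) :
    surv ω F n 0 ^ 2 ≤ ((1 - 1 / (2 * (3 ^ d * H) ^ 2)) ^ n) ^ 2 * (3 ^ d * m) := by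
  classical
  set h : ℝ := 1 / (3 ^ d * H) with hh
  set κ : ℝ := 1 - 1 / (2 * (3 ^ d * H) ^ 2) with hκ
  have h3 : (1 : ℝ) ≤ 3 ^ d := one_le_pow₀ (by norm_num)
  have h3H : 1 ≤ 3 ^ d * H := one_le_mul_of_one_le_of_one_le h3 hH
  have hh0 : 0 ≤ h := by positivity
  have hh1 : h ≤ 1 := by rw [hh, div_le_one (by positivity)]; exact h3H
  have hκh : κ = 1 - h ^ 2 / 2 := by rw [hκ, hh]; field_simp
  have hκ0 : 0 < κ := by rw [hκh]; nlinarith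
  have hbox := subset_box_of_conn h0 hF hFm
  have hcl : (F : Set (Zd d)) ⊆ cluster ω := fun y hy =>
    rtg_mono (fun _ _ h => h.1) (hF y hy)
  set ν : Zd d → ℝ := fun x => nu ω x with hν
  have hν0 : ∀ x ∈ F, 0 ≤ ν x := fun x _ => Nat.cast_nonneg _
  set U : Finset (Zd d) := F ∪ F.biUnion fun x => (openNbrs_finite ω x).toFinset with hU
  have hFU : F ⊆ U := Finset.subset_union_left
  have hUn : ∀ x ∈ F, ∀ y, openAdj ω x y → y ∈ U := fun x hx y hy =>
    Finset.mem_union_right _ (Finset.mem_biUnion.2 ⟨x, hx, by simpa using hy⟩)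
  have hisoF : ∀ A ⊆ F, h * ∑ x ∈ A, ν x ≤ ∑ x ∈ A, ∑ y ∈ U \ A, conduct ω x y := by
    intro A hA
    have e1 : ∑ x ∈ A, ν x ≤ 3 ^ d * A.card := by
      rw [mul_comm, ← nsmul_eq_mul]
      exact Finset.sum_le_card_nsmul _ _ _ fun x _ => by
        simp only [hν]; exact_mod_cast nu_le ω x
    have e2 := set_iso hd hinf hiso (zero_le_one.trans hH) hHm m (A : Set (Zd d))
      ((Finset.coe_subset.2 hA).trans hbox) ((Finset.coe_subset.2 hA).trans hcl)
      (by rw [Set.ncard_coe_finset]; exact (Finset.card_le_card hA).trans hFm)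
      (by rw [Set.ncard_coe_finset]; exact (Finset.card_le_card hA).trans hFm)
    have e3 : ((bdry ω (A : Set (Zd d))).ncard : ℝ) ≤
        ∑ x ∈ A, ∑ y ∈ U \ A, conduct ω x y := by
      set T := (A ×ˢ (U \ A)).filter fun q => openAdj ω q.1 q.2 with hT
      have f1 : bdry ω (A : Set (Zd d)) ⊆ T := by
        rintro ⟨a, b⟩ ⟨u1, u2, u3⟩
        refine Finset.mem_coe.2 (Finset.mem_filter.2 ⟨Finset.mem_product.2
          ⟨u2, Finset.mem_sdiff.2 ⟨hUn a (hA u2) b u1, u3⟩⟩, u1⟩)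
      have f2 := Set.ncard_le_ncard f1 T.finite_toSet
      rw [Set.ncard_coe_finset] at f2
      refine le_trans (Nat.cast_le.2 f2) (le_of_eq ?_)
      rw [← Finset.sum_product', Finset.card_eq_sum_ones, hT, Finset.sum_filter]
      push_cast
      refine Finset.sum_congr rfl fun q _ => ?_
      split_ifs with hq
      · rw [conduct_of_open hq]
      · rw [conduct_of_not_open hq]
    rw [Set.ncard_coe_finset] at e2
    refine le_trans ?_ e3
    calc h * ∑ x ∈ A, ν x ≤ h * (3 ^ d * A.card) := mul_le_mul_of_nonneg_left e1 hh0
      _ = A.card / H := by rw [hh]; field_simp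
      _ ≤ _ := by rw [div_le_iff₀ (by linarith), mul_comm]; exact e2
  have hrev : ∀ x ∈ F, ∀ y ∈ F, ν x * step ω x y = ν y * step ω y x := fun x _ y _ => by
    rw [hν]; simp only [nu_mul_step, conduct_symm ω x y]
  have hform : ∀ f : Zd d → ℝ, |ip F ν f (kop F (step ω) f)| ≤ κ * ip F ν f f := by
    intro f
    set f' : Zd d → ℝ := fun x => if x ∈ F then |f x| else 0 with hf'
    have c := cheeger (F := F) (ν := ν) hFU (conduct_nonneg ω) (conduct_symm ω)
      (fun x hx => sum_conduct_eq ω x (hUn x hx)) hh0 hisoF f'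
      (fun x => by simp only [hf']; split_ifs <;> positivity) (fun x hx => if_neg hx)
    have eN : ∑ x ∈ F, ν x * f' x ^ 2 = ip F ν f f := Finset.sum_congr rfl fun x hx => by
      simp only [hf', if_pos hx, sq_abs]; ring
    have eD : |ip F ν f (kop F (step ω) f)| ≤ ∑ x ∈ F, ∑ y ∈ F, conduct ω x y * f' x * f' y := by
      rw [ip_kop]
      refine (Finset.abs_sum_le_sum_abs _ _).trans (Finset.sum_le_sum fun x hx => ?_)
      refine (Finset.abs_sum_le_sum_abs _ _).trans (Finset.sum_le_sum fun y hy => le_of_eq ?_)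
      simp only [hν, nu_mul_step, hf', if_pos hx, if_pos hy, abs_mul,
        abs_of_nonneg (conduct_nonneg ω x y)]
    rw [eN] at c
    have hN := ip_self_nonneg hν0 f
    refine eD.trans (abs_le_of_sq_le_sq' ?_ (by positivity)).2
    refine c.trans ?_
    rw [mul_pow]
    refine mul_le_mul_of_nonneg_right ?_ (sq_nonneg _)
    rw [hκh]; nlinarith [sq_nonneg (h ^ 2)]
  have hiter : ∀ n, ip F ν ((kop F (step ω))^[n] 1) ((kop F (step ω))^[n] 1) ≤
      (κ ^ n) ^ 2 * ip F ν 1 1 := by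
    intro n
    induction n with
    | zero => simp
    | succ n ih =>
      rw [Function.iterate_succ_apply']
      refine (norm_kop_le hrev hκ0 hform _).trans ?_
      calc κ ^ 2 * _ ≤ κ ^ 2 * ((κ ^ n) ^ 2 * ip F ν 1 1) :=
            mul_le_mul_of_nonneg_left ih (sq_nonneg _)
        _ = _ := by ring
  have hone : ip F ν 1 1 ≤ 3 ^ d * m := by
    have : ip F ν 1 1 ≤ F.card • (3 : ℝ) ^ d := Finset.sum_le_card_nsmul _ _ _ fun x _ => by
      simp only [Pi.one_apply, mul_one, hν]; exact_mod_cast nu_le ω x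
    rw [nsmul_eq_mul, mul_comm] at this
    exact this.trans (mul_le_mul_of_nonneg_left (by exact_mod_cast hFm) (by positivity))
  have hν1 : 1 ≤ ν 0 := by
    obtain ⟨⟨a, b⟩, h1, h2, -⟩ := bdry_nonempty hinf (Set.finite_singleton (0 : Zd d))
      (Set.mem_singleton _) ReflTransGen.refl
    rw [Set.mem_singleton_iff] at h2
    simp only at h1 h2
    rw [h2] at h1
    have : 1 ≤ nu ω 0 := nu_pos h1
    exact (Nat.one_le_cast (α := ℝ)).2 this
  rw [surv_eq_kop ω F n 0 h0]
  set g := (kop F (step ω))^[n] 1 with hg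
  calc g 0 ^ 2 ≤ ν 0 * g 0 * g 0 := by nlinarith [sq_nonneg (g 0)]
    _ ≤ ip F ν g g := Finset.single_le_sum (f := fun x => ν x * g x * g x) (fun x hx => by
        rw [mul_assoc]; exact mul_nonneg (hν0 x hx) (mul_self_nonneg _)) h0
    _ ≤ (κ ^ n) ^ 2 * ip F ν 1 1 := hiter n
    _ ≤ _ := mul_le_mul_of_nonneg_left hone (by positivity)

end upper

/-- The isoperimetric inequality for the sets inside the box of size `v`. -/
def IsoAt {d : ℕ} (ω : Config d) (K v : ℕ) : Prop :=
  ∀ A : Set (Zd d), A ⊆ box d v → ConnOpen ω A → v ≤ A.ncard ^ d →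
    A.ncard ^ (d - 1) ≤ K * (bdry ω A).ncard ^ d

set_option maxHeartbeats 1000000 in
/-- The upper bound for the Laplace transform, with `n = ρ ^ (d + 2)`. -/
lemma laplaceN_upper {d : ℕ} (hd : 1 ≤ d) (K : ℕ) {α : ℝ} (hα0 : 0 < α) (hα1 : α < 1) :
    ∃ Cs > (0 : ℝ), ∀ v0 : ℕ, ∃ ρ0 : ℝ, ∀ ω : Config d, (cluster ω).Infinite →
      (∀ v ≥ v0, IsoAt ω K v) → ∀ (n : ℕ) (ρ : ℝ), ρ0 ≤ ρ → ρ ^ (d + 2) = n →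
        LaplaceN ω α n ≤ Real.exp (-Cs * ρ ^ d) := by
  set T : ℝ := 3 ^ d with hT
  have hT1 : 1 ≤ T := one_le_pow₀ (by norm_num)
  set θ : ℝ := 1 / (2 * T ^ 2 * (T + 3)) with hθ
  have hθ0 : 0 < θ := by positivity
  have hθ1 : θ ≤ 1 := by
    rw [hθ, div_le_one (by positivity)]; nlinarith
  set ε : ℝ := θ ^ d / (2 * (K + 1)) with hε
  have hε0 : 0 < ε := by positivity
  have hε1 : 2 * ε ≤ 1 := by
    have h1 : θ ^ d ≤ 1 := pow_le_one₀ hθ0.le hθ1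
    have h2 : 2 * ε * (K + 1) = θ ^ d := by rw [hε]; field_simp
    have h3 : (0 : ℝ) ≤ K := Nat.cast_nonneg K
    nlinarith
  set b : ℝ := -Real.log α with hb
  have hb0 : 0 < b := by rw [hb]; linarith [Real.log_neg hα0 hα1]
  have hαb : α = Real.exp (-b) := by rw [hb, neg_neg, Real.exp_log hα0]
  set c : ℝ := min (ε * b) 1 with hc
  have hc0 : 0 < c := lt_min (by positivity) one_pos
  refine ⟨c / 2, by positivity, fun v0 => ⟨max (max 1 (1 / θ)) (max (max (1 / ε) (v0 / ε))
    (max (2 / c) (4 * T))), fun ω hinf hiso n ρ hρ hn => ?_⟩⟩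
  simp only [max_le_iff] at hρ
  obtain ⟨⟨hρ1, hρθ⟩, ⟨hρε, hρv⟩, hρc, hρT⟩ := hρ
  set t : ℝ := ρ ^ d with ht
  have hρt : ρ ≤ t := le_self_pow₀ hρ1 (by omega)
  have hρ0 : 0 < ρ := by linarith
  have ht0 : 0 < t := by positivity
  set m : ℕ := ⌈ε * t⌉₊ with hm
  have hεt : 1 ≤ ε * t := by
    rw [div_le_iff₀ hε0] at hρε; nlinarith
  have hm1 : ε * t ≤ m := Nat.le_ceil _
  have hm2 : (m : ℝ) ≤ 2 * ε * t := by
    have := Nat.ceil_lt_add_one (a := ε * t) (by positivity)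
    linarith
  have hmv : v0 ≤ m := by
    rw [div_le_iff₀ hε0] at hρv
    have : (v0 : ℝ) ≤ m := by nlinarith
    exact_mod_cast this
  have hmt : (m : ℝ) ≤ t := hm2.trans (mul_le_of_le_one_left ht0.le hε1)
  set H : ℝ := θ * ρ with hH
  have hH1 : 1 ≤ H := by rw [div_le_iff₀ hθ0] at hρθ; linarith
  have hHm : (m : ℝ) * (K + 1) ≤ H ^ d := by
    have h2 : 2 * ε * (K + 1) = θ ^ d := by rw [hε]; field_simp
    rw [hH, mul_pow, ← h2, ← ht]
    have h3 : (0 : ℝ) ≤ K := Nat.cast_nonneg K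
    nlinarith
  set κ : ℝ := 1 - 1 / (2 * (3 ^ d * H) ^ 2) with hκ
  have hκ0 : 0 ≤ κ := by
    have : 1 ≤ (T * H) ^ 2 := one_le_pow₀ (one_le_mul_of_one_le_of_one_le hT1 hH1)
    rw [hκ, sub_nonneg, div_le_one (by positivity)]; linarith
  set B : ℝ := κ ^ n * (T * m) with hB
  have hm1' : (1 : ℝ) ≤ m := hεt.trans hm1
  have hTm : 1 ≤ T * m := one_le_mul_of_one_le_of_one_le hT1 hm1'
  have hB0 : 0 ≤ B := by positivity
  have hmain := laplaceN_le ω hα0.le hα1.le m n hB0 fun F h0 hF hFm => by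
    have := surv_sq_le hd hinf (hiso m hmv) hH1 hHm h0 hF hFm n
    refine (abs_le_of_sq_le_sq' (this.trans ?_) hB0).2
    rw [hB, mul_pow (κ ^ n)]
    exact mul_le_mul_of_nonneg_left (le_self_pow₀ hTm two_ne_zero) (sq_nonneg (κ ^ n))
  refine hmain.trans ?_
  have hκn : κ ^ n ≤ Real.exp (-(T + 3) * t) := by
    have h1 : κ ≤ Real.exp (-(1 / (2 * (3 ^ d * H) ^ 2))) := by
      have := Real.add_one_le_exp (-(1 / (2 * (3 ^ d * H) ^ 2)))
      rw [hκ]; linarith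
    refine (pow_le_pow_left₀ hκ0 h1 n).trans ?_
    rw [← Real.exp_nat_mul, Real.exp_le_exp]
    have h2 : (n : ℝ) * -(1 / (2 * (3 ^ d * H) ^ 2)) = -(t / (2 * T ^ 2 * θ ^ 2)) := by
      rw [← hn, hH, ← hT, ht]; field_simp; ring
    rw [h2, neg_mul, neg_le_neg_iff, le_div_iff₀ (by positivity)]
    have h3 : 2 * T ^ 2 * (T + 3) * θ = 1 := by rw [hθ]; field_simp
    have h4 : (T + 3) * (2 * T ^ 2 * θ ^ 2) ≤ 1 := by
      calc (T + 3) * (2 * T ^ 2 * θ ^ 2) = (2 * T ^ 2 * (T + 3) * θ) * θ := by ring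
        _ ≤ 1 := by rw [h3, one_mul]; exact hθ1
    nlinarith
  have h2m : ((2 : ℝ) ^ (3 ^ d + 1)) ^ m ≤ Real.exp ((T + 1) * t) := by
    have h1 : (2 : ℝ) ≤ Real.exp 1 := by linarith [Real.add_one_le_exp (1 : ℝ)]
    rw [← pow_mul]
    refine (pow_le_pow_left₀ zero_le_two h1 _).trans ?_
    rw [← Real.exp_nat_mul, mul_one, Real.exp_le_exp]
    push_cast
    rw [← hT]
    exact mul_le_mul_of_nonneg_left hmt (by linarith)
  have hTt : T * m ≤ 1 / 2 * Real.exp t := by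
    have h1 := Real.quadratic_le_exp_of_nonneg ht0.le
    have h3 : T * m ≤ T * t := mul_le_mul_of_nonneg_left hmt (by linarith)
    have h4 : 4 * T * t ≤ t * t := mul_le_mul_of_nonneg_right (hρT.trans hρt) ht0.le
    linarith
  have hsecond : ((2 : ℝ) ^ (3 ^ d + 1)) ^ m * B ≤ 1 / 2 * Real.exp (-t) := by
    have e : 1 / 2 * Real.exp (-t) =
        Real.exp ((T + 1) * t) * (Real.exp (-(T + 3) * t) * (1 / 2 * Real.exp t)) := by
      have : -t = (T + 1) * t + (-(T + 3) * t + t) := by ring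
      rw [this, Real.exp_add, Real.exp_add]; ring
    rw [e]
    exact mul_le_mul h2m (mul_le_mul hκn hTt (by positivity) (Real.exp_pos _).le) hB0
      (Real.exp_pos _).le
  have hfirst : α ^ m ≤ Real.exp (-c * t) := by
    rw [hαb, ← Real.exp_nat_mul, Real.exp_le_exp]
    have h1 : c * t ≤ ε * b * t := mul_le_mul_of_nonneg_right (min_le_left _ _) ht0.le
    have h2 : ε * t * b ≤ m * b := mul_le_mul_of_nonneg_right hm1 hb0.le
    linarith
  have hsecond' : Real.exp (-t) ≤ Real.exp (-c * t) := by
    rw [Real.exp_le_exp]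
    have : c * t ≤ 1 * t := mul_le_mul_of_nonneg_right (min_le_right _ _) ht0.le
    linarith
  have hfin : Real.exp (-c * t) = Real.exp (-(c / 2) * t) * Real.exp (-(c / 2) * t) := by
    rw [← Real.exp_add]; congr 1; ring
  have hsmall : 2 * Real.exp (-(c / 2) * t) ≤ 1 := by
    have h1 : 1 ≤ c / 2 * t := by
      rw [div_le_iff₀ hc0] at hρc
      have := mul_le_mul_of_nonneg_right hρt hc0.le
      linarith
    have h2 := Real.add_one_le_exp (c / 2 * t)
    rw [neg_mul, Real.exp_neg, ← div_eq_mul_inv, div_le_one (Real.exp_pos _)]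
    linarith
  have h1 := mul_le_mul_of_nonneg_right hsmall (Real.exp_pos (-(c / 2) * t)).le
  linarith [Real.exp_pos (-(c / 2) * t)]

section growth

variable {d : ℕ}

lemma clusterN_subset_box (ω : Config d) (k : ℕ) : clusterN ω k ⊆ box d k := by
  intro y hy
  rcases ReflTransGen.cases_tail hy with h | ⟨z, -, hz⟩
  · rw [h, box_eq_ball, mem_ball]; simp
  · exact hz.2.2

lemma clusterN_finite (ω : Config d) (k : ℕ) : (clusterN ω k).Finite :=
  (box_eq_ball (d := d) k ▸ ball_finite (0 : Zd d) k).subset (clusterN_subset_box ω k)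

lemma zero_mem_clusterN (ω : Config d) (k : ℕ) : 0 ∈ clusterN ω k := ReflTransGen.refl

lemma clusterN_subset_cluster (ω : Config d) (k : ℕ) : clusterN ω k ⊆ cluster ω :=
  fun _ hy => rtg_mono (fun _ _ h => h.1) hy

lemma clusterN_conn_zero (ω : Config d) (k : ℕ) {y : Zd d} (hy : y ∈ clusterN ω k) :
    ReflTransGen (restr (openAdj ω) (clusterN ω k)) 0 y := by
  have hy' : ReflTransGen (restr (openAdj ω) (box d k)) 0 y := hy
  induction hy' with
  | refl => exact .refl
  | tail hb hbc ih => exact (ih hb).tail ⟨hbc.1, hb, hy⟩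

lemma clusterN_conn (ω : Config d) (k : ℕ) : ConnOpen ω (clusterN ω k) := fun _ ha _ hb =>
  (rtg_symm (fun _ _ h => ⟨h.1.symm, h.2.2, h.2.1⟩) (clusterN_conn_zero ω k ha)).trans
    (clusterN_conn_zero ω k hb)

lemma clusterN_mono (ω : Config d) {j k : ℕ} (h : j ≤ k) : clusterN ω j ⊆ clusterN ω k := by
  have hb : box d j ⊆ box d k := by
    rw [box_eq_ball, box_eq_ball]
    exact ball_subset (by rw [dst_self]; omega)
  exact fun y hy => rtg_mono (fun a b h => ⟨h.1, hb h.2.1, hb h.2.2⟩) hy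

lemma clusterN_edge {ω : Config d} {k : ℕ} {a b : Zd d} (ha : a ∈ clusterN ω k)
    (hb : b ∉ clusterN ω k) (hab : openAdj ω a b) : k < dst b 0 := by
  by_contra hc
  have : b ∈ box d k := by rw [box_eq_ball]; exact not_lt.1 hc
  exact hb (ReflTransGen.tail ha ⟨hab, clusterN_subset_box ω k ha, this⟩)

lemma clusterN_edge' {ω : Config d} {k : ℕ} {a b : Zd d} (ha : a ∈ clusterN ω k)
    (hb : b ∉ clusterN ω k) (hab : openAdj ω a b) : k ≤ dst a 0 := by
  have h1 := clusterN_edge ha hb hab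
  have h2 := dst_triangle b a 0
  have h3 : dst b a ≤ 1 := by rw [dst_comm]; exact hab.1.dst_le
  omega

lemma le_ncard_clusterN {ω : Config d} (hinf : (cluster ω).Infinite) (k : ℕ) :
    k ≤ (clusterN ω k).ncard := by
  obtain ⟨⟨a, b⟩, hab, ha, hb⟩ := bdry_nonempty hinf (clusterN_finite ω k) (zero_mem_clusterN ω k)
    ReflTransGen.refl
  have h1 := clusterN_edge' ha hb hab
  have hfin := clusterN_finite ω k
  have hco : ((hfin.toFinset : Finset (Zd d)) : Set (Zd d)) = clusterN ω k := hfin.coe_toFinset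
  have h2 := subset_box_of_conn (ω := ω) (F := hfin.toFinset)
    (by rw [Set.Finite.mem_toFinset]; exact zero_mem_clusterN ω k)
    (fun y hy => by rw [hco]; exact clusterN_conn_zero ω k ((Set.Finite.mem_toFinset _).1 hy))
    le_rfl
  rw [hco, box_eq_ball, ← Set.ncard_eq_toFinset_card _ hfin] at h2
  exact h1.trans (h2 ha)

lemma growth_step {ω : Config d} (hd : 1 ≤ d) (hinf : (cluster ω).Infinite) {K k : ℕ}
    (hiso : IsoAt ω K (k + 1)) :
    (clusterN ω (k + 1)).ncard ^ (d - 1) ≤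
      K * (3 ^ d * ((clusterN ω (k + 1)).ncard - (clusterN ω k).ncard)) ^ d := by
  classical
  have h1 := le_ncard_clusterN hinf (k + 1)
  have h2 := hiso _ (clusterN_subset_box ω (k + 1)) (clusterN_conn ω (k + 1))
    (h1.trans (Nat.le_self_pow (by omega) _))
  refine h2.trans ?_
  gcongr
  have hfin := clusterN_finite ω (k + 1)
  have hsub := clusterN_mono ω (Nat.le_succ k)
  rw [← Set.ncard_sdiff hsub (clusterN_finite ω k)]
  set S := clusterN ω (k + 1) \ clusterN ω k with hS
  have hSfin : S.Finite := hfin.subset Set.sdiff_subset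
  set T := hSfin.toFinset.sigma fun x => (openNbrs_finite ω x).toFinset with hT
  have hTc : T.card ≤ 3 ^ d * S.ncard := by
    rw [hT, Finset.card_sigma, mul_comm, Set.ncard_eq_toFinset_card S hSfin, ← smul_eq_mul]
    refine Finset.sum_le_card_nsmul _ _ _ fun x _ => ?_
    rw [← Set.ncard_eq_toFinset_card _ (openNbrs_finite ω x)]
    exact nu_le ω x
  refine le_trans ?_ hTc
  have : bdry ω (clusterN ω (k + 1)) ⊆ (T.image fun q => (q.1, q.2) : Finset (Zd d × Zd d)) := by
    rintro ⟨a, b⟩ ⟨hab, ha, hb⟩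
    refine Finset.mem_coe.2 (Finset.mem_image.2 ⟨⟨a, b⟩, Finset.mem_sigma.2 ⟨?_, ?_⟩, rfl⟩)
    · rw [Set.Finite.mem_toFinset]
      refine ⟨ha, fun hc => ?_⟩
      have h3 := clusterN_edge' ha hb hab
      have h4 := clusterN_subset_box ω k hc
      rw [box_eq_ball] at h4
      have : dst a 0 ≤ k := h4
      simp only at h3
      omega
    · rw [Set.Finite.mem_toFinset]; exact hab
  refine (Set.ncard_le_ncard this (Finset.finite_toSet _)).trans ?_
  rw [Set.ncard_coe_finset]
  exact Finset.card_image_le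

lemma pow_growth {d : ℕ} (hd : 1 ≤ d) (K' : ℕ) : ∃ δ > (0 : ℝ), δ ≤ 1 ∧ ∀ (s : ℕ → ℕ) (v0 : ℕ),
    (∀ k, 1 ≤ s k) → Monotone s →
    (∀ k ≥ v0, s (k + 1) ^ (d - 1) ≤ K' * (s (k + 1) - s k) ^ d) →
    ∀ j, (δ * j) ^ d ≤ s (v0 + j) := by
  obtain ⟨e, rfl⟩ : ∃ e, d = e + 1 := ⟨d - 1, by omega⟩
  set c : ℝ := 1 / (K' + 1) with hc
  have hc0 : 0 < c := by positivity
  have hc1 : c ≤ 1 := by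
    rw [hc, div_le_one (by positivity)]; linarith [(Nat.cast_nonneg K' : (0 : ℝ) ≤ K')]
  set δ : ℝ := c / ((e + 1) * 2 ^ e) with hδ
  have hden : (1 : ℝ) ≤ (e + 1) * 2 ^ e := one_le_mul_of_one_le_of_one_le
    (by linarith [(Nat.cast_nonneg e : (0 : ℝ) ≤ e)]) (one_le_pow₀ one_le_two)
  have hδ0 : 0 < δ := by positivity
  have hδ1 : δ ≤ 1 := by rw [hδ, div_le_one (by positivity)]; linarith
  have hδc : (e + 1) * δ * 2 ^ e = c := by rw [hδ]; field_simp
  have hcK : (K' : ℝ) * c ^ (e + 1) ≤ 1 := by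
    have h1 : c ^ (e + 1) ≤ c := pow_le_of_le_one hc0.le hc1 (by omega)
    have h2 : (K' : ℝ) * c ≤ 1 := by
      rw [hc, mul_one_div, div_le_one (by positivity)]; linarith
    exact (mul_le_mul_of_nonneg_left h1 (Nat.cast_nonneg K')).trans h2
  refine ⟨δ, hδ0, hδ1, fun s v0 hs1 hmono hs j => ?_⟩
  induction j with
  | zero => simp
  | succ j ih =>
    have hy1 : (1 : ℝ) ≤ s (v0 + (j + 1)) := by exact_mod_cast hs1 _
    rcases j.eq_zero_or_pos with rfl | hj
    · refine le_trans ?_ hy1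
      simp only [zero_add, Nat.cast_one, mul_one]
      exact pow_le_one₀ hδ0.le hδ1
    have hj1 : (1 : ℝ) ≤ j := by exact_mod_cast hj
    have hstep := hs (v0 + j) (by omega)
    rw [add_assoc, Nat.add_sub_cancel] at hstep
    have hle : s (v0 + j) ≤ s (v0 + (j + 1)) := hmono (by omega)
    set x : ℝ := (s (v0 + j) : ℝ) with hx
    set y : ℝ := (s (v0 + (j + 1)) : ℝ) with hy
    have hxy : x ≤ y := Nat.cast_le.2 hle
    have hstep' : y ^ e ≤ K' * (y - x) ^ (e + 1) := by
      rw [hx, hy, ← Nat.cast_sub hle]; exact_mod_cast hstep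
    set b : ℝ := δ * j with hb
    have hb0 : 0 < b := by positivity
    have hdiff : c * b ^ e ≤ y - x := by
      refine le_of_pow_le_pow_left₀ (n := e + 1) (by omega) (by linarith) ?_
      have h1 : (b ^ e) ^ (e + 1) ≤ y ^ e := by
        rw [← pow_mul, mul_comm, pow_mul]
        exact pow_le_pow_left₀ (by positivity) (ih.trans hxy) e
      have h2 : 0 ≤ (y - x) ^ (e + 1) := pow_nonneg (by linarith) _
      calc (c * b ^ e) ^ (e + 1) = c ^ (e + 1) * (b ^ e) ^ (e + 1) := by rw [mul_pow]
        _ ≤ c ^ (e + 1) * (K' * (y - x) ^ (e + 1)) :=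
            mul_le_mul_of_nonneg_left (h1.trans hstep') (by positivity)
        _ = (K' * c ^ (e + 1)) * (y - x) ^ (e + 1) := by ring
        _ ≤ _ := mul_le_of_le_one_left h2 hcK
    set a : ℝ := δ * ((j + 1 : ℕ) : ℝ) with ha
    have hab : a = b + δ := by rw [ha, hb]; push_cast; ring
    have ha0 : 0 < a := by positivity
    have ha2 : a ≤ 2 * b := by rw [hab, hb]; nlinarith
    have hbern : a ^ (e + 1) ≤ b ^ (e + 1) + (e + 1) * δ * a ^ e := by
      have h1 := one_add_mul_le_pow (a := b / a - 1) (by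
        have : 0 ≤ b / a := by positivity
        linarith) (e + 1)
      have h2 := mul_le_mul_of_nonneg_right h1 (pow_nonneg ha0.le (e + 1))
      rw [← mul_pow] at h2
      have h3 : (1 + (b / a - 1)) * a = b := by field_simp; ring
      have h4 : (1 + ((e + 1 : ℕ) : ℝ) * (b / a - 1)) * a ^ (e + 1) =
          a ^ (e + 1) - (e + 1) * δ * a ^ e := by
        have : b = a - δ := by linarith
        rw [this, pow_succ]; push_cast; field_simp; ring
      rw [h3, h4] at h2
      linarith
    have hae : a ^ e ≤ 2 ^ e * b ^ e := by
      rw [← mul_pow]; exact pow_le_pow_left₀ ha0.le ha2 e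
    have h5 : (e + 1) * δ * a ^ e ≤ c * b ^ e := by
      rw [← hδc]
      calc (e + 1) * δ * a ^ e ≤ (e + 1) * δ * (2 ^ e * b ^ e) :=
            mul_le_mul_of_nonneg_left hae (by positivity)
        _ = _ := by ring
    linarith

/-- The cluster inside a box has volume of the order of the box. -/
lemma volume_growth (hd : 1 ≤ d) (K : ℕ) : ∃ δ > (0 : ℝ), δ ≤ 1 ∧ ∀ (ω : Config d) (v0 : ℕ),
    (cluster ω).Infinite → (∀ v ≥ v0, IsoAt ω K v) →
    ∀ r : ℕ, 2 * v0 ≤ r → (δ * r) ^ d ≤ (clusterN ω r).ncard := by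
  obtain ⟨δ, hδ0, hδ1, h⟩ := pow_growth hd (K * (3 ^ d) ^ d)
  refine ⟨δ / 2, by positivity, by linarith, fun ω v0 hinf hiso r hr => ?_⟩
  have := h (fun k => (clusterN ω k).ncard) v0
    (fun k => (Set.ncard_pos (clusterN_finite ω k)).2 ⟨0, zero_mem_clusterN ω k⟩)
    (fun j k hjk => Set.ncard_le_ncard (clusterN_mono ω hjk) (clusterN_finite ω k))
    (fun k hk => by
      rw [mul_assoc, ← mul_pow]
      exact growth_step hd hinf (hiso (k + 1) (by omega))) (r - v0)
  simp only [Nat.add_sub_cancel' (show v0 ≤ r by omega)] at this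
  refine le_trans (pow_le_pow_left₀ (by positivity) ?_ d) this
  have h2 : (2 : ℝ) * v0 ≤ r := by exact_mod_cast hr
  rw [Nat.cast_sub (by omega)]
  nlinarith

end growth

section spectral

variable {X : Type*} {F : Finset X} {ν : X → ℝ} {s : X → X → ℝ}

lemma ip_kop_iterate (hrev : ∀ x ∈ F, ∀ y ∈ F, ν x * s x y = ν y * s y x) (k : ℕ) (f g : X → ℝ) :
    ip F ν f ((kop F s)^[k] g) = ip F ν ((kop F s)^[k] f) g := by
  induction k generalizing f with
  | zero => rfl
  | succ k ih =>
    rw [Function.iterate_succ_apply', ip_kop_symm hrev, ih, Function.iterate_succ_apply]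

/-- Log-convexity of the even moments of the killed kernel. -/
lemma pow_mul_le_ip_iterate (hν : ∀ x ∈ F, 0 ≤ ν x)
    (hrev : ∀ x ∈ F, ∀ y ∈ F, ν x * s x y = ν y * s y x) {lam : ℝ} (hlam : 0 < lam) (f : X → ℝ)
    (hf : 0 < ip F ν f f) (h : lam * ip F ν f f ≤ ip F ν f (kop F s f)) (k : ℕ) :
    lam ^ (2 * k) * ip F ν f f ≤ ip F ν f ((kop F s)^[2 * k] f) := by
  set b : ℕ → ℝ := fun k => ip F ν ((kop F s)^[k] f) ((kop F s)^[k] f) with hb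
  have hconv : ∀ k, b (k + 1) ^ 2 ≤ b k * b (k + 2) := by
    intro k
    have e : b (k + 1) = ip F ν ((kop F s)^[k] f) ((kop F s)^[k + 2] f) := by
      simp only [hb]
      rw [Function.iterate_succ_apply' _ (k + 1), ip_kop_symm hrev, Function.iterate_succ_apply']
    rw [e]
    exact ip_cauchy hν _ _
  have hkey : ∀ k, 0 < b k ∧ lam ^ 2 * b k ≤ b (k + 1) := by
    intro k
    induction k with
    | zero =>
      refine ⟨hf, ?_⟩
      have h1 : (lam * b 0) ^ 2 ≤ b 0 * b 1 :=
        (pow_le_pow_left₀ (mul_nonneg hlam.le hf.le) h 2).trans (ip_cauchy hν f (kop F s f))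
      have h2 : 0 < b 0 := hf
      refine le_of_mul_le_mul_left ?_ h2
      linarith
    | succ k ih =>
      obtain ⟨h1, h2⟩ := ih
      have h3 : 0 < b (k + 1) := lt_of_lt_of_le (by positivity) h2
      refine ⟨h3, le_of_mul_le_mul_left ?_ h1⟩
      have h4 := mul_le_mul_of_nonneg_right h2 h3.le
      have h5 := hconv k
      linarith
  have hpow : ∀ k, lam ^ (2 * k) * b 0 ≤ b k := by
    intro k
    induction k with
    | zero => simp
    | succ k ih =>
      refine le_trans ?_ (hkey k).2
      have := mul_le_mul_of_nonneg_left ih (sq_nonneg lam)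
      calc lam ^ (2 * (k + 1)) * b 0 = lam ^ 2 * (lam ^ (2 * k) * b 0) := by ring
        _ ≤ _ := this
  rw [two_mul k, Function.iterate_add_apply, ip_kop_iterate hrev, ← two_mul]
  exact hpow k

end spectral

section lower

variable {d : ℕ}

/-- The tent function of radius `R`. -/
def tent (R : ℕ) (x : Zd d) : ℝ := ((R - dst x 0 : ℕ) : ℝ)

lemma tent_nonneg (R : ℕ) (x : Zd d) : 0 ≤ tent R x := Nat.cast_nonneg _

lemma tent_le (R : ℕ) (x : Zd d) : tent R x ≤ R := Nat.cast_le.2 (Nat.sub_le _ _)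

lemma tent_le_sq (R : ℕ) (x : Zd d) : tent R x ≤ tent R x ^ 2 := by
  rw [tent]
  exact_mod_cast Nat.le_self_pow two_ne_zero _

lemma tent_sub_sq_le {ω : Config d} (R : ℕ) {x y : Zd d} (h : openAdj ω x y) :
    (tent R x - tent R y) ^ 2 ≤ 1 := by
  have h1 := dst_triangle x y 0
  have h2 := dst_triangle y x 0
  have h3 := h.1.dst_le
  rw [dst_comm y x] at h2
  have h4 : ((R - dst x 0 : ℕ) : ℤ) - ((R - dst y 0 : ℕ) : ℤ) ≤ 1 := by omega
  have h5 : -1 ≤ ((R - dst x 0 : ℕ) : ℤ) - ((R - dst y 0 : ℕ) : ℤ) := by omega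
  have h6 : |tent R x - tent R y| ≤ 1 := by
    rw [abs_le, tent, tent]
    constructor
    · exact_mod_cast h5
    · exact_mod_cast h4
  rw [← sq_abs]
  exact pow_le_one₀ (abs_nonneg _) h6

/-- The finite set of sites of the cluster inside a box. -/
noncomputable def clusterFin (ω : Config d) (k : ℕ) : Finset (Zd d) :=
  (clusterN_finite ω k).toFinset

lemma mem_clusterFin {ω : Config d} {k : ℕ} {x : Zd d} :
    x ∈ clusterFin ω k ↔ x ∈ clusterN ω k := Set.Finite.mem_toFinset _

lemma card_clusterFin (ω : Config d) (k : ℕ) : (clusterFin ω k).card = (clusterN ω k).ncard :=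
  (Set.ncard_eq_toFinset_card _ _).symm

lemma one_le_nu {ω : Config d} (hinf : (cluster ω).Infinite) {x : Zd d} (hx : x ∈ cluster ω) :
    (1 : ℝ) ≤ nu ω x := by
  obtain ⟨⟨a, b⟩, h1, h2, -⟩ := bdry_nonempty hinf (Set.finite_singleton x)
    (Set.mem_singleton _) hx
  rw [Set.mem_singleton_iff] at h2
  simp only at h1 h2
  rw [h2] at h1
  have : 1 ≤ nu ω x := nu_pos h1
  exact (Nat.one_le_cast (α := ℝ)).2 this

lemma tent_energy (ω : Config d) (R : ℕ) :
    ip (clusterFin ω R) (fun x => (nu ω x : ℝ)) (tent R) (tent R) -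
      3 ^ d * (clusterFin ω R).card ≤
    ip (clusterFin ω R) (fun x => (nu ω x : ℝ)) (tent R)
      (kop (clusterFin ω R) (step ω) (tent R)) := by
  set A := clusterFin ω R with hA
  set f : Zd d → ℝ := tent R with hf
  have hN : ip A (fun x => (nu ω x : ℝ)) f f = ∑ x ∈ A, ∑ y ∈ A, conduct ω x y * f x ^ 2 := by
    refine Finset.sum_congr rfl fun x hx => ?_
    rw [← Finset.sum_mul]
    by_cases h : ∀ y, openAdj ω x y → y ∈ A
    · rw [← sum_conduct_eq ω x h]
      show (nu ω x : ℝ) * f x * f x = nu ω x * f x ^ 2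
      ring
    · push Not at h
      obtain ⟨y, hxy, hy⟩ := h
      have := clusterN_edge' (mem_clusterFin.1 hx) (fun hc => hy (mem_clusterFin.2 hc)) hxy
      have h0 : f x = 0 := by
        rw [hf, tent, Nat.sub_eq_zero_of_le this, Nat.cast_zero]
      rw [h0]; ring
  have hN' : ip A (fun x => (nu ω x : ℝ)) f f = ∑ x ∈ A, ∑ y ∈ A, conduct ω x y * f y ^ 2 := by
    rw [hN, Finset.sum_comm]
    exact Finset.sum_congr rfl fun x _ => Finset.sum_congr rfl fun y _ => by rw [conduct_symm]
  have hD : ip A (fun x => (nu ω x : ℝ)) f (kop A (step ω) f) =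
      ∑ x ∈ A, ∑ y ∈ A, conduct ω x y * f x * f y := by
    rw [ip_kop]; simp only [nu_mul_step]
  have hE : ∑ x ∈ A, ∑ y ∈ A, conduct ω x y * (f x - f y) ^ 2 ≤ 3 ^ d * A.card := by
    rw [mul_comm, ← nsmul_eq_mul]
    refine Finset.sum_le_card_nsmul _ _ _ fun x _ => ?_
    refine le_trans (Finset.sum_le_sum fun y _ => ?_)
      ((sum_conduct_le ω x A).trans (by exact_mod_cast nu_le ω x))
    by_cases h : openAdj ω x y
    · exact mul_le_of_le_one_right (conduct_nonneg _ _ _) (tent_sub_sq_le R h)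
    · rw [conduct_of_not_open h, zero_mul]
  have hexp : ∑ x ∈ A, ∑ y ∈ A, conduct ω x y * (f x - f y) ^ 2 =
      2 * ip A (fun x => (nu ω x : ℝ)) f f -
        2 * ip A (fun x => (nu ω x : ℝ)) f (kop A (step ω) f) := by
    have : ∀ x y, conduct ω x y * (f x - f y) ^ 2 =
        conduct ω x y * f x ^ 2 + conduct ω x y * f y ^ 2 -
          2 * (conduct ω x y * f x * f y) := fun x y => by ring
    simp only [this, Finset.sum_sub_distrib, Finset.sum_add_distrib, ← Finset.mul_sum]
    rw [← hN, ← hN', hD]; ring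
  have : (0 : ℝ) ≤ 3 ^ d * A.card := by positivity
  linarith

lemma tent_norm {ω : Config d} (hinf : (cluster ω).Infinite) (r : ℕ) :
    (r : ℝ) ^ 2 * (clusterN ω r).ncard ≤
      ip (clusterFin ω (2 * r)) (fun x => (nu ω x : ℝ)) (tent (2 * r)) (tent (2 * r)) := by
  have hsub : clusterFin ω r ⊆ clusterFin ω (2 * r) := fun x hx =>
    mem_clusterFin.2 (clusterN_mono ω (by omega) (mem_clusterFin.1 hx))
  rw [← card_clusterFin, mul_comm, ← nsmul_eq_mul]
  refine le_trans (Finset.card_nsmul_le_sum (clusterFin ω r)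
    (fun x => (nu ω x : ℝ) * tent (2 * r) x * tent (2 * r) x) _ fun x hx => ?_)
    (Finset.sum_le_sum_of_subset_of_nonneg hsub fun x _ _ => by
      have := tent_nonneg (2 * r) x
      positivity)
  have h1 := one_le_nu hinf (clusterN_subset_cluster ω r (mem_clusterFin.1 hx))
  have h2 : (r : ℝ) ≤ tent (2 * r) x := by
    have h3 := clusterN_subset_box ω r (mem_clusterFin.1 hx)
    rw [box_eq_ball] at h3
    have h4 : dst x 0 ≤ r := h3
    exact Nat.cast_le.2 (by omega)
  have h0 : (0 : ℝ) ≤ r := Nat.cast_nonneg r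
  nlinarith [mul_le_mul h2 h2 h0 (h0.trans h2)]

/-- Some site of the cluster survives with at least the tent function's rate. -/
lemma exists_surv_ge {ω : Config d} (hinf : (cluster ω).Infinite) {r : ℕ} (hr : 1 ≤ r) {lam : ℝ}
    (hlam : 0 < lam)
    (h : 3 ^ d * (clusterN ω (2 * r)).ncard ≤ (1 - lam) * (r ^ 2 * (clusterN ω r).ncard))
    (hlam1 : lam ≤ 1) (k : ℕ) :
    ∃ x ∈ clusterFin ω (2 * r), lam ^ (2 * k) / (2 * r) ≤ surv ω (clusterFin ω (2 * r)) (2 * k) x := by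
  set A := clusterFin ω (2 * r) with hA
  set ν : Zd d → ℝ := fun x => nu ω x with hν
  set f : Zd d → ℝ := tent (2 * r) with hf
  have hr0 : (0 : ℝ) < r := by exact_mod_cast hr
  have hν0 : ∀ x ∈ A, 0 ≤ ν x := fun x _ => Nat.cast_nonneg _
  have hrev : ∀ x ∈ A, ∀ y ∈ A, ν x * step ω x y = ν y * step ω y x := fun x _ y _ => by
    rw [hν]; simp only [nu_mul_step, conduct_symm ω x y]
  have hnorm := tent_norm hinf r
  have hen := tent_energy ω (2 * r)
  rw [card_clusterFin] at hen
  have hpos : 0 < ip A ν f f := by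
    refine lt_of_lt_of_le ?_ hnorm
    have : 0 < (clusterN ω r).ncard :=
      (Set.ncard_pos (clusterN_finite ω r)).2 ⟨0, zero_mem_clusterN ω r⟩
    positivity
  have hD : lam * ip A ν f f ≤ ip A ν f (kop A (step ω) f) := by
    have h1 := mul_le_mul_of_nonneg_left hnorm (by linarith : 0 ≤ 1 - lam)
    have h2 : ip A ν f f - 3 ^ d * (clusterN ω (2 * r)).ncard ≤ ip A ν f (kop A (step ω) f) := hen
    have h3 : (1 - lam) * (r ^ 2 * (clusterN ω r).ncard) ≤ (1 - lam) * ip A ν f f := h1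
    linarith
  have hmain := pow_mul_le_ip_iterate hν0 hrev hlam f hpos hD k
  obtain ⟨x, hx, hxk⟩ : ∃ x ∈ A, lam ^ (2 * k) ≤ (kop A (step ω))^[2 * k] f x := by
    by_contra! hc
    have hlt : ip A ν f ((kop A (step ω))^[2 * k] f) < ∑ x ∈ A, ν x * f x * lam ^ (2 * k) := by
      refine Finset.sum_lt_sum (fun x hx => mul_le_mul_of_nonneg_left (hc x hx).le
        (mul_nonneg (hν0 x hx) (tent_nonneg _ _))) ⟨0, ?_, ?_⟩
      · exact mem_clusterFin.2 (zero_mem_clusterN ω _)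
      · refine mul_lt_mul_of_pos_left (hc 0 (mem_clusterFin.2 (zero_mem_clusterN ω _))) ?_
        refine mul_pos (lt_of_lt_of_le one_pos (one_le_nu hinf ReflTransGen.refl)) ?_
        rw [hf, tent, dst_self]
        exact_mod_cast (by omega : 0 < 2 * r - 0)
    have hle : ∑ x ∈ A, ν x * f x * lam ^ (2 * k) ≤ lam ^ (2 * k) * ip A ν f f := by
      rw [ip, Finset.mul_sum]
      refine Finset.sum_le_sum fun x hx => ?_
      have h1 := mul_le_mul_of_nonneg_left (tent_le_sq (2 * r) x) (hν0 x hx)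
      have h2 := mul_le_mul_of_nonneg_left h1 (pow_nonneg hlam.le (2 * k))
      calc ν x * f x * lam ^ (2 * k) = lam ^ (2 * k) * (ν x * f x) := by ring
        _ ≤ lam ^ (2 * k) * (ν x * f x ^ 2) := h2
        _ = _ := by ring
    linarith
  refine ⟨x, hx, ?_⟩
  have hdom : ∀ j, ∀ y ∈ A, (kop A (step ω))^[j] f y ≤ 2 * r * (kop A (step ω))^[j] 1 y := by
    intro j
    induction j with
    | zero =>
      intro y _
      have := tent_le (2 * r) y
      push_cast at this
      simpa [hf] using this
    | succ j ih =>
      intro y hy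
      rw [Function.iterate_succ_apply', Function.iterate_succ_apply', kop, kop, Finset.mul_sum]
      refine Finset.sum_le_sum fun z hz => ?_
      have := mul_le_mul_of_nonneg_left (ih z hz) (step_nonneg ω y z)
      linarith
  rw [surv_eq_kop ω A (2 * k) x hx, div_le_iff₀ (by positivity)]
  exact hxk.trans ((hdom _ x hx).trans (le_of_eq (mul_comm _ _)))

/-- The open subgraph induced on a finite set. -/
def openGraph (ω : Config d) (A : Finset (Zd d)) : SimpleGraph A where
  Adj x y := openAdj ω x y
  symm := ⟨fun _ _ h => h.symm⟩
  loopless := ⟨fun _ h => h.1.ne rfl⟩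

lemma surv_walk_le (ω : Config d) (A : Finset (Zd d)) (n : ℕ) {x y : A}
    (p : (openGraph ω A).Walk x y) :
    ((3 : ℝ) ^ d)⁻¹ ^ p.length * surv ω A n y ≤ surv ω A (n + p.length) x := by
  induction p with
  | nil => simp
  | @cons u v w h p ih =>
    rw [SimpleGraph.Walk.length_cons, ← add_assoc, surv_succ ω _ u.2]
    refine le_trans ?_ (Finset.single_le_sum (f := fun z => step ω u z * surv ω A (n + p.length) z)
      (fun z _ => mul_nonneg (step_nonneg _ _ _) (surv_nonneg _ _ _ _)) v.2)
    calc ((3 : ℝ) ^ d)⁻¹ ^ (p.length + 1) * surv ω A n w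
        = ((3 : ℝ) ^ d)⁻¹ * (((3 : ℝ) ^ d)⁻¹ ^ p.length * surv ω A n w) := by ring
      _ ≤ _ := mul_le_mul (le_step h) ih
        (mul_nonneg (by positivity) (surv_nonneg _ _ _ _)) (step_nonneg _ _ _)

lemma openGraph_reachable {ω : Config d} {A : Finset (Zd d)} (h0 : 0 ∈ A) {y : Zd d}
    (h : ReflTransGen (restr (openAdj ω) ↑A) 0 y) :
    ∀ hy : y ∈ A, (openGraph ω A).Reachable ⟨0, h0⟩ ⟨y, hy⟩ := by
  induction h with
  | refl => exact fun _ => SimpleGraph.Reachable.refl _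
  | @tail b c _ hbc ih =>
    intro hc
    have hb : b ∈ A := hbc.2.1
    have hadj : (openGraph ω A).Adj ⟨b, hb⟩ ⟨c, hc⟩ := hbc.1
    exact (ih hb).trans hadj.reachable

lemma surv_conn_le (ω : Config d) {A : Finset (Zd d)} (h0 : 0 ∈ A)
    (hA : ∀ y ∈ A, ReflTransGen (restr (openAdj ω) ↑A) 0 y) (n : ℕ) {x : Zd d} (hx : x ∈ A) :
    ((3 : ℝ) ^ d)⁻¹ ^ A.card * surv ω A n x ≤ surv ω A n 0 := by
  obtain ⟨q, hq⟩ := (openGraph_reachable h0 (hA x hx) hx).exists_isPath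
  have hlen : q.length ≤ A.card := by
    have := hq.length_lt
    rw [Fintype.card_coe] at this
    exact this.le
  have h1 := surv_walk_le ω A n q
  have h2 : surv ω A (n + q.length) 0 ≤ surv ω A n 0 := surv_anti ω A h0 (Nat.le_add_right _ _)
  have h3 : ((3 : ℝ) ^ d)⁻¹ ^ A.card ≤ ((3 : ℝ) ^ d)⁻¹ ^ q.length :=
    pow_le_pow_of_le_one (by positivity) (inv_le_one_of_one_le₀ (one_le_pow₀ (by norm_num))) hlen
  exact (mul_le_mul_of_nonneg_right h3 (surv_nonneg ω A n x)).trans (h1.trans h2)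

end lower

set_option maxHeartbeats 1000000 in
/-- The lower bound for the Laplace transform, with `n = ρ ^ (d + 2)`. -/
lemma laplaceN_lower {d : ℕ} (hd : 1 ≤ d) (K : ℕ) {α : ℝ} (hα0 : 0 < α) (hα1 : α < 1) :
    ∃ Ci > (0 : ℝ), ∀ v0 : ℕ, ∃ ρ0 : ℝ, ∀ ω : Config d, (cluster ω).Infinite →
      (∀ v ≥ v0, IsoAt ω K v) → ∀ (n : ℕ) (ρ : ℝ), ρ0 ≤ ρ → ρ ^ (d + 2) = n →
        Real.exp (-Ci * ρ ^ d) ≤ LaplaceN ω α n := by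
  have : NeZero d := ⟨by omega⟩
  obtain ⟨δ, hδ0, -, hvol⟩ := volume_growth hd K
  set C : ℝ := (15 / δ) ^ d with hC
  have hC0 : 0 < C := by positivity
  set b : ℝ := -Real.log α with hb
  have hb0 : 0 < b := by rw [hb]; linarith [Real.log_neg hα0 hα1]
  have hαb : α = Real.exp (-b) := by rw [hb, neg_neg, Real.exp_log hα0]
  set M : ℝ := 10 ^ d with hM
  have hM0 : 0 < M := by positivity
  refine ⟨b * M + 2 * d * M + 4 * C + 4, by positivity, fun v0 =>
    ⟨max (max (2 * v0) (2 * C)) 1, fun ω hinf hiso n ρ hρ hn => ?_⟩⟩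
  have hρv : 2 * (v0 : ℝ) ≤ ρ := (le_max_left _ _).trans ((le_max_left _ _).trans hρ)
  have hρC : 2 * C ≤ ρ := (le_max_right _ _).trans ((le_max_left _ _).trans hρ)
  have hρ1 : 1 ≤ ρ := (le_max_right _ _).trans hρ
  have hρ0 : 0 < ρ := one_pos.trans_le hρ1
  set r : ℕ := ⌈ρ⌉₊ with hr
  have hrρ : ρ ≤ r := Nat.le_ceil ρ
  have hr2 : (r : ℝ) ≤ 2 * ρ := by linarith [Nat.ceil_lt_add_one hρ0.le]
  have hr1' : (1 : ℝ) ≤ r := hρ1.trans hrρ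
  have hr1 : 1 ≤ r := by exact_mod_cast hr1'
  have hr0 : (0 : ℝ) < r := by linarith
  have hrv : 2 * v0 ≤ r := by
    have : 2 * (v0 : ℝ) ≤ r := hρv.trans hrρ
    exact_mod_cast this
  have hrr : 2 * C ≤ (r : ℝ) ^ 2 :=
    hρC.trans (hrρ.trans (le_self_pow₀ hr1' two_ne_zero))
  set t : ℝ := ρ ^ d with ht
  have hρt : ρ ≤ t := le_self_pow₀ hρ1 (by omega)
  have ht0 : 0 < t := by positivity
  have hcard : ((clusterN ω (2 * r)).ncard : ℝ) ≤ (5 * r) ^ d := by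
    have h1 : (clusterN ω (2 * r)).ncard ≤ (2 * (2 * r) + 1) ^ d := by
      rw [← ncard_ball (0 : Zd d) (2 * r), ← box_eq_ball]
      exact Set.ncard_le_ncard (clusterN_subset_box ω _)
        (by rw [box_eq_ball]; exact ball_finite _ _)
    calc ((clusterN ω (2 * r)).ncard : ℝ) ≤ ((2 * (2 * r) + 1 : ℕ) : ℝ) ^ d := by exact_mod_cast h1
      _ ≤ (5 * r) ^ d := by
        refine pow_le_pow_left₀ (Nat.cast_nonneg _) ?_ d
        push_cast; linarith
  have hcardM : ((clusterN ω (2 * r)).ncard : ℝ) ≤ M * t := by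
    refine hcard.trans ?_
    rw [hM, ht, ← mul_pow]
    exact pow_le_pow_left₀ (by positivity) (by linarith) d
  set lam : ℝ := 1 - C / r ^ 2 with hlam
  have hlamC : C / (r : ℝ) ^ 2 ≤ 1 / 2 := by
    rw [div_le_iff₀ (by positivity)]; linarith
  have hq0 : 0 ≤ C / (r : ℝ) ^ 2 := by positivity
  have hlam0 : 0 < lam := by rw [hlam]; linarith
  have hlam1 : lam ≤ 1 := by rw [hlam]; linarith
  have hcond : (3 : ℝ) ^ d * (clusterN ω (2 * r)).ncard ≤
      (1 - lam) * (r ^ 2 * (clusterN ω r).ncard) := by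
    have e : (1 - lam) * ((r : ℝ) ^ 2 * (clusterN ω r).ncard) = C * (clusterN ω r).ncard := by
      rw [hlam]; field_simp; ring
    rw [e]
    calc (3 : ℝ) ^ d * (clusterN ω (2 * r)).ncard ≤ 3 ^ d * (5 * r) ^ d :=
          mul_le_mul_of_nonneg_left hcard (by positivity)
      _ = C * (δ * r) ^ d := by
          rw [hC, ← mul_pow, ← mul_pow]; congr 1; field_simp; ring
      _ ≤ _ := mul_le_mul_of_nonneg_left (hvol ω v0 hinf hiso r hrv) hC0.le
  obtain ⟨x, hx, hsurv⟩ := exists_surv_ge hinf hr1 hlam0 hcond hlam1 n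
  set A := clusterFin ω (2 * r) with hA
  have hAcard : (A.card : ℝ) ≤ M * t := by rw [hA, card_clusterFin]; exact hcardM
  have h0A : (0 : Zd d) ∈ A := mem_clusterFin.2 (zero_mem_clusterN ω _)
  have hcoe : (A : Set (Zd d)) = clusterN ω (2 * r) := Set.ext fun y => mem_clusterFin
  have hconn := surv_conn_le ω h0A (fun y hy => by
    rw [hcoe]; exact clusterN_conn_zero ω _ (mem_clusterFin.1 hy)) (2 * n) hx
  have hanti : surv ω A (2 * n) 0 ≤ surv ω A n 0 := surv_anti ω A h0A (by omega)
  have hlap := le_laplaceN ω hα0.le hα1.le A n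
  have hlamn : Real.exp (-(4 * C) * t) ≤ lam ^ (2 * n) := by
    have h1 : Real.exp (-(2 * (C / r ^ 2))) ≤ lam := by
      rw [Real.exp_neg]
      refine inv_le_of_inv_le₀ hlam0 ?_
      have h2 := Real.add_one_le_exp (2 * (C / (r : ℝ) ^ 2))
      refine le_trans ?_ h2
      rw [inv_le_iff_one_le_mul₀ hlam0, hlam]
      have h3 := mul_nonneg hq0 (sub_nonneg.2 hlamC)
      linarith [h3]
    refine le_trans ?_ (pow_le_pow_left₀ (Real.exp_pos _).le h1 _)
    rw [← Real.exp_nat_mul, Real.exp_le_exp]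
    have h2 : (n : ℝ) / r ^ 2 ≤ t := by
      rw [div_le_iff₀ (by positivity), ← hn, pow_add, ← ht]
      exact mul_le_mul_of_nonneg_left (pow_le_pow_left₀ hρ0.le hrρ 2) ht0.le
    have h3 := mul_le_mul_of_nonneg_left h2 (by positivity : 0 ≤ 4 * C)
    have e : ((2 * n : ℕ) : ℝ) * -(2 * (C / r ^ 2)) = -(4 * C * (n / r ^ 2)) := by
      push_cast; ring
    rw [e]; linarith
  have hr4 : Real.exp (-4 * t) ≤ 1 / (2 * r) := by
    rw [neg_mul, Real.exp_neg, ← one_div]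
    refine one_div_le_one_div_of_le (by positivity) ?_
    linarith [Real.add_one_le_exp (4 * t)]
  have h3d : Real.exp (-(2 * d * M) * t) ≤ ((3 : ℝ) ^ d)⁻¹ ^ A.card := by
    have h1 : (3 : ℝ) ≤ Real.exp 2 := by linarith [Real.add_one_le_exp (2 : ℝ)]
    rw [inv_pow, ← pow_mul, neg_mul, Real.exp_neg]
    refine inv_anti₀ (by positivity) ((pow_le_pow_left₀ (by norm_num) h1 _).trans ?_)
    rw [← Real.exp_nat_mul, Real.exp_le_exp]
    push_cast
    have := mul_le_mul_of_nonneg_left hAcard (by positivity : (0 : ℝ) ≤ 2 * d)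
    linarith
  have hαA : Real.exp (-(b * M) * t) ≤ α ^ A.card := by
    rw [hαb, ← Real.exp_nat_mul, Real.exp_le_exp]
    have := mul_le_mul_of_nonneg_left hAcard hb0.le
    linarith
  have e : Real.exp (-(b * M + 2 * d * M + 4 * C + 4) * t) =
      Real.exp (-(b * M) * t) * (Real.exp (-(2 * d * M) * t) *
        (Real.exp (-(4 * C) * t) * Real.exp (-4 * t))) := by
    rw [← Real.exp_add, ← Real.exp_add, ← Real.exp_add]; congr 1; ring
  rw [e]
  have hS : Real.exp (-(4 * C) * t) * Real.exp (-4 * t) ≤ surv ω A (2 * n) x := by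
    refine le_trans (mul_le_mul hlamn hr4 (Real.exp_pos _).le (by positivity)) ?_
    rw [mul_one_div]; exact hsurv
  have hS' := (mul_le_mul h3d hS (by positivity) (by positivity)).trans (hconn.trans hanti)
  exact (mul_le_mul hαA hS' (by positivity) (by positivity)).trans hlap

/-- Laplace transform of the number of visited points: two-sided bounds. -/
theorem stmt0 (d : ℕ) (hd : 2 ≤ d) (p : ℝ) (hp : pc d < p) (hp1 : p ≤ 1)
    (α : ℝ) (hα : α ∈ Set.Ioo (0 : ℝ) 1) :
    ∃ Ci > (0 : ℝ), ∃ Cs > (0 : ℝ),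
      ∀ Q : Measure (Config d), IsBernoulli p Q →
        ∀ᵐ ω ∂Q, (cluster ω).Infinite →
          ∃ N : ℕ, ∀ n ≥ N,
            Real.exp (-Ci * (n : ℝ) ^ ((d : ℝ) / ((d : ℝ) + 2))) ≤ LaplaceN ω α n ∧
              LaplaceN ω α n ≤ Real.exp (-Cs * (n : ℝ) ^ ((d : ℝ) / ((d : ℝ) + 2))) := by
  obtain ⟨p0, hp0, hlt, hperc⟩ := perc_of_pc_lt hp hp1
  lift p to unitInterval using ⟨(hp0.trans hlt).le, hp1⟩
  obtain ⟨K, hK⟩ := isoperimetry hd (Subtype.coe_lt_coe.1 hp0) (Subtype.coe_lt_coe.1 hlt) hperc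
  obtain ⟨Ci, hCi, hlower⟩ := laplaceN_lower (d := d) (by omega) K hα.1 hα.2
  obtain ⟨Cs, hCs, hupper⟩ := laplaceN_upper (d := d) (by omega) K hα.1 hα.2
  refine ⟨Ci, hCi, Cs, hCs, fun Q hQ => ?_⟩
  rw [hQ.eq_bern]
  filter_upwards [hK] with ω ⟨v0, hv0⟩ hinf
  obtain ⟨ρ1, h1⟩ := hlower v0
  obtain ⟨ρ2, h2⟩ := hupper v0
  set R : ℝ := max (max ρ1 ρ2) 0 with hR
  have hR0 : 0 ≤ R := le_max_right _ _
  refine ⟨⌈R ^ (d + 2)⌉₊, fun n hn => ?_⟩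
  have hn0 : (0 : ℝ) ≤ n := Nat.cast_nonneg n
  set ρ : ℝ := (n : ℝ) ^ ((↑(d + 2) : ℝ)⁻¹) with hρ
  have hρn : ρ ^ (d + 2) = n := Real.rpow_inv_natCast_pow hn0 (by omega)
  have hρd : (n : ℝ) ^ ((d : ℝ) / ((d : ℝ) + 2)) = ρ ^ d := by
    rw [hρ, ← Real.rpow_mul_natCast hn0]
    congr 1
    push_cast
    rw [div_eq_inv_mul]
  have hRρ : R ≤ ρ := by
    refine le_of_pow_le_pow_left₀ (n := d + 2) (by omega) (Real.rpow_nonneg hn0 _) ?_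
    rw [hρn]
    exact (Nat.le_ceil _).trans (Nat.cast_le.2 hn)
  rw [hρd]
  exact ⟨h1 ω hinf hv0 n ρ ((le_max_left _ _).trans ((le_max_left _ _).trans hRρ)) hρn,
    h2 ω hinf hv0 n ρ ((le_max_right _ _).trans ((le_max_left _ _).trans hRρ)) hρn⟩

end Perco
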